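/- Let I ⊂ R = k[x,y,z] be the radical ideal of a set X of n distinct points of P² in tight generic n-position with μ(I) ≥ 4 minimal generators, and write n = C(s+1,2) + h with 0 ≤ h ≤ s/2 − 1, where s = indeg(I). Then the following are equivalent: (a) the Rees algebra R_R(I) is Cohen–Macaulay; (b) the special fiber F(I) is Cohen–Macaulay and its minimal graded free resolution over S = k[t_1,…,t_{μ(I)}] has the form 0 → S(−μ(I)+1)^{β_{μ(I)−3}} → ⋯ → S(−3)^{β_1} → S → F(I) → 0; (c) I is linearly presented, i.e., h = 0. -/

import Mathlib

set_option synthInstance.maxHeartbeats 1000000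
set_option maxHeartbeats 1000000

open Matrix MvPolynomial

noncomputable section

def idealHeight {A : Type*} [CommRing A] (I : Ideal A) : ℕ∞ :=
  ⨅ (P : PrimeSpectrum A) (_ : I ≤ P.asIdeal), Order.height P

def minorsIdeal {A : Type*} [CommRing A] {p q : ℕ} (t : ℕ)
    (M : Matrix (Fin p) (Fin q) A) : Ideal A :=
  Ideal.span { x | ∃ (r : Fin t → Fin p) (c : Fin t → Fin q),
    Function.Injective r ∧ Function.Injective c ∧ x = (M.submatrix r c).det }

/-- Condition `G_s` of Artin–Nagata: for every prime `P ⊇ L` with `ht P ≤ s − 1`,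
the localization `L_P` can be generated by at most `ht P` elements. -/
def CondG {A : Type*} [CommRing A] (L : Ideal A) (s : ℕ) : Prop :=
  ∀ P : Ideal A, P.IsPrime → L ≤ P → idealHeight P + 1 ≤ (s : ℕ∞) →
    ∃ c : ℕ, (c : ℕ∞) ≤ idealHeight P ∧ ∃ g : Fin c → A, (∀ i, g i ∈ L) ∧
      ∀ x ∈ L, ∃ u ∉ P, u * x ∈ Ideal.span (Set.range g)

/-- The skew-symmetric matrix of signed `m × m` minors (obtained by omitting two columns)
of an `m × (m+2)` matrix; this is the middle differential of the Buchsbaum–Rim complex. -/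
def bbrim {A : Type*} [CommRing A] {m : ℕ} (ψ : Matrix (Fin m) (Fin (m + 2)) A) :
    Matrix (Fin (m + 2)) (Fin (m + 2)) A :=
  Matrix.of fun i j =>
    if h : (i : ℕ) < (j : ℕ) then
      (-1) ^ ((i : ℕ) + (j : ℕ)) *
        (ψ.submatrix id (fun q => j.succAbove
          ((⟨(i : ℕ), by have := j.isLt; omega⟩ : Fin (m + 1)).succAbove q))).det
    else if h' : (j : ℕ) < (i : ℕ) then
      (-1) ^ ((i : ℕ) + (j : ℕ) + 1) *
        (ψ.submatrix id (fun q => i.succAbove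
          ((⟨(j : ℕ), by have := i.isLt; omega⟩ : Fin (m + 1)).succAbove q))).det
    else 0

def rowMap {A : Type*} [CommRing A] {ι : Type*} [Fintype ι] (g : ι → A) :
    (ι → A) →ₗ[A] A :=
  ∑ i, g i • LinearMap.proj i

/-- Data of a (necessarily minimal) graded free resolution
`0 → ⊕_j R(−a_j) → ⊕_i R(−b_i) → I → 0` of an ideal of a polynomial ring. -/
def HasResolutionData {A : Type*} [CommRing A] {σ : Type*} (I : Ideal (MvPolynomial σ A))
    {N M : ℕ} (b : Fin N → ℕ) (a : Fin M → ℕ) : Prop :=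
  ∃ (g : Fin N → MvPolynomial σ A) (φ : Matrix (Fin N) (Fin M) (MvPolynomial σ A)),
    (∀ i, (g i).IsHomogeneous (b i)) ∧ Ideal.span (Set.range g) = I ∧
    (∀ i j, (φ i j).IsHomogeneous (a j - b i) ∧ (a j ≤ b i → φ i j = 0)) ∧
    Function.Injective φ.mulVecLin ∧
    LinearMap.range φ.mulVecLin = LinearMap.ker (rowMap g)

/-- The Castelnuovo–Mumford regularity of a codimension-two perfect ideal, read off from
its minimal graded free resolution `0 → ⊕_j R(−a_j) → ⊕_i R(−b_i) → I → 0` as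
`max(max_i b_i, max_j a_j − 1)`. -/
def HasRegularity {A : Type*} [CommRing A] {σ : Type*} (I : Ideal (MvPolynomial σ A))
    (r : ℕ) : Prop :=
  ∃ (N M : ℕ) (b : Fin N → ℕ) (a : Fin M → ℕ), HasResolutionData I b a ∧
    (Finset.univ.sup b) ⊔ ((Finset.univ.sup a) - 1) = r

def IsCohenMacaulayRing (A : Type*) [CommRing A] : Prop :=
  ∀ P : Ideal A, P.IsMaximal → ∃ rs : List A,
    (∀ x ∈ rs, x ∈ P) ∧ RingTheory.Sequence.IsRegular A rs ∧
      (rs.length : ℕ∞) = idealHeight P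

def reesPresentation {A : Type*} [CommRing A] {n : ℕ} (f : Fin n → A) :
    MvPolynomial (Fin n) A →ₐ[A] Polynomial A :=
  MvPolynomial.aeval fun i => Polynomial.C (f i) * Polynomial.X

def Ideal.IsLinearType {A : Type*} [CommRing A] (I : Ideal A) : Prop :=
  ∀ (n : ℕ) (f : Fin n → A), Ideal.span (Set.range f) = I →
    RingHom.ker (reesPresentation f) =
      Ideal.span {p | p ∈ RingHom.ker (reesPresentation f) ∧ p.IsHomogeneous 1}

def moduleDepth {A : Type*} [CommRing A] (J : Ideal A) (M : Type*)
    [AddCommGroup M] [Module A M] : ℕ∞ :=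
  sSup {c : ℕ∞ | ∃ rs : List A, (∀ x ∈ rs, x ∈ J) ∧
    RingTheory.Sequence.IsRegular M rs ∧ (rs.length : ℕ∞) = c}

def analyticSpread {A : Type*} [CommRing A] (m I : Ideal A) : WithBot ℕ∞ :=
  ringKrullDim ((reesAlgebra I) ⧸ (Ideal.map (algebraMap A (reesAlgebra I)) m))

section Points

variable {k : Type*} [Field k]

def gradedPiece (I : Ideal (MvPolynomial (Fin 3) k)) (t : ℕ) :
    Submodule k (MvPolynomial (Fin 3) k) :=
  Submodule.restrictScalars k I ⊓ homogeneousSubmodule (Fin 3) k t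

def pointIdeal (p : Fin 3 → k) : Ideal (MvPolynomial (Fin 3) k) :=
  Ideal.span {f | f.IsHomogeneous 1 ∧ MvPolynomial.eval p f = 0}

def vanishingIdeal {n : ℕ} (pts : Fin n → (Fin 3 → k)) : Ideal (MvPolynomial (Fin 3) k) :=
  ⨅ i, pointIdeal (pts i)

def oneTimesPiece (I : Ideal (MvPolynomial (Fin 3) k)) (s : ℕ) :
    Submodule k (MvPolynomial (Fin 3) k) :=
  Submodule.span k {g | ∃ ℓ f, ℓ ∈ homogeneousSubmodule (Fin 3) k 1 ∧
    f ∈ gradedPiece I s ∧ g = ℓ * f}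

def IsPointFamily {n : ℕ} (pts : Fin n → (Fin 3 → k)) : Prop :=
  (∀ i, pts i ≠ 0) ∧ ∀ i j, i ≠ j → ∀ c : k, pts i ≠ c • pts j

def InGenericPosition {n : ℕ} (pts : Fin n → (Fin 3 → k)) : Prop :=
  ∀ t : ℕ, Module.finrank k (gradedPiece (vanishingIdeal pts) t) = (t + 2).choose 2 - n

def InUniformPosition {n : ℕ} (pts : Fin n → (Fin 3 → k)) : Prop :=
  ∀ T : Finset (Fin n), ∀ t : ℕ,
    Module.finrank k (gradedPiece (⨅ i ∈ T, pointIdeal (pts i)) t) = (t + 2).choose 2 - T.card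

def HasInitialDegree (I : Ideal (MvPolynomial (Fin 3) k)) (s : ℕ) : Prop :=
  gradedPiece I s ≠ ⊥ ∧ ∀ t < s, gradedPiece I t = ⊥

def InTightGenericPosition {n : ℕ} (pts : Fin n → (Fin 3 → k)) (s : ℕ) : Prop :=
  InGenericPosition pts ∧
    Module.finrank k (oneTimesPiece (vanishingIdeal pts) s) =
      min (3 * Module.finrank k (gradedPiece (vanishingIdeal pts) s))
        (Module.finrank k (gradedPiece (vanishingIdeal pts) (s + 1)))

def IsBirationalOntoImage {N : ℕ} (f : Fin N → MvPolynomial (Fin 3) k) : Prop :=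
  ∃ (e : ℕ) (G : Fin 3 → MvPolynomial (Fin N) k) (w : MvPolynomial (Fin 3) k),
    w ≠ 0 ∧ (∀ j, (G j).IsHomogeneous e) ∧
      ∀ j, MvPolynomial.aeval f (G j) = w * MvPolynomial.X j

end Points

end

noncomputable section Arguments

open Module (finrank)
open Submodule (span subset_span mem_span_range_iff_exists_fun finrank_mono span_le mem_sup)
open Finsupp (weight)
open Finset (sum_congr mul_sum sum_eq_zero)
open LinearMap (ker)
open Set (range)

local notation:max "R₃" => MvPolynomial (Fin 3)
local notation:max "R₂" => MvPolynomial (Fin 2)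
local notation:max "R[" n "]" => MvPolynomial (Fin n)
local notation:max "ℋ₃" => homogeneousSubmodule (Fin 3)
local notation:max "ℋ₂" => homogeneousSubmodule (Fin 2)
local notation:max "C₁" => Polynomial.C
local notation:max "X₁" => Polynomial.X

section HomogeneousBasics

variable {k : Type*} [Field k] {σ : Type*}

theorem exists_mem_forall_notMem_of_not_le {E : Type*} [AddCommGroup E] [Module k E] [Infinite k]
    (V : Submodule k E) (S : Finset (Submodule k E)) (hS : ∀ p ∈ S, ¬ V ≤ p) :
    ∃ v ∈ V, ∀ p ∈ S, v ∉ p := by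
  classical
  have h := Subspace.biUnion_ne_univ_of_top_notMem (k := k) (E := V)
    (s := S.image fun p => p.comap V.subtype) (by
      intro hmem
      obtain ⟨p, hp, hpt⟩ := Finset.mem_image.1 hmem
      exact hS p hp (Submodule.comap_subtype_eq_top.1 hpt))
  obtain ⟨v, hv⟩ := (Set.ne_univ_iff_exists_notMem _).1 h
  refine ⟨v, v.2, fun p hp hvp => hv ?_⟩
  simp only [Finset.mem_image, Set.iUnion_exists, Set.biUnion_and', Set.iUnion_iUnion_eq_right,
    Set.mem_iUnion]
  exact ⟨p, hp, hvp⟩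

theorem homogeneousComponent_mul_of_isHomogeneous {p q : MvPolynomial σ k} {m : ℕ}
    (hq : q.IsHomogeneous m) (d : ℕ) :
    homogeneousComponent (d + m) (p * q) = homogeneousComponent d p * q := by
  induction p using MvPolynomial.induction_on' with
  | monomial e c =>
    have h1 : (monomial e c : MvPolynomial σ k).IsHomogeneous e.degree :=
      isHomogeneous_monomial c rfl
    rw [homogeneousComponent_of_mem (h1.mul hq), homogeneousComponent_of_mem h1]
    by_cases h : d = e.degree
    · simp [h]
    · rw [if_neg (by omega), if_neg h, zero_mul]
  | add a b ha hb => rw [add_mul, map_add, ha, hb, map_add, add_mul]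

theorem homogeneousComponent_mul_of_lt {p q : MvPolynomial σ k} {m n : ℕ}
    (hq : q.IsHomogeneous m) (hn : n < m) :
    homogeneousComponent n (p * q) = 0 := by
  induction p using MvPolynomial.induction_on' with
  | monomial e c =>
    have h1 : (monomial e c : MvPolynomial σ k).IsHomogeneous e.degree :=
      isHomogeneous_monomial c rfl
    rw [homogeneousComponent_of_mem (h1.mul hq), if_neg (by omega)]
  | add a b ha hb => rw [add_mul, map_add, ha, hb, add_zero]

instance finiteDimensional_homogeneousSubmodule [Finite σ] (d : ℕ) :
    FiniteDimensional k (homogeneousSubmodule σ k d) :=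
  Module.Finite.iff_fg.2 (homogeneousSubmodule_fg σ k d)

theorem finrank_homogeneousSubmodule (m d : ℕ) :
    finrank k (homogeneousSubmodule (Fin m) k d) = m.multichoose d := by
  classical
  have hli := (basisMonomials (Fin m) k).linearIndependent
  let S : Finset (Fin m →₀ ℕ) := Finset.finsuppAntidiag Finset.univ d
  have hS : ∀ e, e ∈ S ↔ e.degree = d := fun e => by
    simp [S, Finset.mem_finsuppAntidiag, Finsupp.degree_eq_sum]
  have hspan : span k ((fun e => (monomial e (1 : k) : R[m] k)) '' S)
      = homogeneousSubmodule (Fin m) k d := by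
    apply le_antisymm
    · rw [span_le]
      rintro _ ⟨e, he, rfl⟩
      exact isHomogeneous_monomial 1 ((hS e).1 he)
    · intro p hp
      rw [p.as_sum]
      refine Submodule.sum_mem _ fun e he => ?_
      have : (monomial e (coeff e p) : R[m] k) = coeff e p • monomial e 1 := by
        rw [smul_monomial, smul_eq_mul, mul_one]
      rw [this]
      refine Submodule.smul_mem _ _ (subset_span ⟨e, ?_, rfl⟩)
      by_contra hne
      exact mem_support_iff.1 he (IsHomogeneous.coeff_eq_zero hp fun h => hne ((hS e).2 h))
  rw [← hspan]
  have h1 : LinearIndependent k (fun e : S => (monomial (e : Fin m →₀ ℕ) (1 : k) : R[m] k)) := by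
    have := hli.comp (fun e : S => (e : Fin m →₀ ℕ)) Subtype.val_injective
    simpa [Function.comp_def] using this
  have h2 := finrank_span_eq_card h1
  have h3 : range (fun e : S => (monomial (e : Fin m →₀ ℕ) (1 : k) : R[m] k))
      = (fun e => (monomial e (1 : k) : R[m] k)) '' S := by
    ext; simp
  rw [h3] at h2
  rw [h2, Fintype.card_coe, Finset.card_finsuppAntidiag_nat_eq_multichoose]
  simp

theorem finrank_homogeneousSubmodule_two (d : ℕ) :
    finrank k (ℋ₂ k d) = d + 1 := by
  rw [finrank_homogeneousSubmodule, Nat.multichoose_eq, Nat.choose_symm_of_eq_add (b := 1) (by omega)]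
  simp [Nat.choose_one_right]; omega

theorem finrank_homogeneousSubmodule_three (d : ℕ) :
    finrank k (ℋ₃ k d) = (d + 2).choose 2 := by
  rw [finrank_homogeneousSubmodule, Nat.multichoose_eq,
    Nat.choose_symm_of_eq_add (b := 2) (by omega)]
  congr 1; omega

/-- The ring map multiplying each variable by a new scaling variable. -/
def scalingHom (k σ : Type*) [Field k] :
    MvPolynomial σ k →ₐ[k] Polynomial (MvPolynomial σ k) :=
  aeval fun i => C₁ (X i) * X₁

theorem scalingHom_of_isHomogeneous {p : MvPolynomial σ k} {d : ℕ} (hp : p.IsHomogeneous d) :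
    scalingHom k σ p = Polynomial.monomial d p := by
  rw [p.as_sum, map_sum, map_sum]
  refine sum_congr rfl fun e he => ?_
  have hd : e.degree = d := by
    by_contra hne
    exact mem_support_iff.1 he (hp.coeff_eq_zero hne)
  rw [scalingHom, aeval_monomial, ← Polynomial.C_mul_X_pow_eq_monomial, monomial_eq, Finsupp.prod, Finsupp.prod]
  simp_rw [mul_pow, Finset.prod_mul_distrib, Finset.prod_pow_eq_pow_sum]
  rw [← hd, Finsupp.degree]
  simp only [map_mul, map_prod, map_pow, ← mul_assoc]
  rfl

theorem coeff_scalingHom (p : MvPolynomial σ k) (d : ℕ) :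
    (scalingHom k σ p).coeff d = homogeneousComponent d p := by
  conv_lhs => rw [← sum_homogeneousComponent p]
  rw [map_sum, Polynomial.finsetSum_coeff]
  simp_rw [scalingHom_of_isHomogeneous (homogeneousComponent_isHomogeneous _ p),
    Polynomial.coeff_monomial]
  rw [Finset.sum_ite_eq']
  split_ifs with h
  · rfl
  · rw [homogeneousComponent_eq_zero]
    simpa using h

theorem isHomogeneous_of_mul_left {p q : MvPolynomial σ k} {n : ℕ} (h : (p * q).IsHomogeneous n)
    (hpq : p * q ≠ 0) : ∃ d ≤ n, p.IsHomogeneous d ∧ q.IsHomogeneous (n - d) := by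
  have inj : Function.Injective (scalingHom k σ) := by
    rw [injective_iff_map_eq_zero]
    intro a ha
    rw [← sum_homogeneousComponent a]
    refine sum_eq_zero fun i _ => ?_
    rw [← coeff_scalingHom, ha, Polynomial.coeff_zero]
  have hp : p ≠ 0 := left_ne_zero_of_mul hpq
  have hq : q ≠ 0 := right_ne_zero_of_mul hpq
  have hp' : scalingHom k σ p ≠ 0 := (map_ne_zero_iff _ inj).2 hp
  have hq' : scalingHom k σ q ≠ 0 := (map_ne_zero_iff _ inj).2 hq
  have hm := scalingHom_of_isHomogeneous h
  rw [map_mul] at hm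
  have h1 := Polynomial.natDegree_mul hp' hq'
  have h2 := Polynomial.natTrailingDegree_mul hp' hq'
  rw [hm, Polynomial.natDegree_monomial_eq _ hpq] at h1
  rw [hm, Polynomial.natTrailingDegree_monomial hpq] at h2
  have h3 := Polynomial.natTrailingDegree_le_natDegree (scalingHom k σ p)
  have h4 := Polynomial.natTrailingDegree_le_natDegree (scalingHom k σ q)
  have key : ∀ {r : MvPolynomial σ k} {e : ℕ}, (scalingHom k σ r).natDegree = e →
      (scalingHom k σ r).natTrailingDegree = e → r.IsHomogeneous e := by
    intro r e he he'
    have : r = homogeneousComponent e r := by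
      apply inj
      rw [scalingHom_of_isHomogeneous (homogeneousComponent_isHomogeneous e r), ← coeff_scalingHom]
      ext1 i
      rw [Polynomial.coeff_monomial]
      split_ifs with hi
      · rw [hi]
      · rcases lt_or_gt_of_ne hi with hi | hi
        · exact Polynomial.coeff_eq_zero_of_natDegree_lt (by omega)
        · exact Polynomial.coeff_eq_zero_of_lt_natTrailingDegree (by omega)
    rw [this]
    exact homogeneousComponent_isHomogeneous e r
  exact ⟨(scalingHom k σ p).natDegree, by omega, key rfl (by omega), key (by omega) (by omega)⟩

end HomogeneousBasics

section LineCharts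

variable {k : Type*} [Field k]

/-- The linear form with coefficient vector `a`. -/
def linForm {m : ℕ} (a : Fin m → k) : R[m] k := ∑ i, a i • X i

theorem linForm_isHomogeneous {m : ℕ} (a : Fin m → k) : (linForm a).IsHomogeneous 1 :=
  (homogeneousSubmodule (Fin m) k 1).sum_mem fun i _ =>
    (homogeneousSubmodule (Fin m) k 1).smul_mem _ (isHomogeneous_X k i)

theorem aeval_linForm {m : ℕ} {S : Type*} [CommRing S] [Algebra k S] (a : Fin m → k)
    (x : Fin m → S) : aeval x (linForm a) = ∑ i, a i • x i := by
  simp [linForm]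

theorem eval_linForm {m : ℕ} (a x : Fin m → k) : eval x (linForm a) = ∑ i, a i * x i := by
  simp [linForm, smul_eval]

theorem eq_linForm_of_isHomogeneous {m : ℕ} {g : R[m] k} (hg : g.IsHomogeneous 1) :
    ∃ a, g = linForm a := by
  have h : g ∈ homogeneousSubmodule (Fin m) k 1 := hg
  rw [homogeneousSubmodule_one_eq_span_X, mem_span_range_iff_exists_fun] at h
  obtain ⟨c, hc⟩ := h
  exact ⟨c, hc.symm⟩

theorem exists_matrix_last_column {v : Fin 3 → k} (hv : v ≠ 0) :
    ∃ M N : Matrix (Fin 3) (Fin 3) k, M * N = 1 ∧ N * M = 1 ∧ ∀ i, M i 2 = v i := by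
  obtain ⟨i, hi⟩ := Function.ne_iff.1 hv
  have key : ∃ M : Matrix (Fin 3) (Fin 3) k, M.det ≠ 0 ∧ ∀ i, M i 2 = v i := by
    fin_cases i
    · refine ⟨!![0, 0, v 0; 1, 0, v 1; 0, 1, v 2], ?_, ?_⟩
      · simpa [Matrix.det_fin_three] using hi
      · intro j; fin_cases j <;> rfl
    · refine ⟨!![1, 0, v 0; 0, 0, v 1; 0, 1, v 2], ?_, ?_⟩
      · simpa [Matrix.det_fin_three] using hi
      · intro j; fin_cases j <;> rfl
    · refine ⟨!![1, 0, v 0; 0, 1, v 1; 0, 0, v 2], ?_, ?_⟩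
      · simpa [Matrix.det_fin_three] using hi
      · intro j; fin_cases j <;> rfl
  obtain ⟨M, hM, hMv⟩ := key
  have hu : IsUnit M.det := isUnit_iff_ne_zero.2 hM
  exact ⟨M, M⁻¹, Matrix.mul_nonsing_inv M hu, Matrix.nonsing_inv_mul M hu, hMv⟩

/-- A line in the plane together with a parametrization: restriction to the line, a graded section
of it, and an equation. -/
structure LineChart (k : Type*) [Field k] where
  res : R₃ k →ₐ[k] R₂ k
  lift : R₂ k →ₐ[k] R₃ k
  eqn : R₃ k
  eqn_hom : eqn.IsHomogeneous 1
  eqn_ne : eqn ≠ 0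
  res_eqn : res eqn = 0
  res_lift : ∀ g, res (lift g) = g
  dvd_sub : ∀ g, eqn ∣ g - lift (res g)
  res_hom : ∀ {g : R₃ k} {d : ℕ}, g.IsHomogeneous d → (res g).IsHomogeneous d
  lift_hom : ∀ {g : R₂ k} {d : ℕ}, g.IsHomogeneous d → (lift g).IsHomogeneous d

theorem aeval_isHomogeneous_of_linear {m : ℕ} {σ : Type*} {x : Fin m → MvPolynomial σ k}
    (hx : ∀ i, (x i).IsHomogeneous 1) {g : R[m] k} {d : ℕ}
    (hg : g.IsHomogeneous d) : (aeval x g).IsHomogeneous d := by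
  have := hg.aeval x hx
  simpa using this

theorem LineChart.exists_eqn_eq {l : R₃ k} (hl : l.IsHomogeneous 1)
    (hl0 : l ≠ 0) : ∃ L : LineChart k, L.eqn = l := by
  obtain ⟨a, rfl⟩ := eq_linForm_of_isHomogeneous hl
  have ha : a ≠ 0 := by
    rintro rfl
    exact hl0 (by simp [linForm])
  obtain ⟨Nt, Mt, h1, h2, hcol⟩ := exists_matrix_last_column ha
  have hNM : ∀ i j, ∑ x, Nt x i * Mt j x = (1 : Matrix (Fin 3) (Fin 3) k) j i := by
    intro i j; rw [← h2, Matrix.mul_apply]; exact sum_congr rfl fun x _ => mul_comm _ _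
  have hMN : ∀ i j, ∑ x, Nt i x * Mt x j = (1 : Matrix (Fin 3) (Fin 3) k) i j := by
    intro i j; rw [← h1, Matrix.mul_apply]
  have hrow : ∀ j : Fin 2, linForm (m := 2) (fun i => if i = j then (1 : k) else 0) = X j := by
    intro j; simp [linForm]
  let res : R₃ k →ₐ[k] R₂ k :=
    aeval fun j => linForm ![Mt 0 j, Mt 1 j]
  let lift : R₂ k →ₐ[k] R₃ k :=
    aeval fun i => linForm fun j => Nt j i.castSucc
  have hres_lin : ∀ b : Fin 3 → k, res (linForm b) =
      linForm ![∑ j, b j * Mt 0 j, ∑ j, b j * Mt 1 j] := by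
    intro b
    rw [aeval_linForm]
    simp only [linForm, Fin.sum_univ_two, Fin.sum_univ_three, Matrix.cons_val_zero,
      Matrix.cons_val_one, smul_add, smul_smul, add_smul]
    abel
  have hX : ∀ j, (X j : R₃ k) - lift (res (X j)) = linForm a * C (Mt 2 j) := by
    intro j
    have e1 : lift (res (X j)) = Mt 0 j • (linForm fun j => Nt j 0)
        + Mt 1 j • (linForm fun j => Nt j 1) := by
      simp [res, lift, linForm, Fin.sum_univ_two]
    have e2 : (X j : R₃ k) = ∑ i, Mt i j • (linForm fun j' => Nt j' i) := by
      simp only [linForm, Finset.smul_sum, smul_smul]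
      rw [Finset.sum_comm]
      simp only [← Finset.sum_smul]
      have : ∀ j', ∑ i, Mt i j * Nt j' i = (1 : Matrix (Fin 3) (Fin 3) k) j' j := by
        intro j'; rw [← hMN]; exact sum_congr rfl fun x _ => mul_comm _ _
      simp [this, Matrix.one_apply]
    rw [e1, e2, Fin.sum_univ_three]
    have e3 : (fun j' => Nt j' 2) = a := funext hcol
    rw [e3, mul_comm, ← smul_eq_C_mul]
    abel
  refine ⟨⟨res, lift, linForm a, linForm_isHomogeneous a, hl0, ?_, ?_, ?_, ?_, ?_⟩, rfl⟩
  · rw [hres_lin]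
    have e : ∀ i, ∑ j, a j * Mt i j = (1 : Matrix (Fin 3) (Fin 3) k) i 2 := by
      intro i; rw [← hNM]; simp [hcol]
    rw [e, e]
    simp [linForm]
  · intro g
    suffices res.comp lift = AlgHom.id k _ from DFunLike.congr_fun this g
    apply MvPolynomial.algHom_ext
    intro i
    simp only [AlgHom.comp_apply, AlgHom.id_apply]
    have : lift (X i) = linForm fun j => Nt j i.castSucc := by simp [lift]
    rw [this, hres_lin, hNM, hNM]
    fin_cases i <;> simp [linForm, Matrix.one_apply]
  · intro g
    suffices h : (Ideal.Quotient.mkₐ k (Ideal.span {linForm a})).comp (AlgHom.id k _) =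
        (Ideal.Quotient.mkₐ k (Ideal.span {linForm a})).comp (lift.comp res) by
      have := DFunLike.congr_fun h g
      rw [← Ideal.mem_span_singleton]
      exact Ideal.Quotient.eq.1 this
    apply MvPolynomial.algHom_ext
    intro j
    refine Ideal.Quotient.eq.2 ?_
    rw [Ideal.mem_span_singleton]
    exact ⟨_, hX j⟩
  · intro g d hg
    exact aeval_isHomogeneous_of_linear (fun i => linForm_isHomogeneous _) hg
  · intro g d hg
    exact aeval_isHomogeneous_of_linear (fun i => linForm_isHomogeneous _) hg

namespace LineChart

variable (L : LineChart k)

theorem res_eq_zero_iff {g : R₃ k} : L.res g = 0 ↔ L.eqn ∣ g := by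
  constructor
  · intro h
    simpa [h] using L.dvd_sub g
  · rintro ⟨c, rfl⟩
    rw [map_mul, L.res_eqn, zero_mul]

theorem isHomogeneous_of_eqn_mul {g : R₃ k} {d : ℕ}
    (h : (L.eqn * g).IsHomogeneous (d + 1)) : g.IsHomogeneous d := by
  rcases eq_or_ne g 0 with rfl | hg
  · exact isHomogeneous_zero _ _ _
  obtain ⟨e, he, h1, h2⟩ := isHomogeneous_of_mul_left h (mul_ne_zero L.eqn_ne hg)
  have := h1.inj_right L.eqn_hom L.eqn_ne
  subst this
  simpa using h2

theorem exists_eq_eqn_mul {g : R₃ k} {d : ℕ} (hg : g.IsHomogeneous (d + 1))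
    (h : L.res g = 0) : ∃ g' : R₃ k, g'.IsHomogeneous d ∧ g = L.eqn * g' := by
  obtain ⟨g', rfl⟩ := L.res_eq_zero_iff.1 h
  exact ⟨g', L.isHomogeneous_of_eqn_mul hg, rfl⟩

end LineChart

end LineCharts

section Koszul

variable {k : Type*} [Field k] {m : ℕ}

/-- The multiples of `a` by forms of degree `d`. -/
def mulPiece (a : R[m] k) (d : ℕ) :
    Submodule k (R[m] k) :=
  (homogeneousSubmodule (Fin m) k d).map (LinearMap.mulLeft k a)

instance (a : R[m] k) (d : ℕ) : FiniteDimensional k (mulPiece a d) := by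
  unfold mulPiece; infer_instance

theorem finrank_map_mulLeft {σ : Type*} {a : MvPolynomial σ k} (ha : a ≠ 0)
    (U : Submodule k (MvPolynomial σ k)) :
    finrank k (U.map (LinearMap.mulLeft k a)) = finrank k U :=
  (Submodule.equivMapOfInjective _ (mul_right_injective₀ ha) U).finrank_eq.symm

theorem finrank_mulPiece {a : R[m] k} (ha : a ≠ 0) (d : ℕ) :
    finrank k (mulPiece a d) = m.multichoose d := by
  rw [mulPiece, finrank_map_mulLeft ha, finrank_homogeneousSubmodule]

theorem mulPiece_le {a : R[m] k} {s d e : ℕ} (ha : a.IsHomogeneous s)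
    (h : s + d = e) : mulPiece a d ≤ homogeneousSubmodule (Fin m) k e := by
  rintro _ ⟨p, hp, rfl⟩
  subst h
  exact ha.mul hp

theorem isHomogeneous_of_mul_of_left {σ : Type*} {a p : MvPolynomial σ k} {s d : ℕ} (ha : a.IsHomogeneous s)
    (ha0 : a ≠ 0) (h : (a * p).IsHomogeneous (s + d)) : p.IsHomogeneous d := by
  rcases eq_or_ne p 0 with rfl | hp
  · exact isHomogeneous_zero _ _ _
  obtain ⟨e, he, h1, h2⟩ := isHomogeneous_of_mul_left h (mul_ne_zero ha0 hp)
  have := h1.inj_right ha ha0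
  subst this
  simpa using h2

theorem mulPiece_inf_mulPiece {a b : R[m] k} {s t c : ℕ} (ha : a.IsHomogeneous s)
    (hb : b.IsHomogeneous t) (hb0 : b ≠ 0) (hab : IsRelPrime a b) :
    mulPiece a (t + c) ⊓ mulPiece b (s + c) = mulPiece (a * b) c := by
  apply le_antisymm
  · rintro x ⟨⟨p, hp, rfl⟩, ⟨q, hq, hx⟩⟩
    simp only [LinearMap.mulLeft_apply] at hx
    have : b ∣ p := hab.symm.dvd_of_dvd_mul_left ⟨q, hx.symm⟩
    obtain ⟨w, rfl⟩ := this
    exact ⟨w, isHomogeneous_of_mul_of_left hb hb0 hp, by simp only [LinearMap.mulLeft_apply]; ring⟩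
  · rintro x ⟨w, hw, rfl⟩
    exact ⟨⟨b * w, hb.mul hw, by simp only [LinearMap.mulLeft_apply]; ring⟩, ⟨a * w, ha.mul hw, by simp only [LinearMap.mulLeft_apply]; ring⟩⟩

theorem mulPiece_inf_mulPiece_eq_bot {a b : R[m] k} {t d e : ℕ}
    (hb : b.IsHomogeneous t) (hab : IsRelPrime a b) (hd : d < t) :
    mulPiece a d ⊓ mulPiece b e = ⊥ := by
  rw [eq_bot_iff]
  rintro x ⟨⟨p, hp, rfl⟩, ⟨q, hq, hx⟩⟩
  simp only [LinearMap.mulLeft_apply] at hx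
  have : b ∣ p := hab.symm.dvd_of_dvd_mul_left ⟨q, hx.symm⟩
  obtain ⟨w, rfl⟩ := this
  rcases eq_or_ne (b * w) 0 with h0 | h0
  · simp [h0]
  · obtain ⟨e, he, h1, h2⟩ := isHomogeneous_of_mul_left hp h0
    have := h1.inj_right hb (left_ne_zero_of_mul h0)
    omega

theorem finrank_mulPiece_sup {a b : R[m] k} {s t c : ℕ} (ha : a.IsHomogeneous s)
    (hb : b.IsHomogeneous t) (ha0 : a ≠ 0) (hb0 : b ≠ 0) (hab : IsRelPrime a b) :
    finrank k ↥(mulPiece a (t + c) ⊔ mulPiece b (s + c)) + m.multichoose c =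
      m.multichoose (t + c) + m.multichoose (s + c) := by
  have h := Submodule.finrank_sup_add_finrank_inf_eq (mulPiece a (t + c)) (mulPiece b (s + c))
  rwa [mulPiece_inf_mulPiece ha hb hb0 hab, finrank_mulPiece ha0, finrank_mulPiece hb0,
    finrank_mulPiece (mul_ne_zero ha0 hb0)] at h

theorem mulPiece_sup_mulPiece_two {a b : R₂ k} {s t d e N : ℕ}
    (ha : a.IsHomogeneous s) (hb : b.IsHomogeneous t) (ha0 : a ≠ 0) (hb0 : b ≠ 0)
    (hab : IsRelPrime a b) (hd : s + d = N) (he : t + e = N) (hN : s + t ≤ N + 1) :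
    mulPiece a d ⊔ mulPiece b e = ℋ₂ k N := by
  have hle : mulPiece a d ⊔ mulPiece b e ≤ ℋ₂ k N :=
    sup_le (mulPiece_le ha hd) (mulPiece_le hb he)
  apply Submodule.eq_of_le_of_finrank_eq hle
  have hm : ∀ j, Nat.multichoose 2 j = j + 1 := Nat.multichoose_two
  rw [finrank_homogeneousSubmodule_two]
  rcases Nat.lt_or_ge N (s + t) with h | h
  · have h1 := Submodule.finrank_sup_add_finrank_inf_eq (mulPiece a d) (mulPiece b e)
    rw [mulPiece_inf_mulPiece_eq_bot hb hab (by omega), finrank_bot, finrank_mulPiece ha0,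
      finrank_mulPiece hb0, hm, hm] at h1
    omega
  · obtain ⟨c, rfl⟩ := Nat.exists_eq_add_of_le h
    obtain rfl : d = t + c := by omega
    obtain rfl : e = s + c := by omega
    have h1 := finrank_mulPiece_sup (c := c) ha hb ha0 hb0 hab
    rw [hm, hm, hm] at h1
    omega

theorem isUnit_of_isHomogeneous_zero {σ : Type*} {g : MvPolynomial σ k} (hg : g.IsHomogeneous 0) (h0 : g ≠ 0) :
    IsUnit g := by
  have hc := (totalDegree_zero_iff_isHomogeneous σ).2 hg
  rw [totalDegree_eq_zero_iff_eq_C] at hc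
  rw [hc] at h0 ⊢
  exact (isUnit_iff_ne_zero.2 (by simpa using h0)).map C

theorem isHomogeneous_zero_of_isUnit {σ : Type*} {g : MvPolynomial σ k} (hg : IsUnit g) :
    g.IsHomogeneous 0 := by
  obtain ⟨g', hg'⟩ := hg.exists_right_inv
  have h1 : (g * g').IsHomogeneous 0 := hg' ▸ isHomogeneous_one σ k
  obtain ⟨d, hd, h2, -⟩ := isHomogeneous_of_mul_left h1 (by simp [hg'])
  rwa [Nat.le_zero.1 hd] at h2

namespace LineChart

variable (L : LineChart k)

theorem isRelPrime_of_res {a b : R₃ k} {s : ℕ} (ha : a.IsHomogeneous s)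
    (ha0 : a ≠ 0) (h : IsRelPrime (L.res a) (L.res b)) : IsRelPrime a b := by
  intro d hda hdb
  have hu : IsUnit (L.res d) := h (map_dvd L.res hda) (map_dvd L.res hdb)
  obtain ⟨c, rfl⟩ := hda
  obtain ⟨e, he, h1, -⟩ := isHomogeneous_of_mul_left ha ha0
  have h2 := L.res_hom h1
  have := h2.inj_right (isHomogeneous_zero_of_isUnit hu) hu.ne_zero
  subst this
  exact isUnit_of_isHomogeneous_zero h1 (left_ne_zero_of_mul ha0)

/-- The equation of a line is a nonzerodivisor modulo two forms that are coprime on the line. -/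
theorem mem_span_pair_of_eqn_mul_mem {a b g : R₃ k}
    (hb0 : L.res b ≠ 0) (h : IsRelPrime (L.res a) (L.res b))
    (hg : L.eqn * g ∈ Ideal.span {a, b}) : g ∈ Ideal.span {a, b} := by
  obtain ⟨p, q, hpq⟩ := Ideal.mem_span_pair.1 hg
  have h1 := congrArg L.res hpq
  simp only [map_add, map_mul, L.res_eqn, zero_mul] at h1
  have h2 : L.res b ∣ L.res p :=
    h.symm.dvd_of_dvd_mul_right ⟨-L.res q, by linear_combination h1⟩
  obtain ⟨w, hw⟩ := h2
  have h3 : L.res q = - (L.res a * w) := by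
    apply mul_right_cancel₀ hb0
    rw [hw] at h1; linear_combination h1
  have hp' : L.res (p - b * L.lift w) = 0 := by simp [L.res_lift, hw]
  have hq' : L.res (q + a * L.lift w) = 0 := by simp [L.res_lift, h3]
  obtain ⟨p', hp'⟩ := L.res_eq_zero_iff.1 hp'
  obtain ⟨q', hq'⟩ := L.res_eq_zero_iff.1 hq'
  refine Ideal.mem_span_pair.2 ⟨p', q', mul_left_cancel₀ L.eqn_ne ?_⟩
  linear_combination hpq - a * hp' - b * hq'

end LineChart

end Koszul

section PointCharts

variable {k : Type*} [Field k]

theorem aeval_mul_right_of_isHomogeneous {σ B : Type*} [CommRing B] [Algebra k B]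
    {g : MvPolynomial σ k} {d : ℕ} (hg : g.IsHomogeneous d) (x : σ → B) (t : B) :
    aeval (fun i => x i * t) g = aeval x g * t ^ d := by
  have h := congrArg (Polynomial.eval₂RingHom (aeval x : MvPolynomial σ k →ₐ[k] B).toRingHom t)
    (scalingHom_of_isHomogeneous hg)
  simp only [Polynomial.coe_eval₂RingHom, Polynomial.eval₂_monomial] at h
  refine Eq.trans ?_ h
  rw [← Polynomial.coe_eval₂RingHom]
  let F : MvPolynomial σ k →+* B :=
    (Polynomial.eval₂RingHom (aeval x : MvPolynomial σ k →ₐ[k] B).toRingHom t).comp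
      (scalingHom k σ).toRingHom
  change (aeval (fun i => x i * t) : MvPolynomial σ k →ₐ[k] B).toRingHom g = F g
  congr 1
  apply MvPolynomial.ringHom_ext
  · intro r
    simp only [AlgHom.toRingHom_eq_coe, RingHom.coe_coe, algHom_C, F, RingHom.comp_apply]
    rw [IsScalarTower.algebraMap_apply k (MvPolynomial σ k) (Polynomial (MvPolynomial σ k))]
    simp
  · intro i
    simp [F, scalingHom]

/-- Affine coordinates at a projective point. -/
structure PointChart (p : Fin 3 → k) where
  loc : R₃ k →ₐ[k] R₂ k
  l : R₃ k
  l' : R₃ k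
  l_hom : l.IsHomogeneous 1
  l'_hom : l'.IsHomogeneous 1
  loc_l : loc l = X 0
  loc_l' : loc l' = X 1
  constantCoeff_loc : ∀ g, constantCoeff (loc g) = eval p g
  span_eq : pointIdeal p = Ideal.span {l, l'}

theorem PointChart.nonempty {p : Fin 3 → k} (hp : p ≠ 0) : Nonempty (PointChart p) := by
  obtain ⟨M, N, h1, h2, hcol⟩ := exists_matrix_last_column hp
  let T : Fin 3 → R₂ k := ![X 0, X 1, 1]
  let loc : R₃ k →ₐ[k] R₂ k :=
    aeval fun j => ∑ c, M j c • T c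
  have hloc : ∀ i, loc (linForm (N i)) = T i := by
    intro i
    rw [aeval_linForm]
    simp only [Finset.smul_sum, smul_smul]
    rw [Finset.sum_comm]
    simp only [← Finset.sum_smul]
    have : ∀ c, ∑ j, N i j * M j c = (1 : Matrix (Fin 3) (Fin 3) k) i c := by
      intro c; rw [← h2, Matrix.mul_apply]
    simp [this, Matrix.one_apply]
  have hev : ∀ i, eval p (linForm (N i)) = (1 : Matrix (Fin 3) (Fin 3) k) i 2 := by
    intro i
    rw [eval_linForm, ← h2, Matrix.mul_apply]
    simp [hcol]
  refine ⟨loc, linForm (N 0), linForm (N 1), linForm_isHomogeneous _, linForm_isHomogeneous _,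
    hloc 0, hloc 1, ?_, ?_⟩
  · intro g
    suffices h : constantCoeff.comp loc.toRingHom = eval p from RingHom.congr_fun h g
    apply MvPolynomial.ringHom_ext
    · intro r; simp
    · intro j
      simp [loc, T, Fin.sum_univ_three, hcol]
  · apply le_antisymm
    · rw [pointIdeal, Ideal.span_le]
      rintro f ⟨hf, hf0⟩
      obtain ⟨a, rfl⟩ := eq_linForm_of_isHomogeneous hf
      have e : linForm a = ∑ i, (∑ j, a j * M j i) • linForm (N i) := by
        have h3 : ∀ j j', ∑ i, M j i * N i j' = (1 : Matrix (Fin 3) (Fin 3) k) j j' := by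
          intro j j'; rw [← h1, Matrix.mul_apply]
        simp only [linForm, Finset.smul_sum, smul_smul, Finset.sum_mul]
        rw [Finset.sum_comm]
        refine sum_congr rfl fun j' _ => ?_
        rw [← Finset.sum_smul, Finset.sum_comm]
        simp only [mul_assoc, ← mul_sum, h3]
        simp [Matrix.one_apply]
      have h0 : ∑ j, a j * M j 2 = 0 := by
        rw [eval_linForm] at hf0
        simpa [hcol] using hf0
      rw [e, Fin.sum_univ_three, h0, zero_smul, add_zero]
      refine Ideal.add_mem _ ?_ ?_ <;> rw [smul_eq_C_mul] <;>
        refine Ideal.mul_mem_left _ _ (Ideal.subset_span ?_) <;> simp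
    · rw [Ideal.span_le]
      rintro f (rfl | rfl)
      · exact Ideal.subset_span ⟨linForm_isHomogeneous _, by rw [hev]; simp⟩
      · exact Ideal.subset_span ⟨linForm_isHomogeneous _, by rw [hev]; simp⟩

theorem eval_eq_zero_of_mem_pointIdeal {p : Fin 3 → k} {g : R₃ k}
    (hg : g ∈ pointIdeal p) : eval p g = 0 := by
  suffices pointIdeal p ≤ RingHom.ker (eval p) from this hg
  rw [pointIdeal, Ideal.span_le]
  exact fun f hf => hf.2

theorem C_pow_mul_sub_mem_pointIdeal {p : Fin 3 → k} {g m : R₃ k} {d : ℕ}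
    (hg : g.IsHomogeneous d) (hm : m.IsHomogeneous 1) :
    C (eval p m) ^ d * g - C (eval p g) * m ^ d ∈ pointIdeal p := by
  rw [← Ideal.Quotient.eq]
  let q := Ideal.Quotient.mkₐ k (pointIdeal p)
  change q _ = q _
  have h1 : C (eval p m) ^ d * g = aeval (fun i => X i * C (eval p m)) g := by
    rw [aeval_mul_right_of_isHomogeneous hg, aeval_X_left_apply, mul_comm]
  have h2 : C (eval p g) * m ^ d = aeval (fun i => C (p i) * m) g := by
    rw [aeval_mul_right_of_isHomogeneous hg]
    congr 1
    exact (aeval_algebraMap_apply (R₃ k) p g).symm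
  rw [h1, h2]
  change (q.comp (aeval fun i => X i * C (eval p m))) g = (q.comp (aeval fun i => C (p i) * m)) g
  congr 1
  apply MvPolynomial.algHom_ext
  intro i
  simp only [AlgHom.comp_apply, aeval_X]
  refine Ideal.Quotient.eq.2 (Ideal.subset_span ⟨?_, by simp [mul_comm]⟩)
  refine IsHomogeneous.sub ?_ ?_
  · simpa using (isHomogeneous_X k i).mul (isHomogeneous_C (Fin 3) (eval p m))
  · simpa using (isHomogeneous_C (Fin 3) (p i)).mul hm

theorem exists_isHomogeneous_one_eval_ne_zero {p : Fin 3 → k} (hp : p ≠ 0) :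
    ∃ m : R₃ k, m.IsHomogeneous 1 ∧ eval p m ≠ 0 := by
  obtain ⟨i, hi⟩ := Function.ne_iff.1 hp
  exact ⟨X i, isHomogeneous_X k i, by simpa using hi⟩

theorem mem_pointIdeal_iff {p : Fin 3 → k} (hp : p ≠ 0) {g : R₃ k} {d : ℕ}
    (hg : g.IsHomogeneous d) : g ∈ pointIdeal p ↔ eval p g = 0 := by
  refine ⟨eval_eq_zero_of_mem_pointIdeal, fun h => ?_⟩
  obtain ⟨m, hm, hmp⟩ := exists_isHomogeneous_one_eval_ne_zero hp
  have h1 := C_pow_mul_sub_mem_pointIdeal (p := p) hg hm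
  rw [h, C_0, zero_mul, sub_zero, ← C_pow] at h1
  have h2 := Ideal.mul_mem_left _ (C ((eval p m ^ d)⁻¹)) h1
  rwa [← mul_assoc, ← C_mul, inv_mul_cancel₀ (pow_ne_zero _ hmp), C_1, one_mul] at h2

namespace PointChart

variable {p : Fin 3 → k} (c : PointChart p)

/-- The two first order derivatives at the point. -/
def du (g : R₃ k) (i : Fin 2) : k :=
  coeff (Finsupp.single i 1) (c.loc g)

theorem du_mul (g g' : R₃ k) (i : Fin 2) :
    c.du (g * g') i = eval p g * c.du g' i + c.du g i * eval p g' := by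
  classical
  rw [du, map_mul, coeff_mul, Finsupp.antidiagonal_single]
  simp [Finset.Nat.antidiagonal_succ, du, ← c.constantCoeff_loc, constantCoeff_eq]

theorem du_add (g g' : R₃ k) (i : Fin 2) :
    c.du (g + g') i = c.du g i + c.du g' i := by
  simp [du]

theorem du_smul (r : k) (g : R₃ k) (i : Fin 2) :
    c.du (r • g) i = r * c.du g i := by
  simp [du]

theorem du_l (i : Fin 2) : c.du c.l i = if i = 0 then 1 else 0 := by
  rw [du, c.loc_l, coeff_X]
  fin_cases i <;> simp [Finsupp.single_left_inj]

theorem du_l' (i : Fin 2) : c.du c.l' i = if i = 1 then 1 else 0 := by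
  rw [du, c.loc_l', coeff_X]
  fin_cases i <;> simp [Finsupp.single_left_inj]

theorem eval_l : eval p c.l = 0 := by rw [← c.constantCoeff_loc, c.loc_l]; simp

theorem eval_l' : eval p c.l' = 0 := by rw [← c.constantCoeff_loc, c.loc_l']; simp

/-- The linear map collecting the first order derivatives. -/
def duLin : R₃ k →ₗ[k] (Fin 2 → k) where
  toFun g := c.du g
  map_add' g g' := funext fun i => c.du_add g g' i
  map_smul' r g := funext fun i => c.du_smul r g i

end PointChart

end PointCharts

section Setup

/-- Points in generic position whose ideal is generated in its initial degree. -/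
structure PointSetup (k : Type*) [Field k] where
  n : ℕ
  s : ℕ
  h : ℕ
  pts : Fin n → (Fin 3 → k)
  fam : IsPointFamily pts
  gen : InGenericPosition pts
  indeg : HasInitialDegree (vanishingIdeal pts) s
  hn : n = (s + 1).choose 2 + h
  hh : 2 * (h + 1) ≤ s
  hs : h + 3 ≤ s
  span_eq : Ideal.span (gradedPiece (vanishingIdeal pts) s : Set (R₃ k)) =
    vanishingIdeal pts

namespace PointSetup

variable {k : Type*} [Field k] (S : PointSetup k)

/-- The ideal of the points. -/
abbrev I : Ideal (R₃ k) := vanishingIdeal S.pts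

/-- The forms of degree `d` vanishing at the points. -/
abbrev piece (d : ℕ) : Submodule k (R₃ k) := gradedPiece S.I d

theorem mem_I {g : R₃ k} : g ∈ S.I ↔ ∀ i, g ∈ pointIdeal (S.pts i) := by
  simp [I, _root_.vanishingIdeal]

theorem mem_piece {g : R₃ k} {d : ℕ} :
    g ∈ S.piece d ↔ g.IsHomogeneous d ∧ ∀ i, eval (S.pts i) g = 0 := by
  constructor
  · rintro ⟨h1, h2⟩
    exact ⟨h2, fun i => eval_eq_zero_of_mem_pointIdeal (S.mem_I.1 h1 i)⟩
  · rintro ⟨h1, h2⟩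
    exact ⟨S.mem_I.2 fun i => (mem_pointIdeal_iff (S.fam.1 i) h1).2 (h2 i), h1⟩

theorem eval_eq_zero {g : R₃ k} (hg : g ∈ S.I) (i) : eval (S.pts i) g = 0 :=
  eval_eq_zero_of_mem_pointIdeal (S.mem_I.1 hg i)

theorem piece_le (d : ℕ) : S.piece d ≤ ℋ₃ k d := inf_le_right

instance (d : ℕ) : FiniteDimensional k (S.piece d) :=
  Submodule.finiteDimensional_of_le (S.piece_le d)

theorem finrank_piece (d : ℕ) : finrank k (S.piece d) = (d + 2).choose 2 - S.n := S.gen d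

theorem piece_eq_bot {d : ℕ} (hd : d < S.s) : S.piece d = ⊥ := S.indeg.2 d hd

theorem mul_mem_piece {g r : R₃ k} {d e : ℕ} (hr : r.IsHomogeneous e)
    (hg : g ∈ S.piece d) : r * g ∈ S.piece (e + d) :=
  ⟨Ideal.mul_mem_left _ _ hg.1, hr.mul hg.2⟩

theorem n_le {d : ℕ} (hd : S.s ≤ d) : S.n ≤ (d + 2).choose 2 := by
  have h1 : (S.s + 2).choose 2 ≤ (d + 2).choose 2 := Nat.choose_le_choose 2 (by omega)
  have h2 : (S.s + 2).choose 2 = (S.s + 1) + (S.s + 1).choose 2 := by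
    rw [Nat.choose_succ_succ' (S.s + 1) 1, Nat.choose_one_right]
  have := S.hn
  have := S.hs
  omega

theorem n_le_pred (h0 : S.h = 0) {d : ℕ} (hd : S.s ≤ d + 1) : S.n ≤ (d + 2).choose 2 := by
  have h1 : (S.s + 1).choose 2 ≤ (d + 2).choose 2 := Nat.choose_le_choose 2 (by omega)
  have := S.hn
  omega

theorem exists_eval_eq {d : ℕ} (hd : S.n ≤ (d + 2).choose 2) (c : Fin S.n → k) :
    ∃ g : R₃ k, g.IsHomogeneous d ∧ ∀ i, eval (S.pts i) g = c i := by
  let E : ℋ₃ k d →ₗ[k] (Fin S.n → k) :=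
    (LinearMap.pi fun i => (aeval (S.pts i) : R₃ k →ₐ[k] k).toLinearMap) ∘ₗ
      (ℋ₃ k d).subtype
  have hE : ∀ g i, E g i = eval (S.pts i) (g : R₃ k) := fun g i => by
    simp [E, aeval_eq_eval]
  have hker : finrank k (ker E) = (d + 2).choose 2 - S.n := by
    rw [← S.finrank_piece d]
    have : (ker E).map (ℋ₃ k d).subtype = S.piece d := by
      ext g
      rw [mem_piece]
      constructor
      · rintro ⟨⟨x, hx⟩, h1, rfl⟩
        exact ⟨hx, fun i => (hE ⟨x, hx⟩ i).symm.trans (congrFun h1 i)⟩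
      · rintro ⟨h1, h2⟩
        exact ⟨⟨g, h1⟩, funext fun i => by rw [hE]; exact h2 i, rfl⟩
    rw [← this]
    exact (Submodule.equivMapOfInjective _ Subtype.val_injective _).finrank_eq
  have h1 := LinearMap.finrank_range_add_finrank_ker E
  rw [hker, finrank_homogeneousSubmodule_three] at h1
  have h2 : LinearMap.range E = ⊤ := by
    apply Submodule.eq_top_of_finrank_eq
    rw [Module.finrank_fintype_fun_eq_card, Fintype.card_fin]
    omega
  obtain ⟨g, hg⟩ := LinearMap.range_eq_top.1 h2 c
  exact ⟨g, g.2, fun i => by rw [← hE, hg]⟩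

theorem exists_separator (i : Fin S.n) :
    ∃ g : R₃ k, g.IsHomogeneous S.s ∧ eval (S.pts i) g = 1 ∧
      ∀ j, j ≠ i → eval (S.pts j) g = 0 := by
  obtain ⟨g, hg, h⟩ := S.exists_eval_eq (S.n_le le_rfl) (Pi.single i 1)
  exact ⟨g, hg, by simp [h], fun j hj => by simp [h, hj]⟩

/-- A line avoiding all the points. -/
def Avoids (L : LineChart k) : Prop := ∀ i, eval (S.pts i) L.eqn ≠ 0

theorem exists_avoids [Infinite k] : ∃ L : LineChart k, S.Avoids L := by
  classical
  let K : Fin 3 → k → Submodule k (R₃ k) := fun _ _ => ⊥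
  obtain ⟨l, hl, hl'⟩ := exists_mem_forall_notMem_of_not_le (ℋ₃ k 1)
    (insert ⊥ (Finset.univ.image fun i => ker
      (aeval (S.pts i) : R₃ k →ₐ[k] k).toLinearMap)) (by
    intro p hp hle
    rcases Finset.mem_insert.1 hp with rfl | hp
    · have := hle (isHomogeneous_X k (0 : Fin 3))
      exact X_ne_zero (0 : Fin 3) this
    · obtain ⟨i, -, rfl⟩ := Finset.mem_image.1 hp
      obtain ⟨m, hm, hm0⟩ := exists_isHomogeneous_one_eval_ne_zero (S.fam.1 i)
      have := hle hm
      exact hm0 (by simpa [aeval_eq_eval] using this))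
  obtain ⟨L, rfl⟩ := LineChart.exists_eqn_eq hl (by
    have := hl' ⊥ (by simp)
    simpa using this)
  refine ⟨L, fun i hi => hl' _ (Finset.mem_insert_of_mem (Finset.mem_image.2 ⟨i, by simp, rfl⟩)) ?_⟩
  simpa [aeval_eq_eval] using hi

variable {S}

theorem Avoids.mem_of_eqn_mul_mem {L : LineChart k} (hL : S.Avoids L) {g : R₃ k}
    {d : ℕ} (hg : g.IsHomogeneous d) (h : L.eqn * g ∈ S.I) : g ∈ S.piece d := by
  refine S.mem_piece.2 ⟨hg, fun i => ?_⟩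
  have := S.eval_eq_zero h i
  rw [map_mul] at this
  exact (mul_eq_zero.1 this).resolve_left (hL i)

theorem Avoids.exists_eq_eqn_mul {L : LineChart k} (hL : S.Avoids L) {g : R₃ k}
    {d : ℕ} (hg : g ∈ S.piece (d + 1)) (h : L.res g = 0) :
    ∃ g' ∈ S.piece d, g = L.eqn * g' := by
  obtain ⟨g', h1, rfl⟩ := L.exists_eq_eqn_mul hg.2 h
  exact ⟨g', hL.mem_of_eqn_mul_mem h1 hg.1, rfl⟩

theorem Avoids.eq_zero_of_res {L : LineChart k} (hL : S.Avoids L) {g : R₃ k}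
    (hg : g ∈ S.piece S.s) (h : L.res g = 0) : g = 0 := by
  have hs := S.hs
  obtain ⟨s', hs'⟩ : ∃ s', S.s = s' + 1 := ⟨S.s - 1, by omega⟩
  rw [hs'] at hg
  obtain ⟨g', h1, rfl⟩ := hL.exists_eq_eqn_mul hg h
  rw [S.piece_eq_bot (by omega)] at h1
  rw [(Submodule.mem_bot k).1 h1, mul_zero]

theorem Avoids.map_res_piece {L : LineChart k} (hL : S.Avoids L) {d : ℕ}
    (hd : S.n ≤ (d + 2).choose 2) :
    (S.piece (d + 1)).map L.res.toLinearMap = ℋ₂ k (d + 1) := by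
  have hle : (S.piece (d + 1)).map L.res.toLinearMap ≤ ℋ₂ k (d + 1) := by
    rintro _ ⟨g, hg, rfl⟩
    exact L.res_hom hg.2
  apply Submodule.eq_of_le_of_finrank_le hle
  let F := L.res.toLinearMap ∘ₗ (S.piece (d + 1)).subtype
  have hr : LinearMap.range F = (S.piece (d + 1)).map L.res.toLinearMap := by
    rw [LinearMap.range_comp, Submodule.range_subtype]
  have hk : (ker F).map (S.piece (d + 1)).subtype =
      (S.piece d).map (LinearMap.mulLeft k L.eqn) := by
    ext g
    constructor
    · rintro ⟨⟨x, hx⟩, h1, rfl⟩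
      obtain ⟨g', h2, h3⟩ := hL.exists_eq_eqn_mul hx (show L.res x = 0 from h1)
      exact ⟨g', h2, h3.symm⟩
    · rintro ⟨g', hg', rfl⟩
      have := S.mul_mem_piece L.eqn_hom hg'
      rw [add_comm] at this
      exact ⟨⟨_, this⟩, show L.res (L.eqn * g') = 0 by rw [map_mul, L.res_eqn, zero_mul], rfl⟩
  have h1 := LinearMap.finrank_range_add_finrank_ker F
  have h2 := (Submodule.equivMapOfInjective (S.piece (d + 1)).subtype Subtype.val_injective
    (ker F)).finrank_eq
  rw [hr, h2, hk, finrank_map_mulLeft L.eqn_ne, S.finrank_piece, S.finrank_piece] at h1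
  rw [finrank_homogeneousSubmodule_two]
  have h3 : (d + 1 + 2).choose 2 = (d + 2) + (d + 2).choose 2 := by
    rw [Nat.choose_succ_succ' (d + 2) 1, Nat.choose_one_right]
  omega

theorem span_V_induction {p : R₃ k → Prop}
    (hmem : ∀ a ∈ S.piece S.s, p a) (hadd : ∀ a b, p a → p b → p (a + b))
    (hmul : ∀ r a, p a → p (r * a)) {g} (hg : g ∈ S.I) : p g := by
  rw [I, ← S.span_eq] at hg
  have h0 : p 0 := hmem 0 (Submodule.zero_mem _)
  induction hg using Submodule.span_induction with
  | mem x hx => exact hmem x hx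
  | zero => exact h0
  | add x y _ _ hx hy => exact hadd x y hx hy
  | smul r x _ hx => exact hmul r x hx

theorem Avoids.isUnit_of_forall_dvd {L : LineChart k} (hL : S.Avoids L)
    {π : R₂ k} (h : ∀ a ∈ S.piece S.s, π ∣ L.res a) : IsUnit π := by
  have h1 : ∀ g ∈ S.I, π ∣ L.res g := fun g hg => by
    refine span_V_induction h (fun a b ha hb => ?_) (fun r a ha => ?_) hg
    · rw [map_add]; exact dvd_add ha hb
    · rw [map_mul]; exact ha.mul_left _
  have h2 : ∀ i : Fin 2, π ∣ X i ^ (S.s + 1) := fun i => by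
    have : (X i ^ (S.s + 1) : R₂ k) ∈
        ℋ₂ k (S.s + 1) := isHomogeneous_X_pow i _
    rw [← hL.map_res_piece (S.n_le le_rfl)] at this
    obtain ⟨g, hg, hg'⟩ := this
    rw [← hg']
    exact h1 g hg.1
  have h3 : IsRelPrime (X 0 ^ (S.s + 1) : R₂ k) (X 1 ^ (S.s + 1)) := by
    apply IsRelPrime.pow
    rw [(X_prime (R := k) (i := (0 : Fin 2))).irreducible.isRelPrime_iff_not_dvd]
    rw [X_dvd_X]
    simp
  exact h3 (h2 0) (h2 1)

theorem exists_du_eq {i : Fin S.n} (c : PointChart (S.pts i)) (t : Fin 2 → k) :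
    ∃ a ∈ S.piece S.s, c.du a = t := by
  suffices h : ⊤ ≤ (S.piece S.s).map c.duLin by
    obtain ⟨a, ha, h'⟩ := h (Submodule.mem_top (x := t))
    exact ⟨a, ha, h'⟩
  have h1 : ∀ g ∈ S.I, c.duLin g ∈ (S.piece S.s).map c.duLin := fun g hg => by
    suffices eval (S.pts i) g = 0 ∧ c.duLin g ∈ (S.piece S.s).map c.duLin from this.2
    refine span_V_induction (p := fun g => eval (S.pts i) g = 0 ∧
      c.duLin g ∈ (S.piece S.s).map c.duLin) (fun a ha => ⟨?_, Submodule.mem_map_of_mem ha⟩)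
      (fun a b ha hb => ?_) (fun r a ha => ?_) hg
    · exact S.eval_eq_zero ha.1 i
    · rw [map_add, map_add, ha.1, hb.1, add_zero]
      exact ⟨rfl, Submodule.add_mem _ ha.2 hb.2⟩
    · refine ⟨by rw [map_mul, ha.1, mul_zero], ?_⟩
      have : c.duLin (r * a) = eval (S.pts i) r • c.duLin a := by
        ext j
        simp only [PointChart.duLin, LinearMap.coe_mk, AddHom.coe_mk, Pi.smul_apply, smul_eq_mul]
        rw [c.du_mul, ha.1, mul_zero, add_zero]
      rw [this]
      exact Submodule.smul_mem _ _ ha.2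
  obtain ⟨g, hg, hg1, hg2⟩ := S.exists_separator i
  have h2 : ∀ m : R₃ k, m.IsHomogeneous 1 → eval (S.pts i) m = 0 →
      c.du m ∈ (S.piece S.s).map c.duLin := fun m hm hm0 => by
    have h3 : m * g ∈ S.I := (S.mem_piece.2 ⟨hm.mul hg, fun j => by
      by_cases hj : j = i
      · rw [hj, map_mul, hm0, zero_mul]
      · rw [map_mul, hg2 j hj, mul_zero]⟩).1
    have h4 : c.duLin (m * g) = c.du m := by
      ext j
      simp only [PointChart.duLin, LinearMap.coe_mk, AddHom.coe_mk]
      rw [c.du_mul, hm0, hg1]; ring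
    rw [← h4]
    exact h1 _ h3
  intro t _
  have e : t = t 0 • c.du c.l + t 1 • c.du c.l' := by
    ext j
    simp only [Pi.add_apply, Pi.smul_apply, c.du_l, c.du_l']
    fin_cases j <;> simp
  rw [e]
  exact Submodule.add_mem _ (Submodule.smul_mem _ _ (h2 _ c.l_hom c.eval_l))
    (Submodule.smul_mem _ _ (h2 _ c.l'_hom c.eval_l'))

end PointSetup

end Setup

section Triples

theorem PointChart.exists_eq_add {k : Type*} [Field k] {p : Fin 3 → k} (c : PointChart p)
    {s : ℕ} (hs : 1 ≤ s) {a : R₃ k} (ha : a.IsHomogeneous s)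
    (ha0 : eval p a = 0) (hp : p ≠ 0) : ∃ A B : R₃ k,
      A.IsHomogeneous (s - 1) ∧ B.IsHomogeneous (s - 1) ∧ a = A * c.l + B * c.l' ∧
      eval p A = c.du a 0 ∧ eval p B = c.du a 1 := by
  have h := (mem_pointIdeal_iff hp ha).2 ha0
  rw [c.span_eq] at h
  obtain ⟨A, B, hAB⟩ := Ideal.mem_span_pair.1 h
  have e : a = homogeneousComponent (s - 1) A * c.l + homogeneousComponent (s - 1) B * c.l' := by
    rw [← homogeneousComponent_mul_of_isHomogeneous c.l_hom,
      ← homogeneousComponent_mul_of_isHomogeneous c.l'_hom, ← map_add, hAB, Nat.sub_add_cancel hs,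
      homogeneousComponent_of_mem ha, if_pos rfl]
  refine ⟨_, _, homogeneousComponent_isHomogeneous _ A, homogeneousComponent_isHomogeneous _ B, e,
    ?_, ?_⟩
  · conv_rhs => rw [e]
    rw [c.du_add, c.du_mul, c.du_mul, c.du_l, c.du_l', c.eval_l, c.eval_l']; simp
  · conv_rhs => rw [e]
    rw [c.du_add, c.du_mul, c.du_mul, c.du_l, c.du_l', c.eval_l, c.eval_l']; simp

namespace PointSetup

variable {k : Type*} [Field k] (S : PointSetup k)

theorem hs_pos : 1 ≤ S.s := by have := S.hs; omega

/-- Chosen affine coordinates at each of the points. -/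
def chart (i : Fin S.n) : PointChart (S.pts i) :=
  (PointChart.nonempty (S.fam.1 i)).some

/-- Three general elements of the initial degree piece. -/
structure GoodTriple (L : LineChart k) (q : ℕ) where
  a1 : R₃ k
  a2 : R₃ k
  a3 : R₃ k
  mem1 : a1 ∈ S.piece S.s
  mem2 : a2 ∈ S.piece S.s
  mem3 : a3 ∈ S.piece S.s
  res1 : L.res a1 ≠ 0
  res2 : L.res a2 ≠ 0
  res3 : L.res a3 ≠ 0
  coprime : IsRelPrime (L.res a1) (L.res a2)
  det_ne : ∀ i, (S.chart i).du a1 0 * (S.chart i).du a2 1 -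
    (S.chart i).du a1 1 * (S.chart i).du a2 0 ≠ 0
  regular : ∀ g ∈ S.I, a3 * g ∈ Ideal.span {a1, a2} → g ∈ Ideal.span {a1, a2}
  disc_ne : L.res a2 * X 1 ^ q - L.res a1 * X 0 ^ q ≠ 0
  coprime_disc : IsRelPrime (L.res a3) (L.res a2 * X 1 ^ q - L.res a1 * X 0 ^ q)
  coprime_left : IsRelPrime (L.res a3) (L.res a1)

variable {S}

/-- The forms whose restriction to a line is divisible by a given form. -/
def dvdRes (L : LineChart k) (π : R₂ k) : Submodule k (R₃ k) :=
  ((Ideal.span {π}).comap L.res).restrictScalars k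

theorem mem_dvdRes {L : LineChart k} {π : R₂ k} {a : R₃ k} :
    a ∈ dvdRes L π ↔ π ∣ L.res a := Ideal.mem_span_singleton

theorem exists_coprime_res [Infinite k] {L : LineChart k} (hL : S.Avoids L)
    {δ : R₂ k} (hδ : δ ≠ 0)
    (T : Finset (Submodule k (R₃ k))) (hT : ∀ p ∈ T, ¬ S.piece S.s ≤ p) :
    ∃ a ∈ S.piece S.s, L.res a ≠ 0 ∧ IsRelPrime δ (L.res a) ∧ ∀ p ∈ T, a ∉ p := by
  classical
  obtain ⟨a, ha, h⟩ := exists_mem_forall_notMem_of_not_le (S.piece S.s)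
    (insert ⊥ (T ∪ (UniqueFactorizationMonoid.factors δ).toFinset.image (dvdRes L))) (by
    intro p hp hle
    rcases Finset.mem_insert.1 hp with rfl | hp
    · exact S.indeg.1 (le_bot_iff.1 hle)
    rcases Finset.mem_union.1 hp with hp | hp
    · exact hT p hp hle
    · obtain ⟨π, hπ, rfl⟩ := Finset.mem_image.1 hp
      have hp := UniqueFactorizationMonoid.prime_of_factor π (Multiset.mem_toFinset.1 hπ)
      exact hp.not_isUnit (hL.isUnit_of_forall_dvd fun a ha => mem_dvdRes.1 (hle ha)))
  refine ⟨a, ha, fun h0 => h ⊥ (by simp) ?_, ?_, fun p hp =>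
    h p (Finset.mem_insert_of_mem (Finset.mem_union_left _ hp))⟩
  · exact (Submodule.mem_bot k).2 (hL.eq_zero_of_res ha h0)
  · rw [UniqueFactorizationMonoid.isRelPrime_iff_no_prime_factors hδ]
    intro d hd hda hdp
    obtain ⟨π, hπ, hass⟩ := UniqueFactorizationMonoid.exists_mem_factors_of_dvd hδ
      hdp.irreducible hd
    exact h (dvdRes L π) (Finset.mem_insert_of_mem (Finset.mem_union_right _
      (Finset.mem_image.2 ⟨π, Multiset.mem_toFinset.2 hπ, rfl⟩)))
      (mem_dvdRes.2 (hass.dvd_iff_dvd_left.1 hda))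

theorem disc_ne_zero {r1 r2 : R₂ k} {s q : ℕ} (h1 : r1.IsHomogeneous s)
    (hcop : IsRelPrime r1 r2) (hq : q ≠ s) :
    r2 * X 1 ^ q - r1 * X 0 ^ q ≠ 0 := by
  intro h
  have h3 : IsRelPrime (X 1 ^ q : R₂ k) (X 0 ^ q) := by
    apply IsRelPrime.pow
    rw [(X_prime (R := k) (i := (1 : Fin 2))).irreducible.isRelPrime_iff_not_dvd, X_dvd_X]
    simp
  have e1 : r1 ∣ X 1 ^ q := hcop.dvd_of_dvd_mul_left ⟨X 0 ^ q, by linear_combination h⟩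
  have e2 : X 1 ^ q ∣ r1 := h3.dvd_of_dvd_mul_right ⟨r2, by linear_combination -h⟩
  obtain ⟨c, hc⟩ := e1
  obtain ⟨c', hc'⟩ := e2
  have hX : (X 1 ^ q : R₂ k) ≠ 0 := pow_ne_zero _ (X_ne_zero _)
  have hu : IsUnit c := by
    refine IsUnit.of_mul_eq_one c' (mul_left_cancel₀ hX ?_)
    linear_combination (-1 : R₂ k) * hc - c * hc'
  have h4 := (h1.mul (isHomogeneous_zero_of_isUnit hu))
  rw [← hc, add_zero] at h4
  exact hq ((isHomogeneous_X_pow (1 : Fin 2) q).inj_right h4 hX)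

theorem exists_goodTriple [Infinite k] {L : LineChart k} (hL : S.Avoids L) {q : ℕ}
    (hq : q ≠ S.s) : Nonempty (S.GoodTriple L q) := by
  classical
  -- the first element
  obtain ⟨a1, ha1, h1, -, hdu1⟩ := exists_coprime_res hL (one_ne_zero (α := R₂ k))
    (Finset.univ.image fun i => ker (S.chart i).duLin) (by
      intro p hp hle
      obtain ⟨i, -, rfl⟩ := Finset.mem_image.1 hp
      obtain ⟨a, ha, h⟩ := S.exists_du_eq (S.chart i) (fun _ => 1)
      have := congrFun (h.symm.trans (hle ha)) 0
      exact one_ne_zero this)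
  -- the second element
  let D : Fin S.n → R₃ k →ₗ[k] k := fun i =>
    ((S.chart i).du a1 0 • LinearMap.proj 1 - (S.chart i).du a1 1 • LinearMap.proj 0) ∘ₗ
      (S.chart i).duLin
  obtain ⟨a2, ha2, h2, hcop, hdu2⟩ := exists_coprime_res hL h1
    (Finset.univ.image fun i => ker (D i)) (by
      intro p hp hle
      obtain ⟨i, -, rfl⟩ := Finset.mem_image.1 hp
      have key : ∀ t : Fin 2 → k, (S.chart i).du a1 0 * t 1 - (S.chart i).du a1 1 * t 0 = 0 := by
        intro t
        obtain ⟨a, ha, h⟩ := S.exists_du_eq (S.chart i) t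
        have : D i a = 0 := hle ha
        rw [← h]
        exact this
      refine hdu1 _ (Finset.mem_image.2 ⟨i, Finset.mem_univ _, rfl⟩) ?_
      change (S.chart i).du a1 = 0
      ext j
      fin_cases j
      · simpa using key ![0, 1]
      · simpa using key ![1, 0])
  have hdet : ∀ i, (S.chart i).du a1 0 * (S.chart i).du a2 1 -
      (S.chart i).du a1 1 * (S.chart i).du a2 0 ≠ 0 := fun i h =>
    hdu2 _ (Finset.mem_image.2 ⟨i, Finset.mem_univ _, rfl⟩) h
  have hδ := disc_ne_zero (L.res_hom ha1.2) hcop hq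
  -- the third element
  set J : Ideal (R₃ k) := Ideal.span {a1, a2}
  let M := Submodule.map (Submodule.mkQ J) S.I
  have hfin := associatedPrimes.finite (R₃ k) M
  obtain ⟨a3, ha3, h3, hcop3, hass⟩ := exists_coprime_res hL (mul_ne_zero h1 hδ)
    ((hfin.toFinset.filter fun P => ¬ S.I ≤ P).image fun P => P.restrictScalars k) (by
      intro p hp hle
      obtain ⟨P, hP, rfl⟩ := Finset.mem_image.1 hp
      refine (Finset.mem_filter.1 hP).2 fun g hg => ?_
      exact span_V_induction (p := (· ∈ P)) (fun a ha => hle ha)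
        (fun a b => P.add_mem) (fun r a => P.mul_mem_left r) hg)
  refine ⟨⟨a1, a2, a3, ha1, ha2, ha3, h1, h2, h3, hcop, hdet, ?_, hδ,
    (hcop3.of_mul_left_right).symm, (hcop3.of_mul_left_left).symm⟩⟩
  intro g hg hga
  by_contra hgJ
  let x : M := ⟨Submodule.mkQ J g, Submodule.mem_map_of_mem hg⟩
  have hx : x ≠ 0 := fun h => hgJ (by
    have := congrArg Subtype.val h
    exact (Submodule.Quotient.mk_eq_zero J).1 this)
  obtain ⟨P, hP, hle⟩ := exists_le_isAssociatedPrime_of_isNoetherianRing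
    (R₃ k) x hx
  have ha3P : a3 ∈ P := hle (by
    rw [Submodule.mem_colon_singleton, Submodule.mem_bot]
    apply Subtype.ext
    exact (Submodule.Quotient.mk_eq_zero J).2 hga)
  have hIP : S.I ≤ P := by
    by_contra hIP
    exact hass _ (Finset.mem_image.2 ⟨P, Finset.mem_filter.2 ⟨hfin.mem_toFinset.2 hP, hIP⟩, rfl⟩)
      ha3P
  obtain ⟨hPp, ⟨y, hyM⟩, hy⟩ := Submodule.isAssociatedPrime_iff.1 hP
  obtain ⟨g', hg', rfl⟩ := hyM
  have hPmem : ∀ r, r ∈ P ↔ r * g' ∈ J := by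
    intro r
    rw [hy, Submodule.mem_colon_singleton, Submodule.mem_bot, Subtype.ext_iff]
    exact Submodule.Quotient.mk_eq_zero J
  obtain ⟨i, hi⟩ : ∃ i, pointIdeal (S.pts i) ≤ P := by
    have h1 : Finset.univ.inf (fun i => pointIdeal (S.pts i)) ≤ P := by
      rwa [Finset.inf_univ_eq_iInf]
    obtain ⟨i, -, hi⟩ := hPp.inf_le'.1 h1
    exact ⟨i, hi⟩
  obtain ⟨A1, B1, hA1, hB1, e1, v1, w1⟩ := (S.chart i).exists_eq_add S.hs_pos ha1.2 (S.eval_eq_zero ha1.1 i)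
    (S.fam.1 i)
  obtain ⟨A2, B2, hA2, hB2, e2, v2, w2⟩ := (S.chart i).exists_eq_add S.hs_pos ha2.2 (S.eval_eq_zero ha2.1 i)
    (S.fam.1 i)
  have hΔ : A1 * B2 - B1 * A2 ∈ P := by
    rw [hPmem]
    have := S.mem_I.1 hg' i
    rw [(S.chart i).span_eq] at this
    obtain ⟨u, v, rfl⟩ := Ideal.mem_span_pair.1 this
    refine Ideal.mem_span_pair.2 ⟨u * B2 - v * A2, v * A1 - u * B1, ?_⟩
    rw [e1, e2]; ring
  have hΔh : (A1 * B2 - B1 * A2).IsHomogeneous (S.s - 1 + (S.s - 1)) :=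
    (hA1.mul hB2).sub (hB1.mul hA2)
  have hc := C_pow_mul_sub_mem_pointIdeal (p := S.pts i) hΔh L.eqn_hom
  have hl : L.eqn ∈ P := by
    apply hPp.mem_of_pow_mem (S.s - 1 + (S.s - 1))
    have h4 : C (eval (S.pts i) (A1 * B2 - B1 * A2)) * L.eqn ^ (S.s - 1 + (S.s - 1)) ∈ P := by
      have := P.sub_mem (P.mul_mem_left (C (eval (S.pts i) L.eqn) ^ (S.s - 1 + (S.s - 1))) hΔ)
        (hi hc)
      rwa [sub_sub_cancel] at this
    have h5 : eval (S.pts i) (A1 * B2 - B1 * A2) ≠ 0 := by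
      rw [map_sub, map_mul, map_mul, v1, v2, w1, w2]
      exact hdet i
    have h6 := P.mul_mem_left (C (eval (S.pts i) (A1 * B2 - B1 * A2))⁻¹) h4
    rwa [← mul_assoc, ← C_mul, inv_mul_cancel₀ h5, C_1, one_mul] at h6
  have h7 := L.mem_span_pair_of_eqn_mul_mem h2 hcop ((hPmem _).1 hl)
  exact hPp.ne_top ((Ideal.eq_top_iff_one P).2 ((hPmem 1).2 (by rwa [one_mul])))

end PointSetup

end Triples

section Independence

theorem sum_polynomial_eval₂_mul_mem {ι B R : Type*} [Fintype ι] [CommRing B] [CommRing R]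
    (φ : B →+* R) (N : Ideal R) (x : R) (g : ι → R) (hx : ∀ r, x * r ∈ N → r ∈ N)
    (h : ∀ q : ι → B, ∑ j, φ (q j) * g j ∈ N ⊔ Ideal.span {x} → q = 0) (q : ι → Polynomial B)
    (hq : ∑ j, (q j).eval₂ φ x * g j ∈ N) : q = 0 := by
  obtain ⟨d, hd⟩ : ∃ d, ∀ j, (q j).natDegree < d :=
    ⟨Finset.univ.sup (fun j => (q j).natDegree) + 1, fun j =>
      Nat.lt_succ_of_le (Finset.le_sup (f := fun j => (q j).natDegree) (Finset.mem_univ j))⟩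
  induction d generalizing q with
  | zero => funext j; exact absurd (hd j) (by omega)
  | succ d ih =>
    have e : ∑ j, (q j).eval₂ φ x * g j =
        ∑ j, φ ((q j).coeff 0) * g j + x * ∑ j, ((q j).divX).eval₂ φ x * g j := by
      rw [mul_sum, ← Finset.sum_add_distrib]
      refine sum_congr rfl fun j _ => ?_
      conv_lhs => rw [← Polynomial.divX_mul_X_add (q j)]
      rw [Polynomial.eval₂_add, Polynomial.eval₂_mul_X, Polynomial.eval₂_C]
      ring
    have h0 : (fun j => (q j).coeff 0) = 0 := by
      apply h
      have : ∑ j, φ ((q j).coeff 0) * g j = ∑ j, (q j).eval₂ φ x * g j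
          - x * ∑ j, ((q j).divX).eval₂ φ x * g j := by rw [e]; ring
      rw [this]
      exact Ideal.sub_mem _ (Ideal.mem_sup_left hq)
        (Ideal.mem_sup_right (Ideal.mem_span_singleton.2 (dvd_mul_right _ _)))
    have h1 : (fun j => (q j).divX) = 0 := by
      rcases Nat.eq_zero_or_pos d with rfl | hd0
      · funext j
        have := hd j
        change (q j).divX = 0
        rw [Polynomial.divX_eq_zero_iff]
        exact Polynomial.eq_C_of_natDegree_eq_zero (by omega)
      · refine ih _ (hx _ ?_) fun j => ?_
        · have h0' : ∀ j, (q j).coeff 0 = 0 := fun j => congrFun h0 j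
          rw [e] at hq
          simpa [h0'] using hq
        · have := hd j
          rw [Polynomial.natDegree_divX_eq_natDegree_tsub_one]
          omega
    funext j
    rw [← Polynomial.divX_mul_X_add (q j), show (q j).divX = 0 from congrFun h1 j,
      show (q j).coeff 0 = 0 from congrFun h0 j]
    simp

theorem aeval_cons_eq_eval₂ {k R : Type*} [Field k] [CommRing R] [Algebra k R] {m : ℕ} (x : R)
    (a : Fin m → R) (q : R[m + 1] k) :
    aeval (Fin.cons x a : Fin (m + 1) → R) q =
      (finSuccEquiv k m q).eval₂ (aeval a : R[m] k →ₐ[k] R).toRingHom x := by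
  let F : R[m + 1] k →+* R :=
    (Polynomial.eval₂RingHom (aeval a : R[m] k →ₐ[k] R).toRingHom x).comp
      (finSuccEquiv k m).toRingEquiv.toRingHom
  change (aeval (Fin.cons x a : Fin (m + 1) → R) : R[m + 1] k →ₐ[k] R).toRingHom q
    = F q
  congr 1
  apply MvPolynomial.ringHom_ext
  · intro r
    have h1 : finSuccEquiv k m (C r) = C₁ (C r) :=
      ((AlgEquiv.symm_apply_eq _).1 (RingHom.congr_fun (finSuccEquiv_comp_C_eq_C m) r)).symm
    simp [F, h1]
  · intro i
    refine Fin.cases ?_ (fun j => ?_) i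
    · simp [F, finSuccEquiv_X_zero]
    · simp [F, finSuccEquiv_X_succ]

theorem sum_aeval_cons_mul_mem {k ι R : Type*} [Field k] [Fintype ι] [CommRing R] [Algebra k R]
    {m : ℕ} (a : Fin m → R) (N : Ideal R) (x : R) (g : ι → R) (hx : ∀ r, x * r ∈ N → r ∈ N)
    (h : ∀ q : ι → R[m] k, ∑ j, aeval a (q j) * g j ∈ N ⊔ Ideal.span {x} → q = 0)
    (q : ι → R[m + 1] k)
    (hq : ∑ j, aeval (Fin.cons x a : Fin (m + 1) → R) (q j) * g j ∈ N) : q = 0 := by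
  simp_rw [aeval_cons_eq_eval₂] at hq
  have := sum_polynomial_eval₂_mul_mem (aeval a : R[m] k →ₐ[k] R).toRingHom N x g
    hx h (fun j => finSuccEquiv k m (q j)) hq
  funext j
  have h1 := congrFun this j
  simpa using h1

variable {k : Type*} [Field k]

theorem homogeneousComponent_aeval {m : ℕ} {σ : Type*} {a : Fin m → MvPolynomial σ k} {s : ℕ}
    (ha : ∀ i, (a i).IsHomogeneous s) (hs : 1 ≤ s) (q : R[m] k) (e : ℕ) :
    homogeneousComponent (s * e) (aeval a q) = aeval a (homogeneousComponent e q) := by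
  induction q using MvPolynomial.induction_on' with
  | monomial u c =>
    have h1 : (monomial u c : R[m] k).IsHomogeneous u.degree :=
      isHomogeneous_monomial c rfl
    have h2 : (aeval a (monomial u c)).IsHomogeneous (s * u.degree) := h1.aeval a ha
    rw [homogeneousComponent_of_mem h2, homogeneousComponent_of_mem h1]
    have : s * e = s * u.degree ↔ e = u.degree := Nat.mul_right_inj (by omega)
    simp only [this]
    split_ifs <;> simp
  | add a b ha hb => rw [map_add, map_add, ha, hb, map_add, map_add]

theorem homogeneousComponent_add_mul_of_isHomogeneous {σ : Type*} {p q : MvPolynomial σ k} {m : ℕ}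
    (hq : q.IsHomogeneous m) {d : ℕ} (hd : m ≤ d) :
    homogeneousComponent d (p * q) = homogeneousComponent (d - m) p * q := by
  obtain ⟨c, rfl⟩ := Nat.exists_eq_add_of_le' hd
  rw [homogeneousComponent_mul_of_isHomogeneous hq, Nat.add_sub_cancel]

/-- Homogeneous elements of an ideal generated by two forms of the same degree. -/
theorem exists_of_isHomogeneous_mem_span_pair {σ : Type*} {a b x : MvPolynomial σ k} {s d : ℕ}
    (ha : a.IsHomogeneous s) (hb : b.IsHomogeneous s) (hx : x.IsHomogeneous (s + d))
    (h : x ∈ Ideal.span {a, b}) : ∃ p q : MvPolynomial σ k,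
      p.IsHomogeneous d ∧ q.IsHomogeneous d ∧ x = a * p + b * q := by
  obtain ⟨p, q, hpq⟩ := Ideal.mem_span_pair.1 h
  refine ⟨_, _, homogeneousComponent_isHomogeneous d p, homogeneousComponent_isHomogeneous d q, ?_⟩
  have h1 := congrArg (homogeneousComponent (d + s)) hpq
  rw [map_add, homogeneousComponent_mul_of_isHomogeneous ha,
    homogeneousComponent_mul_of_isHomogeneous hb, homogeneousComponent_of_mem hx,
    if_pos (add_comm _ _)] at h1
  rw [← h1]; ring

theorem homogeneousComponent_mem_span_pair {σ : Type*} {a b x : MvPolynomial σ k} {s : ℕ}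
    (ha : a.IsHomogeneous s) (hb : b.IsHomogeneous s) (h : x ∈ Ideal.span {a, b}) (d : ℕ) :
    homogeneousComponent d x ∈ Ideal.span {a, b} := by
  obtain ⟨p, q, rfl⟩ := Ideal.mem_span_pair.1 h
  rcases Nat.lt_or_ge d s with hd | hd
  · rw [map_add, homogeneousComponent_mul_of_lt ha hd, homogeneousComponent_mul_of_lt hb hd]
    simp
  · rw [map_add, homogeneousComponent_add_mul_of_isHomogeneous ha hd,
      homogeneousComponent_add_mul_of_isHomogeneous hb hd]
    exact Ideal.mem_span_pair.2 ⟨_, _, rfl⟩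

namespace PointSetup.GoodTriple

variable {S : PointSetup k} {L : LineChart k} {q : ℕ} (t : S.GoodTriple L q)

theorem mem_of_pow_mul_mem {g : R₃ k} (hg : g ∈ S.I) (e : ℕ)
    (h : t.a3 ^ e * g ∈ Ideal.span {t.a1, t.a2}) : g ∈ Ideal.span {t.a1, t.a2} := by
  induction e with
  | zero => simpa using h
  | succ e ih =>
    exact ih (t.regular _ (Ideal.mul_mem_left _ _ hg) (by rwa [← mul_assoc, ← pow_succ']))

theorem a1_ne : t.a1 ≠ 0 := fun h => t.res1 (by rw [h, map_zero])

theorem a2_ne : t.a2 ≠ 0 := fun h => t.res2 (by rw [h, map_zero])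

theorem a3_ne : t.a3 ≠ 0 := fun h => t.res3 (by rw [h, map_zero])

theorem isRelPrime : IsRelPrime t.a1 t.a2 :=
  L.isRelPrime_of_res t.mem1.2 t.a1_ne t.coprime

theorem eq_zero_of_sum_aeval_mul_eq_zero {ι : Type*} [Fintype ι] {d : ℕ}
    {g : ι → R₃ k} (hg : ∀ j, g j ∈ S.piece d)
    (hind : ∀ c : ι → k, ∑ j, c j • g j ∈ Ideal.span {t.a1, t.a2} → c = 0)
    (p : ι → R₃ k)
    (hp : ∑ j, aeval ![t.a1, t.a2, t.a3] (p j) * g j = 0) : p = 0 := by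
  refine sum_aeval_cons_mul_mem ![t.a2, t.a3] ⊥ t.a1 g (fun r hr => ?_) (fun p hp => ?_) p hp
  · rw [Ideal.mem_bot] at hr ⊢
    exact (mul_eq_zero.1 hr).resolve_left t.a1_ne
  rw [bot_sup_eq] at hp
  refine sum_aeval_cons_mul_mem ![t.a3] _ t.a2 g (fun r hr => ?_) (fun p hp => ?_) p hp
  · rw [Ideal.mem_span_singleton] at hr ⊢
    exact t.isRelPrime.dvd_of_dvd_mul_left hr
  rw [← Ideal.span_union, Set.singleton_union] at hp
  funext j
  rw [← sum_homogeneousComponent (p j)]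
  refine sum_eq_zero fun e _ => ?_
  have key : ∀ j, homogeneousComponent e (p j) = monomial (Finsupp.single 0 e)
      (coeff (Finsupp.single 0 e) (p j)) := by
    intro j
    ext m
    have hm : m = Finsupp.single 0 m.degree := by
      refine Finsupp.ext fun i => ?_
      rw [Subsingleton.elim i 0]; simp [Finsupp.degree_eq_sum]
    rw [coeff_homogeneousComponent, coeff_monomial]
    by_cases h : m.degree = e
    · rw [if_pos h, if_pos (by rw [hm, h]), hm, h]
    · rw [if_neg h, if_neg]
      intro h'
      exact h (by rw [← h']; simp)
  have h3 : ∀ i, ((![t.a3] : Fin 1 → _) i).IsHomogeneous S.s := fun i => by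
    rw [Subsingleton.elim i 0]; exact t.mem3.2
  have h1 := homogeneousComponent_mem_span_pair t.mem1.2 t.mem2.2 hp (S.s * e + d)
  rw [map_sum] at h1
  simp_rw [homogeneousComponent_mul_of_isHomogeneous (hg _).2,
    homogeneousComponent_aeval h3 S.hs_pos, key, aeval_monomial] at h1
  have h2 : t.a3 ^ e * ∑ j, coeff (Finsupp.single 0 e) (p j) • g j ∈ Ideal.span {t.a1, t.a2} := by
    convert h1 using 1
    rw [mul_sum]
    refine sum_congr rfl fun j _ => ?_
    simp only [Matrix.cons_val_fin_one, pow_zero, Finsupp.prod_single_index, algebraMap_eq]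
    rw [smul_eq_C_mul]; ring
  have h4 := hind _ (t.mem_of_pow_mul_mem (Ideal.sum_mem _ fun j _ =>
    Submodule.smul_of_tower_mem _ _ (hg j).1) e h2)
  rw [key, show coeff (Finsupp.single 0 e) (p j) = 0 from congrFun h4 j, monomial_zero]

end PointSetup.GoodTriple

end Independence

section Dimensions

theorem two_mul_choose_two (m : ℕ) : 2 * (m + 2).choose 2 = (m + 2) * (m + 1) := by
  rw [mul_comm, Nat.choose_two_right, Nat.div_mul_cancel (Nat.even_mul_pred_self _).two_dvd]
  simp

/-- A family in `U` which is linearly independent modulo a subspace `W` of codimension `e`. -/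
theorem exists_linearIndependent_mod {k M : Type*} [Field k] [AddCommGroup M] [Module k M]
    {U W : Submodule k M} [FiniteDimensional k U] {e : ℕ} (hWU : W ≤ U)
    (he : finrank k W + e = finrank k U) :
    ∃ g : Fin e → M, (∀ j, g j ∈ U) ∧ ∀ c : Fin e → k, ∑ j, c j • g j ∈ W → c = 0 := by
  let W' := W.comap U.subtype
  have h1 : finrank k W' = finrank k W :=
    (Submodule.comapSubtypeEquivOfLe hWU).finrank_eq
  have h2 : finrank k (U ⧸ W') = e := by
    have := Submodule.finrank_quotient_add_finrank W'
    omega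
  let b := Module.finBasisOfFinrankEq k (U ⧸ W') h2
  choose g hg using fun j => Submodule.Quotient.mk_surjective W' (b j)
  refine ⟨fun j => g j, fun j => (g j).2, fun c hc => ?_⟩
  have h3 : ∑ j, c j • b j = 0 := by
    have : ∑ j, c j • g j ∈ W' := by
      change U.subtype _ ∈ W
      simpa using hc
    rw [← Submodule.Quotient.mk_eq_zero, ← Submodule.mkQ_apply, map_sum] at this
    simpa [hg] using this
  funext j
  exact Fintype.linearIndependent_iff.1 b.linearIndependent c h3 j

variable {k : Type*} [Field k]

theorem gradedPiece_span_pair {a b : R₃ k} {s d e : ℕ}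
    (ha : a.IsHomogeneous s) (hb : b.IsHomogeneous s) (hd : s + d = e) :
    gradedPiece (Ideal.span {a, b}) e = mulPiece a d ⊔ mulPiece b d := by
  subst hd
  apply le_antisymm
  · rintro x ⟨h1, h2⟩
    obtain ⟨p, q, hp, hq, rfl⟩ := exists_of_isHomogeneous_mem_span_pair ha hb h2 h1
    exact Submodule.add_mem_sup ⟨p, hp, rfl⟩ ⟨q, hq, rfl⟩
  · refine le_inf ?_ (sup_le (mulPiece_le ha rfl) (mulPiece_le hb rfl))
    refine sup_le ?_ ?_
    · rintro _ ⟨p, -, rfl⟩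
      exact Ideal.mul_mem_right _ _ (Ideal.subset_span (by simp))
    · rintro _ ⟨p, -, rfl⟩
      exact Ideal.mul_mem_right _ _ (Ideal.subset_span (by simp))

namespace PointSetup

variable (S : PointSetup k)

/-- The degree of the residual of the points in a complete intersection of two forms of
initial degree. -/
def residual : ℕ := S.s.choose 2 - S.h

theorem residual_add : S.residual + S.n = S.s ^ 2 := by
  have h1 := S.hn
  have h2 := S.hs
  obtain ⟨m, hm⟩ : ∃ m, S.s = m + 2 := ⟨S.s - 2, by have := S.hh; omega⟩
  have h3 := two_mul_choose_two m
  have h4 := two_mul_choose_two (m + 1)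
  rw [residual, h1, hm]
  have h5 : S.h ≤ (m + 2).choose 2 := by
    have : (m + 2) ≤ 2 * (m + 2).choose 2 := by rw [h3]; nlinarith
    have := S.hh
    omega
  zify [h5] at *
  nlinarith

namespace GoodTriple

variable {S} {L : LineChart k} {q : ℕ} (t : S.GoodTriple L q)

/-- The degree `d` piece of the complete intersection `(a1, a2)`. -/
abbrev pairPiece (d : ℕ) : Submodule k (R₃ k) :=
  gradedPiece (Ideal.span {t.a1, t.a2}) d

theorem pair_le_I : Ideal.span {t.a1, t.a2} ≤ S.I := by
  rw [Ideal.span_le]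
  rintro x (rfl | rfl)
  exacts [t.mem1.1, t.mem2.1]

theorem pairPiece_le (d : ℕ) : t.pairPiece d ≤ S.piece d :=
  inf_le_inf_right _ t.pair_le_I

instance (d : ℕ) : FiniteDimensional k (t.pairPiece d) :=
  Submodule.finiteDimensional_of_le (t.pairPiece_le d)

theorem finrank_pairPiece {d : ℕ} (hd : 2 * S.s ≤ d) :
    finrank k (t.pairPiece d) + S.residual = finrank k (S.piece d) := by
  obtain ⟨c, rfl⟩ := Nat.exists_eq_add_of_le hd
  have h1 := finrank_mulPiece_sup (c := c) t.mem1.2 t.mem2.2 t.a1_ne t.a2_ne t.isRelPrime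
  rw [← gradedPiece_span_pair t.mem1.2 t.mem2.2 (show S.s + (S.s + c) = 2 * S.s + c by ring)] at h1
  rw [S.finrank_piece]
  have h2 := S.n_le (show S.s ≤ 2 * S.s + c by omega)
  have h3 := S.residual_add
  have hm : ∀ e, Nat.multichoose 3 e = (e + 2).choose 2 := fun e => by
    rw [← finrank_homogeneousSubmodule (k := k) 3 e, finrank_homogeneousSubmodule_three]
  rw [hm, hm] at h1
  have e1 := two_mul_choose_two c
  have e2 := two_mul_choose_two (S.s + c)
  have e3 := two_mul_choose_two (2 * S.s + c)
  change finrank k (t.pairPiece (2 * S.s + c)) + _ = _ at h1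
  zify [h2] at *
  nlinarith

theorem exists_independent {d : ℕ} (hd : 2 * S.s ≤ d) :
    ∃ g : Fin S.residual → R₃ k, (∀ j, g j ∈ S.piece d) ∧
      ∀ c : Fin S.residual → k, ∑ j, c j • g j ∈ Ideal.span {t.a1, t.a2} → c = 0 := by
  obtain ⟨g, h1, h2⟩ := exists_linearIndependent_mod (t.pairPiece_le d) (t.finrank_pairPiece hd)
  exact ⟨g, h1, fun c hc => h2 c ⟨hc, Submodule.sum_mem _ fun j _ =>
    Submodule.smul_mem _ _ (h1 j).2⟩⟩

/-- Multiplication by `a3` is injective modulo `(a1, a2)`. -/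
theorem finrank_map_a3_sup {U : Submodule k (R₃ k)} {d : ℕ}
    (hU : U ≤ S.piece d) :
    finrank k ↥(U.map (LinearMap.mulLeft k t.a3) ⊔ t.pairPiece (S.s + d)) +
      finrank k ↥(U ⊓ t.pairPiece d) =
    finrank k (t.pairPiece (S.s + d)) + finrank k U := by
  have : FiniteDimensional k U := Submodule.finiteDimensional_of_le hU
  have h := Submodule.finrank_sup_add_finrank_inf_eq (U.map (LinearMap.mulLeft k t.a3))
    (t.pairPiece (S.s + d))
  have h1 : U.map (LinearMap.mulLeft k t.a3) ⊓ t.pairPiece (S.s + d) =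
      (U ⊓ t.pairPiece d).map (LinearMap.mulLeft k t.a3) := by
    apply le_antisymm
    · rintro _ ⟨⟨u, hu, rfl⟩, h2⟩
      exact ⟨u, ⟨hu, t.regular u (hU hu).1 h2.1, (hU hu).2⟩, rfl⟩
    · rintro _ ⟨u, ⟨hu, h2⟩, rfl⟩
      exact ⟨⟨u, hu, rfl⟩, Ideal.mul_mem_left _ _ h2.1, t.mem3.2.mul h2.2⟩
  rw [h1, finrank_map_mulLeft t.a3_ne, finrank_map_mulLeft t.a3_ne] at h
  omega

theorem map_a3_sup_pairPiece {d : ℕ} (hd : 2 * S.s ≤ d) :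
    (S.piece d).map (LinearMap.mulLeft k t.a3) ⊔ t.pairPiece (S.s + d) = S.piece (S.s + d) := by
  refine Submodule.eq_of_le_of_finrank_eq (sup_le ?_ (t.pairPiece_le _)) ?_
  · rintro _ ⟨u, hu, rfl⟩
    exact S.mul_mem_piece t.mem3.2 hu
  · have h1 := t.finrank_map_a3_sup (le_refl (S.piece d))
    rw [inf_eq_right.2 (t.pairPiece_le d)] at h1
    have h2 := t.finrank_pairPiece hd
    have h3 := t.finrank_pairPiece (show 2 * S.s ≤ S.s + d by omega)
    omega

theorem exists_eq_of_mem_piece {d : ℕ} (hd : 2 * S.s ≤ d) {x : R₃ k}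
    (hx : x ∈ S.piece (S.s + d)) : ∃ p q r : R₃ k, p.IsHomogeneous d ∧
      q.IsHomogeneous d ∧ r ∈ S.piece d ∧ x = t.a1 * p + t.a2 * q + t.a3 * r := by
  rw [← t.map_a3_sup_pairPiece hd] at hx
  obtain ⟨_, ⟨r, hr, rfl⟩, z, hz, rfl⟩ := mem_sup.1 hx
  obtain ⟨p, q, hp, hq, rfl⟩ := exists_of_isHomogeneous_mem_span_pair t.mem1.2 t.mem2.2 hz.2 hz.1
  exact ⟨p, q, r, hp, hq, hr, by simp only [LinearMap.mulLeft_apply]; ring⟩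

end GoodTriple

end PointSetup

end Dimensions

section Birational

variable {k : Type*} [Field k]

theorem finrank_mulPiece_sup_add_sq {a b : R₃ k} {d e : ℕ}
    (ha : a.IsHomogeneous e) (hb : b.IsHomogeneous e) (ha0 : a ≠ 0) (hb0 : b ≠ 0)
    (hab : IsRelPrime a b) (hed : e ≤ d + 1) :
    finrank k ↥(mulPiece a d ⊔ mulPiece b d) + e ^ 2 = (d + e + 2).choose 2 := by
  have hm : ∀ e, Nat.multichoose 3 e = (e + 2).choose 2 := fun e => by
    rw [← finrank_homogeneousSubmodule (k := k) 3 e, finrank_homogeneousSubmodule_three]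
  have e2 := two_mul_choose_two d
  have e3 := two_mul_choose_two (d + e)
  rcases Nat.lt_or_ge d e with h | h
  · obtain rfl : e = d + 1 := by omega
    have h1 := Submodule.finrank_sup_add_finrank_inf_eq (mulPiece a d) (mulPiece b d)
    rw [mulPiece_inf_mulPiece_eq_bot hb hab h, finrank_bot, finrank_mulPiece ha0,
      finrank_mulPiece hb0, hm] at h1
    zify at *
    nlinarith
  · obtain ⟨c, rfl⟩ := Nat.exists_eq_add_of_le h
    have h1 := finrank_mulPiece_sup (c := c) ha hb ha0 hb0 hab
    rw [hm, hm] at h1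
    have e1 := two_mul_choose_two c
    zify at *
    nlinarith

theorem exists_mem_inf_mulPiece_aux {a b p q : R₃ k} {d e : ℕ}
    (ha : a.IsHomogeneous (e + 1)) (hb : b.IsHomogeneous (e + 1)) (ha0 : a ≠ 0) (hb0 : b ≠ 0)
    (hab : IsRelPrime a b) (hp : p.IsHomogeneous (d + 1)) (hq : q.IsHomogeneous (d + 1))
    (hp0 : p ≠ 0) (hq0 : q ≠ 0) (hpq : IsRelPrime p q) (hed : e ≤ d) :
    ∃ x ∈ (mulPiece a d ⊔ mulPiece b d) ⊓ (mulPiece p e ⊔ mulPiece q e), x ≠ 0 := by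
  have h1 := finrank_mulPiece_sup_add_sq ha hb ha0 hb0 hab (show e + 1 ≤ d + 1 by omega)
  have h2 : finrank k ↥(mulPiece p e ⊔ mulPiece q e) = 2 * (e + 2).choose 2 := by
    have h1 := Submodule.finrank_sup_add_finrank_inf_eq (mulPiece p e) (mulPiece q e)
    rw [mulPiece_inf_mulPiece_eq_bot hq hpq (by omega), finrank_bot, finrank_mulPiece hp0,
      finrank_mulPiece hq0, ← finrank_homogeneousSubmodule (k := k) 3 e,
      finrank_homogeneousSubmodule_three] at h1
    omega
  have h3 := Submodule.finrank_sup_add_finrank_inf_eq (mulPiece a d ⊔ mulPiece b d)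
    (mulPiece p e ⊔ mulPiece q e)
  have h4 : finrank k ↥((mulPiece a d ⊔ mulPiece b d) ⊔ (mulPiece p e ⊔ mulPiece q e)) ≤
      (d + (e + 1) + 2).choose 2 := by
    rw [← finrank_homogeneousSubmodule_three (k := k)]
    refine finrank_mono (sup_le (sup_le ?_ ?_) (sup_le ?_ ?_))
    exacts [mulPiece_le ha (by ring), mulPiece_le hb (by ring), mulPiece_le hp (by ring),
      mulPiece_le hq (by ring)]
  have h5 := two_mul_choose_two e
  have h6 : (mulPiece a d ⊔ mulPiece b d) ⊓ (mulPiece p e ⊔ mulPiece q e) ≠ ⊥ := by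
    intro h
    rw [h, finrank_bot] at h3
    nlinarith
  exact (Submodule.ne_bot_iff _).1 h6

theorem exists_mem_inf_mulPiece {a b p q : R₃ k} {d e : ℕ}
    (ha : a.IsHomogeneous (e + 1)) (hb : b.IsHomogeneous (e + 1)) (ha0 : a ≠ 0) (hb0 : b ≠ 0)
    (hab : IsRelPrime a b) (hp : p.IsHomogeneous (d + 1)) (hq : q.IsHomogeneous (d + 1))
    (hp0 : p ≠ 0) (hq0 : q ≠ 0) (hpq : IsRelPrime p q) :
    ∃ x ∈ (mulPiece a d ⊔ mulPiece b d) ⊓ (mulPiece p e ⊔ mulPiece q e), x ≠ 0 := by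
  rcases le_total e d with h | h
  · exact exists_mem_inf_mulPiece_aux ha hb ha0 hb0 hab hp hq hp0 hq0 hpq h
  · rw [inf_comm]
    exact exists_mem_inf_mulPiece_aux hp hq hp0 hq0 hpq ha hb ha0 hb0 hab h

theorem exists_eq_C_of_isHomogeneous_zero {σ : Type*} {p : MvPolynomial σ k}
    (hp : p.IsHomogeneous 0) : ∃ c, p = C c :=
  ⟨_, totalDegree_eq_zero_iff_eq_C.1 (Nat.le_zero.1 hp.totalDegree_le)⟩

namespace PointSetup

variable (S : PointSetup k)

theorem eq_smul_or_eq_smul_of_mul_eq {f f' g g' : R₃ k}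
    (hf : f ∈ S.piece S.s) (hf' : f' ∈ S.piece S.s) (hg : g ∈ S.piece S.s)
    (hg' : g' ∈ S.piece S.s) (hf0 : f ≠ 0) (h : f * g' = f' * g) :
    (∃ c : k, f' = c • f) ∨ ∃ c : k, g = c • f := by
  rcases eq_or_ne f' 0 with hf'0 | hf'0
  · exact Or.inl ⟨0, by rw [hf'0, zero_smul]⟩
  rcases eq_or_ne g 0 with hg0 | hg0
  · exact Or.inr ⟨0, by rw [hg0, zero_smul]⟩
  obtain ⟨q, p, D, hqp, rfl, rfl⟩ := UniqueFactorizationMonoid.exists_reduced_factors f hf0 f'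
  have hD0 := left_ne_zero_of_mul hf0
  have hq0 := right_ne_zero_of_mul hf0
  have hp0 := right_ne_zero_of_mul hf'0
  have h1 : q * g' = p * g := mul_left_cancel₀ hD0 (by rw [← mul_assoc, h, mul_assoc])
  obtain ⟨E, rfl⟩ : q ∣ g := hqp.dvd_of_dvd_mul_left ⟨g', h1.symm⟩
  have h2 : g' = p * E := mul_left_cancel₀ hq0 (by rw [h1]; ring)
  subst h2
  have hE0 := right_ne_zero_of_mul hg0
  obtain ⟨a, b, G, hab, rfl, rfl⟩ := UniqueFactorizationMonoid.exists_reduced_factors D hD0 E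
  have ha0 := right_ne_zero_of_mul hD0
  have hG0 := left_ne_zero_of_mul hD0
  have hb0 := right_ne_zero_of_mul hE0
  obtain ⟨r, hr, hGa, hq⟩ := isHomogeneous_of_mul_left hf.2 hf0
  have hp : p.IsHomogeneous (S.s - r) :=
    isHomogeneous_of_mul_of_left hGa hD0 (by rw [Nat.add_sub_cancel' hr]; exact hf'.2)
  have hGb : (G * b).IsHomogeneous r := by
    refine isHomogeneous_of_mul_of_left hq hq0 ?_
    rw [Nat.sub_add_cancel hr]; exact hg.2
  obtain ⟨i, hi, hG, ha⟩ := isHomogeneous_of_mul_left hGa hD0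
  have hb : b.IsHomogeneous (r - i) :=
    isHomogeneous_of_mul_of_left hG hG0 (by rw [Nat.add_sub_cancel' hi]; exact hGb)
  rcases Nat.eq_zero_or_pos (S.s - r) with hd | hd
  · left
    rw [hd] at hp hq
    obtain ⟨c, rfl⟩ := exists_eq_C_of_isHomogeneous_zero hp
    obtain ⟨c', rfl⟩ := exists_eq_C_of_isHomogeneous_zero hq
    have hc' : c' ≠ 0 := by rintro rfl; simp at hq0
    refine ⟨c / c', ?_⟩
    rw [smul_eq_C_mul, mul_left_comm, ← C_mul, div_mul_cancel₀ _ hc']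
  rcases Nat.eq_zero_or_pos (r - i) with he | he
  · right
    rw [he] at ha hb
    obtain ⟨c, rfl⟩ := exists_eq_C_of_isHomogeneous_zero hb
    obtain ⟨c', rfl⟩ := exists_eq_C_of_isHomogeneous_zero ha
    have hc' : c' ≠ 0 := by rintro rfl; simp at ha0
    refine ⟨c / c', ?_⟩
    have : (C c : R₃ k) = C (c / c') * C c' := by rw [← C_mul, div_mul_cancel₀ _ hc']
    rw [smul_eq_C_mul, this]
    ring
  exfalso
  obtain ⟨d, hd'⟩ := Nat.exists_eq_add_of_le' hd
  obtain ⟨e, he'⟩ := Nat.exists_eq_add_of_le' he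
  rw [hd'] at hp hq
  rw [he'] at ha hb
  obtain ⟨x, ⟨hx1, hx2⟩, hx0⟩ := exists_mem_inf_mulPiece ha hb ha0 hb0 hab hp hq hp0 hq0 hqp.symm
  have hxh : x.IsHomogeneous (e + 1 + d) :=
    sup_le (mulPiece_le ha rfl) (mulPiece_le hb rfl) hx1
  have hmem : G * x ∈ S.piece (i + (e + 1 + d)) := by
    refine S.mem_piece.2 ⟨hG.mul hxh, fun j => ?_⟩
    have k1 := S.eval_eq_zero hf.1 j
    have k2 := S.eval_eq_zero hf'.1 j
    have k3 := S.eval_eq_zero hg.1 j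
    have k4 := S.eval_eq_zero hg'.1 j
    simp only [map_mul] at k1 k2 k3 k4 ⊢
    obtain ⟨_, ⟨u, -, rfl⟩, _, ⟨v, -, rfl⟩, e1⟩ := mem_sup.1 hx1
    obtain ⟨_, ⟨u', -, rfl⟩, _, ⟨v', -, rfl⟩, e2⟩ := mem_sup.1 hx2
    have e1' := congrArg (eval (S.pts j)) e1
    have e2' := congrArg (eval (S.pts j)) e2
    simp only [LinearMap.mulLeft_apply, map_add, map_mul] at e1' e2'
    rw [mul_eq_zero]
    by_contra hne
    rw [not_or] at hne
    obtain ⟨n1, n2⟩ := hne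
    simp only [mul_eq_zero, n1, false_or] at k1 k2 k3 k4
    rcases k1 with k1 | k1
    · rcases k3 with k3 | k3
      · rcases k2 with k2 | k2
        · rcases k4 with k4 | k4
          · exact n2 (by rw [← e2', k4, k3]; ring)
          · exact n2 (by rw [← e1', k1, k4]; ring)
        · exact n2 (by rw [← e2', k2, k3]; ring)
      · exact n2 (by rw [← e1', k1, k3]; ring)
    · rcases k2 with k2 | k2
      · rcases k4 with k4 | k4
        · exact n2 (by rw [← e2', k1, k4]; ring)
        · exact n2 (by rw [← e1', k2, k4]; ring)
      · exact n2 (by rw [← e2', k1, k2]; ring)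
  rw [S.piece_eq_bot (by omega)] at hmem
  exact mul_ne_zero hG0 hx0 ((Submodule.mem_bot k).1 hmem)

theorem finrank_piece_s : finrank k (S.piece S.s) = S.s - S.h + 1 := by
  rw [S.finrank_piece, S.hn]
  have := S.hh
  have h1 : (S.s + 2).choose 2 = (S.s + 1) + (S.s + 1).choose 2 := by
    rw [Nat.choose_succ_succ' (S.s + 1) 1, Nat.choose_one_right]
  omega

end PointSetup

end Birational

section Inverse

variable {k : Type*} [Field k]

theorem isRelPrime_X_X {σ : Type*} {i j : σ} (h : i ≠ j) :
    IsRelPrime (X i : MvPolynomial σ k) (X j) :=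
  (X_prime (i := i)).irreducible.isRelPrime_iff_not_dvd.2 fun h' => h (X_dvd_X.1 h')

/-- A pair of vectors orthogonal to the vector of variables has a cross product parallel to it. -/
theorem exists_cross_eq {f g : Fin 3 → R₃ k} (hf : ∑ i, X i * f i = 0)
    (hg : ∑ i, X i * g i = 0) : ∃ w : R₃ k,
      ∀ j, f (j + 1) * g (j + 2) - f (j + 2) * g (j + 1) = w * X j := by
  rw [Fin.sum_univ_three] at hf hg
  have h01 : X 0 * (f 2 * g 0 - f 0 * g 2) = X 1 * (f 1 * g 2 - f 2 * g 1) := by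
    linear_combination f 2 * hg - g 2 * hf
  have h02 : X 0 * (f 0 * g 1 - f 1 * g 0) = X 2 * (f 1 * g 2 - f 2 * g 1) := by
    linear_combination g 1 * hf - f 1 * hg
  obtain ⟨w, hw⟩ := (isRelPrime_X_X (k := k) (show (0 : Fin 3) ≠ 1 by decide)).dvd_of_dvd_mul_left
    ⟨_, h01.symm⟩
  refine ⟨w, fun j => ?_⟩
  have hX : (X 0 : R₃ k) ≠ 0 := X_ne_zero 0
  fin_cases j
  · change f 1 * g 2 - f 2 * g 1 = w * X 0
    rw [hw]; ring
  · change f 2 * g 0 - f 0 * g 2 = w * X 1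
    apply mul_left_cancel₀ hX
    rw [h01, hw]; ring
  · change f 0 * g 1 - f 1 * g 0 = w * X 2
    apply mul_left_cancel₀ hX
    rw [h02, hw]; ring

theorem eq_zero_of_sum_X_mul_C {m : ℕ} {c : Fin m → k} {f : R[m] k} (hf : f ≠ 0)
    (h : ∑ i, X i * (c i • f) = 0) : c = 0 := by
  have h1 : (∑ i, c i • X i) * f = 0 := by
    rw [← h, Finset.sum_mul]
    exact sum_congr rfl fun i _ => by simp only [smul_eq_C_mul]; ring
  have h2 := (mul_eq_zero.1 h1).resolve_right hf
  funext i
  have h3 := congrArg (coeff (Finsupp.single i 1)) h2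
  rw [coeff_sum] at h3
  simpa [coeff_X, Finsupp.single_left_inj] using h3

theorem exists_ne_smul_of_two_le_finrank {M : Type*} [AddCommGroup M] [Module k M]
    {U : Submodule k M} (h : 2 ≤ finrank k U) :
    ∃ f ∈ U, ∃ g ∈ U, f ≠ 0 ∧ ∀ c : k, g ≠ c • f := by
  have h0 : U ≠ ⊥ := by rintro rfl; simp at h
  obtain ⟨f, hf, hf0⟩ := (Submodule.ne_bot_iff _).1 h0
  have h1 : ¬ U ≤ k ∙ f := fun hle => by
    have := finrank_mono hle
    rw [finrank_span_singleton hf0] at this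
    omega
  obtain ⟨g, hg, hg'⟩ := SetLike.not_le_iff_exists.1 h1
  exact ⟨f, hf, g, hg, hf0, fun c hc => hg' (Submodule.mem_span_singleton.2 ⟨c, hc.symm⟩)⟩

theorem exists_fin_three_eq : ∀ i j : Fin 3, ∃ m : Fin 3,
    (i = m + 1 ∧ j = m + 2) ∨ (i = m + 2 ∧ j = m + 1) ∨ i = j := by decide

namespace PointSetup

variable (S : PointSetup k)

/-- The map of linear syzygies. -/
def mulX : (Fin 3 → S.piece S.s) →ₗ[k] S.piece (S.s + 1) where
  toFun f := ⟨∑ i, X i * (f i : R₃ k), Submodule.sum_mem _ fun i _ => by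
    rw [add_comm]; exact S.mul_mem_piece (isHomogeneous_X _ i) (f i).2⟩
  map_add' f g := by ext1; simp [mul_add, Finset.sum_add_distrib]
  map_smul' c f := by ext1; simp [Finset.smul_sum]

theorem coe_mulX (f : Fin 3 → S.piece S.s) :
    (S.mulX f : R₃ k) = ∑ i, X i * (f i : R₃ k) := rfl

theorem two_le_finrank_ker_mulX : 2 ≤ finrank k (ker S.mulX) := by
  have h1 := LinearMap.finrank_range_add_finrank_ker S.mulX
  have h2 : finrank k (LinearMap.range S.mulX) ≤ _ := Submodule.finrank_le _
  have h3 : finrank k (Fin 3 → S.piece S.s) = 3 * finrank k (S.piece S.s) := by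
    rw [Module.finrank_pi_fintype]; simp
  rw [S.finrank_piece] at h2
  rw [h3, S.finrank_piece_s] at h1
  have hh := S.hh
  have h4 : (S.s + 3).choose 2 = (S.s + 2) + ((S.s + 1) + (S.s + 1).choose 2) := by
    rw [Nat.choose_succ_succ' (S.s + 2) 1, Nat.choose_succ_succ' (S.s + 1) 1, Nat.choose_one_right,
      Nat.choose_one_right]
  have h5 := S.hn
  rw [show S.s + 1 + 2 = S.s + 3 by ring] at h2
  omega

theorem exists_cross_ne_zero : ∃ f g : Fin 3 → S.piece S.s, S.mulX f = 0 ∧ S.mulX g = 0 ∧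
    ∃ i j, (f i * g j : R₃ k) ≠ f j * g i := by
  have h2 := S.two_le_finrank_ker_mulX
  obtain ⟨f, hb0, g, hb1, h0, hli⟩ := exists_ne_smul_of_two_le_finrank h2
  refine ⟨f, g, hb0, hb1, ?_⟩
  by_contra! hne
  obtain ⟨i, hi⟩ := Function.ne_iff.1 h0
  have hi' : (f i : R₃ k) ≠ 0 := fun h => hi (Subtype.ext h)
  obtain ⟨j, hj⟩ : ∃ j, ∀ c : k, (f j : R₃ k) ≠ c • (f i : MvPolynomial _ k) := by
    by_contra! hc
    choose c hc using hc
    have h1 : ∑ j, X j * (c j • (f i : R₃ k)) = 0 := by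
      rw [← (show ((S.mulX f : S.piece (S.s + 1)) : R₃ k) = 0 by rw [hb0]; rfl)]
      exact sum_congr rfl fun j _ => by rw [← hc]
    have h2 := eq_zero_of_sum_X_mul_C hi' h1
    apply hi'
    rw [hc i, h2]; simp
  rcases S.eq_smul_or_eq_smul_of_mul_eq (f i).2 (f j).2 (g i).2 (g j).2 hi' (hne i j) with
    ⟨c, hc⟩ | ⟨c, hc⟩
  · exact hj c hc
  · apply hli c
    funext m
    ext1
    apply mul_left_cancel₀ hi'
    rw [hne i m, hc]
    simp only [Pi.smul_apply, Submodule.coe_smul, smul_eq_C_mul]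
    ring

/-- The `b`-th power of the initial degree piece. -/
def F (b : ℕ) : Submodule k (R₃ k) := S.piece S.s ^ b

theorem mul_mem_F {x y : R₃ k} {a b : ℕ} (hx : x ∈ S.F a) (hy : y ∈ S.F b) :
    x * y ∈ S.F (a + b) := by
  rw [F, pow_add]; exact Submodule.mul_mem_mul hx hy

theorem mem_F_one {x : R₃ k} : x ∈ S.F 1 ↔ x ∈ S.piece S.s := by
  rw [F, pow_one]

theorem exists_mul_X_mem : ∃ w : R₃ k, w ≠ 0 ∧ ∀ j, w * X j ∈ S.F 2 := by
  obtain ⟨f, g, hf, hg, i, j, hij⟩ := S.exists_cross_ne_zero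
  have hf' : ∑ i, X i * (f i : R₃ k) = 0 := by rw [← S.coe_mulX, hf]; rfl
  have hg' : ∑ i, X i * (g i : R₃ k) = 0 := by rw [← S.coe_mulX, hg]; rfl
  obtain ⟨w, hw⟩ := exists_cross_eq (f := fun i => (f i).1) (g := fun i => (g i).1) hf' hg'
  have hmem : ∀ i j, (f i * g j : R₃ k) ∈ S.F 2 := fun i j =>
    S.mul_mem_F (S.mem_F_one.2 (f i).2) (S.mem_F_one.2 (g j).2)
  refine ⟨w, ?_, fun j => ?_⟩
  · rintro rfl
    simp only [zero_mul, sub_eq_zero] at hw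
    obtain ⟨m, h | h | h⟩ := exists_fin_three_eq i j
    · rw [h.1, h.2] at hij
      exact hij (hw m)
    · rw [h.1, h.2] at hij
      exact hij (hw m).symm
    · rw [h] at hij
      exact hij rfl
  · rw [← hw]
    exact Submodule.sub_mem _ (hmem _ _) (hmem _ _)

theorem piece_le_mul (a : ℕ) :
    S.piece (a + S.s) ≤ ℋ₃ k a * S.piece S.s := by
  intro g hg
  suffices h : homogeneousComponent (a + S.s) g ∈ ℋ₃ k a * S.piece S.s by
    rwa [homogeneousComponent_of_mem hg.2, if_pos rfl] at h
  have hgI : g ∈ Ideal.span (S.piece S.s : Set (R₃ k)) := by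
    rw [S.span_eq]; exact hg.1
  clear hg
  induction hgI using Submodule.closure_induction with
  | zero => rw [map_zero]; exact Submodule.zero_mem _
  | add x y _ _ hx hy => rw [map_add]; exact Submodule.add_mem _ hx hy
  | smul_mem r x hx =>
    rw [smul_eq_mul, homogeneousComponent_mul_of_isHomogeneous hx.2]
    exact Submodule.mul_mem_mul (homogeneousComponent_isHomogeneous _ _) hx

theorem exists_pow_mul_mem_F : ∃ w : R₃ k, w ≠ 0 ∧
    ∀ (a : ℕ) (g : R₃ k), g ∈ S.piece (a + S.s) → w ^ a * g ∈ S.F (2 * a + 1) := by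
  obtain ⟨w, hw0, hw⟩ := S.exists_mul_X_mem
  have h1 : (k ∙ w) * ℋ₃ k 1 ≤ S.F 2 := by
    rw [homogeneousSubmodule_one_eq_span_X, Submodule.span_mul_span, span_le]
    rintro _ ⟨_, rfl, _, ⟨j, rfl⟩, rfl⟩
    exact hw j
  refine ⟨w, hw0, fun a g hg => ?_⟩
  have h2 : (k ∙ w ^ a) * ℋ₃ k a ≤ S.F (2 * a) := by
    have := pow_le_pow_left' h1 a
    rwa [mul_pow, Submodule.span_pow, Set.singleton_pow, homogeneousSubmodule_one_pow, F,
      ← pow_mul] at this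
  have h3 := Submodule.mul_mem_mul (Submodule.mem_span_singleton_self (R := k) (w ^ a))
    (S.piece_le_mul a hg)
  rw [← mul_assoc] at h3
  rw [F, pow_succ]
  exact mul_le_mul_left h2 _ h3

end PointSetup

end Inverse

section Hilbert

variable {k : Type*} [Field k] {m : ℕ}

/-- The projection of a free module with generators in degree `e` onto its degree `b` piece. -/
def shiftProj (j e b : ℕ) :
    (Fin j → R[m] k) →ₗ[k] (Fin j → R[m] k) :=
  LinearMap.pi fun i => (if e ≤ b then homogeneousComponent (b - e) else 0) ∘ₗ LinearMap.proj i

theorem shiftProj_apply (j e b : ℕ) (v : Fin j → R[m] k) (i : Fin j) :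
    shiftProj j e b v i = if e ≤ b then homogeneousComponent (b - e) (v i) else 0 := by
  unfold shiftProj; split_ifs <;> simp

theorem shiftProj_shiftProj (j e b : ℕ) (v : Fin j → R[m] k) :
    shiftProj j e b (shiftProj j e b v) = shiftProj j e b v := by
  funext i
  simp only [shiftProj_apply]
  split_ifs
  · rw [homogeneousComponent_of_mem (homogeneousComponent_isHomogeneous _ _), if_pos rfl]
  · rfl

theorem shiftProj_mulVec {p q : ℕ} {M : Matrix (Fin p) (Fin q) (R[m] k)} {δ : ℕ}
    (hM : ∀ i j, (M i j).IsHomogeneous δ) (e b : ℕ) (v : Fin q → R[m] k) :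
    shiftProj p e b (M *ᵥ v) = M *ᵥ shiftProj q (e + δ) b v := by
  funext i
  simp only [shiftProj_apply, mulVec, dotProduct]
  by_cases h : e ≤ b
  · rw [if_pos h, map_sum]
    refine sum_congr rfl fun j _ => ?_
    rw [mul_comm]
    by_cases h' : e + δ ≤ b
    · rw [if_pos h', homogeneousComponent_add_mul_of_isHomogeneous (hM i j) (by omega), mul_comm,
        Nat.sub_sub]
    · rw [if_neg h', homogeneousComponent_mul_of_lt (hM i j) (by omega), mul_zero]
  · rw [if_neg h]
    exact (sum_eq_zero fun j _ => by rw [if_neg (by omega), mul_zero]).symm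

/-- The degree `b` piece of a free module with generators in degree `e`. -/
def shiftPiece (k : Type*) [Field k] (m j e b : ℕ) :
    Submodule k (Fin j → R[m] k) :=
  LinearMap.range (shiftProj j e b)

theorem mem_shiftPiece {j e b : ℕ} {v : Fin j → R[m] k} :
    v ∈ shiftPiece k m j e b ↔ shiftProj j e b v = v :=
  ⟨by rintro ⟨w, rfl⟩; exact shiftProj_shiftProj _ _ _ _, fun h => ⟨v, h⟩⟩

theorem shiftPiece_eq_bot {j e b : ℕ} (h : b < e) : shiftPiece k m j e b = ⊥ := by
  rw [eq_bot_iff]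
  intro v hv
  rw [← mem_shiftPiece.1 hv]
  exact funext fun i => by rw [shiftProj_apply, if_neg (by omega)]; rfl

theorem shiftPiece_eq_pi {j e b : ℕ} (h : e ≤ b) : shiftPiece k m j e b =
    Submodule.pi Set.univ fun _ => homogeneousSubmodule (Fin m) k (b - e) := by
  ext v
  rw [mem_shiftPiece, Submodule.mem_pi]
  constructor
  · intro hv i _
    rw [← hv, shiftProj_apply, if_pos h]
    exact homogeneousComponent_isHomogeneous _ _
  · intro hv
    funext i
    rw [shiftProj_apply, if_pos h, homogeneousComponent_of_mem (hv i trivial), if_pos rfl]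

/-- Functions with values in a submodule. -/
def piSubmoduleEquiv {M : Type*} [AddCommGroup M] [Module k M] (j : ℕ)
    (U : Submodule k M) :
    ↥(Submodule.pi Set.univ fun _ : Fin j => U) ≃ₗ[k] (Fin j → U) where
  toFun v i := ⟨v.1 i, v.2 i trivial⟩
  invFun v := ⟨fun i => v i, fun i _ => (v i).2⟩
  map_add' _ _ := rfl
  map_smul' _ _ := rfl
  left_inv _ := rfl
  right_inv _ := rfl

instance (j e b : ℕ) : FiniteDimensional k (shiftPiece k m j e b) := by
  rcases Nat.lt_or_ge b e with h | h
  · rw [shiftPiece_eq_bot h]; infer_instance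
  · rw [shiftPiece_eq_pi h]
    exact (piSubmoduleEquiv j _).symm.finiteDimensional

theorem finrank_shiftPiece {j e b : ℕ} (he : e ≤ m) :
    finrank k (shiftPiece k (m + 1) j e b) = j * (b + (m - e)).choose m := by
  rcases Nat.lt_or_ge b e with h | h
  · rw [shiftPiece_eq_bot h, finrank_bot, Nat.choose_eq_zero_of_lt (by omega), mul_zero]
  · rw [shiftPiece_eq_pi h, (piSubmoduleEquiv j _).finrank_eq, Module.finrank_pi_fintype]
    simp only [finrank_homogeneousSubmodule, Finset.sum_const, Finset.card_univ, Fintype.card_fin,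
      smul_eq_mul]
    rw [Nat.multichoose_eq, show m + 1 + (b - e) - 1 = b - e + m by omega,
      show b + (m - e) = b - e + m by omega, Nat.choose_symm_add]

theorem exists_polynomial_choose (c m : ℕ) :
    ∃ P : Polynomial ℝ, ∀ b : ℕ, (((b + c).choose m : ℕ) : ℝ) = P.eval (b : ℝ) := by
  refine ⟨C₁ ((m.factorial : ℝ)⁻¹) * (descPochhammer ℝ m).comp (X₁ + C₁ (c : ℝ)), fun b => ?_⟩
  rw [Polynomial.eval_mul, Polynomial.eval_C, Polynomial.eval_comp, Polynomial.eval_add,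
    Polynomial.eval_X, Polynomial.eval_C, ← Nat.cast_add, descPochhammer_eval_eq_descFactorial,
    Nat.descFactorial_eq_factorial_mul_choose, Nat.cast_mul, inv_mul_cancel_left₀]
  exact_mod_cast m.factorial_ne_zero

/-- The Hilbert function of a complex of free modules which is exact in positive degrees is
polynomial when the shifts are small. -/
theorem exists_polynomial_finrank_map {β : ℕ → ℕ} {e δ : ℕ → ℕ}
    (A : ∀ i : ℕ, Matrix (Fin (β i)) (Fin (β (i + 1))) (R[m + 1] k))
    (hA : ∀ i j l, (A i j l).IsHomogeneous (δ i)) (he : ∀ i, e (i + 1) = e i + δ i)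
    {N : ℕ} (hN : ∀ i, i ≤ N → e i ≤ m) (hβ : ∀ i, N < i → β i = 0)
    (hex : ∀ i, LinearMap.range (A (i + 1)).mulVecLin = ker (A i).mulVecLin) (i : ℕ) :
    ∃ P : Polynomial ℝ, ∀ b : ℕ, (finrank k ((shiftPiece k (m + 1) (β (i + 1)) (e (i + 1)) b).map
      ((A i).mulVecLin.restrictScalars k)) : ℝ) = P.eval (b : ℝ) := by
  rcases Nat.lt_or_ge N i with h | h
  · refine ⟨0, fun b => ?_⟩
    have h0 : shiftPiece k (m + 1) (β (i + 1)) (e (i + 1)) b = ⊥ := by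
      rw [eq_bot_iff]
      intro v _
      have : IsEmpty (Fin (β (i + 1))) := by
        rw [hβ (i + 1) (by omega)]; infer_instance
      exact Subsingleton.elim _ _
    rw [h0, Submodule.map_bot, finrank_bot]; simp
  induction h using Nat.decreasingInduction with
  | self =>
    refine ⟨0, fun b => ?_⟩
    have h0 : shiftPiece k (m + 1) (β (N + 1)) (e (N + 1)) b = ⊥ := by
      rw [eq_bot_iff]
      intro v _
      have : IsEmpty (Fin (β (N + 1))) := by
        rw [hβ (N + 1) (by omega)]; infer_instance
      exact Subsingleton.elim _ _
    rw [h0, Submodule.map_bot, finrank_bot]; simp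
  | of_succ i hi ih =>
    obtain ⟨P, hP⟩ := ih
    obtain ⟨P', hP'⟩ := exists_polynomial_choose (m - e (i + 1)) m
    refine ⟨C₁ (β (i + 1) : ℝ) * P' - P, fun b => ?_⟩
    rw [Polynomial.eval_sub, Polynomial.eval_mul, Polynomial.eval_C, ← hP, ← hP', ← Nat.cast_mul,
      ← finrank_shiftPiece (k := k) (hN (i + 1) (by omega)), eq_sub_iff_add_eq, ← Nat.cast_add]
    congr 1
    set W := shiftPiece k (m + 1) (β (i + 1)) (e (i + 1)) b
    let G := ((A i).mulVecLin.restrictScalars k) ∘ₗ W.subtype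
    have h1 := LinearMap.finrank_range_add_finrank_ker G
    rw [LinearMap.range_comp, Submodule.range_subtype] at h1
    rw [← h1]
    congr 1
    have hker : (ker G).map W.subtype = (shiftPiece k (m + 1) (β (i + 1 + 1))
        (e (i + 1 + 1)) b).map ((A (i + 1)).mulVecLin.restrictScalars k) := by
      ext x
      simp only [Submodule.mem_map, LinearMap.mem_ker]
      constructor
      · rintro ⟨x, hx, rfl⟩
        have hx' : x.1 ∈ ker (A i).mulVecLin := hx
        rw [← hex i] at hx'
        obtain ⟨y, hy⟩ := hx'
        refine ⟨shiftProj _ (e (i + 1 + 1)) b y, ⟨y, rfl⟩, ?_⟩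
        change A (i + 1) *ᵥ _ = x.1
        rw [he (i + 1), ← shiftProj_mulVec (hA (i + 1)), ← mulVecLin_apply, hy]
        exact mem_shiftPiece.1 x.2
      · rintro ⟨y, hy, rfl⟩
        have h2 : A (i + 1) *ᵥ y ∈ W := by
          rw [mem_shiftPiece, shiftProj_mulVec (hA (i + 1)), ← he (i + 1), mem_shiftPiece.1 hy]
        refine ⟨⟨A (i + 1) *ᵥ y, h2⟩, ?_, rfl⟩
        have h3 : (A (i + 1)).mulVecLin y ∈ ker (A i).mulVecLin := by
          rw [← hex i]; exact ⟨y, rfl⟩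
        exact h3
    rw [← hker, Submodule.finrank_map_subtype_eq]

end Hilbert

section HilbertFiber

variable {k : Type*} [Field k] {m : ℕ}

theorem span_range_pow_eq_map {A : Type*} [CommRing A] [Algebra k A] {N : ℕ} (f : Fin N → A) (b : ℕ) :
    span k (range f) ^ b =
      (homogeneousSubmodule (Fin N) k b).map (aeval f).toLinearMap := by
  rw [← homogeneousSubmodule_one_pow, Submodule.map_pow, homogeneousSubmodule_one_eq_span_X,
    Submodule.map_span, ← Set.range_comp]
  congr 3
  funext i
  simp

theorem finrank_span_range_pow {A : Type*} [CommRing A] [Algebra k A] {N : ℕ} (f : Fin N → A)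
    (b : ℕ) : finrank k ↥(span k (range f) ^ b) +
      finrank k ↥((RingHom.ker (aeval f : R[N] k →ₐ[k] A)).restrictScalars k ⊓
        homogeneousSubmodule (Fin N) k b) = N.multichoose b := by
  rw [span_range_pow_eq_map, ← finrank_homogeneousSubmodule (k := k) N b]
  let W := homogeneousSubmodule (Fin N) k b
  let G := (aeval f).toLinearMap ∘ₗ W.subtype
  have h1 := LinearMap.finrank_range_add_finrank_ker G
  rw [LinearMap.range_comp, Submodule.range_subtype] at h1
  have hker : (ker G).map W.subtype =
      (RingHom.ker (aeval f : R[N] k →ₐ[k] A)).restrictScalars k ⊓ W := by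
    ext x
    simp only [Submodule.mem_map, LinearMap.mem_ker, Submodule.mem_inf,
      Submodule.restrictScalars_mem, RingHom.mem_ker]
    exact ⟨by rintro ⟨x, hx, rfl⟩; exact ⟨hx, x.2⟩, fun ⟨h2, h3⟩ => ⟨⟨x, h3⟩, h2, rfl⟩⟩
  rw [← hker, Submodule.finrank_map_subtype_eq, h1]

theorem exists_polynomial_finrank_ideal {β : ℕ → ℕ}
    (A : ∀ i : ℕ, Matrix (Fin (β i)) (Fin (β (i + 1))) (R[m + 1] k))
    (hβ0 : β 0 = 1) (hβ : ∀ i, m - 2 < i → β i = 0) (hm : 2 ≤ m)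
    (hA0 : ∀ j l, (A 0 j l).IsHomogeneous 3)
    (hA : ∀ i, 1 ≤ i → ∀ j l, (A i j l).IsHomogeneous 1)
    (hex : ∀ i, LinearMap.range (A (i + 1)).mulVecLin = ker (A i).mulVecLin)
    {Q : Ideal (R[m + 1] k)} (hQ : Ideal.span {x | ∃ j l, x = A 0 j l} = Q) :
    (∃ P : Polynomial ℝ, ∀ b : ℕ, (finrank k
      ↥(Q.restrictScalars k ⊓ homogeneousSubmodule (Fin (m + 1)) k b) : ℝ) = P.eval (b : ℝ)) ∧
    ∀ b < 3, Q.restrictScalars k ⊓ homogeneousSubmodule (Fin (m + 1)) k b = ⊥ := by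
  let δ : ℕ → ℕ := fun i => if i = 0 then 3 else 1
  let e : ℕ → ℕ := fun i => if i = 0 then 0 else i + 2
  have hA' : ∀ i j l, (A i j l).IsHomogeneous (δ i) := by
    intro i j l
    by_cases hi : i = 0
    · subst hi; exact hA0 j l
    · simp only [δ, if_neg hi]; exact hA i (by omega) j l
  have he : ∀ i, e (i + 1) = e i + δ i := by
    intro i
    by_cases hi : i = 0
    · subst hi; rfl
    · simp only [e, δ, if_neg hi, if_neg (Nat.succ_ne_zero i)]
  let j0 : Fin (β 0) := ⟨0, by omega⟩
  have hj0 : ∀ j : Fin (β 0), j = j0 := fun j => Fin.ext (by have := j.2; simp only [j0]; omega)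
  let pr : (Fin (β 0) → R[m + 1] k) →ₗ[k] R[m + 1] k :=
    LinearMap.proj j0
  have hpr : Function.Injective pr := fun v w h => funext fun j => by rw [hj0 j]; exact h
  have key : ∀ b, ((shiftPiece k (m + 1) (β 1) (e 1) b).map
      ((A 0).mulVecLin.restrictScalars k)).map pr =
      Q.restrictScalars k ⊓ homogeneousSubmodule (Fin (m + 1)) k b := by
    intro b
    ext x
    simp only [Submodule.mem_map, Submodule.mem_inf, Submodule.restrictScalars_mem]
    constructor
    · rintro ⟨_, ⟨y, hy, rfl⟩, rfl⟩
      refine ⟨?_, ?_⟩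
      · rw [← hQ]
        change ∑ l, A 0 j0 l * y l ∈ _
        exact Ideal.sum_mem _ fun l _ => Ideal.mul_mem_right (y l) _ (Ideal.subset_span (show A 0 j0 l ∈ {x | ∃ j l, x = A 0 j l} from ⟨j0, l, rfl⟩))
      · have h1 : shiftProj (β 0) (e 0) b (A 0 *ᵥ y) = A 0 *ᵥ y := by
          rw [shiftProj_mulVec (hA' 0), ← he 0]
          exact congrArg _ (mem_shiftPiece.1 hy)
        have h2 := congrFun h1 j0
        rw [shiftProj_apply, if_pos (show e 0 ≤ b from Nat.zero_le _)] at h2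
        change (A 0 *ᵥ y) j0 ∈ _
        rw [← h2]
        exact homogeneousComponent_isHomogeneous _ _
    · rintro ⟨hx, hxb⟩
      have h1 : {x | ∃ j l, x = A 0 j l} = range (A 0 j0) := by
        ext x; constructor
        · rintro ⟨j, l, rfl⟩; rw [hj0 j]; exact ⟨l, rfl⟩
        · rintro ⟨l, rfl⟩; exact ⟨j0, l, rfl⟩
      rw [← hQ, h1] at hx
      obtain ⟨c, hc⟩ := Ideal.mem_span_range_iff_exists_fun.1 hx
      refine ⟨A 0 *ᵥ shiftProj (β 1) (e 1) b c, ⟨_, ⟨c, rfl⟩, rfl⟩, ?_⟩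
      rw [he 0, ← shiftProj_mulVec (hA' 0)]
      change shiftProj (β 0) (e 0) b (A 0 *ᵥ c) j0 = x
      rw [shiftProj_apply, if_pos (show e 0 ≤ b from Nat.zero_le _)]
      have h2 : (A 0 *ᵥ c) j0 = x := by
        rw [← hc]
        change ∑ l, A 0 j0 l * c l = _
        exact sum_congr rfl fun l _ => mul_comm (A 0 j0 l) (c l)
      rw [h2, show b - e 0 = b from rfl]
      rw [homogeneousComponent_of_mem hxb, if_pos rfl]
  constructor
  · obtain ⟨P, hP⟩ := exists_polynomial_finrank_map (N := m - 2) (m := m) A hA' he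
      (fun i hi => by simp only [e]; split_ifs <;> omega) hβ hex 0
    refine ⟨P, fun b => ?_⟩
    rw [← hP, ← key, ← (Submodule.equivMapOfInjective pr hpr _).finrank_eq]
  · intro b hb
    rw [← key, shiftPiece_eq_bot (show b < e 1 from hb), Submodule.map_bot, Submodule.map_bot]

end HilbertFiber

section Growth

theorem nonpos_of_forall_mul_sq_le {a b c : ℝ} (h : ∀ x : ℕ, a * (x : ℝ) ^ 2 ≤ b * x + c) : a ≤ 0 := by
  by_contra! ha
  obtain ⟨x, hx⟩ := exists_nat_gt ((|b| + |c|) / a + 1)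
  have h1 := h x
  have h2 : (|b| + |c|) / a < x := by linarith
  rw [div_lt_iff₀ ha] at h2
  have h3 : (1 : ℝ) ≤ x := by
    have : 0 ≤ (|b| + |c|) / a := by positivity
    linarith
  nlinarith [le_abs_self b, le_abs_self c, abs_nonneg c, abs_nonneg b]

theorem natDegree_le_two_of_le {P : Polynomial ℝ} {c : ℝ}
    (h : ∀ b : ℕ, |P.eval (b : ℝ)| ≤ c * ((b : ℝ) + 1) ^ 2) : P.natDegree ≤ 2 := by
  by_contra! hd
  have h1 := Polynomial.abs_div_tendsto_atTop_atTop_of_degree_gt P (X₁ ^ 2 : Polynomial ℝ)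
    (by rw [Polynomial.degree_X_pow, Polynomial.degree_eq_natDegree (by rintro rfl; simp at hd)]
        exact_mod_cast hd) (by simp)
  have h2 := (h1.comp tendsto_natCast_atTop_atTop).eventually (Filter.eventually_gt_atTop (4 * c))
  obtain ⟨N, hN⟩ := Filter.eventually_atTop.1 h2
  have h3 := hN (N + 1) (by omega)
  have h4 := h (N + 1)
  simp only [Function.comp, Polynomial.eval_pow, Polynomial.eval_X] at h3
  have h0 : (0 : ℝ) < ((N + 1 : ℕ) : ℝ) := by positivity
  rw [abs_div, lt_div_iff₀ (by positivity), abs_of_pos (by positivity : (0:ℝ) < ((N + 1 : ℕ) : ℝ) ^ 2)] at h3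
  have h5 : (1 : ℝ) ≤ ((N + 1 : ℕ) : ℝ) := by exact_mod_cast Nat.le_add_left 1 N
  have hc : 0 ≤ c := by
    have := (abs_nonneg _).trans (h 0)
    simpa using this
  have h6 : (((N + 1 : ℕ) : ℝ) + 1) ^ 2 ≤ 4 * ((N + 1 : ℕ) : ℝ) ^ 2 := by nlinarith
  nlinarith

theorem le_of_quadratic_growth {H : ℕ → ℕ} {P : Polynomial ℝ} (hP : ∀ b : ℕ, (H b : ℝ) = P.eval (b : ℝ))
    {c : ℝ} (hc : ∀ b : ℕ, (H b : ℝ) ≤ c * ((b : ℝ) + 1) ^ 2) {r d : ℕ}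
    (hr : ∀ x : ℕ, r * (x + 2).choose 2 ≤ H (d + x)) :
    r + 2 * H 1 ≤ H 0 + H 2 := by
  have hdeg : P.natDegree < 3 := Nat.lt_succ_of_le
    (natDegree_le_two_of_le (c := c) fun b => by
      rw [← hP, abs_of_nonneg (Nat.cast_nonneg _)]; exact hc b)
  have hev : ∀ b : ℕ, (H b : ℝ) = P.coeff 0 + P.coeff 1 * b + P.coeff 2 * (b : ℝ) ^ 2 := fun b => by
    rw [hP, Polynomial.eval_eq_sum_range' hdeg]
    simp [Finset.sum_range_succ]
  have h0 := hev 0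
  have h1 := hev 1
  have h2 := hev 2
  push_cast at h0 h1 h2
  have key : (r : ℝ) / 2 - P.coeff 2 ≤ 0 := by
    apply nonpos_of_forall_mul_sq_le (b := P.coeff 1 + 2 * P.coeff 2 * d - 3 * r / 2)
      (c := P.coeff 0 + P.coeff 1 * d + P.coeff 2 * d ^ 2 - r)
    intro x
    have h3 : (r : ℝ) * ((x + 2).choose 2 : ℕ) ≤ H (d + x) := by exact_mod_cast hr x
    have h4 : (2 : ℝ) * ((x + 2).choose 2 : ℕ) = (x + 2) * (x + 1) := by
      exact_mod_cast two_mul_choose_two x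
    rw [hev (d + x)] at h3
    push_cast at h3
    nlinarith
  have : (r : ℝ) + 2 * H 1 ≤ H 0 + H 2 := by rw [h0, h1, h2]; linarith
  exact_mod_cast this

end Growth

section FiberGrowth

namespace PointSetup

variable {k : Type*} [Field k] (S : PointSetup k)

theorem F_le (b : ℕ) : S.F b ≤ ℋ₃ k (b * S.s) := by
  induction b with
  | zero =>
    intro x hx
    rw [F, pow_zero, Submodule.mem_one] at hx
    obtain ⟨y, rfl⟩ := hx
    rw [Nat.zero_mul]
    exact isHomogeneous_C _ _
  | succ b ih =>
    rw [F, pow_succ, Nat.succ_mul]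
    exact Submodule.mul_le.2 fun x hx y hy => (ih hx).mul hy.2

instance (b : ℕ) : FiniteDimensional k (S.F b) := Submodule.finiteDimensional_of_le (S.F_le b)

variable {S} in
theorem GoodTriple.aeval_mem_F {L : LineChart k} {q : ℕ} (t : S.GoodTriple L q)
    {p : R₃ k} {b : ℕ} (hp : p.IsHomogeneous b) :
    aeval ![t.a1, t.a2, t.a3] p ∈ S.F b := by
  have h1 : aeval ![t.a1, t.a2, t.a3] p ∈
      (ℋ₃ k b).map (aeval ![t.a1, t.a2, t.a3]).toLinearMap := ⟨p, hp, rfl⟩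
  rw [← span_range_pow_eq_map] at h1
  refine pow_le_pow_left' (span_le.2 ?_) b h1
  rintro _ ⟨i, rfl⟩
  fin_cases i
  exacts [t.mem1, t.mem2, t.mem3]

variable {S} in
theorem GoodTriple.residual_mul_le {L : LineChart k} {q : ℕ} (t : S.GoodTriple L q) (x : ℕ) :
    S.residual * (x + 2).choose 2 ≤ finrank k (S.F (2 * S.s + 1 + x)) := by
  obtain ⟨g, hg, hind⟩ := t.exists_independent (d := 2 * S.s) le_rfl
  obtain ⟨w, hw, hF⟩ := S.exists_pow_mul_mem_F
  let Φ : (Fin S.residual → ℋ₃ k x) →ₗ[k] S.F (2 * S.s + 1 + x) :=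
    { toFun := fun p => ⟨∑ j, aeval ![t.a1, t.a2, t.a3] (p j).1 * (w ^ S.s * g j), by
        refine Submodule.sum_mem _ fun j _ => ?_
        rw [add_comm (2 * S.s + 1) x]
        exact S.mul_mem_F (t.aeval_mem_F (p j).2) (hF S.s (g j) (by rw [← two_mul]; exact hg j))⟩
      map_add' := fun p p' => by
        ext1
        simp [add_mul, Finset.sum_add_distrib]
      map_smul' := fun c p => by
        ext1
        simp [Finset.smul_sum] }
  have hinj : Function.Injective Φ := by
    rw [← LinearMap.ker_eq_bot, LinearMap.ker_eq_bot']
    intro p hp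
    have h1 : ∑ j, aeval ![t.a1, t.a2, t.a3] (p j).1 * (w ^ S.s * g j) = 0 := congrArg Subtype.val hp
    have h2 : w ^ S.s * ∑ j, aeval ![t.a1, t.a2, t.a3] (p j).1 * g j = 0 := by
      rw [← h1, mul_sum]
      exact sum_congr rfl fun j _ => by ring
    have h3 := t.eq_zero_of_sum_aeval_mul_eq_zero hg hind (fun j => (p j).1)
      ((mul_eq_zero.1 h2).resolve_left (pow_ne_zero _ hw))
    exact funext fun j => Subtype.ext (congrFun h3 j)
  have := LinearMap.finrank_le_finrank_of_injective hinj
  rwa [Module.finrank_pi_fintype, Finset.sum_const, Finset.card_univ, Fintype.card_fin, smul_eq_mul,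
    finrank_homogeneousSubmodule_three] at this

theorem finrank_F_le (b : ℕ) : (finrank k (S.F b) : ℝ) ≤
    ((S.s : ℝ) + 2) ^ 2 * ((b : ℝ) + 1) ^ 2 := by
  have h1 := finrank_mono (S.F_le b)
  rw [finrank_homogeneousSubmodule_three] at h1
  have h2 : (2 : ℝ) * ((b * S.s + 2).choose 2 : ℕ) = (b * S.s + 2) * (b * S.s + 1) := by
    exact_mod_cast two_mul_choose_two (b * S.s)
  have h3 : (finrank k (S.F b) : ℝ) ≤ ((b * S.s + 2).choose 2 : ℕ) := by exact_mod_cast h1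
  have hb : (0 : ℝ) ≤ b := Nat.cast_nonneg _
  have hs : (0 : ℝ) ≤ S.s := Nat.cast_nonneg _
  have h4 : (b : ℝ) * S.s + 2 ≤ (S.s + 2) * (b + 1) := by nlinarith
  have h5 : (0 : ℝ) ≤ (b : ℝ) * S.s := by positivity
  nlinarith [mul_self_le_mul_self (by linarith) h4]

/-- A fiber whose first syzygies are cubic and with linear resolution forces `h = 0`. -/
theorem h_eq_zero_of_polynomial [Infinite k] {P : Polynomial ℝ}
    (hP : ∀ b : ℕ, (finrank k (S.F b) : ℝ) = P.eval (b : ℝ))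
    (h2 : finrank k (S.F 2) = (S.s - S.h + 1).multichoose 2) : S.h = 0 := by
  obtain ⟨L, hL⟩ := S.exists_avoids
  obtain ⟨t⟩ := S.exists_goodTriple hL (q := S.s + 1) (by omega)
  have h1 := le_of_quadratic_growth (H := fun b => finrank k (S.F b)) hP S.finrank_F_le
    t.residual_mul_le
  have hF1 : S.F 1 = S.piece S.s := by rw [F, pow_one]
  have hF0 : finrank k (S.F 0) ≤ 1 := by
    have := finrank_mono (S.F_le 0)
    rwa [finrank_homogeneousSubmodule_three, Nat.zero_mul] at this
  rw [h2, hF1, S.finrank_piece_s, Nat.multichoose_eq] at h1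
  obtain ⟨m, hm⟩ : ∃ m, S.s = m + S.h + 2 := ⟨S.s - S.h - 2, by have := S.hs; omega⟩
  have e1 := two_mul_choose_two (m + 2)
  have e2 := two_mul_choose_two (m + S.h)
  rw [show S.s - S.h + 1 + 2 - 1 = m + 2 + 2 by omega] at h1
  rw [residual, show S.s.choose 2 = (m + S.h + 2).choose 2 by rw [← hm]] at h1
  have hs := S.hs
  by_contra hh
  obtain ⟨g, hg⟩ : ∃ g, S.h = g + 1 := ⟨S.h - 1, by omega⟩
  obtain ⟨m', rfl⟩ : ∃ m', m = m' + 1 := ⟨m - 1, by omega⟩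
  have : 2 * (m' + 1 + (g + 1) + 2).choose 2 + 4 * (m' + 1 + 3) ≤ 2 + 2 * (g + 1) + 2 * (m' + 1 + 2 + 2).choose 2 := by
    rw [hg] at h1 hm
    omega
  rw [hg] at e2
  nlinarith

end PointSetup

end FiberGrowth

section Depth

variable {A : Type*} [CommRing A]

/-- The element `x` is a nonzerodivisor modulo the ideal `N`. -/
def IsRegularMod (x : A) (N : Ideal A) : Prop := ∀ a, x * a ∈ N → a ∈ N

theorem IsRegularMod.pow {x : A} {N : Ideal A} (hx : IsRegularMod x N) (m : ℕ) :
    IsRegularMod (x ^ m) N := by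
  induction m with
  | zero => intro a ha; simpa using ha
  | succ m ih => intro a ha; exact hx _ (ih _ (by rwa [← mul_assoc, ← pow_succ]))

theorem mem_sup_span_singleton_iff {x a : A} {N : Ideal A} :
    a ∈ N ⊔ Ideal.span {x} ↔ ∃ b, a - x * b ∈ N := by
  rw [sup_comm, Ideal.mem_span_singleton_sup]
  constructor
  · rintro ⟨b, c, hc, rfl⟩
    exact ⟨b, by convert hc using 1; ring⟩
  · rintro ⟨b, hb⟩
    exact ⟨b, _, hb, by ring⟩

/-- There is a sequence of `r` elements of `J` regular modulo `N`. -/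
def HasRegularSeq (J : Ideal A) : ℕ → Ideal A → Prop
  | 0, _ => True
  | r + 1, N => ∃ x ∈ J, IsRegularMod x N ∧ HasRegularSeq J r (N ⊔ Ideal.span {x})

theorem HasRegularSeq.of_succ {J : Ideal A} {r : ℕ} : ∀ {N : Ideal A},
    HasRegularSeq J (r + 1) N → HasRegularSeq J r N := by
  induction r with
  | zero => intro _ _; trivial
  | succ r ih => rintro N ⟨x, hx, hxN, h⟩; exact ⟨x, hx, hxN, ih h⟩

theorem HasRegularSeq.mono {J : Ideal A} {r r' : ℕ} {N : Ideal A} (h : HasRegularSeq J r N)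
    (hr : r' ≤ r) : HasRegularSeq J r' N := by
  induction hr with
  | refl => exact h
  | step _ ih => exact ih h.of_succ

theorem exists_isRegularMod {k : Type*} [Field k] [Infinite k] [Algebra k A] [IsNoetherianRing A]
    (V : Submodule k A) (Ns : Finset (Ideal A)) (Us : Finset (Submodule k A))
    (hN : ∀ N ∈ Ns, ∀ e ∉ N, ∃ v ∈ V, v * e ∉ N) (hU : ∀ U ∈ Us, ¬ V ≤ U) :
    ∃ v ∈ V, (∀ N ∈ Ns, IsRegularMod v N) ∧ ∀ U ∈ Us, v ∉ U := by
  classical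
  have hfin : ∀ N : Ideal A, (associatedPrimes A (A ⧸ N)).Finite := fun N =>
    associatedPrimes.finite A (A ⧸ N)
  let S : Finset (Submodule k A) := Us ∪ Ns.biUnion fun N =>
    (hfin N).toFinset.image fun p => p.restrictScalars k
  obtain ⟨v, hv, hvS⟩ := exists_mem_forall_notMem_of_not_le V S (by
    intro p hp hVp
    rcases Finset.mem_union.1 hp with hp | hp
    · exact hU p hp hVp
    · obtain ⟨N, hNs, hp⟩ := Finset.mem_biUnion.1 hp
      obtain ⟨P, hP, rfl⟩ := Finset.mem_image.1 hp
      have hP' := (isAssociatedPrime_iff.1 ((hfin N).mem_toFinset.1 hP))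
      obtain ⟨hprime, x, rfl⟩ := hP'
      obtain ⟨e, rfl⟩ := Ideal.Quotient.mk_surjective x
      have hmem : ∀ a : A, a ∈ Submodule.colon (⊥ : Submodule A (A ⧸ N)) {Ideal.Quotient.mk N e} ↔
          a * e ∈ N := by
        intro a
        rw [Submodule.mem_colon_singleton, Submodule.mem_bot, ← Ideal.Quotient.eq_zero_iff_mem,
          map_mul]
        rfl
      have he : e ∉ N := fun h => hprime.ne_top ((Ideal.eq_top_iff_one _).2
        ((hmem 1).2 (by rwa [one_mul])))
      obtain ⟨v, hv, hve⟩ := hN N hNs e he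
      exact hve ((hmem v).1 (hVp hv)))
  refine ⟨v, hv, ?_, fun U hU => hvS U (Finset.mem_union_left _ hU)⟩
  intro N hNs a ha
  by_contra haN
  obtain ⟨P, hP, hle⟩ := exists_le_isAssociatedPrime_of_isNoetherianRing A
    (Ideal.Quotient.mk N a) (fun h => haN (Ideal.Quotient.eq_zero_iff_mem.1 h))
  refine hvS (P.restrictScalars k) (Finset.mem_union_right _ (Finset.mem_biUnion.2 ⟨N, hNs,
    Finset.mem_image.2 ⟨P, (hfin N).mem_toFinset.2 hP, rfl⟩⟩)) (hle ?_)
  rw [Submodule.mem_colon_singleton, Submodule.mem_bot]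
  exact Ideal.Quotient.eq_zero_iff_mem.2 ha

theorem IsRegularMod.swap {x y : A} {N : Ideal A} (hx : IsRegularMod x N)
    (hy : IsRegularMod y (N ⊔ Ideal.span {x})) : IsRegularMod x (N ⊔ Ideal.span {y}) := by
  intro a ha
  obtain ⟨b, hb⟩ := mem_sup_span_singleton_iff.1 ha
  have h1 : y * b ∈ N ⊔ Ideal.span {x} := mem_sup_span_singleton_iff.2 ⟨a, by
    rw [← neg_sub]; exact N.neg_mem hb⟩
  obtain ⟨c, hc⟩ := mem_sup_span_singleton_iff.1 (hy b h1)
  refine mem_sup_span_singleton_iff.2 ⟨c, hx _ ?_⟩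
  have := N.add_mem hb (N.mul_mem_left y hc)
  convert this using 1
  ring

theorem HasRegularSeq.two_swap {k : Type*} [Field k] [Infinite k] [Algebra k A] [IsNoetherianRing A]
    {J N : Ideal A} (h : HasRegularSeq J 2 N) {y : A} (hyN : IsRegularMod y N) :
    HasRegularSeq J 1 (N ⊔ Ideal.span {y}) := by
  obtain ⟨x, hx, hxN, x', hx', hxN', -⟩ := h
  obtain ⟨v, hv, hvN, -⟩ := exists_isRegularMod (k := k) (J.restrictScalars k)
    {N ⊔ Ideal.span {y}} ∅ (by
      intro N' hN' e he
      rw [Finset.mem_singleton] at hN'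
      subst hN'
      by_contra! hcon
      have hcon' : ∀ v ∈ J, v * e ∈ N ⊔ Ideal.span {y} := hcon
      obtain ⟨f, hf⟩ := mem_sup_span_singleton_iff.1 (hcon' x hx)
      have hfx : f ∈ N ⊔ Ideal.span {x} := by
        apply hxN'
        obtain ⟨g, hg⟩ := mem_sup_span_singleton_iff.1 (hcon' x' hx')
        refine mem_sup_span_singleton_iff.2 ⟨g, hyN _ ?_⟩
        have := N.sub_mem (N.mul_mem_left x hg) (N.mul_mem_left x' hf)
        convert this using 1
        ring
      obtain ⟨g, hg⟩ := mem_sup_span_singleton_iff.1 hfx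
      refine he (mem_sup_span_singleton_iff.2 ⟨g, hxN _ ?_⟩)
      have := N.add_mem hf (N.mul_mem_left y hg)
      convert this using 1
      ring) (by simp)
  exact ⟨v, hv, hvN _ (Finset.mem_singleton_self _), trivial⟩

/-- Any regular element may be used as the first element of a regular sequence. -/
theorem HasRegularSeq.swap {k : Type*} [Field k] [Infinite k] [Algebra k A] [IsNoetherianRing A]
    {J : Ideal A} {r : ℕ} : ∀ {N : Ideal A}, HasRegularSeq J (r + 1) N → ∀ {y : A}, y ∈ J →
      IsRegularMod y N → HasRegularSeq J r (N ⊔ Ideal.span {y}) := by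
  classical
  induction r with
  | zero => intros; trivial
  | succ r ih =>
    intro N h y hy hyN
    rcases Nat.eq_zero_or_pos r with rfl | hr
    · exact h.two_swap (k := k) hyN
    obtain ⟨z, hz, hzN, -⟩ := (h.mono (r' := 2) (by omega)).two_swap (k := k) hyN
    obtain ⟨x, hx, hxN, hx'⟩ := h
    obtain ⟨z', hz', hzN', -⟩ := id hx'
    obtain ⟨w, hw, hwN, -⟩ := exists_isRegularMod (k := k) (J.restrictScalars k)
      {N, N ⊔ Ideal.span {x}, N ⊔ Ideal.span {y}} ∅ (by
        intro N' hN' e he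
        simp only [Finset.mem_insert, Finset.mem_singleton] at hN'
        rcases hN' with rfl | rfl | rfl
        · exact ⟨x, hx, fun h => he (hxN e h)⟩
        · exact ⟨z', hz', fun h => he (hzN' e h)⟩
        · exact ⟨z, hz, fun h => he (hzN e h)⟩) (by simp)
    have hw1 := hwN N (by simp)
    have hw2 := hwN (N ⊔ Ideal.span {x}) (by simp)
    have hw3 := hwN (N ⊔ Ideal.span {y}) (by simp)
    have h1 : HasRegularSeq J r (N ⊔ Ideal.span {x} ⊔ Ideal.span {w}) := ih hx' hw hw2
    have h2 : HasRegularSeq J (r + 1) (N ⊔ Ideal.span {w}) :=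
      ⟨x, hx, hxN.swap hw2, by rwa [sup_right_comm]⟩
    exact ⟨w, hw, hw3, by
      rw [sup_right_comm]; exact ih h2 hy (hyN.swap hw3)⟩

theorem hasRegularSeq_of_isWeaklyRegular {J : Ideal A} {rs : List A} (hJ : ∀ x ∈ rs, x ∈ J)
    (h : RingTheory.Sequence.IsWeaklyRegular A rs) : HasRegularSeq J rs.length ⊥ := by
  have key : ∀ m ≤ rs.length, HasRegularSeq J m (Ideal.ofList (rs.take (rs.length - m))) := by
    intro m
    induction m with
    | zero => intro _; trivial
    | succ m ih =>
      intro hm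
      have hi : rs.length - (m + 1) < rs.length := by omega
      refine ⟨rs[rs.length - (m + 1)], hJ _ (List.getElem_mem _), ?_, ?_⟩
      · intro a ha
        have h1 := h.regular_mod_prev _ hi
        have h2 : (rs[rs.length - (m + 1)] • (Submodule.Quotient.mk a : A ⧸ (Ideal.ofList
            (rs.take (rs.length - (m + 1))) • ⊤ : Submodule A A))) = rs[rs.length - (m + 1)] • 0 := by
          rw [smul_zero, ← Submodule.Quotient.mk_smul, Submodule.Quotient.mk_eq_zero]
          simpa using ha
        have h3 := h1 h2
        rw [Submodule.Quotient.mk_eq_zero] at h3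
        simpa using h3
      · have h1 : rs.take (rs.length - m) = rs.take (rs.length - (m + 1)) ++
            [rs[rs.length - (m + 1)]] := by
          rw [show rs.length - m = rs.length - (m + 1) + 1 by omega]
          exact List.take_succ_eq_append_getElem hi
        have h2 := ih (by omega)
        rw [h1, Ideal.ofList_append, Ideal.ofList_singleton] at h2
        exact h2
  have := key _ le_rfl
  rwa [Nat.sub_self, List.take_zero, Ideal.ofList_nil] at this

end Depth

section Reduction

theorem finrank_mul_le {k A : Type*} [Field k] [CommRing A] [Algebra k A] (M N : Submodule k A)
    [FiniteDimensional k M] [FiniteDimensional k N] :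
    finrank k ↥(M * N) ≤ finrank k M * finrank k N := by
  rw [← Submodule.mulMap_range, ← Module.finrank_tensorProduct]
  exact LinearMap.finrank_range_le _

theorem finiteDimensional_mul {k A : Type*} [Field k] [CommRing A] [Algebra k A]
    (M N : Submodule k A) [hM : FiniteDimensional k M] [hN : FiniteDimensional k N] :
    FiniteDimensional k ↥(M * N) :=
  Module.Finite.iff_fg.2 ((Module.Finite.iff_fg.1 hM).mul (Module.Finite.iff_fg.1 hN))

namespace PointSetup

variable {k : Type*} [Field k] {S : PointSetup k}

namespace GoodTriple

variable {L : LineChart k} {q : ℕ} (t : S.GoodTriple L q)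

/-- The span of a good triple. -/
def spanA : Submodule k (R₃ k) :=
  span k (range ![t.a1, t.a2, t.a3])

theorem spanA_le : t.spanA ≤ S.piece S.s := by
  refine span_le.2 ?_
  rintro _ ⟨i, rfl⟩
  fin_cases i
  exacts [t.mem1, t.mem2, t.mem3]

instance : FiniteDimensional k t.spanA := Submodule.finiteDimensional_of_le t.spanA_le

theorem residual_pos : 0 < S.residual := by
  obtain ⟨m, hm⟩ : ∃ m, S.s = m + 2 := ⟨S.s - 2, by have := S.hs; omega⟩
  have h1 := two_mul_choose_two m
  have h2 := S.hh
  rw [residual, hm]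
  rw [hm] at h2
  have : m + 2 ≤ (m + 2) * (m + 1) := Nat.le_mul_of_pos_right _ (by omega)
  omega

theorem finrank_spanA : finrank k t.spanA = 3 := by
  obtain ⟨g, hg, hind⟩ := t.exists_independent (d := 2 * S.s) le_rfl
  have h1 : LinearIndependent k ![t.a1, t.a2, t.a3] := by
    classical
    rw [Fintype.linearIndependent_iff]
    intro c hc
    let p : Fin S.residual → R₃ k :=
      fun j => if j = ⟨0, residual_pos⟩ then ∑ i, c i • X i else 0
    have hp := t.eq_zero_of_sum_aeval_mul_eq_zero hg hind p (by
      rw [Finset.sum_eq_single ⟨0, residual_pos⟩]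
      · simp only [p, if_pos, map_sum, map_smul, aeval_X, hc, zero_mul]
      · intro j _ hj
        simp only [p, if_neg hj, map_zero, zero_mul]
      · simp)
    have h2 := congrFun hp ⟨0, residual_pos⟩
    simp only [p, if_pos, Pi.zero_apply] at h2
    intro i
    have h3 := congrArg (coeff (Finsupp.single i 1)) h2
    simpa [coeff_sum, coeff_X, Finsupp.single_left_inj, Finset.sum_ite_eq'] using h3
  rw [spanA, finrank_span_eq_card h1, Fintype.card_fin]

theorem finrank_spanA_pow (x : ℕ) : finrank k ↥(t.spanA ^ x) ≤ (x + 2).choose 2 := by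
  have h1 := finrank_span_range_pow (k := k) ![t.a1, t.a2, t.a3] x
  rw [Nat.multichoose_eq, show 3 + x - 1 = x + 2 by omega, Nat.choose_symm_add] at h1
  exact le_of_add_le_left h1.le

instance (x : ℕ) : FiniteDimensional k ↥(t.spanA ^ x) := by
  have : t.spanA ^ x ≤ S.F x := pow_le_pow_left' t.spanA_le x
  exact Submodule.finiteDimensional_of_le this

theorem F_le_of_three (h3 : S.F 3 ≤ t.spanA * S.F 2) (x : ℕ) : S.F (2 + x) ≤ t.spanA ^ x * S.F 2 := by
  induction x with
  | zero => rw [pow_zero, one_mul]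
  | succ x ih =>
    calc S.F (2 + (x + 1)) = S.F (2 + x) * S.piece S.s := pow_succ _ _
      _ ≤ t.spanA ^ x * S.F 2 * S.piece S.s := mul_le_mul_left ih _
      _ = t.spanA ^ x * S.F 3 := by rw [mul_assoc]; rfl
      _ ≤ t.spanA ^ x * (t.spanA * S.F 2) := mul_le_mul_right h3 _
      _ = t.spanA ^ (x + 1) * S.F 2 := by rw [← mul_assoc, ← pow_succ]

theorem exists_complement : ∃ u : Fin (S.s - S.h - 2) → R₃ k,
    S.piece S.s = t.spanA ⊔ span k (range u) := by
  obtain ⟨u, hu, hind⟩ := exists_linearIndependent_mod t.spanA_le (e := S.s - S.h - 2) (by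
    rw [t.finrank_spanA, S.finrank_piece_s]; have := S.hs; omega)
  have hfin : FiniteDimensional k (span k (range u)) :=
    .span_of_finite k (Set.finite_range u)
  refine ⟨u, (Submodule.eq_of_le_of_finrank_le (sup_le t.spanA_le (span_le.2 ?_)) ?_).symm⟩
  · rintro _ ⟨i, rfl⟩
    exact hu i
  have h1 : LinearIndependent k u := Fintype.linearIndependent_iff.2 fun c hc i =>
    congrFun (hind c (by rw [hc]; exact Submodule.zero_mem _)) i
  have h2 : t.spanA ⊓ span k (range u) = ⊥ := by
    rw [eq_bot_iff]
    rintro x ⟨hx, hxu⟩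
    obtain ⟨c, rfl⟩ := (mem_span_range_iff_exists_fun k).1 hxu
    rw [hind c hx]
    simp
  have h3 := Submodule.finrank_sup_add_finrank_inf_eq t.spanA (span k (range u))
  rw [h2, finrank_bot, t.finrank_spanA, finrank_span_eq_card h1, Fintype.card_fin] at h3
  rw [S.finrank_piece_s, ← add_zero (finrank k _), h3]
  omega

theorem finrank_F_le_of_three (h3 : S.F 3 ≤ t.spanA * S.F 2) (x : ℕ) :
    finrank k (S.F (2 + x)) ≤ (x + 4).choose 2 + (S.s - S.h - 2) * (x + 3).choose 2 +
      (S.s - S.h - 2 + 1).choose 2 * (x + 2).choose 2 := by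
  obtain ⟨u, hu⟩ := t.exists_complement
  set U := span k (range u) with hU
  have hfin : FiniteDimensional k U := .span_of_finite k (Set.finite_range u)
  have hfin1 : FiniteDimensional k ↥(t.spanA ^ (x + 1) * U) := finiteDimensional_mul _ _
  have e1 : t.spanA ^ x * S.F 2 =
      t.spanA ^ (x + 2) ⊔ t.spanA ^ (x + 1) * U ⊔ t.spanA ^ x * U ^ 2 := by
    rw [F, hu, pow_two (t.spanA ⊔ U), Submodule.mul_sup, Submodule.sup_mul, Submodule.sup_mul,
      Submodule.mul_sup, Submodule.mul_sup, Submodule.mul_sup, pow_two U, mul_comm U t.spanA,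
      ← mul_assoc, ← mul_assoc, ← pow_succ, ← pow_succ, sup_assoc, sup_assoc]
    congr 1
    rw [← sup_assoc, sup_idem]
  have hfin2 : FiniteDimensional k ↥(U ^ 2) := by
    rw [pow_two]; exact finiteDimensional_mul _ _
  have hfin4 : FiniteDimensional k ↥(t.spanA ^ x * U ^ 2) := finiteDimensional_mul _ _
  have hfin3 : FiniteDimensional k ↥(t.spanA ^ (x + 2) ⊔ t.spanA ^ (x + 1) * U) :=
    Submodule.finiteDimensional_sup _ _
  have hfin5 : FiniteDimensional k ↥(t.spanA ^ (x + 2) ⊔ t.spanA ^ (x + 1) * U ⊔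
    t.spanA ^ x * U ^ 2) := Submodule.finiteDimensional_sup _ _
  have h1 := finrank_mono ((t.F_le_of_three h3 x).trans e1.le)
  have h2 := Submodule.finrank_add_le_finrank_add_finrank
    (t.spanA ^ (x + 2) ⊔ t.spanA ^ (x + 1) * U) (t.spanA ^ x * U ^ 2)
  have h4 := Submodule.finrank_add_le_finrank_add_finrank
    (t.spanA ^ (x + 2)) (t.spanA ^ (x + 1) * U)
  have h5 := finrank_mul_le (t.spanA ^ (x + 1)) U
  have h6 := finrank_mul_le (t.spanA ^ x) (U ^ 2)
  have h7 : finrank k U ≤ S.s - S.h - 2 := by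
    have := finrank_range_le_card (R := k) u
    rwa [Fintype.card_fin] at this
  have h8 : finrank k ↥(U ^ 2) ≤ (S.s - S.h - 2 + 1).choose 2 := by
    have := finrank_span_range_pow (k := k) u 2
    rw [Nat.multichoose_eq, show S.s - S.h - 2 + 2 - 1 = S.s - S.h - 2 + 1 by omega] at this
    exact le_of_add_le_left this.le
  have h9 := t.finrank_spanA_pow (x + 2)
  have h10 := (h5.trans (Nat.mul_le_mul (t.finrank_spanA_pow (x + 1)) h7))
  have h11 := (h6.trans (Nat.mul_le_mul (t.finrank_spanA_pow x) h8))
  rw [mul_comm (Nat.choose _ _)] at h10 h11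
  exact h1.trans (h2.trans (add_le_add (h4.trans (add_le_add h9 h10)) h11))

theorem h_eq_zero_of_three (h3 : S.F 3 ≤ t.spanA * S.F 2) : S.h = 0 := by
  obtain ⟨m, hm⟩ : ∃ m, S.s = m + S.h + 2 := ⟨S.s - S.h - 2, by have := S.hs; omega⟩
  have hm' : S.s - S.h - 2 = m := by omega
  have key : ((S.residual : ℝ) - (1 + m + (m + 1).choose 2)) / 2 ≤ 0 := by
    have h4 : ∀ x : ℕ, (S.residual : ℝ) * (x + 2).choose 2 ≤ ((2 * S.s - 1 + x) + 4).choose 2 +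
        m * ((2 * S.s - 1 + x) + 3).choose 2 + (m + 1).choose 2 * ((2 * S.s - 1 + x) + 2).choose 2 := by
      intro x
      have h5 := t.residual_mul_le x
      have h6 := t.finrank_F_le_of_three h3 (2 * S.s - 1 + x)
      rw [show 2 + (2 * S.s - 1 + x) = 2 * S.s + 1 + x by have := S.hs; omega, hm'] at h6
      exact_mod_cast h5.trans h6
    set d := 2 * S.s - 1
    set e := (m + 1).choose 2
    have c2 : ∀ y : ℕ, (2 : ℝ) * (y + 2).choose 2 = (y + 2) * (y + 1) := fun y => by
      exact_mod_cast two_mul_choose_two y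
    apply nonpos_of_forall_mul_sq_le
      (b := ((2 * d + 7) + m * (2 * d + 5) + e * (2 * d + 3) - 3 * S.residual) / 2)
      (c := ((d + 4) * (d + 3) + m * ((d + 3) * (d + 2)) + e * ((d + 2) * (d + 1)) - 2 * S.residual) / 2)
    intro x
    have h5 := h4 x
    have c0 := c2 x
    have c3 := c2 (d + x + 2)
    have c4 := c2 (d + x + 1)
    have c5 := c2 (d + x)
    rw [show d + x + 2 + 2 = d + x + 4 by omega] at c3
    rw [show d + x + 1 + 2 = d + x + 3 by omega] at c4
    push_cast at c3 c4 c5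
    have h6 := mul_le_mul_of_nonneg_left h5 (show (0 : ℝ) ≤ 2 by norm_num)
    have h7 : (S.residual : ℝ) * (2 * ((x + 2).choose 2 : ℕ)) ≤ 2 * ((d + x + 4).choose 2 : ℕ) +
        m * (2 * ((d + x + 3).choose 2 : ℕ)) + e * (2 * ((d + x + 2).choose 2 : ℕ)) := by linarith
    rw [c0, c3, c4, c5] at h7
    nlinarith
  have h5 : S.residual ≤ 1 + m + (m + 1).choose 2 := by
    have : (S.residual : ℝ) ≤ 1 + m + (m + 1).choose 2 := by linarith
    exact_mod_cast this
  have hs := S.hs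
  obtain ⟨m', rfl⟩ : ∃ m', m = m' + 1 := ⟨m - 1, by omega⟩
  have e1 := two_mul_choose_two m'
  have e2 := two_mul_choose_two (m' + 1 + S.h)
  rw [show m' + 1 + 1 = m' + 2 from rfl, residual, show S.s.choose 2 = (m' + 1 + S.h + 2).choose 2 by rw [← hm]] at h5
  by_contra hh
  obtain ⟨g, hg⟩ : ∃ g, S.h = g + 1 := ⟨S.h - 1, by omega⟩
  have : 2 * (m' + 1 + S.h + 2).choose 2 ≤ 2 * (1 + (m' + 1)) + 2 * (m' + 2).choose 2 + 2 * S.h := by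
    omega
  rw [hg] at e2 this
  nlinarith

end GoodTriple

end PointSetup

end Reduction

section GeneralQuotient

theorem exists_mul_notMem_of_isRegularMod {k A : Type*} [Field k] [CommRing A] [Algebra k A] {J N : Ideal A} {W : Submodule k A}
    (hrad : ∀ a ∈ J, ∃ m : ℕ, a ^ m ∈ Ideal.span (W : Set A)) {x : A} (hx : x ∈ J)
    (hxN : IsRegularMod x N) {e : A} (he : e ∉ N) : ∃ v ∈ W, v * e ∉ N := by
  by_contra! hcon
  obtain ⟨m, hm⟩ := hrad x hx
  refine he (hxN.pow m e ?_)
  have hle : Ideal.span (W : Set A) ≤ Submodule.comap (LinearMap.mulRight A e) N :=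
    span_le.2 fun v hv => hcon v hv
  exact hle hm

variable {k A : Type*} [Field k] [Infinite k] [CommRing A] [Algebra k A] [IsNoetherianRing A]

/-- If `J` contains a regular sequence of length `r` and is the radical of the ideal generated by
a `k`-subspace `W` of dimension at most `r`, then `r - 1` general elements of `W` form a regular
sequence modulo which `W` is spanned by any prescribed element. -/
theorem HasRegularSeq.exists_quotient {J : Ideal A} {W : Submodule k A} [FiniteDimensional k W]
    (hWJ : ∀ w ∈ W, w ∈ J) (hrad : ∀ a ∈ J, ∃ m : ℕ, a ^ m ∈ Ideal.span (W : Set A))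
    {v : A} (hv : v ∈ W) : ∀ (r : ℕ) {N : Ideal A} {U : Submodule k A},
    HasRegularSeq J (r + 1) N → N ≤ Ideal.span (W : Set A) → U ≤ W →
    finrank k W ≤ r + finrank k U → (∀ u ∈ U, ∃ c : k, u - c • v ∈ N) →
    ∃ N' ≤ Ideal.span (W : Set A), (∀ w ∈ W, ∃ c : k, w - c • v ∈ N') ∧ IsRegularMod v N' := by
  intro r
  induction r with
  | zero =>
    rintro N U ⟨x, hx, hxN, -⟩ hN hUW hU huv
    have hUeq : U = W := Submodule.eq_of_le_of_finrank_le hUW (by simpa using hU)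
    subst hUeq
    refine ⟨N, hN, huv, fun e he => by_contra fun heN => ?_⟩
    obtain ⟨w, hw, hwe⟩ := exists_mul_notMem_of_isRegularMod hrad hx hxN heN
    obtain ⟨c, hc⟩ := huv w hw
    apply hwe
    have h1 := N.add_mem (N.mul_mem_right e hc) (Submodule.smul_of_tower_mem N c he)
    convert h1 using 1
    rw [sub_mul, smul_mul_assoc]
    ring
  | succ r ih =>
    intro N U hseq hN hUW hU huv
    obtain ⟨x, hx, hxN, -⟩ := id hseq
    classical
    obtain ⟨θ, hθ, hθN, hθU⟩ := exists_isRegularMod W {N} (if U = W then ∅ else {U})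
      (by
        intro N' hN' e he
        obtain rfl := Finset.mem_singleton.1 hN'
        exact exists_mul_notMem_of_isRegularMod hrad hx hxN he)
      (by
        intro U' hU'
        split_ifs at hU' with h
        · simp at hU'
        · obtain rfl := Finset.mem_singleton.1 hU'
          exact fun hle => h (le_antisymm hUW hle))
    have hθreg := hθN N (by simp)
    refine ih (N := N ⊔ Ideal.span {θ}) (U := U ⊔ span k {θ})
      (hseq.swap (k := k) (hWJ θ hθ) hθreg)
      (sup_le hN (Ideal.span_le.2 (by simpa using Ideal.subset_span hθ)))
      (sup_le hUW (by simpa using hθ)) ?_ ?_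
    · by_cases h : U = W
      · subst h
        have := finrank_mono (s := U) (t := U ⊔ span k {θ})
        rw [sup_eq_left.2 (by simpa using hθ)]
        omega
      · have hθU' : θ ∉ U := hθU U (by simp [h])
        have : FiniteDimensional k U := Submodule.finiteDimensional_of_le hUW
        have hlt : U < U ⊔ span k {θ} := by
          refine lt_of_le_of_ne le_sup_left fun heq => hθU' ?_
          rw [heq]
          exact Submodule.mem_sup_right (Submodule.mem_span_singleton_self θ)
        have := Submodule.finrank_lt_finrank_of_lt hlt
        omega
    · intro u hu
      obtain ⟨u', hu', t, ht, rfl⟩ := mem_sup.1 hu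
      obtain ⟨b, rfl⟩ := Submodule.mem_span_singleton.1 ht
      obtain ⟨c, hc⟩ := huv u' hu'
      refine ⟨c, ?_⟩
      have h1 : b • θ ∈ N ⊔ Ideal.span {θ} := Submodule.smul_of_tower_mem _ b
        (Submodule.mem_sup_right (Ideal.mem_span_singleton_self θ))
      convert add_mem (Submodule.mem_sup_left (T := Ideal.span {θ}) hc) h1 using 1
      ring

end GeneralQuotient

section ReesAugmentation

variable {k : Type*} [Field k] (I : Ideal (R₃ k))

/-- The degree zero part of the Rees algebra, followed by the substitution of zero for the first
`j` variables. -/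
def reesEval (j : ℕ) : reesAlgebra I →+* R₃ k :=
  ((aeval fun i : Fin 3 => if (i : ℕ) < j then 0 else X i :
    R₃ k →ₐ[k] R₃ k) : _ →+* _).comp
      (Polynomial.constantCoeff.comp (reesAlgebra I).val.toRingHom)

theorem reesEval_apply (j : ℕ) (a : reesAlgebra I) :
    reesEval I j a = aeval (fun i : Fin 3 => if (i : ℕ) < j then 0 else X i) (a.1.coeff 0) := rfl

/-- The augmentation of the Rees algebra of an ideal of a polynomial ring. -/
def reesAug : reesAlgebra I →+* k :=
  (MvPolynomial.constantCoeff).comp (Polynomial.constantCoeff.comp (reesAlgebra I).val.toRingHom)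

theorem reesAug_apply (a : reesAlgebra I) :
    reesAug I a = MvPolynomial.constantCoeff (a.1.coeff 0) := rfl

/-- The homogeneous maximal ideal of the Rees algebra. -/
def reesMax : Ideal (reesAlgebra I) := RingHom.ker (reesAug I)

theorem mem_reesMax {a : reesAlgebra I} :
    a ∈ reesMax I ↔ MvPolynomial.constantCoeff (a.1.coeff 0) = 0 := by
  rw [reesMax, RingHom.mem_ker, reesAug_apply]

theorem reesMax_isMaximal : (reesMax I).IsMaximal := by
  refine RingHom.ker_isMaximal_of_surjective _ fun c => ⟨algebraMap (R₃ k) _ (C c), ?_⟩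
  rw [reesAug_apply]
  simp

/-- The element `f T` of the Rees algebra. -/
def reesT {f : R₃ k} (hf : f ∈ I) : reesAlgebra I :=
  ⟨Polynomial.monomial 1 f, reesAlgebra.monomial_mem.2 (by simpa using hf)⟩

theorem reesT_mem_reesMax {f : R₃ k} (hf : f ∈ I) : reesT I hf ∈ reesMax I := by
  rw [mem_reesMax, reesT]
  simp [Polynomial.coeff_monomial]

theorem reesEval_algebraMap (j : ℕ) (r : R₃ k) :
    reesEval I j (algebraMap _ _ r) =
      aeval (fun i : Fin 3 => if (i : ℕ) < j then 0 else X i) r := by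
  rw [reesEval_apply]
  simp

theorem ker_reesEval_lt (j : ℕ) (hj : j < 3) :
    ∃ a ∈ RingHom.ker (reesEval I (j + 1)), a ∉ RingHom.ker (reesEval I j) := by
  refine ⟨algebraMap (R₃ k) _ (X ⟨j, hj⟩), ?_, ?_⟩
  · rw [RingHom.mem_ker, reesEval_algebraMap]
    simp
  · rw [RingHom.mem_ker, reesEval_algebraMap]
    simp

theorem ker_reesEval_mono (j : ℕ) :
    RingHom.ker (reesEval I j) ≤ RingHom.ker (reesEval I (j + 1)) := by
  intro a ha
  rw [RingHom.mem_ker, reesEval_apply] at ha ⊢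
  have h := congrArg (aeval fun i : Fin 3 => if (i : ℕ) < j + 1 then 0 else X i :
    R₃ k →ₐ[k] R₃ k) ha
  rw [map_zero, ← AlgHom.comp_apply, comp_aeval] at h
  convert h using 3
  ext1 i
  split_ifs with h1 h2 h3
  · simp
  · rw [aeval_X, if_pos h1]
  · omega
  · rw [aeval_X, if_neg h1]

theorem four_le_idealHeight_reesMax (hI : I ≠ ⊥) : (4 : ℕ∞) ≤ idealHeight (reesMax I) := by
  obtain ⟨f, hf, hf0⟩ := Submodule.exists_mem_ne_zero_of_ne_bot hI
  let p : ℕ → PrimeSpectrum (reesAlgebra I) := fun j =>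
    ⟨RingHom.ker (reesEval I j), RingHom.ker_isPrime _⟩
  have hlt : ∀ j < 3, p j < p (j + 1) := by
    intro j hj
    obtain ⟨a, ha, ha'⟩ := ker_reesEval_lt I j hj
    exact lt_of_le_of_ne (ker_reesEval_mono I j) fun heq => ha' (by
      have := congrArg PrimeSpectrum.asIdeal heq
      change RingHom.ker (reesEval I j) = RingHom.ker (reesEval I (j + 1)) at this
      rwa [this])
  have h0 : (⊥ : PrimeSpectrum (reesAlgebra I)) < p 0 := by
    refine lt_of_le_of_ne bot_le fun heq => ?_
    have h1 : reesT I hf ∈ (p 0).asIdeal := by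
      change reesT I hf ∈ RingHom.ker (reesEval I 0)
      rw [RingHom.mem_ker, reesEval_apply, reesT]
      simp [Polynomial.coeff_monomial]
    rw [← heq] at h1
    have h2 : reesT I hf = 0 := h1
    have h3 : Polynomial.monomial 1 f = 0 := congrArg Subtype.val h2
    exact hf0 (by simpa using h3)
  have hp3 : p 3 ≤ ⟨reesMax I, (reesMax_isMaximal I).isPrime⟩ := by
    intro a ha
    change a ∈ RingHom.ker (reesEval I 3) at ha
    change a ∈ reesMax I
    rw [RingHom.mem_ker, reesEval_apply] at ha
    rw [mem_reesMax]
    have h := congrArg MvPolynomial.constantCoeff ha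
    rw [map_zero] at h
    rw [← h]
    have : (fun i : Fin 3 => if (i : ℕ) < 3 then (0 : R₃ k) else X i) = 0 := by
      ext1 i
      simp
    rw [this, aeval_zero, ← C_eq_algebraMap, constantCoeff_C]
  refine le_iInf₂ fun P hP => ?_
  have h3 := Order.height_mono (hp3.trans hP)
  have a1 := Order.height_add_one_le h0
  have a2 := Order.height_add_one_le (hlt 0 (by omega))
  have a3 := Order.height_add_one_le (hlt 1 (by omega))
  have a4 := Order.height_add_one_le (hlt 2 (by omega))
  refine le_trans ?_ h3
  refine le_trans ?_ a4
  refine le_trans ?_ (add_le_add_left a3 1)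
  refine le_trans ?_ (add_le_add_left (add_le_add_left a2 1) 1)
  refine le_trans ?_ (add_le_add_left (add_le_add_left (add_le_add_left a1 1) 1) 1)
  rw [add_assoc, add_assoc, add_assoc]
  norm_num

theorem hasRegularSeq_reesMax (hI : I ≠ ⊥) (h : IsCohenMacaulayRing (reesAlgebra I)) :
    HasRegularSeq (reesMax I) 4 ⊥ := by
  obtain ⟨rs, hrs, hreg, hlen⟩ := h _ (reesMax_isMaximal I)
  refine (hasRegularSeq_of_isWeaklyRegular hrs hreg.toIsWeaklyRegular).mono ?_
  have := four_le_idealHeight_reesMax I hI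
  rw [← hlen] at this
  exact_mod_cast this

end ReesAugmentation

namespace PointSetup

variable {k : Type*} [Field k] {S : PointSetup k}

namespace GoodTriple

variable {L : LineChart k} {q : ℕ} (t : S.GoodTriple L q)

theorem exists_eq_on_line {N : ℕ} (hN : S.s ≤ N + 1) (hN' : q ≤ N + 1)
    {p : R₂ k} (hp : p.IsHomogeneous (N + (S.s + q))) :
    ∃ u v w : R₂ k, u.IsHomogeneous N ∧ v.IsHomogeneous N ∧
      w.IsHomogeneous N ∧
      p = (L.res t.a2 * X 1 ^ q - L.res t.a1 * X 0 ^ q) * u + L.res t.a3 * X 1 ^ q * v +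
        L.res t.a3 * X 0 ^ q * w := by
  have h1 : (L.res t.a2 * X 1 ^ q - L.res t.a1 * X 0 ^ q).IsHomogeneous (S.s + q) := by
    refine IsHomogeneous.sub ((L.res_hom t.mem2.2).mul ?_) ((L.res_hom t.mem1.2).mul ?_)
    · simpa using (isHomogeneous_X k (1 : Fin 2)).pow q
    · simpa using (isHomogeneous_X k (0 : Fin 2)).pow q
  have h2 := mulPiece_sup_mulPiece_two (N := N + (S.s + q)) (d := N) (e := N + q) h1
    (L.res_hom t.mem3.2) t.disc_ne t.res3 t.coprime_disc.symm (by ring) (by ring) (by omega)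
  have h3 : p ∈ ℋ₂ k (N + (S.s + q)) := hp
  rw [← h2] at h3
  obtain ⟨_, ⟨u, hu, rfl⟩, _, ⟨e, he, rfl⟩, rfl⟩ := mem_sup.1 h3
  have hX : IsRelPrime (X 1 ^ q : R₂ k) (X 0 ^ q) := by
    refine IsRelPrime.pow ?_
    rw [(X_prime (i := (1 : Fin 2))).irreducible.isRelPrime_iff_not_dvd, X_dvd_X]
    simp
  have h4 := mulPiece_sup_mulPiece_two (N := N + q) (d := N) (e := N) (s := q) (t := q)
    (by simpa using (isHomogeneous_X k (1 : Fin 2)).pow q)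
    (by simpa using (isHomogeneous_X k (0 : Fin 2)).pow q)
    (pow_ne_zero _ (X_ne_zero _)) (pow_ne_zero _ (X_ne_zero _)) hX (by ring) (by ring) (by omega)
  rw [SetLike.mem_coe, ← h4] at he
  obtain ⟨_, ⟨v, hv, rfl⟩, _, ⟨w, hw, rfl⟩, rfl⟩ := mem_sup.1 he
  refine ⟨u, v, w, hu, hv, hw, ?_⟩
  simp only [LinearMap.mulLeft_apply]
  ring

/-- Every form of large degree is, up to a multiple of the equation of the line, a combination of
the `2 × 2` minors of the matrix with rows `(a₁, a₂, a₃)` and `(h₁, h₂, h₃)`. -/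
theorem exists_eq_minors {N : ℕ} (hN : S.s ≤ N + 1) (hN' : q ≤ N + 1)
    {h1 h2 h3 : R₃ k} (hh1 : h1.IsHomogeneous q) (hh2 : h2.IsHomogeneous q)
    (hh3 : h3.IsHomogeneous q) (r1 : L.res h1 = X 1 ^ q) (r2 : L.res h2 = X 0 ^ q)
    (r3 : L.res h3 = 0) {e : ℕ} (he : e + 1 = N + (S.s + q)) {g : R₃ k}
    (hg : g.IsHomogeneous (e + 1)) :
    ∃ u v w g' : R₃ k, g'.IsHomogeneous e ∧
      g = (t.a1 * h2 - t.a2 * h1) * u + (t.a1 * h3 - t.a3 * h1) * v +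
        (t.a2 * h3 - t.a3 * h2) * w + L.eqn * g' := by
  obtain ⟨u, v, w, hu, hv, hw, h⟩ := t.exists_eq_on_line hN hN' (he ▸ L.res_hom hg)
  have hm : ∀ {a b c d x : R₃ k}, a.IsHomogeneous S.s → b.IsHomogeneous q →
      c.IsHomogeneous S.s → d.IsHomogeneous q → x.IsHomogeneous N →
      ((a * b - c * d) * x).IsHomogeneous (e + 1) := by
    intro a b c d x ha hb hc hd hx
    have := ((ha.mul hb).sub (hc.mul hd)).mul hx
    rwa [show S.s + q + N = e + 1 by omega] at this
  obtain ⟨g', hg', hgg⟩ := L.exists_eq_eqn_mul (g := g - ((t.a1 * h2 - t.a2 * h1) * L.lift (-u) +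
      (t.a1 * h3 - t.a3 * h1) * L.lift (-v) + (t.a2 * h3 - t.a3 * h2) * L.lift (-w))) (d := e)
    (hg.sub (((hm t.mem1.2 hh2 t.mem2.2 hh1 (L.lift_hom hu.neg)).add
      (hm t.mem1.2 hh3 t.mem3.2 hh1 (L.lift_hom hv.neg))).add
      (hm t.mem2.2 hh3 t.mem3.2 hh2 (L.lift_hom hw.neg)))) (by
      simp only [map_sub, map_add, map_mul, L.res_lift, r1, r2, r3]
      rw [h]
      ring)
  exact ⟨L.lift (-u), L.lift (-v), L.lift (-w), g', hg', by rw [← hgg]; ring⟩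

end GoodTriple

end PointSetup

section ReesGenerators

theorem mem_of_det_eq_zero {A : Type*} [CommRing A] {J : Ideal A} [J.IsPrime] {m : ℕ}
    {D : Matrix (Fin m) (Fin m) A} (hD : D.det = 0) {a : A}
    (h : ∀ i j, Matrix.diagonal (fun _ => a) i j - D i j ∈ J) : a ∈ J := by
  have hq := congrArg (Ideal.Quotient.mk J) hD
  rw [map_zero, RingHom.map_det] at hq
  have hq' : (Ideal.Quotient.mk J).mapMatrix D =
      Matrix.diagonal fun _ => Ideal.Quotient.mk J a := by
    ext i j
    have := Ideal.Quotient.eq_zero_iff_mem.2 (h i j)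
    rw [map_sub, sub_eq_zero] at this
    rw [RingHom.mapMatrix_apply, Matrix.map_apply, ← this]
    by_cases hij : i = j
    · subst hij; simp
    · simp [hij]
  rw [hq', Matrix.det_diagonal, Finset.prod_const] at hq
  exact Ideal.Quotient.eq_zero_iff_mem.1 (eq_zero_of_pow_eq_zero hq)

variable {k : Type*} [Field k] {I : Ideal (R₃ k)}

theorem sub_C_mem_of_X_mem {σ : Type*} {J : Ideal (MvPolynomial σ k)} (hJ : ∀ i, X i ∈ J)
    (r : MvPolynomial σ k) : r - C (MvPolynomial.constantCoeff r) ∈ J := by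
  induction r using MvPolynomial.induction_on with
  | C a => simp
  | add p q hp hq =>
    have := J.add_mem hp hq
    convert this using 1
    rw [map_add, C_add]
    ring
  | mul_X p i _ =>
    rw [map_mul, constantCoeff_X, mul_zero, C_0, sub_zero]
    exact J.mul_mem_left _ (hJ i)

theorem coe_algebraMap_rees (r : R₃ k) :
    ((algebraMap (R₃ k) (reesAlgebra I) r : reesAlgebra I) :
      Polynomial (R₃ k)) = C₁ r := rfl

theorem reesT_mul (r : R₃ k) {f : R₃ k} (hf : f ∈ I)
    (h : r * f ∈ I) :
    reesT I h = algebraMap (R₃ k) (reesAlgebra I) r * reesT I hf := by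
  ext1
  rw [MulMemClass.coe_mul, coe_algebraMap_rees]
  simp [reesT, Polynomial.C_mul_monomial]

theorem algebraMap_mul_reesT_comm {f g : R₃ k} (hf : f ∈ I) (hg : g ∈ I) :
    algebraMap (R₃ k) (reesAlgebra I) f * reesT I hg =
      algebraMap (R₃ k) (reesAlgebra I) g * reesT I hf := by
  rw [← reesT_mul f hg (I.mul_mem_left _ hg), ← reesT_mul g hf (I.mul_mem_left _ hf)]
  congr 1
  exact mul_comm f g

theorem reesT_mem_of_span {V : Set (R₃ k)} (hV : Ideal.span V = I)
    {J : Ideal (reesAlgebra I)}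
    (h : ∀ f ∈ V, ∀ hf : f ∈ I, reesT I hf ∈ J) {f : R₃ k} (hf : f ∈ I) :
    reesT I hf ∈ J := by
  suffices ∀ f (_ : f ∈ Ideal.span V), ∀ hf : f ∈ I, reesT I hf ∈ J from this f (hV ▸ hf) hf
  intro f hfV
  induction hfV using Submodule.span_induction with
  | mem x hx => exact h x hx
  | zero =>
    intro hf
    convert J.zero_mem
    ext1
    simp [reesT]
  | add x y hx hy ihx ihy =>
    intro hf
    have hx' : x ∈ I := hV ▸ hx
    have hy' : y ∈ I := hV ▸ hy
    convert J.add_mem (ihx hx') (ihy hy')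
    ext1
    simp [reesT]
  | smul a x hx ihx =>
    intro hf
    have hx' : x ∈ I := hV ▸ hx
    have h1 : reesT I hf = _ := reesT_mul a hx' hf
    rw [h1]
    exact J.mul_mem_left _ (ihx hx')

theorem reesMax_le {J : Ideal (reesAlgebra I)}
    (hX : ∀ i, algebraMap (R₃ k) (reesAlgebra I) (X i) ∈ J)
    (hT : ∀ f, ∀ hf : f ∈ I, reesT I hf ∈ J) : reesMax I ≤ J := by
  have h0 : ∀ r : R₃ k, MvPolynomial.constantCoeff r = 0 →
      algebraMap (R₃ k) (reesAlgebra I) r ∈ J := by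
    intro r hr
    have := sub_C_mem_of_X_mem (J := J.comap (algebraMap _ _)) hX r
    rwa [hr, C_0, sub_zero] at this
  have h1 : ∀ (i : ℕ) (r : R₃ k) (hr : r ∈ I ^ (i + 1)),
      (⟨Polynomial.monomial (i + 1) r, reesAlgebra.monomial_mem.2 hr⟩ : reesAlgebra I) ∈ J := by
    intro i r hr
    have hr' : r ∈ I ^ i * I := by rwa [← pow_succ]
    suffices ∀ hr : r ∈ I ^ (i + 1),
      (⟨Polynomial.monomial (i + 1) r, reesAlgebra.monomial_mem.2 hr⟩ : reesAlgebra I) ∈ J from this hr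
    clear hr
    induction hr' using Submodule.mul_induction_on' with
    | mem_mul_mem m hm n hn =>
      intro hr
      convert J.mul_mem_left ⟨Polynomial.monomial i m, reesAlgebra.monomial_mem.2 hm⟩ (hT n hn)
      ext1
      rw [MulMemClass.coe_mul]
      simp [reesT, Polynomial.monomial_mul_monomial]
    | add x hx y hy ihx ihy =>
      intro hr
      rw [← pow_succ] at hx hy
      convert J.add_mem (ihx hx) (ihy hy)
      ext1
      simp
  rintro ⟨a, ha⟩ haM
  rw [mem_reesMax] at haM
  have h2 : (⟨a, ha⟩ : reesAlgebra I) = ∑ i ∈ Finset.range (a.natDegree + 1),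
      ⟨Polynomial.monomial i (a.coeff i), reesAlgebra.monomial_mem.2 (ha i)⟩ := by
    ext1
    rw [AddSubmonoidClass.coe_finsetSum]
    exact a.as_sum_range
  rw [h2]
  refine J.sum_mem fun i _ => ?_
  rcases i with _ | i
  · exact h0 _ haM
  · exact h1 i _ (ha (i + 1))

end ReesGenerators

namespace PointSetup

variable {k : Type*} [Field k] {S : PointSetup k}

namespace GoodTriple

variable {L : LineChart k} {q : ℕ} (t : S.GoodTriple L q)

/-- The four elements of the Rees algebra generating an ideal primary to its maximal ideal. -/
def parameter : Fin 4 → reesAlgebra S.I :=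
  ![algebraMap (R₃ k) _ L.eqn ^ q,
    algebraMap (R₃ k) _ (L.lift (X 1)) ^ q - reesT S.I t.mem1.1,
    algebraMap (R₃ k) _ (L.lift (X 0)) ^ q - reesT S.I t.mem2.1,
    reesT S.I t.mem3.1]

theorem reesT_pow_mem {J : Ideal (reesAlgebra S.I)} [J.IsPrime] (h1 : reesT S.I t.mem1.1 ∈ J)
    (h2 : reesT S.I t.mem2.1 ∈ J) (h3 : reesT S.I t.mem3.1 ∈ J) {f : R₃ k}
    (hf : f ∈ S.piece S.s) : reesT S.I hf.1 ∈ J := by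
  classical
  let B := ℋ₃ k (2 * S.s)
  let b := Module.finBasis k B
  have hfb : ∀ i, ∃ x y z : B, f * (b i).1 = t.a1 * x.1 + t.a2 * y.1 + t.a3 * z.1 := by
    intro i
    have : (b i).1 * f ∈ S.piece (S.s + 2 * S.s) := by
      rw [add_comm]
      exact S.mul_mem_piece (b i).2 hf
    obtain ⟨x, y, z, hx, hy, hz, h⟩ := t.exists_eq_of_mem_piece le_rfl this
    exact ⟨⟨x, hx⟩, ⟨y, hy⟩, ⟨z, hz.2⟩, by rw [mul_comm, h]⟩
  choose x y z hxyz using hfb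
  let ι : R₃ k →+* reesAlgebra S.I := algebraMap _ _
  let D : Matrix (Fin (finrank k B)) (Fin (finrank k B)) (reesAlgebra S.I) :=
    Matrix.diagonal (fun _ => reesT S.I hf.1) - Matrix.of fun i j =>
      (ι (C (b.repr (x i) j)) * reesT S.I t.mem1.1 + ι (C (b.repr (y i) j)) * reesT S.I t.mem2.1 +
        ι (C (b.repr (z i) j)) * reesT S.I t.mem3.1)
  have hexp : ∀ w : B, w.1 = ∑ j, C (b.repr w j) * (b j).1 := by
    intro w
    conv_lhs => rw [← b.sum_repr w]
    rw [AddSubmonoidClass.coe_finsetSum]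
    refine sum_congr rfl fun j _ => ?_
    rw [Submodule.coe_smul, smul_eq_C_mul]
  have hD : D.det = 0 := by
    rw [← Matrix.exists_mulVec_eq_zero_iff]
    refine ⟨fun i => ι (b i).1, ?_, ?_⟩
    · have hpos : 0 < finrank k B := by
        rw [finrank_homogeneousSubmodule_three]
        exact Nat.choose_pos (by omega)
      intro h0
      have := congrFun h0 ⟨0, hpos⟩
      have h1 : (b ⟨0, hpos⟩).1 = 0 := by
        have h2 := congrArg (fun a : reesAlgebra S.I => a.1.coeff 0) this
        simpa [ι] using h2
      exact b.ne_zero ⟨0, hpos⟩ (Subtype.ext h1)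
    · ext1 i
      rw [Matrix.sub_mulVec, Pi.sub_apply, Matrix.mulVec_diagonal, Pi.zero_apply, sub_eq_zero]
      simp only [Matrix.mulVec, dotProduct, Matrix.of_apply]
      have e1 : ∀ (w : B) {a : R₃ k} (ha : a ∈ S.I),
          ∑ j, ι (C (b.repr w j)) * reesT S.I ha * ι (b j).1 = ι w.1 * reesT S.I ha := by
        intro w a ha
        conv_rhs => rw [hexp w, map_sum, Finset.sum_mul]
        refine sum_congr rfl fun j _ => ?_
        rw [map_mul]
        ring
      simp only [add_mul, Finset.sum_add_distrib]
      rw [e1 (x i) t.mem1.1, e1 (y i) t.mem2.1, e1 (z i) t.mem3.1]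
      ext1
      simp only [ι, AddMemClass.coe_add, MulMemClass.coe_mul, coe_algebraMap_rees, reesT,
        Polynomial.C_mul_monomial, Polynomial.monomial_mul_C]
      rw [hxyz i, map_add, map_add]
      simp only [mul_comm]
  refine mem_of_det_eq_zero hD fun i j => ?_
  simp only [D, Matrix.sub_apply, sub_sub_cancel, Matrix.of_apply]
  exact J.add_mem (J.add_mem (J.mul_mem_left _ h1) (J.mul_mem_left _ h2)) (J.mul_mem_left _ h3)

theorem reesMax_le_of_parameter_mem (hq : 1 ≤ q) {J : Ideal (reesAlgebra S.I)} [hJ : J.IsPrime]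
    (h : ∀ i, t.parameter i ∈ J) : reesMax S.I ≤ J := by
  let ι : R₃ k →+* reesAlgebra S.I := algebraMap _ _
  have p0 : ι L.eqn ^ q ∈ J := h 0
  have p1 : ι (L.lift (X 1)) ^ q - reesT S.I t.mem1.1 ∈ J := h 1
  have p2 : ι (L.lift (X 0)) ^ q - reesT S.I t.mem2.1 ∈ J := h 2
  have p3 : reesT S.I t.mem3.1 ∈ J := h 3
  have hl : ι L.eqn ∈ J := hJ.mem_of_pow_mem _ p0
  have c12 : ι t.a1 * reesT S.I t.mem2.1 = ι t.a2 * reesT S.I t.mem1.1 :=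
    algebraMap_mul_reesT_comm _ _
  have c13 : ι t.a1 * reesT S.I t.mem3.1 = ι t.a3 * reesT S.I t.mem1.1 :=
    algebraMap_mul_reesT_comm _ _
  have c23 : ι t.a2 * reesT S.I t.mem3.1 = ι t.a3 * reesT S.I t.mem2.1 :=
    algebraMap_mul_reesT_comm _ _
  have m12 : ι (t.a1 * L.lift (X 0) ^ q - t.a2 * L.lift (X 1) ^ q) ∈ J := by
    have := J.sub_mem (J.mul_mem_left (ι t.a1) p2) (J.mul_mem_left (ι t.a2) p1)
    convert this using 1
    simp only [map_sub, map_mul, map_pow]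
    linear_combination c12
  have m13 : ι (t.a1 * 0 - t.a3 * L.lift (X 1) ^ q) ∈ J := by
    have := J.sub_mem (J.mul_mem_left (-ι t.a3) p1) (J.mul_mem_left (ι t.a1) p3)
    convert this using 1
    simp only [map_sub, map_mul, map_pow, map_zero]
    linear_combination c13
  have m23 : ι (t.a2 * 0 - t.a3 * L.lift (X 0) ^ q) ∈ J := by
    have := J.sub_mem (J.mul_mem_left (-ι t.a3) p2) (J.mul_mem_left (ι t.a2) p3)
    convert this using 1
    simp only [map_sub, map_mul, map_pow, map_zero]
    linear_combination c23
  have hlift : ∀ i, (L.lift (X i) ^ q).IsHomogeneous q := fun i => by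
    simpa using (L.lift_hom (isHomogeneous_X k i)).pow q
  have hdeg : ∀ g : R₃ k, g.IsHomogeneous (S.s + q + (S.s + q) - 1 + 1) →
      ι g ∈ J := by
    intro g hg
    obtain ⟨u, v, w, g', -, h⟩ := t.exists_eq_minors (N := S.s + q) (by omega) (by omega)
      (hlift 1) (hlift 0) (isHomogeneous_zero _ _ _) (by rw [map_pow, L.res_lift])
      (by rw [map_pow, L.res_lift]) (map_zero _) (by omega) hg
    rw [h, map_add, map_add, map_add, map_mul ι _ u, map_mul ι _ v, map_mul ι _ w, map_mul ι L.eqn]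
    exact J.add_mem (J.add_mem (J.add_mem (J.mul_mem_right _ m12) (J.mul_mem_right _ m13))
      (J.mul_mem_right _ m23)) (J.mul_mem_right _ hl)
  have hX : ∀ i, ι (X i) ∈ J := by
    intro i
    refine hJ.mem_of_pow_mem (S.s + q + (S.s + q) - 1 + 1) ?_
    rw [← map_pow]
    exact hdeg _ (by simpa using (isHomogeneous_X k i).pow (S.s + q + (S.s + q) - 1 + 1))
  have hconst : ∀ i, ι (L.lift (X i)) ∈ J := by
    intro i
    have h1 := sub_C_mem_of_X_mem (J := J.comap ι) hX (L.lift (X i))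
    have h2 : MvPolynomial.constantCoeff (L.lift (X i)) = 0 := by
      have := (L.lift_hom (isHomogeneous_X k i)).coeff_eq_zero (d := 0) (by simp)
      rwa [MvPolynomial.constantCoeff_eq]
    rwa [h2, C_0, sub_zero] at h1
  have t1 : reesT S.I t.mem1.1 ∈ J := by
    have := J.sub_mem (J.pow_mem_of_mem (hconst 1) q (by omega)) p1
    rwa [sub_sub_cancel] at this
  have t2 : reesT S.I t.mem2.1 ∈ J := by
    have := J.sub_mem (J.pow_mem_of_mem (hconst 0) q (by omega)) p2
    rwa [sub_sub_cancel] at this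
  refine reesMax_le hX fun f hf => reesT_mem_of_span S.span_eq (fun f hf' hf => ?_) hf
  exact t.reesT_pow_mem t1 t2 p3 hf'

theorem exists_pow_mem_span_parameter (hq : 1 ≤ q) {a : reesAlgebra S.I} (ha : a ∈ reesMax S.I) :
    ∃ m : ℕ, a ^ m ∈ Ideal.span
      ((span k (range t.parameter) : Submodule k (reesAlgebra S.I)) :
        Set (reesAlgebra S.I)) := by
  change a ∈ Ideal.radical _
  rw [Ideal.radical_eq_sInf, Ideal.mem_sInf]
  rintro J ⟨hJ, hJp⟩
  exact t.reesMax_le_of_parameter_mem hq (fun i => hJ (Ideal.subset_span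
    (subset_span ⟨i, rfl⟩))) ha

end GoodTriple

end PointSetup

namespace PointSetup

variable {k : Type*} [Field k] (S : PointSetup k)

theorem pow_I_le (b : ℕ) : S.I ^ b ≤ Ideal.span (S.F b : Set (R₃ k)) := by
  induction b with
  | zero =>
    rw [pow_zero, Ideal.one_eq_top, top_le_iff, Ideal.eq_top_iff_one]
    exact Ideal.subset_span (show (1 : R₃ k) ∈ S.piece S.s ^ 0 by
      rw [pow_zero]; exact Submodule.one_le.1 le_rfl)
  | succ b ih =>
    rw [pow_succ]
    refine (Ideal.mul_mono ih S.span_eq.ge).trans ?_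
    rw [Ideal.span_mul_span']
    refine Ideal.span_mono ?_
    rintro _ ⟨x, hx, y, hy, rfl⟩
    exact S.mul_mem_F hx (S.mem_F_one.2 hy)

theorem homogeneousComponent_of_mem_pow {b : ℕ} {x : R₃ k} (hx : x ∈ S.I ^ b) :
    (∀ d < b * S.s, homogeneousComponent d x = 0) ∧ homogeneousComponent (b * S.s) x ∈ S.F b := by
  have hx' : x ∈ span (R₃ k) (S.F b : Set (R₃ k)) :=
    S.pow_I_le b hx
  clear hx
  induction hx' using Submodule.closure_induction with
  | zero => simp
  | add x y _ _ hx hy =>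
    refine ⟨fun d hd => ?_, ?_⟩
    · rw [map_add, hx.1 d hd, hy.1 d hd, add_zero]
    · rw [map_add]
      exact add_mem hx.2 hy.2
  | smul_mem r x hx =>
    have hx' : x.IsHomogeneous (b * S.s) := S.F_le b hx
    refine ⟨fun d hd => homogeneousComponent_mul_of_lt hx' hd, ?_⟩
    have := homogeneousComponent_mul_of_isHomogeneous (p := r) hx' 0
    rw [zero_add] at this
    rw [smul_eq_mul, this, homogeneousComponent_zero, ← smul_eq_C_mul]
    exact Submodule.smul_mem _ _ hx

theorem F_le_pow_I (b : ℕ) : S.F b ≤ (S.I ^ b).restrictScalars k := by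
  induction b with
  | zero =>
    intro y _
    simp
  | succ b ih =>
    rw [F, pow_succ]
    refine Submodule.mul_le.2 fun y hy z hz => ?_
    rw [Submodule.restrictScalars_mem, pow_succ]
    exact Ideal.mul_mem_mul (ih hy) hz.1

/-- The forms `x` of the `j`-th power such that `x T ^ j` is congruent to a form of degree `d`
modulo the ideal `N` of the Rees algebra. -/
def reducible (N : Ideal (reesAlgebra S.I)) (j d : ℕ) :
    Submodule k (R₃ k) where
  carrier := {x | ∃ a : reesAlgebra S.I, a.1 = Polynomial.monomial j x ∧
    ∃ g : R₃ k, g.IsHomogeneous d ∧ a - algebraMap _ _ g ∈ N}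
  add_mem' := by
    rintro x y ⟨a, ha, g, hg, hag⟩ ⟨b, hb, g', hg', hbg⟩
    refine ⟨a + b, by rw [AddMemClass.coe_add, ha, hb, map_add], g + g', hg.add hg', ?_⟩
    convert N.add_mem hag hbg using 1
    rw [map_add]
    ring
  zero_mem' := ⟨0, by simp, 0, isHomogeneous_zero _ _ _, by simp⟩
  smul_mem' := by
    rintro c x ⟨a, ha, g, hg, hag⟩
    refine ⟨algebraMap (R₃ k) _ (C c) * a, ?_, C c * g, ?_, ?_⟩
    · rw [MulMemClass.coe_mul, ha, coe_algebraMap_rees, Polynomial.C_mul_monomial, smul_eq_C_mul]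
    · simpa using (isHomogeneous_C (Fin 3) c).mul hg
    · rw [map_mul, ← mul_sub]
      exact N.mul_mem_left _ hag

theorem reducible_mul_le (N : Ideal (reesAlgebra S.I)) (j d j' d' : ℕ) :
    S.reducible N j d * S.reducible N j' d' ≤ S.reducible N (j + j') (d + d') := by
  refine Submodule.mul_le.2 ?_
  rintro x ⟨a, ha, g, hg, hag⟩ y ⟨b, hb, g', hg', hbg⟩
  refine ⟨a * b, by rw [MulMemClass.coe_mul, ha, hb, Polynomial.monomial_mul_monomial], g * g',
    hg.mul hg', ?_⟩
  convert N.add_mem (N.mul_mem_right b hag) (N.mul_mem_left (algebraMap _ _ g) hbg) using 1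
  rw [map_mul]
  ring

theorem homogeneousSubmodule_le_reducible (N : Ideal (reesAlgebra S.I)) (d : ℕ) :
    ℋ₃ k d ≤ S.reducible N 0 d := fun x hx =>
  ⟨algebraMap (R₃ k) _ x, by rw [coe_algebraMap_rees, Polynomial.monomial_zero_left],
    x, hx, by simp⟩

variable {S} 

namespace GoodTriple

variable {L : LineChart k} {q : ℕ} (t : S.GoodTriple L q)

theorem mul_F_le {d : ℕ} (hd : 2 * S.s ≤ d) (b : ℕ) :
    ℋ₃ k d * S.F b ≤ t.spanA ^ b * ℋ₃ k d := by
  induction b with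
  | zero => rw [F, pow_zero, pow_zero, one_mul, mul_one]
  | succ b ih =>
    have h1 : ℋ₃ k d * S.piece S.s ≤
        t.spanA * ℋ₃ k d := by
      refine Submodule.mul_le.2 fun x hx y hy => ?_
      have := S.mul_mem_piece hx hy
      rw [add_comm] at this
      obtain ⟨p, q, r, hp, hq, hr, h⟩ := t.exists_eq_of_mem_piece hd this
      rw [h]
      have ha : ∀ i, ![t.a1, t.a2, t.a3] i ∈ t.spanA := fun i => subset_span ⟨i, rfl⟩
      exact add_mem (add_mem (Submodule.mul_mem_mul (ha 0) hp) (Submodule.mul_mem_mul (ha 1) hq))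
        (Submodule.mul_mem_mul (ha 2) hr.2)
    calc ℋ₃ k d * S.F (b + 1)
        = ℋ₃ k d * S.F b * S.piece S.s := by
          rw [F, pow_succ, mul_assoc]; rfl
      _ ≤ t.spanA ^ b * ℋ₃ k d * S.piece S.s := mul_le_mul_left ih _
      _ = t.spanA ^ b * (ℋ₃ k d * S.piece S.s) := mul_assoc _ _ _
      _ ≤ t.spanA ^ b * (t.spanA * ℋ₃ k d) := mul_le_mul_right h1 _
      _ = t.spanA ^ (b + 1) * ℋ₃ k d := by rw [pow_succ, mul_assoc]

theorem pow_mul_le_reducible {N : Ideal (reesAlgebra S.I)} (h : t.spanA ≤ S.reducible N 1 q)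
    (b d : ℕ) : t.spanA ^ b * ℋ₃ k d ≤ S.reducible N b (b * q + d) := by
  induction b with
  | zero =>
    rw [pow_zero, one_mul, zero_mul, zero_add]
    exact S.homogeneousSubmodule_le_reducible N d
  | succ b ih =>
    rw [pow_succ', mul_assoc]
    refine (mul_le_mul' h ih).trans ((S.reducible_mul_le _ _ _ _ _).trans ?_)
    rw [add_comm 1 b, show q + (b * q + d) = (b + 1) * q + d by ring]

/-- Forms of large degree are divisible by powers of the equation of the line modulo an ideal of
the Rees algebra modulo which `a_i T` is congruent to `h_i`. -/
theorem exists_pow_mul_sub_mem {N : Ideal (reesAlgebra S.I)} {h1 h2 h3 : R₃ k}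
    (hh1 : h1.IsHomogeneous q) (hh2 : h2.IsHomogeneous q)
    (hh3 : h3.IsHomogeneous q) (r1 : L.res h1 = X 1 ^ q) (r2 : L.res h2 = X 0 ^ q)
    (r3 : L.res h3 = 0)
    (e1 : reesT S.I t.mem1.1 - algebraMap _ _ h1 ∈ N)
    (e2 : reesT S.I t.mem2.1 - algebraMap _ _ h2 ∈ N)
    (e3 : reesT S.I t.mem3.1 - algebraMap _ _ h3 ∈ N) {e N₀ : ℕ} (hN : S.s ≤ N₀ + 1)
    (hN' : q ≤ N₀ + 1) (he : e + 1 = N₀ + (S.s + q)) : ∀ (m : ℕ) {g : R₃ k},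
    g.IsHomogeneous (e + m) → ∃ g' : R₃ k, g'.IsHomogeneous e ∧
      algebraMap _ (reesAlgebra S.I) (g - L.eqn ^ m * g') ∈ N := by
  let ι : R₃ k →+* reesAlgebra S.I := algebraMap _ _
  have key : ∀ {a b x y : R₃ k} (ha : a ∈ S.I) (hb : b ∈ S.I),
      reesT S.I ha - ι x ∈ N → reesT S.I hb - ι y ∈ N → ι (a * y - b * x) ∈ N := by
    intro a b x y ha hb hx hy
    have := N.sub_mem (N.mul_mem_left (ι b) hx) (N.mul_mem_left (ι a) hy)
    convert this using 1
    have hc : ι a * reesT S.I hb = ι b * reesT S.I ha := algebraMap_mul_reesT_comm _ _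
    rw [map_sub, map_mul, map_mul]
    linear_combination hc
  intro m
  induction m with
  | zero =>
    intro g hg
    exact ⟨g, hg, by simp⟩
  | succ m ih =>
    intro g hg
    obtain ⟨u, v, w, g1, hg1, hgg⟩ := t.exists_eq_minors (N := N₀ + m) (e := e + m) (by omega)
      (by omega) hh1 hh2 hh3 r1 r2 r3 (by omega) hg
    obtain ⟨g', hg', h⟩ := ih hg1
    refine ⟨g', hg', ?_⟩
    have h4 : g - L.eqn ^ (m + 1) * g' = (t.a1 * h2 - t.a2 * h1) * u + (t.a1 * h3 - t.a3 * h1) * v +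
        (t.a2 * h3 - t.a3 * h2) * w + L.eqn * (g1 - L.eqn ^ m * g') := by
      rw [hgg]
      ring
    rw [h4]
    change ι _ ∈ N
    rw [map_add, map_add, map_add, map_mul ι _ u, map_mul ι _ v, map_mul ι _ w, map_mul ι L.eqn]
    exact N.add_mem (N.add_mem (N.add_mem (N.mul_mem_right _ (key _ _ e1 e2))
      (N.mul_mem_right _ (key _ _ e1 e3))) (N.mul_mem_right _ (key _ _ e2 e3)))
      (N.mul_mem_left _ h)

end GoodTriple

end PointSetup

namespace PointSetup

variable {k : Type*} [Field k] {S : PointSetup k}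

namespace GoodTriple

variable {L : LineChart k} {q : ℕ} (t : S.GoodTriple L q)

theorem mem_spanA_mul_F_of_mem_span_parameter {b : ℕ} {x : R₃ k}
    (hx : x ∈ S.F (b + 1)) (hq : 1 ≤ q) (hq' : q ≤ (b + 1) * S.s) {a : reesAlgebra S.I}
    (ha : a ∈ Ideal.span (range t.parameter)) (hax : a.1.coeff (b + 1) = x) :
    x ∈ t.spanA * S.F b := by
  obtain ⟨c, hc⟩ := Ideal.mem_span_range_iff_exists_fun.1 ha
  have hx' : x ∈ ℋ₃ k ((b + 1) * S.s) := S.F_le _ hx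
  have low : ∀ (r : reesAlgebra S.I) {p : R₃ k}, p.IsHomogeneous q →
      homogeneousComponent ((b + 1) * S.s) (r.1.coeff (b + 1) * p) = 0 := by
    intro r p hp
    have h1 := homogeneousComponent_mul_of_isHomogeneous (p := r.1.coeff (b + 1)) hp
      ((b + 1) * S.s - q)
    rw [Nat.sub_add_cancel hq'] at h1
    have h2 := (S.homogeneousComponent_of_mem_pow (r.2 (b + 1))).1 ((b + 1) * S.s - q) (by
      have : 0 < S.s := S.hs_pos
      have : 0 < (b + 1) * S.s := by positivity
      omega)
    rw [h1, h2, zero_mul]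
  have top : ∀ (r : reesAlgebra S.I) {p : R₃ k}, p ∈ t.spanA →
      homogeneousComponent ((b + 1) * S.s) (r.1.coeff b * p) ∈ t.spanA * S.F b := by
    intro r p hp
    have hp' : p.IsHomogeneous S.s := (t.spanA_le hp).2
    have h1 := homogeneousComponent_mul_of_isHomogeneous (p := r.1.coeff b) hp' (b * S.s)
    rw [show (b + 1) * S.s = b * S.s + S.s by ring, h1, mul_comm t.spanA]
    exact Submodule.mul_mem_mul (S.homogeneousComponent_of_mem_pow (r.2 b)).2 hp
  have hlift : ∀ i, (L.lift (X i) ^ q).IsHomogeneous q := fun i => by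
    simpa using (L.lift_hom (isHomogeneous_X k i)).pow q
  have hl : (L.eqn ^ q).IsHomogeneous q := by simpa using L.eqn_hom.pow q
  have hA : ∀ i, ![t.a1, t.a2, t.a3] i ∈ t.spanA := fun i => subset_span ⟨i, rfl⟩
  have hT : ∀ (r : reesAlgebra S.I) {f : R₃ k} (hf : f ∈ S.I),
      (r * reesT S.I hf).1.coeff (b + 1) = r.1.coeff b * f := by
    intro r f hf
    rw [MulMemClass.coe_mul, reesT, Polynomial.coeff_mul_monomial]
  have hC : ∀ (r : reesAlgebra S.I) (f : R₃ k),
      (r * algebraMap (R₃ k) _ f ^ q).1.coeff (b + 1) =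
        r.1.coeff (b + 1) * f ^ q := by
    intro r f
    rw [← map_pow, MulMemClass.coe_mul, coe_algebraMap_rees, Polynomial.coeff_mul_C]
  have hsum : x = (c 0).1.coeff (b + 1) * L.eqn ^ q +
      ((c 1).1.coeff (b + 1) * L.lift (X 1) ^ q - (c 1).1.coeff b * t.a1) +
      ((c 2).1.coeff (b + 1) * L.lift (X 0) ^ q - (c 2).1.coeff b * t.a2) +
      (c 3).1.coeff b * t.a3 := by
    rw [← hax, ← hc, Fin.sum_univ_four]
    change (c 0 * algebraMap (R₃ k) _ L.eqn ^ q +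
      c 1 * (algebraMap (R₃ k) _ (L.lift (X 1)) ^ q - reesT S.I t.mem1.1) +
      c 2 * (algebraMap (R₃ k) _ (L.lift (X 0)) ^ q - reesT S.I t.mem2.1) +
      c 3 * reesT S.I t.mem3.1).1.coeff (b + 1) = _
    rw [mul_sub, mul_sub]
    simp only [AddMemClass.coe_add, AddSubgroupClass.coe_sub, Polynomial.coeff_add,
      Polynomial.coeff_sub, hC]
    rw [hT _ t.mem1.1, hT _ t.mem2.1, hT _ t.mem3.1]
  have hx0 := homogeneousComponent_of_mem (m := (b + 1) * S.s) hx' (n := (b + 1) * S.s)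
  rw [if_pos rfl] at hx0
  rw [← hx0, hsum]
  simp only [map_add, map_sub, low _ hl, low _ (hlift _), zero_add, zero_sub]
  exact add_mem (add_mem (neg_mem (top _ (hA 0))) (neg_mem (top _ (hA 1)))) (top _ (hA 2))

theorem parameter_mem_reesMax (hq : 1 ≤ q) (i : Fin 4) : t.parameter i ∈ reesMax S.I := by
  have hι : ∀ {r : R₃ k}, r.IsHomogeneous 1 →
      algebraMap (R₃ k) (reesAlgebra S.I) r ^ q ∈ reesMax S.I := by
    intro r hr
    refine (reesMax S.I).pow_mem_of_mem ?_ q (by omega)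
    rw [mem_reesMax, coe_algebraMap_rees, Polynomial.coeff_C_zero, MvPolynomial.constantCoeff_eq]
    exact hr.coeff_eq_zero (by simp)
  fin_cases i
  · exact hι L.eqn_hom
  · exact (reesMax S.I).sub_mem (hι (L.lift_hom (isHomogeneous_X k 1))) (reesT_mem_reesMax _ _)
  · exact (reesMax S.I).sub_mem (hι (L.lift_hom (isHomogeneous_X k 0))) (reesT_mem_reesMax _ _)
  · exact reesT_mem_reesMax _ t.mem3.1

end GoodTriple

theorem I_ne_bot : S.I ≠ ⊥ := by
  intro h0
  refine S.indeg.1 (eq_bot_iff.2 fun x hx => ?_)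
  have : x ∈ S.I := hx.1
  rwa [h0] at this

/-- If the Rees algebra of the ideal of the points is Cohen–Macaulay, then `h = 0`. -/
theorem h_eq_zero_of_rees [Infinite k] (hCM : IsCohenMacaulayRing (reesAlgebra S.I)) :
    S.h = 0 := by
  obtain ⟨L, hL⟩ := S.exists_avoids
  obtain ⟨t⟩ := S.exists_goodTriple hL (q := S.s + 1) (by omega)
  have hreg := hasRegularSeq_reesMax S.I I_ne_bot hCM
  let W : Submodule k (reesAlgebra S.I) := span k (range t.parameter)
  have hWfin : FiniteDimensional k W := FiniteDimensional.span_of_finite k (Set.finite_range _)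
  have hW4 : finrank k W ≤ 4 :=
    (finrank_range_le_card (R := k) t.parameter).trans (by simp)
  have hWM : ∀ w ∈ W, w ∈ reesMax S.I := by
    intro w hw
    have : W ≤ (reesMax S.I).restrictScalars k := span_le.2 (by
      rintro _ ⟨i, rfl⟩
      exact t.parameter_mem_reesMax (by omega) i)
    exact this hw
  have hmem : ∀ i, t.parameter i ∈ W := fun i => subset_span ⟨i, rfl⟩
  have hv0 : t.parameter 0 ≠ 0 := by
    intro h0
    have h1 := congrArg (fun a : reesAlgebra S.I => a.1.coeff 0) h0
    have h2 : (t.parameter 0) = algebraMap (R₃ k) _ (L.eqn ^ (S.s + 1)) := by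
      rw [map_pow]; rfl
    simp only [h2, coe_algebraMap_rees, Polynomial.coeff_C_zero, ZeroMemClass.coe_zero,
      Polynomial.coeff_zero] at h1
    exact L.eqn_ne (eq_zero_of_pow_eq_zero h1)
  have hnoeth : IsNoetherianRing (reesAlgebra S.I) := inferInstance
  obtain ⟨N, hNW, hc, hreg⟩ := HasRegularSeq.exists_quotient (k := k) (W := W) hWM
    (fun a ha => t.exists_pow_mem_span_parameter (by omega) ha) (hmem 0) 3
    (U := span k {t.parameter 0}) hreg bot_le
    ((Submodule.span_singleton_le_iff_mem _ _).2 (hmem 0))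
    (by rw [finrank_span_singleton hv0]; exact hW4)
    (by
      intro u hu
      obtain ⟨c, rfl⟩ := Submodule.mem_span_singleton.1 hu
      exact ⟨c, by simp⟩)
  have hNW' : N ≤ Ideal.span (range t.parameter) := by
    refine hNW.trans (Ideal.span_le.2 fun w hw => ?_)
    have : W ≤ (Ideal.span (range t.parameter)).restrictScalars k :=
      span_le.2 Ideal.subset_span
    exact this hw
  let ι : R₃ k →+* reesAlgebra S.I := algebraMap _ _
  have hreg1 : IsRegularMod (ι L.eqn) N := by
    intro a ha
    refine hreg a ?_
    change ι L.eqn ^ (S.s + 1) * a ∈ N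
    rw [pow_succ, mul_assoc]
    exact N.mul_mem_left _ ha
  have hsmul : ∀ c : k, c • t.parameter 0 = ι (C c * L.eqn ^ (S.s + 1)) := by
    intro c
    rw [map_mul, map_pow, Algebra.smul_def]
    rfl
  obtain ⟨c1, hc1⟩ := hc _ (hmem 1)
  obtain ⟨c2, hc2⟩ := hc _ (hmem 2)
  obtain ⟨c3, hc3⟩ := hc _ (hmem 3)
  rw [hsmul] at hc1 hc2 hc3
  have hE : ∀ c : k, (C c * L.eqn ^ (S.s + 1)).IsHomogeneous (S.s + 1) := fun c => by
    simpa using (isHomogeneous_C (Fin 3) c).mul (L.eqn_hom.pow (S.s + 1))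
  have hlift : ∀ i, (L.lift (X i) ^ (S.s + 1)).IsHomogeneous (S.s + 1) := fun i => by
    simpa using (L.lift_hom (isHomogeneous_X k i)).pow (S.s + 1)
  have e1 : reesT S.I t.mem1.1 - ι (L.lift (X 1) ^ (S.s + 1) - C c1 * L.eqn ^ (S.s + 1)) ∈ N := by
    have := N.neg_mem hc1
    convert this using 1
    rw [map_sub, map_pow]
    change _ = -(ι (L.lift (X 1)) ^ (S.s + 1) - reesT S.I t.mem1.1 - _)
    ring
  have e2 : reesT S.I t.mem2.1 - ι (L.lift (X 0) ^ (S.s + 1) - C c2 * L.eqn ^ (S.s + 1)) ∈ N := by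
    have := N.neg_mem hc2
    convert this using 1
    rw [map_sub, map_pow]
    change _ = -(ι (L.lift (X 0)) ^ (S.s + 1) - reesT S.I t.mem2.1 - _)
    ring
  have e3 : reesT S.I t.mem3.1 - ι (C c3 * L.eqn ^ (S.s + 1)) ∈ N := hc3
  have hresE : ∀ c : k, L.res (C c * L.eqn ^ (S.s + 1)) = 0 := fun c => by
    rw [map_mul, map_pow, L.res_eqn, zero_pow (by omega), mul_zero]
  have hA : t.spanA ≤ S.reducible N 1 (S.s + 1) := by
    refine span_le.2 ?_
    rintro _ ⟨i, rfl⟩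
    fin_cases i
    · exact ⟨_, rfl, _, (hlift 1).sub (hE c1), e1⟩
    · exact ⟨_, rfl, _, (hlift 0).sub (hE c2), e2⟩
    · exact ⟨_, rfl, _, hE c3, e3⟩
  refine t.h_eq_zero_of_three fun ζ hζ => ?_
  have hζ1 : L.eqn ^ (2 * S.s) * ζ ∈ S.reducible N 3 (3 * (S.s + 1) + 2 * S.s) :=
    t.pow_mul_le_reducible hA 3 (2 * S.s) (t.mul_F_le le_rfl 3 (Submodule.mul_mem_mul (by
      simpa using L.eqn_hom.pow (2 * S.s)) hζ))
  obtain ⟨a, ha, g, hg, hag⟩ := hζ1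
  have hg' : g.IsHomogeneous ((3 * S.s + 2) + (2 * S.s + 1)) := by
    convert hg using 1
    ring
  obtain ⟨g', -, hgg⟩ := t.exists_pow_mul_sub_mem ((hlift 1).sub (hE c1)) ((hlift 0).sub (hE c2))
    (hE c3) (by rw [map_sub, hresE, map_pow, L.res_lift, sub_zero])
    (by rw [map_sub, hresE, map_pow, L.res_lift, sub_zero]) (hresE c3) e1 e2 e3
    (N₀ := S.s + 2) (by omega) (by omega) (by omega) (2 * S.s + 1) hg'
  have hζI : ζ ∈ S.I ^ 3 := S.F_le_pow_I 3 hζ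
  let z : reesAlgebra S.I := ⟨Polynomial.monomial 3 ζ, reesAlgebra.monomial_mem.2 hζI⟩
  have hz : a = ι L.eqn ^ (2 * S.s) * z := by
    ext1
    rw [ha, MulMemClass.coe_mul, ← map_pow, coe_algebraMap_rees, Polynomial.C_mul_monomial]
  have hz2 : ι L.eqn ^ (2 * S.s) * (z - ι (L.eqn * g')) ∈ N := by
    have := N.add_mem hag hgg
    convert this using 1
    rw [hz]
    change _ = ι L.eqn ^ (2 * S.s) * z - ι g + ι (g - L.eqn ^ (2 * S.s + 1) * g')
    rw [map_sub, map_mul, map_mul, map_pow]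
    ring
  have hz3 := hNW' (hreg1.pow _ _ hz2)
  refine t.mem_spanA_mul_F_of_mem_span_parameter (b := 2) hζ (by omega) (by
    have := S.hs_pos; omega) hz3 ?_
  rw [AddSubgroupClass.coe_sub, Polynomial.coeff_sub]
  change (Polynomial.monomial 3 ζ).coeff 3 - (C₁ (L.eqn * g')).coeff 3 = ζ
  rw [Polynomial.coeff_monomial_same, Polynomial.coeff_C_of_ne_zero (by norm_num), sub_zero]

end PointSetup

namespace PointChart

variable {k : Type*} [Field k] {p : Fin 3 → k} (c : PointChart p)

/-- The restriction to the line through the point with direction `v`. -/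
def ray (v : Fin 2 → k) : R₃ k →ₐ[k] Polynomial k :=
  (aeval fun j => C₁ (v j) * X₁).comp c.loc

theorem coeff_zero_aeval_mul_X (v : Fin 2 → k) (g : R₂ k) :
    (aeval (fun j => C₁ (v j) * X₁) g).coeff 0 = constantCoeff g := by
  induction g using MvPolynomial.induction_on with
  | C a => simp
  | add p q hp hq => rw [map_add, Polynomial.coeff_add, hp, hq, map_add]
  | mul_X p i hp => simp

theorem coeff_ray_zero (v : Fin 2 → k) (g : R₃ k) :
    (c.ray v g).coeff 0 = eval p g := by
  rw [← c.constantCoeff_loc, ray, AlgHom.comp_apply, coeff_zero_aeval_mul_X]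

theorem coeff_ray_one (v : Fin 2 → k) (g : R₃ k) :
    (c.ray v g).coeff 1 = v 0 * c.du g 0 + v 1 * c.du g 1 := by
  rw [ray, AlgHom.comp_apply, du, du]
  induction c.loc g using MvPolynomial.induction_on with
  | C a =>
    have h : ∀ i : Fin 2, (0 : Fin 2 →₀ ℕ) ≠ Finsupp.single i 1 := fun i h => by
      simpa using congrArg (fun z => z i) h
    simp [coeff_C, h]
  | add p q hp hq =>
    rw [map_add, Polynomial.coeff_add, hp, hq, coeff_add, coeff_add]
    ring
  | mul_X p i hp =>
    rw [map_mul, aeval_X, ← mul_assoc, Polynomial.coeff_mul_X, Polynomial.coeff_mul_C,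
      coeff_zero_aeval_mul_X, constantCoeff_eq, mul_comm]
    fin_cases i <;> simp [coeff_mul_X']

theorem X_dvd_ray {g : R₃ k} (hg : eval p g = 0) (v : Fin 2 → k) :
    X₁ ∣ c.ray v g := by
  rw [Polynomial.X_dvd_iff, coeff_ray_zero, hg]

theorem X_sq_dvd_ray {g : R₃ k} (hg : eval p g = 0) (hg' : c.du g = 0)
    (v : Fin 2 → k) : X₁ ^ 2 ∣ c.ray v g := by
  rw [Polynomial.X_pow_dvd_iff]
  intro d hd
  interval_cases d
  · rw [coeff_ray_zero, hg]
  · rw [coeff_ray_one, hg']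
    simp

theorem eval_eq_zero_of_X_pow_dvd_ray {g : R₃ k} {m : ℕ}
    (h : ∀ v, X₁ ^ (m + 1) ∣ c.ray v g) : eval p g = 0 := by
  rw [← c.coeff_ray_zero 0]
  exact Polynomial.X_pow_dvd_iff.1 (h 0) 0 (by omega)

theorem du_eq_zero_of_X_pow_dvd_ray {g : R₃ k} {m : ℕ}
    (h : ∀ v, X₁ ^ (m + 2) ∣ c.ray v g) : c.du g = 0 := by
  have h1 : ∀ v : Fin 2 → k, v 0 * c.du g 0 + v 1 * c.du g 1 = 0 := fun v => by
    rw [← coeff_ray_one]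
    exact Polynomial.X_pow_dvd_iff.1 (h v) 1 (by omega)
  ext i
  have := h1 (Pi.single i 1)
  fin_cases i <;> simpa using this

theorem coeff_ray_two_mul {a b : R₃ k} (ha : eval p a = 0) (hb : eval p b = 0)
    (v : Fin 2 → k) : (c.ray v (a * b)).coeff 2 =
      (v 0 * c.du a 0 + v 1 * c.du a 1) * (v 0 * c.du b 0 + v 1 * c.du b 1) := by
  rw [map_mul, Polynomial.coeff_mul, Finset.Nat.sum_antidiagonal_eq_sum_range_succ_mk]
  simp [Finset.sum_range_succ, coeff_ray_zero, ha, hb, coeff_ray_one]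

end PointChart

/-- A syzygy of two independent linear forms in two variables is a multiple of the Koszul one. -/
theorem exists_koszul_of_syzygy {k : Type*} [Field k] {a b a' b' x y x' y' : k}
    (hΔ : a * b' - b * a' ≠ 0)
    (h : ∀ v w : k, (v * a + w * b) * (v * x + w * y) + (v * a' + w * b') * (v * x' + w * y') = 0) :
    ∃ c : k, x = c * a' ∧ y = c * b' ∧ x' = -c * a ∧ y' = -c * b := by
  have e1 := h 1 0
  have e2 := h 0 1
  have e3 := h 1 1
  simp only [one_mul, zero_mul, add_zero, zero_add] at e1 e2 e3
  have hc : (a * y + a' * y') / (a * b' - b * a') * (a * b' - b * a') = a * y + a' * y' :=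
    div_mul_cancel₀ _ hΔ
  set c := (a * y + a' * y') / (a * b' - b * a')
  refine ⟨c, ?_, ?_, ?_, ?_⟩ <;> apply mul_right_cancel₀ hΔ
  · linear_combination b' * e1 - a' * (e3 - e1 - e2) - a' * hc
  · linear_combination -a' * e2 - b' * hc
  · linear_combination a * (e3 - e1 - e2) - b * e1 + a * hc
  · linear_combination a * e2 + b * hc

namespace PointSetup

variable {k : Type*} [Field k] (S : PointSetup k)

/-- The forms of degree `d` singular at the points. -/
def double (d : ℕ) : Submodule k (R₃ k) :=
  S.piece d ⊓ ⨅ i, ker (S.chart i).duLin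

theorem mem_double {g : R₃ k} {d : ℕ} :
    g ∈ S.double d ↔ g ∈ S.piece d ∧ ∀ i, (S.chart i).du g = 0 := by
  simp only [double, Submodule.mem_inf, Submodule.mem_iInf, LinearMap.mem_ker]
  rfl

theorem double_le (d : ℕ) : S.double d ≤ S.piece d := inf_le_left

instance (d : ℕ) : FiniteDimensional k (S.double d) :=
  Submodule.finiteDimensional_of_le (S.double_le d)

theorem finrank_piece_le_double (d : ℕ) :
    finrank k (S.piece d) ≤ finrank k (S.double d) + 2 * S.n := by
  let E : S.piece d →ₗ[k] (Fin S.n → Fin 2 → k) :=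
    (LinearMap.pi fun i => (S.chart i).duLin) ∘ₗ (S.piece d).subtype
  have hker : (ker E).map (S.piece d).subtype = S.double d := by
    ext g
    rw [mem_double]
    constructor
    · rintro ⟨⟨x, hx⟩, h1, rfl⟩
      exact ⟨hx, fun i => congrFun h1 i⟩
    · rintro ⟨h1, h2⟩
      exact ⟨⟨g, h1⟩, funext fun i => h2 i, rfl⟩
  have h0 : finrank k (ker E) = finrank k (S.double d) := by
    rw [← hker]
    exact (Submodule.equivMapOfInjective _ Subtype.val_injective _).finrank_eq
  have h1 := LinearMap.finrank_range_add_finrank_ker E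
  have h2 := (LinearMap.range E).finrank_le
  rw [Module.finrank_pi_fintype] at h2
  simp only [Module.finrank_fintype_fun_eq_card, Fintype.card_fin, Finset.sum_const,
    Finset.card_univ, smul_eq_mul] at h2
  omega

/-- The forms of degree `d` with a triple point at all the points. -/
def triple (d : ℕ) : Submodule k (R₃ k) :=
  ℋ₃ k d ⊓ ⨅ i, ⨅ v,
    ((Ideal.span {(X₁ ^ 3 : Polynomial k)}).restrictScalars k).comap
      ((S.chart i).ray v).toLinearMap

theorem mem_triple {g : R₃ k} {d : ℕ} :
    g ∈ S.triple d ↔ g.IsHomogeneous d ∧ ∀ i v, X₁ ^ 3 ∣ (S.chart i).ray v g := by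
  simp only [triple, Submodule.mem_inf, Submodule.mem_iInf, mem_homogeneousSubmodule,
    Submodule.mem_comap, Submodule.restrictScalars_mem, Ideal.mem_span_singleton]
  rfl

theorem triple_le_piece (d : ℕ) : S.triple d ≤ S.piece d := fun _ hg =>
  S.mem_piece.2 ⟨(S.mem_triple.1 hg).1, fun i =>
    (S.chart i).eval_eq_zero_of_X_pow_dvd_ray (m := 2) ((S.mem_triple.1 hg).2 i)⟩

theorem mul_mem_double {a b : R₃ k} {d e : ℕ} (ha : a ∈ S.piece d)
    (hb : b ∈ S.piece e) : a * b ∈ S.double (d + e) := by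
  refine S.mem_double.2 ⟨S.mul_mem_piece ha.2 hb, fun i => funext fun j => ?_⟩
  rw [PointChart.du_mul, S.eval_eq_zero ha.1, S.eval_eq_zero hb.1]
  simp

theorem mul_mem_triple {a b : R₃ k} {d e : ℕ} (ha : a ∈ S.piece d)
    (hb : b ∈ S.double e) : a * b ∈ S.triple (d + e) := by
  have hb' := S.mem_double.1 hb
  refine S.mem_triple.2 ⟨ha.2.mul hb'.1.2, fun i v => ?_⟩
  rw [map_mul, pow_succ']
  exact mul_dvd_mul ((S.chart i).X_dvd_ray (S.eval_eq_zero ha.1 i) v)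
    ((S.chart i).X_sq_dvd_ray (S.eval_eq_zero hb'.1.1 i) (hb'.2 i) v)

theorem F_two_le_double : S.F 2 ≤ S.double (2 * S.s) := by
  rw [F, pow_two, Submodule.mul_le]
  intro a ha b hb
  rw [two_mul]
  exact S.mul_mem_double ha hb

theorem F_three_le_triple : S.F 3 ≤ S.triple (3 * S.s) := by
  rw [F, pow_succ', Submodule.mul_le]
  intro a ha b hb
  rw [show 3 * S.s = S.s + 2 * S.s by ring]
  exact S.mul_mem_triple ha (S.F_two_le_double hb)

namespace GoodTriple

variable {S} {L : LineChart k} {q : ℕ} (t : S.GoodTriple L q)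

theorem eval_eq_zero_of_du {p r : R₃ k} {i : Fin S.n}
    (h : (S.chart i).du (t.a1 * p + t.a2 * r) = 0) :
    eval (S.pts i) p = 0 ∧ eval (S.pts i) r = 0 := by
  have h1 : ∀ j, (S.chart i).du t.a1 j * eval (S.pts i) p +
      (S.chart i).du t.a2 j * eval (S.pts i) r = 0 := fun j => by
    have := congrFun h j
    rw [PointChart.du_add, PointChart.du_mul, PointChart.du_mul, S.eval_eq_zero t.mem1.1,
      S.eval_eq_zero t.mem2.1] at this
    simpa using this
  have e0 := h1 0
  have e1 := h1 1
  constructor <;> apply mul_left_cancel₀ (t.det_ne i) <;> rw [mul_zero]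
  · linear_combination (S.chart i).du t.a2 1 * e0 - (S.chart i).du t.a2 0 * e1
  · linear_combination (S.chart i).du t.a1 0 * e1 - (S.chart i).du t.a1 1 * e0

theorem exists_eq_of_mem_double_inf {e : ℕ} {g : R₃ k}
    (hg : g ∈ S.double (S.s + e) ⊓ t.pairPiece (S.s + e)) :
    ∃ p ∈ S.piece e, ∃ r ∈ S.piece e, g = t.a1 * p + t.a2 * r := by
  obtain ⟨h1, h2⟩ := hg
  obtain ⟨p, r, hp, hr, rfl⟩ := exists_of_isHomogeneous_mem_span_pair t.mem1.2 t.mem2.2 h2.2 h2.1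
  have h := fun i => t.eval_eq_zero_of_du ((S.mem_double.1 h1).2 i)
  exact ⟨p, S.mem_piece.2 ⟨hp, fun i => (h i).1⟩, r, S.mem_piece.2 ⟨hr, fun i => (h i).2⟩, rfl⟩

theorem double_inf_pairPiece_eq_bot {e : ℕ} (he : e < S.s) :
    S.double (S.s + e) ⊓ t.pairPiece (S.s + e) = ⊥ := by
  rw [eq_bot_iff]
  intro g hg
  obtain ⟨p, hp, r, hr, rfl⟩ := t.exists_eq_of_mem_double_inf hg
  rw [S.piece_eq_bot he, Submodule.mem_bot] at hp hr
  simp [hp, hr]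

theorem finrank_double_inf_pairPiece_lt :
    finrank k ↥(S.double (S.s + S.s) ⊓ t.pairPiece (S.s + S.s)) <
      2 * finrank k (S.piece S.s) := by
  let Φ : (S.piece S.s × S.piece S.s) →ₗ[k] R₃ k :=
    (LinearMap.mulLeft k t.a1 ∘ₗ (S.piece S.s).subtype).coprod
      (LinearMap.mulLeft k t.a2 ∘ₗ (S.piece S.s).subtype)
  have h1 : S.double (S.s + S.s) ⊓ t.pairPiece (S.s + S.s) ≤ LinearMap.range Φ := by
    intro g hg
    obtain ⟨p, hp, r, hr, rfl⟩ := t.exists_eq_of_mem_double_inf hg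
    exact ⟨(⟨p, hp⟩, ⟨r, hr⟩), by simp [Φ]⟩
  have h2 := LinearMap.finrank_range_add_finrank_ker Φ
  rw [Module.finrank_prod] at h2
  have h3 : 1 ≤ finrank k (ker Φ) := by
    refine Submodule.one_le_finrank_iff.2 ((Submodule.ne_bot_iff _).2
      ⟨(⟨t.a2, t.mem2⟩, ⟨-t.a1, Submodule.neg_mem _ t.mem1⟩), ?_, fun h => t.a2_ne ?_⟩)
    · simp [Φ, mul_comm]
    · exact congrArg (fun z => (z.1 : R₃ k)) h
  have h4 := finrank_mono h1
  omega

theorem finrank_double_le {d : ℕ} (hd : S.s ≤ d) :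
    finrank k (S.double d) ≤
      S.residual + finrank k ↥(S.double d ⊓ t.pairPiece d) := by
  have h1 := t.finrank_map_a3_sup (S.double_le d)
  have h2 := t.finrank_pairPiece (d := S.s + d) (by omega)
  have h3 : (S.double d).map (LinearMap.mulLeft k t.a3) ⊔ t.pairPiece (S.s + d) ≤
      S.piece (S.s + d) := by
    refine sup_le ?_ (t.pairPiece_le _)
    rintro _ ⟨u, hu, rfl⟩
    exact S.mul_mem_piece t.mem3.2 (S.double_le d hu)
  have h4 := finrank_mono h3
  omega

theorem map_a3_double_sup {d : ℕ} (hd : S.s ≤ d)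
    (h : S.residual + finrank k ↥(S.double d ⊓ t.pairPiece d) ≤
      finrank k (S.double d)) :
    (S.double d).map (LinearMap.mulLeft k t.a3) ⊔ t.pairPiece (S.s + d) = S.piece (S.s + d) := by
  have h1 := t.finrank_map_a3_sup (S.double_le d)
  have h2 := t.finrank_pairPiece (d := S.s + d) (by omega)
  refine Submodule.eq_of_le_of_finrank_le (sup_le ?_ (t.pairPiece_le _)) ?_
  · rintro _ ⟨u, hu, rfl⟩
    exact S.mul_mem_piece t.mem3.2 (S.double_le d hu)
  · omega

theorem exists_eq_of_mem_triple {e : ℕ} (he : S.n ≤ (e + 2).choose 2)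
    (hsup : (S.double (S.s + e)).map (LinearMap.mulLeft k t.a3) ⊔ t.pairPiece (S.s + (S.s + e)) =
      S.piece (S.s + (S.s + e)))
    {g : R₃ k} (hg : g ∈ S.triple (S.s + (S.s + e))) :
    ∃ x ∈ S.double (S.s + e), ∃ y ∈ S.double (S.s + e), ∃ z ∈ S.double (S.s + e),
      g = t.a1 * x + t.a2 * y + t.a3 * z := by
  have hg1 := S.triple_le_piece _ hg
  rw [← hsup] at hg1
  obtain ⟨_, ⟨z, hz, rfl⟩, w, hw, rfl⟩ := mem_sup.1 hg1
  obtain ⟨p, r, hp, hr, rfl⟩ := exists_of_isHomogeneous_mem_span_pair t.mem1.2 t.mem2.2 hw.2 hw.1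
  have hW : t.a1 * p + t.a2 * r ∈ S.triple (S.s + (S.s + e)) := by
    have := Submodule.sub_mem _ hg (S.mul_mem_triple t.mem3 hz)
    simpa using this
  have hW' := (S.mem_triple.1 hW).2
  have hev := fun i => t.eval_eq_zero_of_du
    ((S.chart i).du_eq_zero_of_X_pow_dvd_ray (m := 1) (hW' i))
  have hk : ∀ i, ∃ c : k, (S.chart i).du p 0 = c * (S.chart i).du t.a2 0 ∧
      (S.chart i).du p 1 = c * (S.chart i).du t.a2 1 ∧
      (S.chart i).du r 0 = -c * (S.chart i).du t.a1 0 ∧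
      (S.chart i).du r 1 = -c * (S.chart i).du t.a1 1 := fun i => by
    refine exists_koszul_of_syzygy (t.det_ne i) fun v w => ?_
    have := Polynomial.X_pow_dvd_iff.1 (hW' i ![v, w]) 2 (by norm_num)
    rw [map_add, Polynomial.coeff_add,
      PointChart.coeff_ray_two_mul _ (S.eval_eq_zero t.mem1.1 i) (hev i).1,
      PointChart.coeff_ray_two_mul _ (S.eval_eq_zero t.mem2.1 i) (hev i).2] at this
    simpa using this
  choose c hc0 hc1 hc2 hc3 using hk
  obtain ⟨v, hv, hvc⟩ := S.exists_eval_eq he c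
  refine ⟨p - t.a2 * v, S.mem_double.2 ⟨S.mem_piece.2 ⟨hp.sub (t.mem2.2.mul hv), fun i => ?_⟩,
    fun i => ?_⟩, r + t.a1 * v, S.mem_double.2 ⟨S.mem_piece.2 ⟨hr.add (t.mem1.2.mul hv),
    fun i => ?_⟩, fun i => ?_⟩, z, hz, ?_⟩
  · simp [(hev i).1, S.eval_eq_zero t.mem2.1 i]
  · have h0 : ∀ j, (S.chart i).du (p - t.a2 * v) j =
        (S.chart i).du p j - c i * (S.chart i).du t.a2 j := fun j => by
      rw [sub_eq_add_neg, ← neg_one_smul k (t.a2 * v), PointChart.du_add, PointChart.du_smul,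
        PointChart.du_mul, hvc, S.eval_eq_zero t.mem2.1 i]
      ring
    ext j
    rw [h0]
    fin_cases j <;> simp [hc0, hc1]
  · simp [(hev i).2, S.eval_eq_zero t.mem1.1 i]
  · have h0 : ∀ j, (S.chart i).du (r + t.a1 * v) j =
        (S.chart i).du r j + c i * (S.chart i).du t.a1 j := fun j => by
      rw [PointChart.du_add, PointChart.du_mul, hvc, S.eval_eq_zero t.mem1.1 i]
      ring
    ext j
    rw [h0]
    fin_cases j <;> simp [hc2, hc3]
  · simp only [LinearMap.mulLeft_apply]
    ring

theorem mem_spanA_mul {U : Submodule k (R₃ k)} {x y z : R₃ k}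
    (hx : x ∈ U) (hy : y ∈ U) (hz : z ∈ U) : t.a1 * x + t.a2 * y + t.a3 * z ∈ t.spanA * U :=
  add_mem (add_mem (Submodule.mul_mem_mul (subset_span ⟨0, rfl⟩) hx)
    (Submodule.mul_mem_mul (subset_span ⟨1, rfl⟩) hy))
    (Submodule.mul_mem_mul (subset_span ⟨2, rfl⟩) hz)

theorem finrank_double_two_le (t : S.GoodTriple L q) (h0 : S.h = 0) :
    finrank k (S.double (S.s + S.s)) ≤ (S.s + 2).choose 2 := by
  have h1 := t.finrank_double_le (Nat.le_add_left S.s S.s)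
  have h2 := t.finrank_double_inf_pairPiece_lt
  rw [S.finrank_piece_s, h0] at h2
  have h3 : S.residual = S.s.choose 2 - S.h := rfl
  have h4 : (S.s + 2).choose 2 = (S.s + 1) + (S.s + S.s.choose 2) := by
    rw [Nat.choose_succ_succ' (S.s + 1) 1, Nat.choose_one_right, Nat.choose_succ_succ' S.s 1,
      Nat.choose_one_right]
  omega

end GoodTriple

theorem le_finrank_double_two (h0 : S.h = 0) :
    (S.s + 2).choose 2 ≤ finrank k (S.double (S.s + S.s)) := by
  have h1 := S.finrank_piece_le_double (S.s + S.s)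
  rw [S.finrank_piece] at h1
  have h2 := S.hn
  obtain ⟨m, hm⟩ : ∃ m, S.s = m + 1 := ⟨S.s - 1, by have := S.hs; omega⟩
  have h3 := two_mul_choose_two m
  have h4 := two_mul_choose_two (m + 1)
  have h5 := two_mul_choose_two (m + 1 + (m + 1))
  rw [h0, hm] at h2
  rw [hm] at h1 ⊢
  rw [show m + 1 + 1 = m + 2 by ring] at h2
  ring_nf at h1 h2 h3 h4 h5 ⊢
  omega

theorem le_finrank_double_pred (h0 : S.h = 0) {d : ℕ} (hd : d + 1 = S.s) :
    S.s.choose 2 ≤ finrank k (S.double (S.s + d)) := by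
  have h1 := S.finrank_piece_le_double (S.s + d)
  rw [S.finrank_piece] at h1
  have h2 := S.hn
  obtain ⟨m, hm⟩ : ∃ m, d = m + 1 := ⟨d - 1, by have := S.hs; omega⟩
  subst hm
  have h3 := two_mul_choose_two m
  have h4 := two_mul_choose_two (m + 1)
  have h5 := two_mul_choose_two (m + 1 + 1 + (m + 1))
  rw [← hd] at h1 h2 ⊢
  rw [h0] at h2
  rw [show m + 1 + 1 + 1 = m + 1 + 2 by ring] at h2
  ring_nf at h1 h2 h3 h4 h5 ⊢
  omega

namespace GoodTriple

variable {S} {L : LineChart k} {q : ℕ} (t : S.GoodTriple L q)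

theorem triple_three_le (h0 : S.h = 0) {g : R₃ k}
    (hg : g ∈ S.triple (3 * S.s)) : g ∈ t.spanA * S.double (S.s + S.s) := by
  have h1 := S.le_finrank_double_two h0
  have h2 := t.finrank_double_inf_pairPiece_lt
  rw [S.finrank_piece_s, h0] at h2
  have h3 : S.residual = S.s.choose 2 - S.h := rfl
  have h4 : (S.s + 2).choose 2 = (S.s + 1) + (S.s + S.s.choose 2) := by
    rw [Nat.choose_succ_succ' (S.s + 1) 1, Nat.choose_one_right, Nat.choose_succ_succ' S.s 1,
      Nat.choose_one_right]
  have hsup := t.map_a3_double_sup (Nat.le_add_left S.s S.s) (by omega)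
  rw [show 3 * S.s = S.s + (S.s + S.s) by ring] at hg
  obtain ⟨x, hx, y, hy, z, hz, rfl⟩ := t.exists_eq_of_mem_triple (S.n_le le_rfl) hsup hg
  exact t.mem_spanA_mul hx hy hz

theorem triple_pred_le (h0 : S.h = 0) {d : ℕ} (hd : d + 1 = S.s) {g : R₃ k}
    (hg : g ∈ S.triple (S.s + (S.s + d))) :
    ∃ x ∈ S.double (S.s + d), ∃ y ∈ S.double (S.s + d), ∃ z ∈ S.double (S.s + d),
      g = t.a1 * x + t.a2 * y + t.a3 * z := by
  have h1 := S.le_finrank_double_pred h0 hd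
  have h2 := t.double_inf_pairPiece_eq_bot (e := d) (by omega)
  have h3 : S.residual = S.s.choose 2 - S.h := rfl
  have hsup := t.map_a3_double_sup (Nat.le_add_right S.s d) (by rw [h2, finrank_bot]; omega)
  exact t.exists_eq_of_mem_triple (S.n_le_pred h0 (by omega)) hsup hg

theorem finrank_double_pred (t : S.GoodTriple L q) (h0 : S.h = 0) {d : ℕ} (hd : d + 1 = S.s) :
    finrank k (S.double (S.s + d)) = S.s.choose 2 := by
  have h1 := S.le_finrank_double_pred h0 hd
  have h2 := t.finrank_double_le (Nat.le_add_right S.s d)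
  rw [t.double_inf_pairPiece_eq_bot (e := d) (by omega), finrank_bot] at h2
  have h3 : S.residual = S.s.choose 2 - S.h := rfl
  omega

end GoodTriple

end PointSetup

namespace PointChart

variable {k : Type*} [Field k] {q : Fin 3 → k} (c : PointChart q)

theorem exists_eq_smul_add {m : R₃ k} (hm : m.IsHomogeneous 1)
    (h : eval q m = 0) (hq : q ≠ 0) : ∃ α β : k, m = α • c.l + β • c.l' := by
  have h1 := (mem_pointIdeal_iff hq hm).2 h
  rw [c.span_eq] at h1
  obtain ⟨a, b, ha, hb, rfl⟩ := exists_of_isHomogeneous_mem_span_pair (d := 0) c.l_hom c.l'_hom hm h1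
  obtain ⟨α, rfl⟩ := exists_eq_C_of_isHomogeneous_zero ha
  obtain ⟨β, rfl⟩ := exists_eq_C_of_isHomogeneous_zero hb
  exact ⟨α, β, by simp [smul_eq_C_mul, mul_comm]⟩

theorem l_ne_zero : c.l ≠ 0 := fun h => by
  have := c.loc_l
  rw [h, map_zero] at this
  exact X_ne_zero _ this.symm

theorem l'_ne_zero : c.l' ≠ 0 := fun h => by
  have := c.loc_l'
  rw [h, map_zero] at this
  exact X_ne_zero _ this.symm

theorem isRelPrime_l_l' : IsRelPrime c.l c.l' := by
  rintro d ⟨e, he⟩ ⟨e', he'⟩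
  have hd : d ≠ 0 := fun h => c.l_ne_zero (by rw [he, h, zero_mul])
  have he0 : e ≠ 0 := fun h => c.l_ne_zero (by rw [he, h, mul_zero])
  have he0' : e' ≠ 0 := fun h => c.l'_ne_zero (by rw [he', h, mul_zero])
  have h1 := c.l_hom.totalDegree c.l_ne_zero
  have h1' := c.l'_hom.totalDegree c.l'_ne_zero
  rw [he, totalDegree_mul_of_isDomain hd he0] at h1
  rw [he', totalDegree_mul_of_isDomain hd he0'] at h1'
  rcases Nat.eq_zero_or_pos d.totalDegree with h0 | h0
  · rw [totalDegree_eq_zero_iff_eq_C] at h0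
    rw [h0] at hd ⊢
    rw [ne_eq, C_eq_zero] at hd
    exact (IsUnit.mk0 _ hd).map C
  · have h2 : e = C (coeff 0 e) := (totalDegree_eq_zero_iff_eq_C).1 (by omega)
    have h2' : e' = C (coeff 0 e') := (totalDegree_eq_zero_iff_eq_C).1 (by omega)
    have h3 : C (coeff 0 e') * c.l = C (coeff 0 e) * c.l' := by
      rw [← h2, ← h2', he, he']
      ring
    have h4 := congrArg (fun g => c.du g 0) h3
    simp only [← smul_eq_C_mul, PointChart.du_smul, du_l, du_l'] at h4
    refine absurd ?_ he0'
    rw [h2']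
    simpa using h4

end PointChart

namespace PointSetup

variable {k : Type*} [Field k] (S : PointSetup k)

/-- A form of degree less than the initial degree vanishing at the points is zero. -/
theorem eq_zero_of_eval_eq_zero {d : ℕ} (hd : d < S.s) {w : R₃ k}
    (hw : w.IsHomogeneous d) (h : ∀ i, eval (S.pts i) w = 0) : w = 0 := by
  have h1 := S.mem_piece.2 ⟨hw, h⟩
  rwa [S.piece_eq_bot hd] at h1

variable {S}

/-- The cofactor of a linear syzygy of forms through the points which vanishes at a point. -/
theorem exists_cofactor {d : ℕ} {ι : Type*} [Fintype ι] {f : ι → R₃ k}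
    (hf : ∀ i, f i ∈ S.piece (d + 1)) {q : Fin 3 → k} (hq : q ≠ 0) (c : PointChart q)
    {m : ι → R₃ k} (hm : ∀ i, (m i).IsHomogeneous 1)
    (hmq : ∀ i, eval q (m i) = 0) (h : ∑ i, m i * f i = 0) :
    ∃ (w : R₃ k) (α β : ι → k), w.IsHomogeneous d ∧
      (∀ j, (eval (S.pts j) c.l ≠ 0 ∨ eval (S.pts j) c.l' ≠ 0) → eval (S.pts j) w = 0) ∧
      (∀ i, m i = α i • c.l + β i • c.l') ∧ ∑ i, α i • f i = c.l' * w ∧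
      ∑ i, β i • f i = - (c.l * w) := by
  choose α β hαβ using fun i => c.exists_eq_smul_add (hm i) (hmq i) hq
  have hα : ∑ i, α i • f i ∈ S.piece (d + 1) :=
    Submodule.sum_mem _ fun i _ => Submodule.smul_mem _ _ (hf i)
  have hβ : ∑ i, β i • f i ∈ S.piece (d + 1) :=
    Submodule.sum_mem _ fun i _ => Submodule.smul_mem _ _ (hf i)
  have h1 : c.l * ∑ i, α i • f i = - (c.l' * ∑ i, β i • f i) := by
    rw [eq_neg_iff_add_eq_zero, ← h, mul_sum, mul_sum, ← Finset.sum_add_distrib]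
    refine sum_congr rfl fun i _ => ?_
    rw [hαβ i, smul_eq_C_mul, smul_eq_C_mul, smul_eq_C_mul, smul_eq_C_mul]
    ring
  have h2 : c.l' ∣ ∑ i, α i • f i := by
    refine c.isRelPrime_l_l'.symm.dvd_of_dvd_mul_left ?_
    rw [h1]
    exact (dvd_mul_right _ _).neg_right
  obtain ⟨w, hw⟩ := h2
  have hw' : ∑ i, β i • f i = - (c.l * w) := by
    apply mul_left_cancel₀ c.l'_ne_zero
    rw [hw] at h1
    linear_combination h1
  have hwd : w.IsHomogeneous d := by
    refine isHomogeneous_of_mul_of_left c.l'_hom c.l'_ne_zero ?_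
    rw [← hw, add_comm]
    exact hα.2
  refine ⟨w, α, β, hwd, fun j hj => ?_, hαβ, hw, hw'⟩
  have e1 := S.eval_eq_zero hα.1 j
  have e2 := S.eval_eq_zero hβ.1 j
  rw [hw, map_mul] at e1
  rw [hw', map_neg, map_mul, neg_eq_zero] at e2
  rcases hj with hj | hj
  · exact (mul_eq_zero.1 e2).resolve_left hj
  · exact (mul_eq_zero.1 e1).resolve_left hj

theorem eq_zero_of_syzygy {d : ℕ} (hd : d + 1 = S.s) {ι : Type*} [Fintype ι]
    {f : ι → R₃ k} (hf : ∀ i, f i ∈ S.piece (d + 1))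
    (hfi : LinearIndependent k f) {q : Fin 3 → k} (hq : q ≠ 0) {a : R₃ k}
    (ha : a ∈ S.piece S.s) (haq : eval q a ≠ 0)
    {m : ι → R₃ k} (hm : ∀ i, (m i).IsHomogeneous 1)
    (hmq : ∀ i, eval q (m i) = 0) (h : ∑ i, m i * f i = 0) : m = 0 := by
  obtain ⟨c⟩ := PointChart.nonempty hq
  obtain ⟨w, α, β, hw, hw0, hαβ, h1, h2⟩ := exists_cofactor hf hq c hm hmq h
  have hw' : w = 0 := by
    refine S.eq_zero_of_eval_eq_zero (by omega) hw fun j => hw0 j ?_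
    by_contra! hj
    obtain ⟨x, hx, hxj⟩ := exists_isHomogeneous_one_eval_ne_zero (S.fam.1 j)
    have h3 := C_pow_mul_sub_mem_pointIdeal (p := q) ha.2 hx
    rw [c.span_eq] at h3
    have h4 : Ideal.span {c.l, c.l'} ≤ RingHom.ker (eval (S.pts j)) := by
      rw [Ideal.span_le]
      rintro y (rfl | rfl)
      exacts [hj.1, hj.2]
    have h5 := h4 h3
    rw [RingHom.mem_ker, map_sub, map_mul, map_mul, S.eval_eq_zero ha.1, mul_zero, zero_sub,
      neg_eq_zero, eval_C, map_pow] at h5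
    exact (mul_ne_zero haq (pow_ne_zero _ hxj)) h5
  rw [hw', mul_zero] at h1
  rw [hw', mul_zero, neg_zero] at h2
  have h3 := Fintype.linearIndependent_iff.1 hfi α h1
  have h4 := Fintype.linearIndependent_iff.1 hfi β h2
  ext1 i
  rw [hαβ, h3, h4]
  simp

theorem exists_generator {d : ℕ} (hd : d + 1 = S.s) {ι : Type*} [Fintype ι]
    {f : ι → R₃ k} (hf : ∀ i, f i ∈ S.piece (d + 1))
    (hfi : LinearIndependent k f) (p : Fin S.n) {κ : Type*} [Fintype κ]
    {m : κ → ι → R₃ k} (hm : ∀ j i, (m j i).IsHomogeneous 1)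
    (hmi : LinearIndependent k m) (h : ∀ j, ∑ i, m j i * f i = 0) :
    ∃ v : κ → k, ∀ γ : κ → k, (∀ i, ∑ j, γ j * eval (S.pts p) (m j i) = 0) →
      ∃ c : k, γ = c • v := by
  have hq := S.fam.1 p
  obtain ⟨c⟩ := PointChart.nonempty hq
  have hs : ∀ j, j ≠ p → eval (S.pts j) c.l ≠ 0 ∨ eval (S.pts j) c.l' ≠ 0 := fun j hj => by
    by_contra! hj'
    obtain ⟨g, hg, hg1, hg2⟩ := S.exists_separator j
    have h3 := (mem_pointIdeal_iff hq hg).2 (hg2 p hj.symm)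
    rw [c.span_eq] at h3
    have h4 : Ideal.span {c.l, c.l'} ≤ RingHom.ker (eval (S.pts j)) := by
      rw [Ideal.span_le]
      rintro y (rfl | rfl)
      exacts [hj'.1, hj'.2]
    have h5 := h4 h3
    rw [RingHom.mem_ker, hg1] at h5
    exact one_ne_zero h5
  have key : ∀ γ : κ → k, (∀ i, ∑ j, γ j * eval (S.pts p) (m j i) = 0) →
      ∃ (w : R₃ k) (α β : ι → k), w.IsHomogeneous d ∧
      (∀ j, (eval (S.pts j) c.l ≠ 0 ∨ eval (S.pts j) c.l' ≠ 0) → eval (S.pts j) w = 0) ∧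
      (∀ i, ∑ j, γ j • m j i = α i • c.l + β i • c.l') ∧ ∑ i, α i • f i = c.l' * w ∧
      ∑ i, β i • f i = - (c.l * w) := fun γ hγ => by
    refine exists_cofactor hf hq c (fun i => ?_) (fun i => ?_) ?_
    · exact Submodule.sum_mem (ℋ₃ k 1) fun j _ =>
        Submodule.smul_mem _ _ (hm j i)
    · rw [map_sum, ← hγ i]
      simp
    · simp only [Finset.sum_mul]
      rw [Finset.sum_comm]
      refine sum_eq_zero fun j _ => ?_
      simp only [smul_mul_assoc, ← Finset.smul_sum, h j, smul_zero]
  by_cases hall : ∀ γ : κ → k, (∀ i, ∑ j, γ j * eval (S.pts p) (m j i) = 0) → γ = 0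
  · exact ⟨0, fun γ hγ => ⟨0, by simp [hall γ hγ]⟩⟩
  push Not at hall
  obtain ⟨v, hv, hv0⟩ := hall
  have hzero : ∀ γ : κ → k, (∀ i, ∑ j, γ j • m j i = 0) → γ = 0 := fun γ h => by
    refine funext (Fintype.linearIndependent_iff.1 hmi γ ?_)
    ext1 i
    rw [Finset.sum_apply]
    exact h i
  obtain ⟨w, α, β, hw, hw0, hαβ, h1, h2⟩ := key v hv
  have hwp : eval (S.pts p) w ≠ 0 := fun hwp => by
    have hw' : w = 0 := by
      refine S.eq_zero_of_eval_eq_zero (by omega) hw fun j => ?_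
      rcases eq_or_ne j p with rfl | hj
      exacts [hwp, hw0 j (hs j hj)]
    rw [hw', mul_zero] at h1
    rw [hw', mul_zero, neg_zero] at h2
    have h3 := Fintype.linearIndependent_iff.1 hfi α h1
    have h4 := Fintype.linearIndependent_iff.1 hfi β h2
    exact hv0 (hzero v fun i => by rw [hαβ, h3, h4]; simp)
  refine ⟨v, fun γ hγ => ?_⟩
  obtain ⟨w', α', β', hw', hw0', hαβ', h1', h2'⟩ := key γ hγ
  set r := eval (S.pts p) w' / eval (S.pts p) w
  have hr : r * eval (S.pts p) w = eval (S.pts p) w' := div_mul_cancel₀ _ hwp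
  have hz : w' - C r * w = 0 := by
    refine S.eq_zero_of_eval_eq_zero (d := d) (by omega) (hw'.sub ?_) fun j => ?_
    · simpa using (isHomogeneous_C (Fin 3) r).mul hw
    · rw [map_sub, map_mul, eval_C]
      rcases eq_or_ne j p with rfl | hj
      · rw [hr, sub_self]
      · rw [hw0 j (hs j hj), hw0' j (hs j hj), mul_zero, sub_zero]
  have hzw : w' = C r * w := sub_eq_zero.1 hz
  have h3 := Fintype.linearIndependent_iff.1 hfi (fun i => α' i - r * α i) (by
    simp only [sub_smul, mul_smul, Finset.sum_sub_distrib, ← Finset.smul_sum]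
    rw [h1, h1', hzw, smul_eq_C_mul]
    ring)
  have h4 := Fintype.linearIndependent_iff.1 hfi (fun i => β' i - r * β i) (by
    simp only [sub_smul, mul_smul, Finset.sum_sub_distrib, ← Finset.smul_sum]
    rw [h2, h2', hzw, smul_eq_C_mul]
    ring)
  refine ⟨r, sub_eq_zero.1 (hzero (γ - r • v) fun i => ?_)⟩
  simp only [Pi.sub_apply, Pi.smul_apply, smul_eq_mul, sub_smul, mul_smul, Finset.sum_sub_distrib,
    ← Finset.smul_sum]
  rw [hαβ, hαβ', sub_eq_zero.1 (h3 i), sub_eq_zero.1 (h4 i)]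
  simp only [smul_eq_C_mul, C_mul]
  ring

end PointSetup

section Syzygies

variable {k : Type*} [Field k] {σ ι : Type*} [Fintype ι]

/-- The linear map sending a tuple to its combination with a given family. -/
def syzMap (f : ι → MvPolynomial σ k) (U : Submodule k (MvPolynomial σ k)) :
    (ι → U) →ₗ[k] MvPolynomial σ k :=
  ∑ i, LinearMap.mulRight k (f i) ∘ₗ U.subtype ∘ₗ LinearMap.proj i

theorem syzMap_apply (f : ι → MvPolynomial σ k) (U : Submodule k (MvPolynomial σ k)) (m : ι → U) :
    syzMap f U m = ∑ i, (m i : MvPolynomial σ k) * f i := by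
  simp [syzMap]

/-- The syzygies of a family with entries in a given space. -/
def syz (f : ι → MvPolynomial σ k) (U : Submodule k (MvPolynomial σ k)) :
    Submodule k (ι → MvPolynomial σ k) :=
  (ker (syzMap f U)).map (U.subtype.compLeft ι)

theorem mem_syz {f : ι → MvPolynomial σ k} {U : Submodule k (MvPolynomial σ k)}
    {m : ι → MvPolynomial σ k} : m ∈ syz f U ↔ (∀ i, m i ∈ U) ∧ ∑ i, m i * f i = 0 := by
  constructor
  · rintro ⟨m, hm, rfl⟩
    exact ⟨fun i => (m i).2, (syzMap_apply f U m).symm.trans hm⟩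
  · rintro ⟨h1, h2⟩
    refine ⟨fun i => ⟨m i, h1 i⟩, ?_, rfl⟩
    rw [SetLike.mem_coe, LinearMap.mem_ker, syzMap_apply]
    exact h2

theorem finrank_syz (f : ι → MvPolynomial σ k) (U : Submodule k (MvPolynomial σ k))
    [FiniteDimensional k U] :
    finrank k (LinearMap.range (syzMap f U)) + finrank k (syz f U) =
      Fintype.card ι * finrank k U := by
  have h1 := LinearMap.finrank_range_add_finrank_ker (syzMap f U)
  rw [Module.finrank_pi_fintype, Finset.sum_const, Finset.card_univ, smul_eq_mul] at h1
  rw [← h1, syz]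
  congr 1
  refine ((Submodule.equivMapOfInjective _ ?_ _).finrank_eq).symm
  intro a b hab
  funext i
  exact Subtype.ext (congrFun hab i)

instance (f : ι → MvPolynomial σ k) (U : Submodule k (MvPolynomial σ k))
    [FiniteDimensional k U] : FiniteDimensional k (syz f U) :=
  inferInstanceAs (FiniteDimensional k ((ker (syzMap f U)).map (U.subtype.compLeft ι)))

end Syzygies

namespace PointSetup

variable {k : Type*} [Field k] {S : PointSetup k} {ι : Type*} [Fintype ι]
  {f : ι → R₃ k}

theorem range_syzMap_le (hf : ∀ i, f i ∈ S.piece S.s) (e : ℕ) :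
    LinearMap.range (syzMap f (ℋ₃ k e)) ≤ S.piece (e + S.s) := by
  rintro _ ⟨m, rfl⟩
  rw [syzMap_apply]
  exact Submodule.sum_mem _ fun i _ => S.mul_mem_piece (m i).2 (hf i)

theorem le_range_syzMap (hspan : span k (range f) = S.piece S.s) (e : ℕ) :
    S.piece (e + S.s) ≤ LinearMap.range (syzMap f (ℋ₃ k e)) := by
  intro x hx
  have hf : ∀ i, f i ∈ S.piece S.s := fun i => by
    rw [← hspan]
    exact subset_span ⟨i, rfl⟩
  have h1 : S.I ≤ Ideal.span (range f) := by
    intro y hy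
    refine S.span_V_induction (p := fun y => y ∈ Ideal.span (range f)) (fun a ha => ?_)
      (fun a b => add_mem) (fun r a => Ideal.mul_mem_left _ r) hy
    rw [← hspan] at ha
    have : span k (range f) ≤ (Ideal.span (range f)).restrictScalars k :=
      span_le.2 Ideal.subset_span
    exact this ha
  obtain ⟨c, hc⟩ := Ideal.mem_span_range_iff_exists_fun.1 (h1 hx.1)
  refine ⟨fun i => ⟨homogeneousComponent e (c i), homogeneousComponent_isHomogeneous e _⟩, ?_⟩
  have h2 := homogeneousComponent_of_mem (m := e + S.s) (n := e + S.s) hx.2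
  rw [if_pos rfl] at h2
  rw [syzMap_apply, ← h2, ← hc, map_sum]
  refine sum_congr rfl fun i _ => ?_
  rw [homogeneousComponent_mul_of_isHomogeneous (hf i).2]

theorem injective_of_syzygies {d : ℕ} (hd : d + 1 = S.s) [Infinite k]
    (hf : ∀ i, f i ∈ S.piece (d + 1)) (hfi : LinearIndependent k f) {κ : Type*} [Fintype κ]
    {m : κ → ι → R₃ k} (hm : ∀ j i, (m j i).IsHomogeneous 1)
    (hmi : LinearIndependent k m) (h : ∀ j, ∑ i, m j i * f i = 0)
    {c : κ → R₃ k} (hc : ∀ i, ∑ j, c j * m j i = 0) : c = 0 := by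
  by_contra h0
  obtain ⟨j0, hj0⟩ := Function.ne_iff.1 h0
  obtain ⟨a, ha, ha0⟩ := Submodule.exists_mem_ne_zero_of_ne_bot S.indeg.1
  obtain ⟨q, hq⟩ : ∃ q : Fin 3 → k, eval q (c j0 * a) ≠ 0 := by
    by_contra! h1
    exact mul_ne_zero hj0 ha0 (MvPolynomial.funext fun q => by rw [h1, map_zero])
  rw [map_mul] at hq
  have haq := right_ne_zero_of_mul hq
  have hq0 : q ≠ 0 := by
    rintro rfl
    apply haq
    rw [eval_zero, constantCoeff_eq]
    refine IsHomogeneous.coeff_eq_zero ha.2 ?_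
    have := S.hs
    simp only [map_zero]
    omega
  have h1 := eq_zero_of_syzygy hd hf hfi hq0 ha haq (m := fun i => ∑ j, eval q (c j) • m j i)
    (fun i => Submodule.sum_mem (ℋ₃ k 1) fun j _ =>
        Submodule.smul_mem _ _ (hm j i))
    (fun i => by
      have := congrArg (eval q) (hc i)
      simpa [map_sum] using this)
    (by
      simp only [Finset.sum_mul]
      rw [Finset.sum_comm]
      refine sum_eq_zero fun j _ => ?_
      simp only [smul_mul_assoc, ← Finset.smul_sum, h j, smul_zero])
  refine left_ne_zero_of_mul hq (Fintype.linearIndependent_iff.1 hmi (fun j => eval q (c j)) ?_ j0)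
  ext1 i
  rw [Finset.sum_apply]
  exact congrFun h1 i

theorem finrank_syz_le [Infinite k] (h0 : S.h = 0) (hι : Fintype.card ι = S.s + 1)
    (hspan : span k (range f) = S.piece S.s) (hfi : LinearIndependent k f) :
    finrank k (syz f (S.piece S.s)) ≤ S.n := by
  have hf : ∀ i, f i ∈ S.piece S.s := fun i => by
    rw [← hspan]
    exact subset_span ⟨i, rfl⟩
  obtain ⟨d, hd⟩ : ∃ d, d + 1 = S.s := ⟨S.s - 1, by have := S.hs; omega⟩
  have hf' : ∀ i, f i ∈ S.piece (d + 1) := hd ▸ hf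
  have hn := S.hn
  rw [h0, add_zero] at hn
  have c1 := two_mul_choose_two d
  have c2 := two_mul_choose_two (d + 1)
  have c3 := two_mul_choose_two (d + 1 + 1)
  have c4 := two_mul_choose_two (d + 1 + (d + 1))
  -- linear syzygies
  have e1 := finrank_syz f (ℋ₃ k 1)
  have e2 := finrank_mono (range_syzMap_le hf 1)
  rw [S.finrank_piece] at e2
  rw [hι, finrank_homogeneousSubmodule_three] at e1
  have e3 : S.s ≤ finrank k (syz f (ℋ₃ k 1)) := by
    rw [← hd] at e1 e2 hn ⊢
    rw [hn] at e2
    have c0 : (1 + 2).choose 2 = 3 := rfl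
    rw [c0] at e1
    ring_nf at e1 e2 c1 c2 c3 ⊢
    omega
  obtain ⟨m, hmi⟩ := exists_linearIndependent_of_le_finrank e3
  have hm := fun j => mem_syz.1 (m j).2
  have hmi' : LinearIndependent k fun j => (m j : ι → R₃ k) :=
    hmi.map' (Submodule.subtype _) (Submodule.ker_subtype _)
  -- syzygies of degree `s`
  let Ψ : (Fin S.s → ℋ₃ k d) →ₗ[k] (ι → R₃ k) :=
    LinearMap.pi fun i => syzMap (fun j => (m j).1 i) _
  have hΨ : ∀ c i, Ψ c i = ∑ j, (c j : R₃ k) * (m j).1 i := fun c i =>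
    syzMap_apply _ _ _
  have hΨi : Function.Injective Ψ := by
    rw [← LinearMap.ker_eq_bot, eq_bot_iff]
    intro c hc
    have := injective_of_syzygies hd hf' hfi (fun j i => (hm j).1 i) hmi' (fun j => (hm j).2)
      (c := fun j => (c j : R₃ k)) fun i => by
        rw [← hΨ]
        exact congrFun hc i
    exact funext fun j => Subtype.ext (congrFun this j)
  have hΨr : LinearMap.range Ψ = syz f (ℋ₃ k S.s) := by
    apply Submodule.eq_of_le_of_finrank_le
    · rintro _ ⟨c, rfl⟩
      refine mem_syz.2 ⟨fun i => ?_, ?_⟩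
      · have : ∀ e, d + 1 = e → Ψ c i ∈ ℋ₃ k e := by
          rintro _ rfl
          rw [hΨ]
          exact Submodule.sum_mem _ fun j _ => (c j).2.mul ((hm j).1 i)
        exact this _ hd
      · simp only [hΨ, Finset.sum_mul]
        rw [Finset.sum_comm]
        refine sum_eq_zero fun j _ => ?_
        simp only [mul_assoc, ← mul_sum, (hm j).2, mul_zero]
    · rw [LinearMap.finrank_range_of_inj hΨi, Module.finrank_pi_fintype, Finset.sum_const,
        Finset.card_univ, Fintype.card_fin, smul_eq_mul, finrank_homogeneousSubmodule_three]
      have e4 := finrank_syz f (ℋ₃ k S.s)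
      have e5 := finrank_mono (le_range_syzMap hspan S.s)
      rw [S.finrank_piece] at e5
      rw [hι, finrank_homogeneousSubmodule_three] at e4
      rw [← hd] at e4 e5 hn ⊢
      rw [hn] at e5
      rw [tsub_le_iff_right] at e5
      rw [show d + 1 + 1 = d + 2 from rfl] at e4 e5
      have c1' := congrArg (fun z => (d + 2) * z) c1
      have c2' := congrArg (fun z => (d + 2) * z) c2
      nlinarith [c1', c2', c4, e4, e5, c1]
  -- evaluation at the points
  choose v hv using fun p => exists_generator hd hf' hfi p (fun j i => (hm j).1 i) hmi'
    (fun j => (hm j).2)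
  let E : (Fin S.s → ℋ₃ k d) →ₗ[k] (Fin S.n → Fin S.s → k) :=
    LinearMap.pi fun p => LinearMap.pi fun j =>
      (aeval (S.pts p) : R₃ k →ₐ[k] k).toLinearMap ∘ₗ
        (ℋ₃ k d).subtype ∘ₗ LinearMap.proj j
  have hE : ∀ c p j, E c p j = eval (S.pts p) (c j : R₃ k) := fun c p j => by
    simp [E, aeval_eq_eval]
  have hEi : Function.Injective E := by
    rw [← LinearMap.ker_eq_bot, eq_bot_iff]
    intro c hc
    refine funext fun j => Subtype.ext (S.eq_zero_of_eval_eq_zero (by omega) (c j).2 fun p => ?_)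
    rw [← hE]
    exact congrFun (congrFun hc p) j
  let G : (Fin S.n → k) →ₗ[k] (Fin S.n → Fin S.s → k) :=
    LinearMap.pi fun p => (LinearMap.toSpanSingleton k _ (v p)) ∘ₗ LinearMap.proj p
  have hG : ∀ a p, G a p = a p • v p := fun a p => rfl
  set K := (syz f (S.piece S.s)).comap Ψ with hK
  have h1 : K.map Ψ = syz f (S.piece S.s) := by
    rw [hK, Submodule.map_comap_eq, hΨr, inf_eq_right]
    intro x hx
    exact mem_syz.2 ⟨fun i => ((mem_syz.1 hx).1 i).2, (mem_syz.1 hx).2⟩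
  have h2 : K.map E ≤ LinearMap.range G := by
    rintro _ ⟨c, hc, rfl⟩
    have : ∀ p, ∃ a : k, E c p = a • v p := fun p => hv p _ fun i => by
      have := S.eval_eq_zero ((mem_syz.1 hc).1 i).1 p
      rw [hΨ, map_sum] at this
      simpa [hE] using this
    choose a ha using this
    exact ⟨a, funext fun p => by rw [hG, ha]⟩
  rw [← h1, ← (Submodule.equivMapOfInjective Ψ hΨi K).finrank_eq,
    (Submodule.equivMapOfInjective E hEi K).finrank_eq]
  refine (finrank_mono h2).trans ((LinearMap.finrank_range_le G).trans ?_)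
  simp

end PointSetup

section Independence

/-- A family of `N` elements of a module over a domain is independent if its span contains
at least `N` independent elements. -/
theorem linearIndependent_of_mem_span {P M E J : Type*} [CommRing P] [IsDomain P]
    [AddCommGroup M] [Module P M] [Fintype E] [Fintype J] (hcard : Fintype.card E ≤ Fintype.card J)
    {w : E → M} {g : J → M} (hg : LinearIndependent P g)
    (hmem : ∀ j, g j ∈ span P (range w)) : LinearIndependent P w := by
  classical
  rw [Fintype.linearIndependent_iff]
  intro p hp
  choose N hN using fun j => (mem_span_range_iff_exists_fun P).1 (hmem j)
  have hnot : ¬ LinearIndependent P (fun o : Option J => o.elim p N) := fun h => by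
    have := h.fintype_card_le_finrank
    rw [Fintype.card_option, Module.finrank_fintype_fun_eq_card] at this
    omega
  obtain ⟨c, hc, o, ho⟩ := Fintype.not_linearIndependent_iff.1 hnot
  rw [Fintype.sum_option] at hc
  simp only [Option.elim_none, Option.elim_some] at hc
  have h1 : ∑ j, c (some j) • g j = 0 := by
    let Φ := Fintype.linearCombination P w
    have h2 : Φ (c none • p + ∑ j, c (some j) • N j) = 0 := by rw [hc, map_zero]
    rw [map_add, map_sum, map_smul] at h2
    simp only [map_smul] at h2
    simp only [Φ, Fintype.linearCombination_apply, hN, hp, smul_zero, zero_add] at h2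
    exact h2
  have h2 := Fintype.linearIndependent_iff.1 hg _ h1
  have h3 : c none ≠ 0 := by
    rcases o with _ | j
    · exact ho
    · exact absurd (h2 j) ho
  simp only [h2, zero_smul, Finset.sum_const_zero, add_zero] at hc
  intro i
  exact (mul_eq_zero.1 (congrFun hc i)).resolve_left h3

/-- Independence over the image of a ring homomorphism. -/
theorem eq_zero_of_sum_map_mul_eq_zero {P R E J : Type*} [CommRing P] [IsDomain P] [CommRing R]
    [Fintype E] [Fintype J] (φ : P →+* R) (hcard : Fintype.card E ≤ Fintype.card J)
    {w : E → R} {g : J → R} (hg : ∀ p : J → P, ∑ j, φ (p j) * g j = 0 → p = 0)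
    (hmem : ∀ j, ∃ N : E → P, ∑ e, φ (N e) * w e = g j) (p : E → P)
    (hp : ∑ e, φ (p e) * w e = 0) : p = 0 := by
  let _ : Module P R := Module.compHom R φ
  have hind : LinearIndependent P w :=
    linearIndependent_of_mem_span (g := g) hcard
      (Fintype.linearIndependent_iff.2 fun p hp => congrFun (hg p hp)) fun j => by
        obtain ⟨N, hN⟩ := hmem j
        rw [← hN]
        exact Submodule.sum_mem _ fun e _ => Submodule.smul_mem _ (N e)
          (subset_span ⟨e, rfl⟩)
  exact funext (Fintype.linearIndependent_iff.1 hind p hp)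

/-- The exponents of total degree at most two. -/
def exponentsLeTwo (m : ℕ) : Finset (Fin m →₀ ℕ) :=
  (Finset.range 3).biUnion fun d => Finset.finsuppAntidiag Finset.univ d

theorem mem_exponentsLeTwo {m : ℕ} {e : Fin m →₀ ℕ} : e ∈ exponentsLeTwo m ↔ e.degree ≤ 2 := by
  simp only [exponentsLeTwo, Finset.mem_biUnion, Finset.mem_range, Finset.mem_finsuppAntidiag,
    Finset.subset_univ, and_true, Finsupp.degree_eq_sum, exists_eq_right']
  change ∑ i, e i < 3 ↔ _
  omega

theorem card_exponentsLeTwo_le (m : ℕ) : (exponentsLeTwo m).card ≤ (m + 2).choose 2 := by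
  refine Finset.card_biUnion_le.trans ?_
  simp only [Finset.card_finsuppAntidiag_nat_eq_multichoose, Finset.card_univ, Fintype.card_fin]
  simp only [Finset.sum_range_succ, Finset.sum_range_zero, Nat.multichoose_zero_right,
    Nat.multichoose_one_right, Nat.multichoose_eq m 2]
  rw [zero_add, Nat.choose_succ_succ' (m + 1) 1, Nat.choose_one_right,
    show m + 2 - 1 = m + 1 by omega, show 1 + 1 = 2 from rfl]
  omega

end Independence

namespace PointSetup

variable {k : Type*} [Field k] {S : PointSetup k}

namespace GoodTriple

variable {L : LineChart k} {q : ℕ} (t : S.GoodTriple L q)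

theorem F_two_eq_double [Infinite k] (t : S.GoodTriple L q) (h0 : S.h = 0) :
    S.F 2 = S.double (S.s + S.s) := by
  have hle := S.F_two_le_double
  rw [two_mul] at hle
  refine Submodule.eq_of_le_of_finrank_le hle ?_
  have h1 : finrank k (S.piece S.s) = S.s + 1 := by
    rw [S.finrank_piece_s, h0, Nat.sub_zero]
  let b := Module.finBasisOfFinrankEq k (S.piece S.s) h1
  let f : Fin (S.s + 1) → R₃ k := fun i => b i
  have hfi : LinearIndependent k f := b.linearIndependent.map' (S.piece S.s).subtype (by simp)
  have hspan : span k (range f) = S.piece S.s := by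
    have := congrArg (Submodule.map (S.piece S.s).subtype) b.span_eq
    rw [Submodule.map_span, ← Set.range_comp, Submodule.map_top, Submodule.range_subtype] at this
    exact this
  have h2 := finrank_syz_le h0 (Fintype.card_fin _) hspan hfi
  have h3 := finrank_syz f (S.piece S.s)
  rw [h1, Fintype.card_fin] at h3
  have h4 : LinearMap.range (syzMap f (S.piece S.s)) ≤ S.F 2 := by
    rintro _ ⟨m, rfl⟩
    rw [syzMap_apply, F, pow_two]
    exact Submodule.sum_mem _ fun i _ => Submodule.mul_mem_mul (m i).2 (b i).2
  have : FiniteDimensional k (S.F 2) := Submodule.finiteDimensional_of_le hle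
  have h5 := finrank_mono h4
  have h6 := t.finrank_double_two_le h0
  have h7 := S.hn
  have h8 : 2 * (S.s + 1).choose 2 = (S.s + 1) * S.s := by
    obtain ⟨m, hm⟩ : ∃ m, S.s = m + 1 := ⟨S.s - 1, by have := S.hs; omega⟩
    rw [hm]
    exact two_mul_choose_two m
  have h9 := two_mul_choose_two S.s
  nlinarith

theorem F_three_le [Infinite k] (h0 : S.h = 0) : S.F 3 ≤ t.spanA * S.F 2 := by
  rw [t.F_two_eq_double h0]
  exact fun g hg => t.triple_three_le h0 (S.F_three_le_triple hg)

theorem exists_complement_spanA (t : S.GoodTriple L q) (h0 : S.h = 0) {m : ℕ} (hm : m + 2 = S.s) :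
    ∃ u : Fin m → R₃ k, 
      S.piece S.s = t.spanA ⊔ span k (range u) ∧
      ∀ c : Fin m → k, ∑ j, c j • u j ∈ t.spanA → c = 0 := by
  obtain ⟨u, hu, hind⟩ := exists_linearIndependent_mod (e := m) t.spanA_le (by
    rw [t.finrank_spanA, S.finrank_piece_s, h0]; omega)
  refine ⟨u, ?_, hind⟩
  symm
  refine Submodule.eq_of_le_of_finrank_le (sup_le t.spanA_le ?_) ?_
  · rw [span_le]
    rintro _ ⟨j, rfl⟩
    exact hu j
  · have h1 : t.spanA ⊓ span k (range u) = ⊥ := by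
      rw [eq_bot_iff]
      rintro x ⟨hx, hx'⟩
      obtain ⟨c, rfl⟩ := (mem_span_range_iff_exists_fun k).1 hx'
      rw [hind c hx]
      simp
    have : FiniteDimensional k (span k (range u)) :=
      FiniteDimensional.span_of_finite k (Set.finite_range u)
    have h2 := Submodule.finrank_sup_add_finrank_inf_eq t.spanA (span k (range u))
    have h3 : LinearIndependent k u := by
      rw [Fintype.linearIndependent_iff]
      intro c hc i
      exact congrFun (hind c (by rw [hc]; exact zero_mem _)) i
    rw [h1, finrank_bot, finrank_span_eq_card h3, t.finrank_spanA, Fintype.card_fin] at h2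
    rw [S.finrank_piece_s, h0]
    omega

/-- Evaluation of polynomials in the complementary variables with coefficients in the
polynomial ring of the good triple. -/
def fiberEval {m : ℕ} (u : Fin m → R₃ k) :
    R[m] (R₃ k) →ₐ[k] R₃ k :=
  aevalTower (aeval ![t.a1, t.a2, t.a3]) u

theorem fiberEval_C {m : ℕ} (u : Fin m → R₃ k) (p : R₃ k) :
    t.fiberEval u (C p) = aeval ![t.a1, t.a2, t.a3] p := aevalTower_C _ _ _

theorem fiberEval_X {m : ℕ} (u : Fin m → R₃ k) (i : Fin m) :
    t.fiberEval u (X i) = u i := aevalTower_X _ _ _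

theorem fiberEval_monomial {m : ℕ} (u : Fin m → R₃ k) (e : Fin m →₀ ℕ)
    (p : R₃ k) :
    t.fiberEval u (monomial e p) = aeval ![t.a1, t.a2, t.a3] p * t.fiberEval u (monomial e 1) := by
  rw [← t.fiberEval_C u, ← map_mul, C_mul_monomial, mul_one]

theorem exists_fiberEval_of_mem_piece {m : ℕ} {u : Fin m → R₃ k}
    (hu : S.piece S.s = t.spanA ⊔ span k (range u)) {x : R₃ k}
    (hx : x ∈ S.piece S.s) : ∃ P, P.totalDegree ≤ 1 ∧ t.fiberEval u P = x := by
  rw [hu] at hx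
  obtain ⟨y, hy, z, hz, rfl⟩ := mem_sup.1 hx
  obtain ⟨c, rfl⟩ := (mem_span_range_iff_exists_fun k).1 hy
  obtain ⟨d, rfl⟩ := (mem_span_range_iff_exists_fun k).1 hz
  refine ⟨C (∑ i, c i • X i) + ∑ i, C (C (d i)) * X i, ?_, ?_⟩
  · refine (totalDegree_add _ _).trans (max_le (by rw [totalDegree_C]; omega) ?_)
    refine totalDegree_finsetSum_le fun i _ => (totalDegree_mul _ _).trans ?_
    rw [totalDegree_C, totalDegree_X]
  · rw [map_add, fiberEval_C, map_sum, map_sum]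
    simp only [aeval_X, map_mul, fiberEval_C, fiberEval_X, aeval_C,
      MvPolynomial.algebraMap_eq, smul_eq_C_mul]

theorem exists_fiberEval_of_mem_F_two {m : ℕ} {u : Fin m → R₃ k}
    (hu : S.piece S.s = t.spanA ⊔ span k (range u)) {g : R₃ k}
    (hg : g ∈ S.F 2) : ∃ P, P.totalDegree ≤ 2 ∧ t.fiberEval u P = g := by
  have h1 := @exists_fiberEval_of_mem_piece k _ S L q t m u hu
  rw [F, pow_two] at hg
  induction hg using Submodule.mul_induction_on' with
  | mem_mul_mem x hx y hy =>
    obtain ⟨P, hP, rfl⟩ := h1 hx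
    obtain ⟨Q, hQ, rfl⟩ := h1 hy
    exact ⟨P * Q, (totalDegree_mul _ _).trans (by omega), map_mul _ _ _⟩
  | add x _ y _ hx hy =>
    obtain ⟨P, hP, rfl⟩ := hx
    obtain ⟨Q, hQ, rfl⟩ := hy
    exact ⟨P + Q, (totalDegree_add _ _).trans (max_le hP hQ), map_add _ _ _⟩

theorem exists_double_family (t : S.GoodTriple L q) (h0 : S.h = 0) {d : ℕ} (hd : d + 1 = S.s) :
    ∃ g : Fin (S.s.choose 2) → R₃ k, (∀ j, g j ∈ S.double (S.s + d)) ∧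
      span k (range g) = S.double (S.s + d) ∧
      ∀ p : Fin (S.s.choose 2) → R₃ k,
        ∑ j, aeval ![t.a1, t.a2, t.a3] (p j) * g j = 0 → p = 0 := by
  let b := Module.finBasisOfFinrankEq k (S.double (S.s + d)) (t.finrank_double_pred h0 hd)
  refine ⟨fun j => b j, fun j => (b j).2, ?_, ?_⟩
  · have := congrArg (Submodule.map (S.double (S.s + d)).subtype) b.span_eq
    rw [Submodule.map_span, ← Set.range_comp, Submodule.map_top, Submodule.range_subtype] at this
    exact this
  · refine t.eq_zero_of_sum_aeval_mul_eq_zero (fun j => S.double_le _ (b j).2) fun c hc => ?_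
    have h1 : ∑ j, c j • (b j : R₃ k) ∈
        S.double (S.s + d) ⊓ t.pairPiece (S.s + d) := by
      have h2 : ∑ j, c j • (b j : R₃ k) ∈ S.double (S.s + d) :=
        Submodule.sum_mem _ fun j _ => Submodule.smul_mem _ _ (b j).2
      exact ⟨h2, hc, (S.double_le _ h2).2⟩
    rw [t.double_inf_pairPiece_eq_bot (by omega), Submodule.mem_bot] at h1
    have h2 : ∑ j, c j • b j = 0 := Subtype.ext (by simpa using h1)
    exact funext fun j => Fintype.linearIndependent_iff.1 b.linearIndependent c h2 j

/-- The special fibre is free over the polynomial ring of a good triple: independence. -/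
theorem fiberEval_eq_sum {m : ℕ} (u : Fin m → R₃ k)
    {P : R[m] (R₃ k)} (hP : P.totalDegree ≤ 2) :
    t.fiberEval u P = ∑ e : exponentsLeTwo m,
      aeval ![t.a1, t.a2, t.a3] (coeff (e : Fin m →₀ ℕ) P) *
        t.fiberEval u (monomial (e : Fin m →₀ ℕ) 1) := by
  have h1 : P = ∑ e ∈ exponentsLeTwo m, monomial e (coeff e P) := by
    conv_lhs => rw [P.as_sum]
    refine Finset.sum_subset (fun e he => mem_exponentsLeTwo.2 ?_) fun e _ he => ?_
    · refine le_trans ?_ hP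
      rw [Finsupp.degree_eq_sum]
      have := le_totalDegree he
      rwa [Finsupp.sum_fintype _ _ (fun _ => rfl)] at this
    · rw [notMem_support_iff.1 he, monomial_zero]
  conv_lhs => rw [h1]
  rw [map_sum, ← Finset.sum_coe_sort]
  exact sum_congr rfl fun e _ => t.fiberEval_monomial u _ _

theorem eq_zero_of_fiberEval_eq_zero [Infinite k] (h0 : S.h = 0) {m : ℕ} (hm : m + 2 = S.s)
    {u : Fin m → R₃ k}
    (hu : S.piece S.s = t.spanA ⊔ span k (range u))
    {P : R[m] (R₃ k)} (hP : P.totalDegree ≤ 2)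
    (h : t.fiberEval u P = 0) : P = 0 := by
  classical
  obtain ⟨d, hd⟩ : ∃ d, d + 1 = S.s := ⟨m + 1, by omega⟩
  obtain ⟨g, hg, -, hgi⟩ := t.exists_double_family h0 hd
  let w : exponentsLeTwo m → R₃ k :=
    fun e => t.fiberEval u (monomial (e : Fin m →₀ ℕ) 1)
  have hexp := fun P (hP : totalDegree P ≤ 2) => t.fiberEval_eq_sum u hP
  rw [hexp P hP] at h
  have h1 := eq_zero_of_sum_map_mul_eq_zero (g := fun j => L.eqn * g j)
    (aeval ![t.a1, t.a2, t.a3] : R₃ k →ₐ[k] R₃ k).toRingHom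
    (by
      rw [Fintype.card_coe, Fintype.card_fin, ← hm]
      exact card_exponentsLeTwo_le m)
    (fun p hp => hgi p (by
      apply mul_left_cancel₀ L.eqn_ne
      rw [mul_zero, ← hp, mul_sum]
      exact sum_congr rfl fun j _ => mul_left_comm _ _ _))
    (fun j => by
      have h1 : L.eqn * g j ∈ S.F 2 := by
        rw [t.F_two_eq_double h0, S.mem_double]
        have h2 := S.mem_double.1 (hg j)
        refine ⟨?_, fun i => ?_⟩
        · have := S.mul_mem_piece L.eqn_hom h2.1
          rwa [show 1 + (S.s + d) = S.s + S.s by omega] at this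
        · funext l
          rw [PointChart.du_mul, h2.2 i, S.eval_eq_zero h2.1.1]
          simp
      obtain ⟨P, hP, hPg⟩ := t.exists_fiberEval_of_mem_F_two hu h1
      exact ⟨fun e : exponentsLeTwo m => coeff (e : Fin m →₀ ℕ) P, (hexp P hP).symm.trans hPg⟩)
    (fun e : exponentsLeTwo m => coeff (e : Fin m →₀ ℕ) P) h
  ext1 e
  by_cases he : e.degree ≤ 2
  · exact congrFun h1 ⟨e, mem_exponentsLeTwo.2 he⟩
  · rw [coeff_zero]
    by_contra hne
    have := le_totalDegree (mem_support_iff.2 hne)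
    rw [Finsupp.sum_fintype _ _ (fun _ => rfl), ← Finsupp.degree_eq_sum] at this
    omega

end GoodTriple

end PointSetup

section Descent

variable {k : Type*} [Field k] {n : ℕ}

theorem exists_eq_rename_succ_add (p : R[n + 1] k) :
    ∃ r q, p = rename Fin.succ r + X 0 * q := by
  induction p using MvPolynomial.induction_on with
  | C a => exact ⟨C a, 0, by simp⟩
  | add p p' hp hp' =>
    obtain ⟨r, q, rfl⟩ := hp
    obtain ⟨r', q', rfl⟩ := hp'
    exact ⟨r + r', q + q', by rw [map_add]; ring⟩
  | mul_X p i hp =>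
    obtain ⟨r, q, rfl⟩ := hp
    refine Fin.cases ⟨0, rename Fin.succ r + X 0 * q, by rw [map_zero]; ring⟩ (fun j => ?_) i
    exact ⟨r * X j, q * X j.succ, by rw [map_mul, rename_X]; ring⟩

theorem aeval_rename_succ_add {B : Type*} [CommRing B] [Algebra k B] (θ : Fin (n + 1) → B)
    (r : R[n] k) (q : R[n + 1] k) :
    aeval θ (rename Fin.succ r + X 0 * q) = aeval (fun i => θ i.succ) r + θ 0 * aeval θ q := by
  rw [map_add, aeval_rename, map_mul, aeval_X]
  rfl

theorem eq_zero_of_forall_X_dvd {B ι : Type*} [CommRing B] [IsDomain B] [Algebra k B] [Fintype ι]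
    {θ : Fin (n + 1) → B} (h0 : θ 0 ≠ 0) {e : ι → B}
    (hrel : ∀ p : ι → R[n + 1] k, ∑ i, aeval θ (p i) * e i = 0 →
      ∀ i, X 0 ∣ p i) (p : ι → R[n + 1] k)
    (hp : ∑ i, aeval θ (p i) * e i = 0) : p = 0 := by
  have h : ∀ N : ℕ, ∀ p : ι → R[n + 1] k, ∑ i, aeval θ (p i) * e i = 0 →
      ∀ i, X 0 ^ N ∣ p i := by
    intro N
    induction N with
    | zero => intro p _ i; rw [pow_zero]; exact one_dvd _
    | succ N ih =>
      intro p hp i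
      choose q hq using hrel p hp
      have h1 := ih q (by
        apply mul_left_cancel₀ h0
        rw [mul_zero, ← hp, mul_sum]
        refine sum_congr rfl fun i _ => ?_
        rw [hq i, map_mul, aeval_X, mul_assoc]) i
      rw [hq i, pow_succ']
      exact mul_dvd_mul_left _ h1
  funext i
  by_contra hne
  obtain ⟨q, hq⟩ := h ((p i).totalDegree + 1) p hp i
  have hq0 : q ≠ 0 := by rintro rfl; exact hne (by rw [hq, mul_zero]; rfl)
  have h1 := congrArg totalDegree hq
  rw [totalDegree_mul_of_isDomain (pow_ne_zero _ (X_ne_zero _)) hq0, totalDegree_X_pow] at h1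
  omega

end Descent

section Binary

/-- A binary form in `y + a T` and `x + b T` vanishes only trivially, if `a` and the
determinant are regular. -/
theorem eq_zero_of_sum_mul_pow_mul_pow {B : Type*} [CommRing B] {y x a b : B}
    (ha : ∀ c, a * c = 0 → c = 0) (hδ : ∀ c, (b * y - a * x) * c = 0 → c = 0) (e : ℕ) (c : ℕ → B)
    (h : ∑ α ∈ Finset.range (e + 1), C₁ (c α) *
      ((C₁ y + C₁ a * X₁) ^ α *
        (C₁ x + C₁ b * X₁) ^ (e - α)) = 0) :
    ∀ α ≤ e, c α = 0 := by
  set u : Polynomial B := C₁ y + C₁ a * X₁ with hu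
  set v : Polynomial B := C₁ x + C₁ b * X₁ with hv
  have hconst : ∀ (g : Polynomial B) (d : B), u * g = C₁ d → g = 0 := by
    intro g d hg
    by_contra hne
    have h1 := congrArg (fun f => Polynomial.coeff f (g.natDegree + 1)) hg
    simp only [hu, add_mul, Polynomial.coeff_add, Polynomial.coeff_C_mul, mul_assoc,
      Polynomial.coeff_X_mul, Polynomial.coeff_C_succ] at h1
    rw [Polynomial.coeff_eq_zero_of_natDegree_lt (Nat.lt_succ_self _), mul_zero, zero_add] at h1
    exact hne (Polynomial.leadingCoeff_eq_zero.1 (ha _ h1))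
  have hpow : ∀ (m : ℕ) (c : B), (b * y - a * x) ^ m * c = 0 → c = 0 := by
    intro m
    induction m with
    | zero => intro c hc; rwa [pow_zero, one_mul] at hc
    | succ m ih => intro c hc; exact ih c (hδ _ (by rw [← hc]; ring))
  induction e generalizing c with
  | zero =>
    intro α hα
    rw [Nat.le_zero.1 hα]
    simpa using h
  | succ e ih =>
    rw [Finset.sum_range_succ'] at h
    simp only [pow_zero, one_mul, Nat.sub_zero] at h
    set G := ∑ α ∈ Finset.range (e + 1), C₁ (c (α + 1)) * (u ^ α * v ^ (e - α)) with hG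
    have h1 : u * G + C₁ (c 0) * v ^ (e + 1) = 0 := by
      rw [← h, hG, mul_sum]
      congr 1
      refine sum_congr rfl fun α _ => ?_
      rw [show e + 1 - (α + 1) = e - α by omega]
      ring
    have h2 : C₁ a * v = C₁ b * u - C₁ (b * y - a * x) := by
      rw [hu, hv]
      simp only [map_sub, map_mul]
      ring
    obtain ⟨w, hw⟩ : u ∣ (C₁ a * v) ^ (e + 1) -
        (-C₁ (b * y - a * x)) ^ (e + 1) := by
      refine dvd_trans ⟨C₁ b, ?_⟩ (sub_dvd_pow_sub_pow _ _ _)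
      rw [h2]
      ring
    have h3 : u * (-(C₁ a ^ (e + 1) * G) - C₁ (c 0) * w) =
        C₁ (c 0 * (-(b * y - a * x)) ^ (e + 1)) := by
      rw [map_mul, map_pow, map_neg]
      rw [mul_pow] at hw
      linear_combination (-C₁ a ^ (e + 1)) * h1 + C₁ (c 0) * hw
    have h4 := hconst _ _ h3
    rw [h4, mul_zero, eq_comm, Polynomial.C_eq_zero, neg_pow] at h3
    have h5 : c 0 = 0 := by
      apply hpow (e + 1)
      have h6 : (-1 : B) ^ (e + 1) * (-1) ^ (e + 1) = 1 := by rw [← mul_pow]; simp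
      linear_combination (-1 : B) ^ (e + 1) * h3 - (b * y - a * x) ^ (e + 1) * c 0 * h6
    rw [h5, map_zero, zero_mul, add_zero] at h1
    have h6 := ih (fun α => c (α + 1)) (hconst G 0 (by rw [h1, map_zero]))
    intro α hα
    rcases α with _ | α
    · exact h5
    · exact h6 α (by omega)

theorem dvd_of_dvd_sum_mul_pow_mul_pow {P : Type*} [CommRing P] [DecompositionMonoid P] [IsDomain P]
    {y x a b z : P}
    (ha : IsRelPrime z a) (hδ : IsRelPrime z (b * y - a * x)) (e : ℕ) (c : ℕ → P)
    (h : C₁ z ∣ ∑ α ∈ Finset.range (e + 1), C₁ (c α) *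
      ((C₁ y + C₁ a * X₁) ^ α *
        (C₁ x + C₁ b * X₁) ^ (e - α))) :
    ∀ α ≤ e, z ∣ c α := by
  let π := Ideal.Quotient.mk (Ideal.span {z})
  have hπ : ∀ c, π c = 0 ↔ z ∣ c := fun c =>
    Ideal.Quotient.eq_zero_iff_mem.trans Ideal.mem_span_singleton
  have h1 := eq_zero_of_sum_mul_pow_mul_pow (y := π y) (x := π x) (a := π a) (b := π b)
    (fun c hc => by
      obtain ⟨c, rfl⟩ := Ideal.Quotient.mk_surjective c
      rw [← map_mul, hπ] at hc
      exact (hπ c).2 (ha.dvd_of_dvd_mul_left hc))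
    (fun c hc => by
      obtain ⟨c, rfl⟩ := Ideal.Quotient.mk_surjective c
      rw [← map_mul, ← map_mul, ← map_sub, ← map_mul, hπ] at hc
      exact (hπ c).2 (hδ.dvd_of_dvd_mul_left hc)) e (fun α => π (c α)) (by
    obtain ⟨g, hg⟩ := h
    have := congrArg (Polynomial.mapRingHom π) hg
    rw [map_mul, map_sum, Polynomial.coe_mapRingHom, Polynomial.map_C, (hπ z).2 dvd_rfl, map_zero, zero_mul] at this
    rw [← this]
    refine sum_congr rfl fun α _ => ?_
    simp)
  exact fun α hα => (hπ _).1 (h1 α hα)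

theorem MvPolynomial.IsHomogeneous.eq_sum_range {k : Type*} [CommSemiring k] {f : R₂ k} {e : ℕ}
    (hf : f.IsHomogeneous e) :
    f = ∑ α ∈ Finset.range (e + 1),
      C (coeff (Finsupp.single 0 α + Finsupp.single 1 (e - α)) f) * (X 0 ^ α * X 1 ^ (e - α)) := by
  have hmon : ∀ α (c : k), C c * (X 0 ^ α * X 1 ^ (e - α) : R₂ k) =
      monomial (Finsupp.single 0 α + Finsupp.single 1 (e - α)) c := by
    intro α c
    rw [X_pow_eq_monomial, X_pow_eq_monomial, monomial_mul, C_mul_monomial, mul_one, mul_one]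
  simp only [hmon]
  ext d
  rw [coeff_sum]
  simp only [coeff_monomial]
  have hiff : ∀ α, Finsupp.single 0 α + Finsupp.single 1 (e - α) = d ↔ d 0 = α ∧ d 1 = e - α := by
    intro α
    rw [Finsupp.ext_iff, Fin.forall_fin_two]
    simp
    constructor <;> rintro ⟨h1, h2⟩ <;> exact ⟨h1.symm, h2.symm⟩
  by_cases hd : d.degree = e
  · rw [Finsupp.degree_eq_sum, Fin.sum_univ_two] at hd
    rw [Finset.sum_eq_single (d 0), if_pos ((hiff _).2 ⟨rfl, by omega⟩),
      (hiff _).2 ⟨rfl, by omega⟩]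
    · intro α _ hα
      exact if_neg fun h => hα ((hiff α).1 h).1.symm
    · intro h
      exact absurd (Finset.mem_range.2 (by omega)) h
  · rw [hf.coeff_eq_zero hd, sum_eq_zero]
    intro α hα
    refine if_neg fun h => hd ?_
    have := (hiff α).1 h
    rw [Finsupp.degree_eq_sum, Fin.sum_univ_two]
    have := Finset.mem_range.1 hα
    omega

end Binary

section Slant

variable {k : Type*} [Field k] {σ : Type*}

/-- The polynomials over a polynomial ring which are homogeneous of degree `n` when the new
variable is given degree `-r`. -/
def slantPiece (k σ : Type*) [Field k] (r n : ℕ) :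
    Submodule k (Polynomial (MvPolynomial σ k)) where
  carrier := {F | ∀ b, (F.coeff b).IsHomogeneous (n + r * b)}
  add_mem' hF hG b := by
    rw [Polynomial.coeff_add]
    exact (hF b).add (hG b)
  zero_mem' b := by
    rw [Polynomial.coeff_zero]
    exact isHomogeneous_zero _ _ _
  smul_mem' c F hF b := by
    rw [Polynomial.coeff_smul]
    exact (homogeneousSubmodule σ k _).smul_mem c (hF b)

theorem one_mem_slantPiece (r : ℕ) : (1 : Polynomial (MvPolynomial σ k)) ∈ slantPiece k σ r 0 := by
  intro b
  rw [Polynomial.coeff_one]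
  split_ifs with h
  · rw [h, mul_zero]
    exact isHomogeneous_one _ _
  · exact isHomogeneous_zero _ _ _

theorem mul_mem_slantPiece {r m n : ℕ} {F G : Polynomial (MvPolynomial σ k)}
    (hF : F ∈ slantPiece k σ r m) (hG : G ∈ slantPiece k σ r n) :
    F * G ∈ slantPiece k σ r (m + n) := by
  intro b
  rw [Polynomial.coeff_mul]
  refine IsHomogeneous.sum _ _ _ fun x hx => ?_
  have := (hF x.1).mul (hG x.2)
  have h := Finset.HasAntidiagonal.mem_antidiagonal.1 hx
  convert this using 1
  rw [← h]
  ring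

theorem C_mem_slantPiece {r n : ℕ} {p : MvPolynomial σ k} (hp : p.IsHomogeneous n) :
    C₁ p ∈ slantPiece k σ r n := by
  intro b
  rw [Polynomial.coeff_C]
  split_ifs with h
  · rw [h, mul_zero]
    exact hp
  · exact isHomogeneous_zero _ _ _

theorem C_mul_X_mem_slantPiece {r n : ℕ} {p : MvPolynomial σ k} (hp : p.IsHomogeneous (n + r)) :
    C₁ p * X₁ ∈ slantPiece k σ r n := by
  intro b
  rw [Polynomial.coeff_C_mul_X]
  split_ifs with h
  · rw [h, mul_one]
    exact hp
  · exact isHomogeneous_zero _ _ _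

theorem aeval_mem_of_graded {B : Type*} [CommRing B] [Algebra k B] {W : ℕ → Submodule k B}
    (h1 : 1 ∈ W 0) (hW : ∀ {m n x y}, x ∈ W m → y ∈ W n → x * y ∈ W (m + n)) {m e : ℕ}
    {θ : Fin m → B} (hθ : ∀ i, θ i ∈ W 1) {p : R[m] k} (hp : p.IsHomogeneous e) :
    aeval θ p ∈ W e := by
  have hpow : ∀ i n, θ i ^ n ∈ W n := by
    intro i n
    induction n with
    | zero => rwa [pow_zero]
    | succ n ih => rw [pow_succ]; exact hW ih (hθ i)
  rw [p.as_sum, map_sum]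
  refine Submodule.sum_mem _ fun d hd => ?_
  have h2 : d.degree = e := by
    by_contra hne
    exact mem_support_iff.1 hd (hp.coeff_eq_zero hne)
  rw [aeval_monomial, ← Algebra.smul_def, Finsupp.prod_fintype _ _ (fun _ => pow_zero _)]
  refine Submodule.smul_mem _ _ ?_
  rw [← h2, Finsupp.degree_eq_sum]
  have : ∀ s : Finset (Fin m), ∏ i ∈ s, θ i ^ d i ∈ W (∑ i ∈ s, d i) := by
    intro s
    classical
    induction s using Finset.induction_on with
    | empty => simpa using h1
    | insert i s hi ih =>
      rw [Finset.prod_insert hi, Finset.sum_insert hi]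
      exact hW (hpow i (d i)) ih
  exact this Finset.univ

theorem aeval_mem_slantPiece {m r e : ℕ} {θ : Fin m → Polynomial (MvPolynomial σ k)}
    (hθ : ∀ i, θ i ∈ slantPiece k σ r 1) {p : R[m] k} (hp : p.IsHomogeneous e) :
    aeval θ p ∈ slantPiece k σ r e :=
  aeval_mem_of_graded (one_mem_slantPiece r) mul_mem_slantPiece hθ hp

theorem homogeneousComponent_coeff_aeval {m r : ℕ} {θ : Fin m → Polynomial (MvPolynomial σ k)}
    (hθ : ∀ i, θ i ∈ slantPiece k σ r 1) (p : R[m] k) (e b : ℕ) :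
    homogeneousComponent (e + r * b) ((aeval θ p).coeff b) =
      (aeval θ (homogeneousComponent e p)).coeff b := by
  conv_lhs => rw [← sum_homogeneousComponent p, map_sum, Polynomial.finsetSum_coeff, map_sum]
  have h1 : ∀ i, homogeneousComponent (e + r * b)
      ((aeval θ (homogeneousComponent i p)).coeff b) =
        if i = e then (aeval θ (homogeneousComponent i p)).coeff b else 0 := by
    intro i
    rw [homogeneousComponent_of_mem (aeval_mem_slantPiece hθ (homogeneousComponent_isHomogeneous i p) b)]
    simp only [Nat.add_right_cancel_iff, eq_comm]
  simp only [h1]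
  rw [Finset.sum_ite_eq']
  split_ifs with h
  · rfl
  · rw [homogeneousComponent_eq_zero _ _ (by simpa using h), map_zero, Polynomial.coeff_zero]

end Slant

section LineAlgebra

variable {k : Type*} [Field k] {s : ℕ} {a1 a2 a3 : R₂ k}
  {ι : Type*} [Fintype ι] {ρ : ι → R₂ k}

theorem aeval_swap_injective :
    Function.Injective (aeval ![X 1, X 0] : R₂ k →ₐ[k] R₂ k) := by
  have h : (aeval ![X 1, X 0] : R₂ k →ₐ[k] R₂ k).comp
      (aeval ![X 1, X 0]) = AlgHom.id k _ := by
    ext i : 1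
    fin_cases i <;> simp
  intro p q hpq
  have := congrArg (aeval ![X 1, X 0] : R₂ k →ₐ[k] R₂ k) hpq
  rw [← AlgHom.comp_apply, ← AlgHom.comp_apply, h] at this
  exact this

theorem eq_zero_of_dvd_sum_aeval_mul (h1 : a1.IsHomogeneous s) (h2 : a2.IsHomogeneous s)
    (h3 : a3.IsHomogeneous s) (hs : 1 ≤ s) (hr1 : IsRelPrime a3 a1)
    (hr2 : IsRelPrime a3 (a2 * X 1 - a1 * X 0)) (hρ : ∀ j, (ρ j).IsHomogeneous s)
    (hind : ∀ c : ι → k, a3 ∣ ∑ j, c j • ρ j → c = 0) (p : ι → R₂ k)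
    (hp : C₁ a3 ∣ ∑ j, aeval ![C₁ (X 1) + C₁ a1 * X₁,
      C₁ (X 0) + C₁ a2 * X₁] (p j) * C₁ (ρ j)) : p = 0 := by
  obtain ⟨r, rfl⟩ : ∃ r, s = 1 + r := ⟨s - 1, by omega⟩
  set θ : Fin 2 → Polynomial (R₂ k) :=
    ![C₁ (X 1) + C₁ a1 * X₁,
      C₁ (X 0) + C₁ a2 * X₁] with hθdef
  have hθ : ∀ i, θ i ∈ slantPiece k (Fin 2) r 1 := by
    intro i
    fin_cases i
    · exact Submodule.add_mem _ (C_mem_slantPiece (isHomogeneous_X _ _)) (C_mul_X_mem_slantPiece h1)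
    · exact Submodule.add_mem _ (C_mem_slantPiece (isHomogeneous_X _ _)) (C_mul_X_mem_slantPiece h2)
  have hcomp : ∀ e, C₁ a3 ∣ ∑ j, aeval θ (homogeneousComponent e (p j)) * C₁ (ρ j) := by
    intro e
    rw [Polynomial.C_dvd_iff_dvd_coeff] at hp ⊢
    intro b
    have h4 := hp b
    rw [Polynomial.finsetSum_coeff] at h4 ⊢
    simp only [Polynomial.coeff_mul_C] at h4 ⊢
    obtain ⟨g, hg⟩ := h4
    simp only [← homogeneousComponent_coeff_aeval hθ]
    have h5 := congrArg (homogeneousComponent (e + r * b + (1 + r))) hg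
    rw [map_sum, mul_comm a3, homogeneousComponent_mul_of_isHomogeneous h3] at h5
    simp only [homogeneousComponent_mul_of_isHomogeneous (hρ _)] at h5
    exact ⟨_, h5.trans (mul_comm _ _)⟩
  have hzero : ∀ e j, homogeneousComponent e (p j) = 0 := by
    intro e
    let d : ι → ℕ → k := fun j α =>
      coeff (Finsupp.single 0 α + Finsupp.single 1 (e - α)) (homogeneousComponent e (p j))
    have hd : ∀ j, homogeneousComponent e (p j) =
        ∑ α ∈ Finset.range (e + 1), C (d j α) * (X 0 ^ α * X 1 ^ (e - α)) := fun j =>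
      (homogeneousComponent_isHomogeneous e (p j)).eq_sum_range
    have h6 := dvd_of_dvd_sum_mul_pow_mul_pow (y := X 1) (x := X 0) hr1 hr2 e
      (fun α => ∑ j, d j α • ρ j) (by
        convert hcomp e using 1
        simp only [hd, map_sum, Finset.sum_mul]
        rw [Finset.sum_comm]
        refine sum_congr rfl fun α _ => sum_congr rfl fun j _ => ?_
        have h8 : ∀ c : k, algebraMap k (Polynomial (R₂ k)) c =
          C₁ (C c) := fun c => rfl
        simp only [smul_eq_C_mul, map_mul, map_pow, aeval_X, aeval_C, h8]
        simp only [hθdef, Matrix.cons_val_zero, Matrix.cons_val_one]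
        ring)
    intro j
    rw [hd j]
    refine sum_eq_zero fun α hα => ?_
    have h7 := congrFun (hind _ (h6 α (by have := Finset.mem_range.1 hα; omega))) j
    simp only [Pi.zero_apply] at h7
    rw [h7, map_zero, zero_mul]
  funext j
  rw [← sum_homogeneousComponent (p j)]
  exact sum_eq_zero fun e _ => hzero e j

/-- Independence in the Rees algebra of the restrictions to a line. -/
theorem eq_zero_of_sum_aeval_mul_elim (h1 : a1.IsHomogeneous s) (h2 : a2.IsHomogeneous s)
    (h3 : a3.IsHomogeneous s) (h30 : a3 ≠ 0) (hs : 1 ≤ s) (hr1 : IsRelPrime a3 a1)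
    (hr2 : IsRelPrime a3 (a2 * X 1 - a1 * X 0)) (hρ : ∀ j, (ρ j).IsHomogeneous s)
    (hind : ∀ c : ι → k, a3 ∣ ∑ j, c j • ρ j → c = 0) (p : Option ι → R₃ k)
    (hp : ∑ o, aeval ![C₁ a3 * X₁,
      C₁ (X 1) + C₁ a1 * X₁,
      C₁ (X 0) + C₁ a2 * X₁] (p o) *
        o.elim 1 (fun j => C₁ (ρ j) * X₁) = 0) : p = 0 := by
  set θ : Fin 2 → Polynomial (R₂ k) :=
    ![C₁ (X 1) + C₁ a1 * X₁,
      C₁ (X 0) + C₁ a2 * X₁] with hθdef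
  set Θ : Fin 3 → Polynomial (R₂ k) :=
    ![C₁ a3 * X₁, C₁ (X 1) + C₁ a1 * X₁,
      C₁ (X 0) + C₁ a2 * X₁] with hΘdef
  have hΘ0 : Θ 0 = C₁ a3 * X₁ := rfl
  have hsucc : (fun i : Fin 2 => Θ i.succ) = θ := by
    funext i
    fin_cases i <;> rfl
  refine eq_zero_of_forall_X_dvd (θ := Θ)
    (by rw [hΘ0]; exact mul_ne_zero (Polynomial.C_ne_zero.2 h30) Polynomial.X_ne_zero) ?_ p hp
  intro p hp
  choose r q hrq using fun o => exists_eq_rename_succ_add (p o)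
  have hae : ∀ o, aeval Θ (p o) = aeval θ (r o) + C₁ a3 * X₁ * aeval Θ (q o) := by
    intro o
    rw [hrq o, aeval_rename_succ_add, hsucc, hΘ0]
  rw [Fintype.sum_option] at hp
  simp only [Option.elim_none, Option.elim_some, mul_one] at hp
  have hnone : r none = 0 := by
    have h4 := congrArg (Polynomial.aeval (0 : R₂ k)) hp
    rw [hae] at h4
    simp only [map_add, map_sum, map_mul, Polynomial.aeval_X, mul_zero, zero_mul,
      Finset.sum_const_zero, add_zero, map_zero] at h4
    apply aeval_swap_injective
    rw [map_zero, ← h4]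
    have h5 : (((Polynomial.aeval (0 : R₂ k)).restrictScalars k).comp
        (aeval θ) : R₂ k →ₐ[k] R₂ k) = aeval ![X 1, X 0] := by
      ext i : 1
      fin_cases i <;> simp [hθdef]
    exact (AlgHom.congr_fun h5 (r none)).symm
  have hsome : (fun j => r (some j)) = 0 := by
    refine eq_zero_of_dvd_sum_aeval_mul h1 h2 h3 hs hr1 hr2 hρ hind _ ?_
    have h4 : C₁ a3 * aeval Θ (q none) +
        ∑ j, aeval Θ (p (some j)) * C₁ (ρ j) = 0 := by
      apply mul_left_cancel₀ (Polynomial.X_ne_zero (R := R₂ k))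
      rw [mul_zero, ← hp, hae none, hnone, map_zero, zero_add, mul_add, mul_sum]
      congr 1
      · ring
      · exact sum_congr rfl fun j _ => by ring
    refine ⟨-(aeval Θ (q none) + ∑ j, X₁ * aeval Θ (q (some j)) * C₁ (ρ j)), ?_⟩
    simp only [hae, add_mul, Finset.sum_add_distrib] at h4
    have h5 : ∑ j, C₁ a3 * X₁ * aeval Θ (q (some j)) * C₁ (ρ j) =
        C₁ a3 * ∑ j, X₁ * aeval Θ (q (some j)) * C₁ (ρ j) := by
      rw [mul_sum]
      exact sum_congr rfl fun j _ => by ring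
    rw [h5] at h4
    linear_combination h4
  intro o
  rw [hrq o]
  rcases o with _ | j
  · rw [hnone, map_zero, zero_add]
    exact dvd_mul_right _ _
  · rw [show r (some j) = 0 from congrFun hsome j, map_zero, zero_add]
    exact dvd_mul_right _ _

end LineAlgebra

section LowOrder

variable {k : Type*} [Field k] {σ : Type*}

theorem coeff_mul_C_add_C_mul_X {A : Type*} [CommRing A] (F : Polynomial A) (c d : A) (b : ℕ) :
    (F * (C₁ c + C₁ d * X₁)).coeff (b + 1) =
      F.coeff (b + 1) * c + F.coeff b * d := by
  rw [mul_add, Polynomial.coeff_add, Polynomial.coeff_mul_C, ← mul_assoc, Polynomial.coeff_mul_X,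
    Polynomial.coeff_mul_C]

theorem homogeneousComponent_mul_eq_zero {F c : MvPolynomial σ k} {m n e : ℕ}
    (hc : c.IsHomogeneous m) (hF : ∀ d < n, homogeneousComponent d F = 0) (he : e < n + m) :
    homogeneousComponent e (F * c) = 0 := by
  rcases lt_or_ge e m with h | h
  · exact homogeneousComponent_mul_of_lt hc h
  · obtain ⟨d, rfl⟩ := Nat.exists_eq_add_of_le h
    rw [add_comm m d, homogeneousComponent_mul_of_isHomogeneous hc, hF d (by omega), zero_mul]

/-- The lowest components of the coefficients of a polynomial expression. -/
theorem homogeneousComponent_coeff_aeval_low {m s : ℕ} {c d : Fin m → MvPolynomial σ k}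
    (hc : ∀ i, (c i).IsHomogeneous 1) (hd : ∀ i, (d i).IsHomogeneous s)
    (p : R[m] k) (b : ℕ) :
    (∀ e < s * b, homogeneousComponent e ((aeval (fun i => C₁ (c i) +
      C₁ (d i) * X₁) p).coeff b) = 0) ∧
    homogeneousComponent (s * b) ((aeval (fun i => C₁ (c i) +
      C₁ (d i) * X₁) p).coeff b) =
        (aeval (fun i => C₁ (d i) * X₁) p).coeff b := by
  induction p using MvPolynomial.induction_on generalizing b with
  | C x =>
    rw [aeval_C, aeval_C]
    change (∀ e < s * b, homogeneousComponent e ((C₁ (C x)).coeff b) = 0) ∧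
      homogeneousComponent (s * b) ((C₁ (C x)).coeff b) = (C₁ (C x)).coeff b
    rw [Polynomial.coeff_C]
    split_ifs with h
    · subst h
      refine ⟨fun e he => by simp at he, ?_⟩
      rw [homogeneousComponent_of_mem (isHomogeneous_C σ x), if_pos (mul_zero s)]
    · simp
  | add p q hp hq =>
    rw [map_add, map_add, Polynomial.coeff_add, Polynomial.coeff_add]
    exact ⟨fun e he => by rw [map_add, (hp b).1 e he, (hq b).1 e he, add_zero],
      by rw [map_add, (hp b).2, (hq b).2]⟩
  | mul_X p i hp =>
    rw [map_mul, map_mul, aeval_X, aeval_X]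
    rcases b with _ | b
    · refine ⟨fun e he => by simp at he, ?_⟩
      rw [Polynomial.mul_coeff_zero, Polynomial.mul_coeff_zero]
      simp only [Polynomial.coeff_add, Polynomial.coeff_C_zero, Polynomial.coeff_mul_X_zero,
        add_zero, mul_zero]
      exact homogeneousComponent_mul_of_lt (hc i) one_pos
    · have h1 := coeff_mul_C_add_C_mul_X (aeval (fun i => C₁ (d i) * X₁) p)
        0 (d i) b
      rw [map_zero, zero_add, mul_zero, zero_add] at h1
      rw [coeff_mul_C_add_C_mul_X, h1]
      refine ⟨fun e he => ?_, ?_⟩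
      · rw [map_add, homogeneousComponent_mul_eq_zero (hc i) (hp (b + 1)).1 (by omega),
          homogeneousComponent_mul_eq_zero (hd i) (hp b).1 (by rw [mul_add, mul_one] at he; omega),
          add_zero]
      · rw [map_add, homogeneousComponent_mul_eq_zero (hc i) (hp (b + 1)).1 (by omega), zero_add,
          show s * (b + 1) = s * b + s by ring, homogeneousComponent_mul_of_isHomogeneous (hd i),
          (hp b).2]

end LowOrder

namespace PointSetup

namespace GoodTriple

variable {k : Type*} [Field k] {S : PointSetup k} {L : LineChart k} (t : S.GoodTriple L 1)

/-- Four elements of degree one generating a Noether normalization of the Rees algebra. -/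
def reesVar : Fin 4 → Polynomial (R₃ k) :=
  fun i => C₁ (![L.eqn, 0, L.lift (X 1), L.lift (X 0)] i) +
    C₁ (![0, t.a3, t.a1, t.a2] i) * X₁

theorem reesVar_zero : t.reesVar 0 = C₁ L.eqn := by simp [reesVar]

theorem reesVar_one : t.reesVar 1 = C₁ t.a3 * X₁ := by simp [reesVar]

theorem reesVar_two :
    t.reesVar 2 = C₁ (L.lift (X 1)) + C₁ t.a1 * X₁ := by
  simp [reesVar]

theorem reesVar_three :
    t.reesVar 3 = C₁ (L.lift (X 0)) + C₁ t.a2 * X₁ := by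
  simp [reesVar]

theorem homogeneousComponent_coeff_aeval_reesVar (p : R[4] k) (b : ℕ) :
    (∀ e < S.s * b, homogeneousComponent e ((aeval t.reesVar p).coeff b) = 0) ∧
    homogeneousComponent (S.s * b) ((aeval t.reesVar p).coeff b) =
      (aeval (fun i => C₁ (![0, t.a3, t.a1, t.a2] i) * X₁) p).coeff b := by
  have hc : ∀ i, (![L.eqn, 0, L.lift (X 1), L.lift (X 0)] i).IsHomogeneous 1 := by
    intro i
    fin_cases i
    · exact L.eqn_hom
    · exact isHomogeneous_zero _ _ _
    · exact L.lift_hom (isHomogeneous_X _ _)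
    · exact L.lift_hom (isHomogeneous_X _ _)
  have hds : ∀ i, (![0, t.a3, t.a1, t.a2] i).IsHomogeneous S.s := by
    intro i
    fin_cases i
    · exact isHomogeneous_zero _ _ _
    · exact t.mem3.2
    · exact t.mem1.2
    · exact t.mem2.2
  exact homogeneousComponent_coeff_aeval_low hc hds p b

/-- The elements of the Rees algebra built from forms of degree `s` and `2 * s - 1`. -/
def reesBasis (L : LineChart k) {ι κ : Type*} (p : ι → R₃ k)
    (g : κ → R₃ k) : Option ι ⊕ κ → Polynomial (R₃ k) :=
  Sum.elim (fun o => o.elim 1 fun j => C₁ (p j) * X₁)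
    (fun i => C₁ (L.eqn * g i) * X₁ ^ 2)

theorem exists_complement_a3 (hL : S.Avoids L) (h0 : S.h = 0) :
    ∃ p : Fin S.s → R₃ k, (∀ j, p j ∈ S.piece S.s) ∧
      S.piece S.s = span k {t.a3} ⊔ span k (range p) ∧
      ∀ c : Fin S.s → k, L.res t.a3 ∣ ∑ j, c j • L.res (p j) → c = 0 := by
  have hle : span k {t.a3} ≤ S.piece S.s :=
    (Submodule.span_singleton_le_iff_mem _ _).2 t.mem3
  have h1 : finrank k (span k {t.a3}) = 1 := finrank_span_singleton t.a3_ne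
  have h2 : finrank k (S.piece S.s) = S.s + 1 := by rw [S.finrank_piece_s, h0, Nat.sub_zero]
  obtain ⟨p, hp, hind⟩ := exists_linearIndependent_mod hle (e := S.s) (by rw [h1, h2, add_comm])
  refine ⟨p, hp, ?_, fun c hc => hind c ?_⟩
  · symm
    have hple : span k (range p) ≤ S.piece S.s := by
      rw [span_le]
      rintro _ ⟨j, rfl⟩
      exact hp j
    refine Submodule.eq_of_le_of_finrank_le (sup_le hle hple) ?_
    have h3 : span k {t.a3} ⊓ span k (range p) = ⊥ := by
      rw [eq_bot_iff]
      rintro x ⟨hx1, hx2⟩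
      obtain ⟨c, rfl⟩ := (mem_span_range_iff_exists_fun k).1 hx2
      rw [hind c hx1]
      simp
    have h4 : LinearIndependent k p := Fintype.linearIndependent_iff.2 fun c hc =>
      congrFun (hind c (by rw [hc]; exact Submodule.zero_mem _))
    have h5 := finrank_span_eq_card h4
    rw [Fintype.card_fin] at h5
    have : FiniteDimensional k (span k (range p)) :=
      Submodule.finiteDimensional_of_le hple
    have h6 := Submodule.finrank_sup_add_finrank_inf_eq (span k {t.a3})
      (span k (range p))
    rw [h3, finrank_bot, h1, h5] at h6
    omega
  · have hmem : ∑ j, c j • p j ∈ S.piece S.s :=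
      Submodule.sum_mem _ fun j _ => Submodule.smul_mem _ _ (hp j)
    obtain ⟨g, hg⟩ := hc
    have h3 : (L.res t.a3 * g).IsHomogeneous (S.s + 0) := by
      rw [← hg]
      simp only [← map_smul, ← map_sum]
      exact L.res_hom hmem.2
    obtain ⟨x, rfl⟩ := exists_eq_C_of_isHomogeneous_zero
      (isHomogeneous_of_mul_of_left (L.res_hom t.mem3.2) t.res3 h3)
    have h4 : ∑ j, c j • p j - x • t.a3 = 0 := by
      refine hL.eq_zero_of_res (sub_mem hmem (Submodule.smul_mem _ _ t.mem3)) ?_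
      rw [map_sub, map_smul, map_sum]
      simp only [map_smul]
      rw [hg, smul_eq_C_mul, mul_comm, sub_self]
    rw [sub_eq_zero.1 h4]
    exact Submodule.smul_mem _ _ (Submodule.mem_span_singleton_self _)

theorem eq_zero_of_sum_reesVar_mul_eq_zero {ι κ : Type*} [Fintype ι] [Fintype κ]
    {d : ℕ} (hd : d + 1 = S.s)
    {p : ι → R₃ k} (hp : ∀ j, p j ∈ S.piece S.s)
    (hpi : ∀ c : ι → k, L.res t.a3 ∣ ∑ j, c j • L.res (p j) → c = 0)
    {g : κ → R₃ k} (hg : ∀ j, g j ∈ S.double (S.s + d))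
    (hgi : ∀ P : κ → R₃ k,
      ∑ j, aeval ![t.a1, t.a2, t.a3] (P j) * g j = 0 → P = 0)
    (P : Option ι ⊕ κ → R[4] k)
    (hP : ∑ i, aeval t.reesVar (P i) * reesBasis L p g i = 0) : P = 0 := by
  have hl : (C₁ L.eqn : Polynomial (R₃ k)) ≠ 0 :=
    Polynomial.C_ne_zero.2 L.eqn_ne
  refine eq_zero_of_forall_X_dvd (θ := t.reesVar) (by rwa [t.reesVar_zero]) ?_ P hP
  clear hP P
  intro P hP
  rw [Fintype.sum_sum_type] at hP
  simp only [reesBasis, Sum.elim_inl, Sum.elim_inr] at hP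
  choose r q hrq using fun i => exists_eq_rename_succ_add (P i)
  have hae : ∀ i, aeval t.reesVar (P i) = aeval (fun i => t.reesVar i.succ) (r i) +
      C₁ L.eqn * aeval t.reesVar (q i) := by
    intro i
    rw [hrq i, aeval_rename_succ_add, t.reesVar_zero]
  -- restriction to the line
  have hinl : (fun o => r (Sum.inl o)) = 0 := by
    refine eq_zero_of_sum_aeval_mul_elim (L.res_hom t.mem1.2) (L.res_hom t.mem2.2)
      (L.res_hom t.mem3.2) t.res3 S.hs_pos t.coprime_left (by simpa using t.coprime_disc)
      (ρ := fun j => L.res (p j)) (fun j => L.res_hom (hp j).2) hpi _ ?_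
    have h1 := congrArg (Polynomial.mapAlgHom L.res) hP
    rw [map_add, map_sum, map_sum, map_zero] at h1
    have h2 : ∑ x, Polynomial.mapAlgHom L.res (aeval t.reesVar (P (Sum.inr x)) *
        (C₁ (L.eqn * g x) * X₁ ^ 2)) = 0 := by
      refine sum_eq_zero fun x _ => ?_
      simp [L.res_eqn]
    rw [h2, add_zero] at h1
    rw [← h1]
    refine sum_congr rfl fun o _ => ?_
    rw [hae, map_mul, map_add, map_mul]
    have h3 : Polynomial.mapAlgHom L.res (C₁ L.eqn) = 0 := by simp [L.res_eqn]
    have h4 : (Polynomial.mapAlgHom L.res).comp (aeval (fun i : Fin 3 => t.reesVar i.succ)) =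
        aeval ![C₁ (L.res t.a3) * X₁,
          C₁ (X 1) + C₁ (L.res t.a1) * X₁,
          C₁ (X 0) + C₁ (L.res t.a2) * X₁] := by
      ext i : 1
      rw [AlgHom.comp_apply, aeval_X, aeval_X]
      fin_cases i
      · change Polynomial.mapAlgHom L.res (t.reesVar 1) = _
        rw [t.reesVar_one]; simp
      · change Polynomial.mapAlgHom L.res (t.reesVar 2) = _
        rw [t.reesVar_two]; simp [L.res_lift]
      · change Polynomial.mapAlgHom L.res (t.reesVar 3) = _
        rw [t.reesVar_three]; simp [L.res_lift]
    rw [h3, zero_mul, add_zero, ← h4, AlgHom.comp_apply]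
    congr 1
    rcases o with _ | j <;> simp
  have hinl' : ∀ o, r (Sum.inl o) = 0 := congrFun hinl
  -- the remaining coefficients
  have hsum : ∑ o, aeval t.reesVar (q (Sum.inl o)) *
        o.elim 1 (fun j => C₁ (p j) * X₁) +
      ∑ i, aeval t.reesVar (P (Sum.inr i)) * (C₁ (g i) * X₁ ^ 2) = 0 := by
    apply mul_left_cancel₀ hl
    rw [mul_zero, ← hP, mul_add, mul_sum, mul_sum]
    refine congrArg₂ (· + ·) (sum_congr rfl fun o _ => ?_)
      (sum_congr rfl fun i _ => ?_)
    · rw [hae, hinl', map_zero, zero_add, mul_assoc]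
    · rw [map_mul, mul_left_comm, mul_assoc]
  have hlow := fun (x : R[4] k) b => t.homogeneousComponent_coeff_aeval_reesVar x b
  have hkey : ∀ b, ∑ i, (aeval (fun i => C₁ (![0, t.a3, t.a1, t.a2] i) * X₁)
      (P (Sum.inr i))).coeff b * g i = 0 := by
    intro b
    have h1 := congrArg (fun F => homogeneousComponent (S.s * b + (S.s + d))
      (Polynomial.coeff F (b + 2))) hsum
    simp only [Polynomial.coeff_add, Polynomial.finsetSum_coeff, map_add, map_sum,
      Polynomial.coeff_zero, map_zero] at h1
    rw [sum_eq_zero, zero_add] at h1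
    · refine Eq.trans ?_ h1
      refine sum_congr rfl fun i _ => ?_
      rw [← mul_assoc, Polynomial.coeff_mul_X_pow, Polynomial.coeff_mul_C,
        homogeneousComponent_mul_of_isHomogeneous (S.double_le _ (hg i)).2]
      rw [(hlow (P (Sum.inr i)) b).2]
    · intro o _
      rcases o with _ | j
      · rw [Option.elim_none, mul_one]
        exact (hlow (q (Sum.inl none)) (b + 2)).1 (S.s * b + (S.s + d)) (by rw [mul_add]; omega)
      · rw [Option.elim_some, ← mul_assoc, Polynomial.coeff_mul_X, Polynomial.coeff_mul_C]
        exact homogeneousComponent_mul_eq_zero (n := S.s * (b + 1)) (m := S.s)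
          (e := S.s * b + (S.s + d)) (hp j).2 (hlow (q (Sum.inl (some j))) (b + 1)).1
          (by rw [mul_add]; omega)
  have hzero : (fun i => aeval ![X 2, X 0, X 1] (r (Sum.inr i)) :
      κ → R₃ k) = 0 := by
    refine hgi _ ?_
    have h1 : ∑ i, aeval (fun i => C₁ (![0, t.a3, t.a1, t.a2] i) * X₁)
      (P (Sum.inr i)) * C₁ (g i) = 0 := by
      refine Polynomial.ext fun b => ?_
      rw [Polynomial.finsetSum_coeff, Polynomial.coeff_zero]
      refine Eq.trans ?_ (hkey b)
      exact sum_congr rfl fun i _ => Polynomial.coeff_mul_C _ _ _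
    have h2 := congrArg (Polynomial.aeval (1 : R₃ k)) h1
    rw [map_sum, map_zero] at h2
    refine Eq.trans ?_ h2
    refine sum_congr rfl fun i _ => ?_
    rw [map_mul, Polynomial.aeval_C]
    congr 1
    rw [hrq, aeval_rename_succ_add, map_add, map_mul]
    have h3 : ((Polynomial.aeval (1 : R₃ k)).restrictScalars k).comp
        (aeval (fun i : Fin 3 => C₁ (![0, t.a3, t.a1, t.a2] i.succ) * X₁)) =
        (aeval ![t.a1, t.a2, t.a3]).comp (aeval ![X 2, X 0, X 1]) := by
      ext i : 1
      fin_cases i <;> simp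
    have h4 := AlgHom.congr_fun h3 (r (Sum.inr i))
    simp only [AlgHom.comp_apply, AlgHom.coe_restrictScalars'] at h4
    rw [h4]
    simp
  have hinr : ∀ i, r (Sum.inr i) = 0 := by
    intro i
    have h1 := congrArg (aeval ![X 1, X 2, X 0] :
      R₃ k →ₐ[k] R₃ k) (congrFun hzero i)
    have h2 : (aeval ![X 1, X 2, X 0] :
        R₃ k →ₐ[k] R₃ k).comp (aeval ![X 2, X 0, X 1]) =
        AlgHom.id k _ := by
      ext i : 1
      fin_cases i <;> simp
    rw [Pi.zero_apply, map_zero, ← AlgHom.comp_apply, h2] at h1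
    exact h1
  intro i
  rw [hrq i]
  rcases i with o | i
  · rw [hinl', map_zero, zero_add]
    exact dvd_mul_right _ _
  · rw [hinr, map_zero, zero_add]
    exact dvd_mul_right _ _

end GoodTriple

end PointSetup

section LineGeneration

variable {k : Type*} [Field k] {s : ℕ} {a1 a2 a3 : R₂ k}
  {ι : Type*} [Fintype ι] {ρ : ι → R₂ k}

theorem eq_of_natDegree_le_two {A : Type*} [CommRing A] {F : Polynomial A}
    (hF : ∀ b, 2 < b → F.coeff b = 0) : F = C₁ (F.coeff 0) +
      C₁ (F.coeff 1) * X₁ + C₁ (F.coeff 2) * X₁ ^ 2 := by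
  refine Polynomial.ext fun b => ?_
  rw [Polynomial.coeff_add, Polynomial.coeff_add, Polynomial.coeff_C, Polynomial.coeff_C_mul_X,
    Polynomial.coeff_C_mul_X_pow]
  rcases b with _ | _ | _ | b
  · simp
  · simp
  · simp
  · rw [hF _ (by omega)]
    simp

/-- The elements of a slanted graded piece of degree at most two. -/
def slantTwo (k : Type*) [Field k] (r : ℕ) :
    Submodule k (Polynomial (R₂ k)) :=
  slantPiece k (Fin 2) r 2 ⊓ (Polynomial.degreeLE (R₂ k) 2).restrictScalars k

theorem finrank_slantTwo_le (k : Type*) [Field k] (r : ℕ) :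
    FiniteDimensional k (slantTwo k r) ∧ finrank k (slantTwo k r) ≤ 3 * r + 9 := by
  let f : (ℋ₂ k 2 × ℋ₂ k (2 + r)) ×
      ℋ₂ k (2 + r * 2) →ₗ[k] Polynomial (R₂ k) :=
    LinearMap.coprod (LinearMap.coprod
      (((Polynomial.monomial 0).restrictScalars k).comp (Submodule.subtype _))
      (((Polynomial.monomial 1).restrictScalars k).comp (Submodule.subtype _)))
      (((Polynomial.monomial 2).restrictScalars k).comp (Submodule.subtype _))
  have hle : slantTwo k r ≤ LinearMap.range f := by
    rintro F ⟨hF, hF'⟩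
    have hdeg : F.degree ≤ 2 := Polynomial.mem_degreeLE.1 hF'
    have h1 : ∀ b, 2 < b → F.coeff b = 0 := fun b hb =>
      Polynomial.coeff_eq_zero_of_degree_lt (hdeg.trans_lt (by exact_mod_cast hb))
    refine ⟨((⟨F.coeff 0, by simpa using hF 0⟩, ⟨F.coeff 1, by simpa using hF 1⟩),
      ⟨F.coeff 2, hF 2⟩), ?_⟩
    conv_rhs => rw [eq_of_natDegree_le_two h1]
    simp [f, ← Polynomial.C_mul_X_pow_eq_monomial]
  have hfin : FiniteDimensional k (slantTwo k r) := Submodule.finiteDimensional_of_le hle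
  refine ⟨hfin, (finrank_mono hle).trans (f.finrank_range_le.trans ?_)⟩
  rw [Module.finrank_prod, Module.finrank_prod, finrank_homogeneousSubmodule_two,
    finrank_homogeneousSubmodule_two, finrank_homogeneousSubmodule_two]
  omega

theorem mul_mem_slantPiece_inf_degreeLE {σ : Type*} {r : ℕ} {F G : Polynomial (MvPolynomial σ k)}
    {m n : ℕ} (hF : F ∈ slantPiece k σ r m ⊓
      (Polynomial.degreeLE (MvPolynomial σ k) m).restrictScalars k)
    (hG : G ∈ slantPiece k σ r n ⊓
      (Polynomial.degreeLE (MvPolynomial σ k) n).restrictScalars k) :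
    F * G ∈ slantPiece k σ r (m + n) ⊓
      (Polynomial.degreeLE (MvPolynomial σ k) ((m + n : ℕ) : WithBot ℕ)).restrictScalars k := by
  refine ⟨mul_mem_slantPiece hF.1 hG.1, ?_⟩
  have h1 : F.degree ≤ m := Polynomial.mem_degreeLE.1 hF.2
  have h2 : G.degree ≤ n := Polynomial.mem_degreeLE.1 hG.2
  refine Polynomial.mem_degreeLE.2 ((Polynomial.degree_mul_le _ _).trans ?_)
  push_cast
  exact add_le_add h1 h2

/-- Generation, in degree two, of the Rees algebra of the restrictions to a line. -/
theorem exists_sum_aeval_mul_elim {r : ℕ} (hι : Fintype.card ι = r + 1)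
    (h1 : a1.IsHomogeneous (r + 1)) (h2 : a2.IsHomogeneous (r + 1))
    (h3 : a3.IsHomogeneous (r + 1)) (h30 : a3 ≠ 0) (hr1 : IsRelPrime a3 a1)
    (hr2 : IsRelPrime a3 (a2 * X 1 - a1 * X 0)) (hρ : ∀ j, (ρ j).IsHomogeneous (r + 1))
    (hind : ∀ c : ι → k, a3 ∣ ∑ j, c j • ρ j → c = 0)
    {G : Polynomial (R₂ k)} (hG : G ∈ slantTwo k r) :
    ∃ P : Option ι → R₃ k, (P none).IsHomogeneous 2 ∧
      (∀ j, (P (some j)).IsHomogeneous 1) ∧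
      ∑ o, aeval ![C₁ a3 * X₁,
        C₁ (X 1) + C₁ a1 * X₁,
        C₁ (X 0) + C₁ a2 * X₁] (P o) *
          o.elim 1 (fun j => C₁ (ρ j) * X₁) = G := by
  set Θ : Fin 3 → Polynomial (R₂ k) := ![C₁ a3 * X₁,
    C₁ (X 1) + C₁ a1 * X₁,
    C₁ (X 0) + C₁ a2 * X₁] with hΘdef
  let W : ℕ → Submodule k (Polynomial (R₂ k)) := fun n =>
    slantPiece k (Fin 2) r n ⊓
      (Polynomial.degreeLE (R₂ k) (n : WithBot ℕ)).restrictScalars k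
  have hX : ∀ a : R₂ k, a.IsHomogeneous (r + 1) →
      C₁ a * X₁ ∈ W 1 := fun a ha =>
    ⟨C_mul_X_mem_slantPiece (by rwa [add_comm]), Polynomial.mem_degreeLE.2 (by
      simpa using Polynomial.degree_C_mul_X_le a)⟩
  have hC : ∀ i, C₁ (X i : R₂ k) ∈ W 1 := fun i =>
    ⟨C_mem_slantPiece (isHomogeneous_X _ _), Polynomial.mem_degreeLE.2
      (Polynomial.degree_C_le.trans (by norm_num))⟩
  have hΘ : ∀ i, Θ i ∈ W 1 := by
    intro i
    fin_cases i
    · exact hX _ h3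
    · exact add_mem (hC 1) (hX _ h1)
    · exact add_mem (hC 0) (hX _ h2)
  have h1W : (1 : Polynomial (R₂ k)) ∈ W 0 :=
    ⟨one_mem_slantPiece r, Polynomial.mem_degreeLE.2 Polynomial.degree_one_le⟩
  have hae : ∀ {e : ℕ} {p : R₃ k}, p.IsHomogeneous e → aeval Θ p ∈ W e :=
    fun hp => aeval_mem_of_graded h1W mul_mem_slantPiece_inf_degreeLE hΘ hp
  let f : ℋ₃ k 2 × (ι → ℋ₃ k 1) →ₗ[k]
      Polynomial (R₂ k) :=
    LinearMap.coprod ((aeval Θ).toLinearMap.comp (Submodule.subtype _))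
      (∑ j, (LinearMap.mulRight k (C₁ (ρ j) * X₁)).comp
        ((aeval Θ).toLinearMap.comp ((Submodule.subtype _).comp (LinearMap.proj j))))
  have hf : ∀ x, f x = aeval Θ (x.1 : R₃ k) +
      ∑ j, aeval Θ (x.2 j : R₃ k) * (C₁ (ρ j) * X₁) := by
    intro x
    simp [f, LinearMap.sum_apply, mul_assoc]
  have hinj : ker f = ⊥ := by
    rw [LinearMap.ker_eq_bot']
    intro x hx
    have h4 := eq_zero_of_sum_aeval_mul_elim h1 h2 h3 h30 (by omega) hr1 hr2 hρ hind
      (fun o => o.elim (x.1 : R₃ k) fun j => (x.2 j : R₃ k)) (by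
        refine Eq.trans ?_ hx
        rw [hf, Fintype.sum_option]
        simp only [Option.elim_none, Option.elim_some, mul_one]
        rfl)
    refine Prod.ext (Subtype.ext (congrFun h4 none)) (funext fun j => Subtype.ext ?_)
    exact congrFun h4 (some j)
  have hle : LinearMap.range f ≤ slantTwo k r := by
    rintro _ ⟨x, rfl⟩
    rw [hf]
    refine add_mem (hae x.1.2) (Submodule.sum_mem _ fun j _ => ?_)
    exact mul_mem_slantPiece_inf_degreeLE (hae (x.2 j).2) (hX _ (hρ j))
  obtain ⟨hfin, hrank⟩ := finrank_slantTwo_le k r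
  have heq : LinearMap.range f = slantTwo k r := by
    refine Submodule.eq_of_le_of_finrank_le hle (hrank.trans ?_)
    rw [LinearMap.finrank_range_of_inj (LinearMap.ker_eq_bot.1 hinj), Module.finrank_prod,
      Module.finrank_pi_fintype, finrank_homogeneousSubmodule_three,
      finrank_homogeneousSubmodule_three, Finset.sum_const, Finset.card_univ, hι]
    simp [Nat.choose]
    omega
  rw [← heq] at hG
  obtain ⟨x, rfl⟩ := hG
  refine ⟨fun o => o.elim (x.1 : R₃ k) fun j => (x.2 j : R₃ k),
    x.1.2, fun j => (x.2 j).2, ?_⟩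
  rw [hf, Fintype.sum_option]
  simp

end LineGeneration

namespace PointSetup

variable {k : Type*} [Field k] {S : PointSetup k} {L : LineChart k}

theorem mul_mem_double_of_isHomogeneous {x g : R₃ k} {d e : ℕ}
    (hx : x.IsHomogeneous e) (hg : g ∈ S.double d) : x * g ∈ S.double (e + d) := by
  have h := S.mem_double.1 hg
  refine S.mem_double.2 ⟨S.mul_mem_piece hx h.1, fun i => funext fun l => ?_⟩
  rw [PointChart.du_mul, h.2 i, S.eval_eq_zero h.1.1]
  simp

theorem Avoids.mem_double_of_eqn_mul_mem (hL : S.Avoids L) {g : R₃ k} {d : ℕ}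
    (hg : g.IsHomogeneous d) (h : L.eqn * g ∈ S.double (d + 1)) : g ∈ S.double d := by
  have h1 := S.mem_double.1 h
  have h2 : g ∈ S.piece d := hL.mem_of_eqn_mul_mem hg h1.1.1
  refine S.mem_double.2 ⟨h2, fun i => funext fun l => ?_⟩
  have h3 := congrFun (h1.2 i) l
  rw [PointChart.du_mul, S.eval_eq_zero h2.1, mul_zero, add_zero] at h3
  exact (mul_eq_zero.1 h3).resolve_left (hL i)

namespace GoodTriple

variable (t : S.GoodTriple L 1) {ι κ : Type*} [Fintype ι] [Fintype κ]

/-- The span of the basis elements over the subalgebra generated by the four variables. -/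
def reesSpan (p : ι → R₃ k) (g : κ → R₃ k) :
    Submodule k (Polynomial (R₃ k)) :=
  LinearMap.range (∑ i, (LinearMap.mulRight k (reesBasis L p g i)).comp
    ((aeval t.reesVar).toLinearMap.comp
      (LinearMap.proj (φ := fun _ : Option ι ⊕ κ => R[4] k) i)))

variable {p : ι → R₃ k} {g : κ → R₃ k}

theorem mem_reesSpan {w : Polynomial (R₃ k)} : w ∈ t.reesSpan p g ↔
    ∃ P : Option ι ⊕ κ → R[4] k,
      ∑ i, aeval t.reesVar (P i) * reesBasis L p g i = w := by
  simp [reesSpan, LinearMap.mem_range]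

theorem aeval_mul_mem_reesSpan (q : R[4] k)
    {w : Polynomial (R₃ k)} (hw : w ∈ t.reesSpan p g) :
    aeval t.reesVar q * w ∈ t.reesSpan p g := by
  obtain ⟨P, rfl⟩ := t.mem_reesSpan.1 hw
  refine t.mem_reesSpan.2 ⟨fun i => q * P i, ?_⟩
  simp only [map_mul, mul_sum, mul_assoc]

theorem reesVar_mul_mem_reesSpan (i : Fin 4)
    {w : Polynomial (R₃ k)} (hw : w ∈ t.reesSpan p g) :
    t.reesVar i * w ∈ t.reesSpan p g := by
  simpa using t.aeval_mul_mem_reesSpan (X i) hw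

theorem reesBasis_mem_reesSpan (i : Option ι ⊕ κ) : reesBasis L p g i ∈ t.reesSpan p g := by
  classical
  refine t.mem_reesSpan.2 ⟨Pi.single i 1, ?_⟩
  rw [Finset.sum_eq_single i]
  · simp
  · intro j _ hj
    simp [hj]
  · simp

theorem mul_mem_reesSpan_of_basis {y : Polynomial (R₃ k)}
    (h : ∀ i, y * reesBasis L p g i ∈ t.reesSpan p g)
    {w : Polynomial (R₃ k)} (hw : w ∈ t.reesSpan p g) :
    y * w ∈ t.reesSpan p g := by
  obtain ⟨P, rfl⟩ := t.mem_reesSpan.1 hw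
  rw [mul_sum]
  refine Submodule.sum_mem _ fun i _ => ?_
  rw [mul_left_comm]
  exact t.aeval_mul_mem_reesSpan _ (h i)

theorem C_mul_X_mem_reesSpan (hp : S.piece S.s ≤ span k {t.a3} ⊔ span k (range p))
    {f : R₃ k} (hf : f ∈ S.piece S.s) :
    C₁ f * X₁ ∈ t.reesSpan p g := by
  let F : R₃ k →ₗ[k] Polynomial (R₃ k) :=
    (Polynomial.monomial 1).restrictScalars k
  have hF : ∀ x, F x = C₁ x * X₁ := fun x => by
    rw [← pow_one X₁, Polynomial.C_mul_X_pow_eq_monomial]; rfl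
  have h : span k {t.a3} ⊔ span k (range p) ≤
      (t.reesSpan p g).comap F := by
    refine sup_le (span_le.2 ?_) (span_le.2 ?_)
    · rintro _ rfl
      rw [SetLike.mem_coe, Submodule.mem_comap, hF, ← t.reesVar_one, ← mul_one (t.reesVar 1)]
      exact t.reesVar_mul_mem_reesSpan 1 (t.reesBasis_mem_reesSpan (p := p) (g := g) (Sum.inl none))
    · rintro _ ⟨j, rfl⟩
      rw [SetLike.mem_coe, Submodule.mem_comap, hF]
      exact t.reesBasis_mem_reesSpan (p := p) (g := g) (Sum.inl (some j))
  rw [← hF]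
  exact h (hp hf)

theorem C_mem_reesSpan (hp : S.piece S.s ≤ span k {t.a3} ⊔ span k (range p))
    {x : R₃ k} (hx : x.IsHomogeneous 1) :
    C₁ x ∈ t.reesSpan p g := by
  have h1 : (1 : Polynomial (R₃ k)) ∈ t.reesSpan p g :=
    t.reesBasis_mem_reesSpan (p := p) (g := g) (Sum.inl none)
  have hX : ∀ i, C₁ (L.lift (X i)) ∈ t.reesSpan p g := by
    intro i
    fin_cases i
    · have h2 := Submodule.sub_mem _ (t.reesVar_mul_mem_reesSpan 3 h1)
        (t.C_mul_X_mem_reesSpan (g := g) hp t.mem2)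
      rwa [t.reesVar_three, mul_one, add_sub_cancel_right] at h2
    · have h2 := Submodule.sub_mem _ (t.reesVar_mul_mem_reesSpan 2 h1)
        (t.C_mul_X_mem_reesSpan (g := g) hp t.mem1)
      rwa [t.reesVar_two, mul_one, add_sub_cancel_right] at h2
  obtain ⟨y, hy, hxy⟩ := L.exists_eq_eqn_mul (d := 0) (g := x - L.lift (L.res x))
    (hx.sub (L.lift_hom (L.res_hom hx))) (by rw [map_sub, L.res_lift, sub_self])
  obtain ⟨c, rfl⟩ := exists_eq_C_of_isHomogeneous_zero hy
  obtain ⟨a, ha⟩ := eq_linForm_of_isHomogeneous (L.res_hom hx)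
  have hlift : L.lift (L.res x) = ∑ i, a i • L.lift (X i) := by
    rw [ha, linForm, map_sum]
    refine sum_congr rfl fun i _ => ?_
    rw [← map_smul, smul_eq_C_mul]
  have hx' : x = c • L.eqn + ∑ i, a i • L.lift (X i) := by
    rw [← hlift, smul_eq_C_mul, mul_comm, ← hxy, sub_add_cancel]
  have hCs : ∀ (c : k) (y : R₃ k), C₁ (c • y) = c • C₁ y :=
    fun c y => by rw [Polynomial.smul_C]
  rw [hx', Polynomial.C_add, hCs, map_sum]
  refine Submodule.add_mem _ (Submodule.smul_mem _ _ ?_) (Submodule.sum_mem _ fun i _ => ?_)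
  · have h2 := t.reesVar_mul_mem_reesSpan 0 h1
    rwa [t.reesVar_zero, mul_one] at h2
  · rw [hCs]
    exact Submodule.smul_mem _ _ (hX i)

theorem C_mul_X_sq_mem_reesSpan {d : ℕ}
    (hg : S.double (S.s + d) ≤ span k (range g))
    {f : R₃ k} (hf : f ∈ S.double (S.s + d)) :
    C₁ (L.eqn * f) * X₁ ^ 2 ∈ t.reesSpan p g := by
  let F : R₃ k →ₗ[k] Polynomial (R₃ k) :=
    ((Polynomial.monomial 2).restrictScalars k).comp (LinearMap.mulLeft k L.eqn)
  have hF : ∀ x, F x = C₁ (L.eqn * x) * X₁ ^ 2 := fun x => by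
    rw [Polynomial.C_mul_X_pow_eq_monomial]; rfl
  have h : span k (range g) ≤ (t.reesSpan p g).comap F := by
    refine span_le.2 ?_
    rintro _ ⟨j, rfl⟩
    rw [SetLike.mem_coe, Submodule.mem_comap, hF]
    exact t.reesBasis_mem_reesSpan (p := p) (g := g) (Sum.inr j)
  rw [← hF]
  exact h (hg hf)

/-- The elements of degree two of the Rees algebra lie in the span of the basis. -/
theorem mem_reesSpan_of_degree_two (hL : S.Avoids L) {d : ℕ}
    (hd : d + 1 = S.s) (hι : Fintype.card ι = S.s)
    (hpm : ∀ j, p j ∈ S.piece S.s)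
    (hpi : ∀ c : ι → k, L.res t.a3 ∣ ∑ j, c j • L.res (p j) → c = 0)
    (hp : S.piece S.s ≤ span k {t.a3} ⊔ span k (range p))
    (hg : S.double (S.s + d) ≤ span k (range g))
    {w : Polynomial (R₃ k)} (hw : w ∈ reesAlgebra S.I)
    (hws : w ∈ slantPiece k (Fin 3) d 2 ⊓
      (Polynomial.degreeLE (R₃ k) (2 : ℕ)).restrictScalars k) :
    w ∈ t.reesSpan p g := by
  let W : ℕ → Submodule k (Polynomial (R₃ k)) := fun n =>
    (slantPiece k (Fin 3) d n ⊓
      (Polynomial.degreeLE (R₃ k) (n : ℕ)).restrictScalars k) ⊓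
      (Subalgebra.toSubmodule (reesAlgebra S.I)).restrictScalars k
  have hWmul : ∀ {m n x y}, x ∈ W m → y ∈ W n → x * y ∈ W (m + n) := fun hx hy =>
    ⟨mul_mem_slantPiece_inf_degreeLE hx.1 hy.1, (reesAlgebra S.I).mul_mem hx.2 hy.2⟩
  have hW1 : (1 : Polynomial (R₃ k)) ∈ W 0 :=
    ⟨⟨one_mem_slantPiece d, Polynomial.mem_degreeLE.2 Polynomial.degree_one_le⟩,
      (reesAlgebra S.I).one_mem⟩
  have hWX : ∀ f ∈ S.piece S.s, C₁ f * X₁ ∈ W 1 := fun f hf =>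
    ⟨⟨C_mul_X_mem_slantPiece (by rw [add_comm, hd]; exact hf.2), Polynomial.mem_degreeLE.2 (by
      simpa using Polynomial.degree_C_mul_X_le f)⟩, by
      rw [← pow_one X₁, Polynomial.C_mul_X_pow_eq_monomial]
      exact reesAlgebra.monomial_mem.2 (by rw [pow_one]; exact hf.1)⟩
  have hWC : ∀ x : R₃ k, x.IsHomogeneous 1 → C₁ x ∈ W 1 := fun x hx =>
    ⟨⟨C_mem_slantPiece hx, Polynomial.mem_degreeLE.2 (Polynomial.degree_C_le.trans (by norm_num))⟩,
      (reesAlgebra S.I).algebraMap_mem x⟩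
  have hWθ : ∀ i : Fin 3, t.reesVar i.succ ∈ W 1 := by
    intro i
    fin_cases i
    · change t.reesVar 1 ∈ _
      rw [t.reesVar_one]
      exact hWX _ t.mem3
    · change t.reesVar 2 ∈ _
      rw [t.reesVar_two]
      exact Submodule.add_mem _ (hWC _ (L.lift_hom (isHomogeneous_X _ _))) (hWX _ t.mem1)
    · change t.reesVar 3 ∈ _
      rw [t.reesVar_three]
      exact Submodule.add_mem _ (hWC _ (L.lift_hom (isHomogeneous_X _ _))) (hWX _ t.mem2)
  have hWae : ∀ {e : ℕ} {q : R₃ k}, q.IsHomogeneous e →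
      aeval (fun i : Fin 3 => t.reesVar i.succ) q ∈ W e :=
    fun hq => aeval_mem_of_graded (W := W) hW1 hWmul hWθ hq
  have hwW : w ∈ W 2 := ⟨hws, hw⟩
  have hres : Polynomial.mapAlgHom L.res w ∈ slantTwo k d := by
    refine ⟨fun b => ?_, Polynomial.mem_degreeLE.2 ?_⟩
    · simp only [Polynomial.coe_mapAlgHom, Polynomial.coeff_map]
      exact L.res_hom (hws.1 b)
    · exact (Polynomial.degree_map_le).trans (Polynomial.mem_degreeLE.1 hws.2)
  obtain ⟨P, hP0, hP1, hPw⟩ := exists_sum_aeval_mul_elim (ι := ι) (r := d) (by omega)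
    (hd ▸ L.res_hom t.mem1.2) (hd ▸ L.res_hom t.mem2.2) (hd ▸ L.res_hom t.mem3.2) t.res3
    t.coprime_left (by simpa using t.coprime_disc) (ρ := fun j => L.res (p j))
    (fun j => hd ▸ L.res_hom (hpm j).2) hpi hres
  have h4 : (Polynomial.mapAlgHom L.res).comp (aeval (fun i : Fin 3 => t.reesVar i.succ)) =
      aeval ![C₁ (L.res t.a3) * X₁,
        C₁ (X 1) + C₁ (L.res t.a1) * X₁,
        C₁ (X 0) + C₁ (L.res t.a2) * X₁] := by
    ext i : 1
    rw [AlgHom.comp_apply, aeval_X, aeval_X]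
    fin_cases i
    · change Polynomial.mapAlgHom L.res (t.reesVar 1) = _
      rw [t.reesVar_one]; simp
    · change Polynomial.mapAlgHom L.res (t.reesVar 2) = _
      rw [t.reesVar_two]; simp [L.res_lift]
    · change Polynomial.mapAlgHom L.res (t.reesVar 3) = _
      rw [t.reesVar_three]; simp [L.res_lift]
  set v : Polynomial (R₃ k) :=
    ∑ o, aeval (fun i : Fin 3 => t.reesVar i.succ) (P o) * reesBasis L p g (Sum.inl o) with hv
  have hvspan : v ∈ t.reesSpan p g := by
    refine Submodule.sum_mem _ fun o _ => ?_
    have h5 := t.aeval_mul_mem_reesSpan (rename Fin.succ (P o))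
      (t.reesBasis_mem_reesSpan (p := p) (g := g) (Sum.inl o))
    rwa [aeval_rename] at h5
  have hvW : v ∈ W 2 := by
    rw [hv, Fintype.sum_option]
    refine Submodule.add_mem _ ?_ (Submodule.sum_mem _ fun j _ => ?_)
    · rw [show reesBasis L p g (Sum.inl none) = 1 from rfl, mul_one]
      exact hWae hP0
    · rw [show reesBasis L p g (Sum.inl (some j)) = C₁ (p j) * X₁ from rfl]
      exact hWmul (m := 1) (n := 1) (hWae (hP1 j)) (hWX _ (hpm j))
  have hvres : Polynomial.mapAlgHom L.res v = Polynomial.mapAlgHom L.res w := by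
    rw [← hPw, hv, map_sum]
    refine sum_congr rfl fun o _ => ?_
    rw [map_mul, ← h4, AlgHom.comp_apply]
    refine congrArg₂ (· * ·) rfl ?_
    rcases o with _ | j <;> simp [reesBasis]
  have hsub : w - v ∈ W 2 := Submodule.sub_mem _ hwW hvW
  suffices h : w - v ∈ t.reesSpan p g by
    have := Submodule.add_mem _ h hvspan
    rwa [sub_add_cancel] at this
  have hzero : ∀ b, L.res ((w - v).coeff b) = 0 := by
    intro b
    have h6 : Polynomial.mapAlgHom L.res (w - v) = 0 := by rw [map_sub, hvres, sub_self]
    have h7 := congrArg (fun F => Polynomial.coeff F b) h6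
    simpa using h7
  generalize w - v = w' at hsub hzero
  have hdeg : ∀ b, 2 < b → w'.coeff b = 0 := fun b hb =>
    Polynomial.coeff_eq_zero_of_degree_lt ((Polynomial.mem_degreeLE.1 hsub.1.2).trans_lt
      (by exact_mod_cast hb))
  have hI : ∀ b, w'.coeff b ∈ S.I ^ b := fun b => hsub.2 b
  have hhom := hsub.1.1
  obtain ⟨c0, h01, h02⟩ := L.exists_eq_eqn_mul (d := 1) (by simpa using hhom 0) (hzero 0)
  have hhom1 : (w'.coeff 1).IsHomogeneous (S.s + 1) := by
    have := hhom 1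
    rwa [show 2 + d * 1 = S.s + 1 by omega] at this
  obtain ⟨c1, h11, h12⟩ := hL.exists_eq_eqn_mul
    (⟨by simpa using hI 1, hhom1⟩ : w'.coeff 1 ∈ S.piece (S.s + 1)) (hzero 1)
  have hhom2 : (w'.coeff 2).IsHomogeneous (S.s + d + 1) := by
    have := hhom 2
    rwa [show 2 + d * 2 = S.s + d + 1 by omega] at this
  have hF2 : w'.coeff 2 ∈ S.double (S.s + d + 1) := by
    have h8 := (S.homogeneousComponent_of_mem_pow (hI 2)).2
    have h9 : (w'.coeff 2).IsHomogeneous (2 * S.s) := by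
      rwa [show S.s + d + 1 = 2 * S.s by omega] at hhom2
    rw [homogeneousComponent_of_mem (m := 2 * S.s) (n := 2 * S.s) h9, if_pos rfl] at h8
    have h10 := S.F_two_le_double h8
    rwa [show 2 * S.s = S.s + d + 1 by omega] at h10
  obtain ⟨c2, h21, h22⟩ := L.exists_eq_eqn_mul hhom2 (hzero 2)
  have h23 : c2 ∈ S.double (S.s + d) := by
    rw [h22] at hF2
    exact hL.mem_double_of_eqn_mul_mem h21 hF2
  have hfin : w' = t.reesVar 0 * (C₁ c0 + C₁ c1 * X₁) +
      C₁ (L.eqn * c2) * X₁ ^ 2 := by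
    conv_lhs => rw [eq_of_natDegree_le_two hdeg, h02, h12, h22]
    rw [t.reesVar_zero, mul_add, ← mul_assoc, ← Polynomial.C_mul, ← Polynomial.C_mul]
  rw [hfin]
  exact Submodule.add_mem _ (t.reesVar_mul_mem_reesSpan 0 (Submodule.add_mem _
    (t.C_mem_reesSpan hp h01) (t.C_mul_X_mem_reesSpan hp h11)))
    (t.C_mul_X_sq_mem_reesSpan hg h23)

end GoodTriple

end PointSetup

namespace PointSetup.GoodTriple

variable {k : Type*} [Field k] {S : PointSetup k} {L : LineChart k}
  (t : S.GoodTriple L 1) {ι κ : Type*} [Fintype ι] [Fintype κ]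
  {p : ι → R₃ k} {g : κ → R₃ k}

theorem C_mul_X_pow_mem_rees {f : R₃ k} {b : ℕ} (hf : f ∈ S.I ^ b) :
    C₁ f * X₁ ^ b ∈ reesAlgebra S.I := by
  rw [Polynomial.C_mul_X_pow_eq_monomial]
  exact reesAlgebra.monomial_mem.2 hf

theorem C_mul_X_pow_mem_slant {f : R₃ k} {b d n : ℕ}
    (hf : f.IsHomogeneous (n + d * b)) (hb : b ≤ n) :
    C₁ f * X₁ ^ b ∈ slantPiece k (Fin 3) d n ⊓
      (Polynomial.degreeLE (R₃ k) (n : ℕ)).restrictScalars k := by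
  refine ⟨fun c => ?_, Polynomial.mem_degreeLE.2 ((Polynomial.degree_C_mul_X_pow_le b f).trans
    (by exact_mod_cast hb))⟩
  rw [Polynomial.coeff_C_mul_X_pow]
  split_ifs with h
  · rwa [h]
  · exact isHomogeneous_zero _ _ _

theorem reesAlgebra_le_reesSpan [Infinite k] (hL : S.Avoids L) (h0 : S.h = 0) {d : ℕ}
    (hd : d + 1 = S.s) (hι : Fintype.card ι = S.s)
    (hpm : ∀ j, p j ∈ S.piece S.s)
    (hpi : ∀ c : ι → k, L.res t.a3 ∣ ∑ j, c j • L.res (p j) → c = 0)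
    (hp : S.piece S.s ≤ span k {t.a3} ⊔ span k (range p))
    (hgm : ∀ j, g j ∈ S.double (S.s + d))
    (hg : S.double (S.s + d) ≤ span k (range g))
    {w : Polynomial (R₃ k)} (hw : w ∈ reesAlgebra S.I) :
    w ∈ t.reesSpan p g := by
  have hB : ∀ {f : R₃ k} {b : ℕ}, b ≤ 2 → f.IsHomogeneous (2 + d * b) →
      f ∈ S.I ^ b → C₁ f * X₁ ^ b ∈ t.reesSpan p g := fun hb hf hfI =>
    t.mem_reesSpan_of_degree_two hL hd hι hpm hpi hp hg (C_mul_X_pow_mem_rees hfI)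
      (C_mul_X_pow_mem_slant hf hb)
  have hdouble : ∀ {f : R₃ k}, f ∈ S.double (S.s + S.s) →
      C₁ f * X₁ ^ 2 ∈ t.reesSpan p g := by
    intro f hf
    refine hB le_rfl ?_ (S.F_le_pow_I 2 (by rwa [t.F_two_eq_double h0]))
    rw [show 2 + d * 2 = S.s + S.s by omega]
    exact (S.double_le _ hf).2
  have hlin : ∀ {x f : R₃ k}, x.IsHomogeneous 1 → f ∈ S.double (S.s + d) →
      C₁ (x * f) * X₁ ^ 2 ∈ t.reesSpan p g := by
    intro x f hx hf
    refine hdouble ?_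
    have := mul_mem_double_of_isHomogeneous hx hf
    rwa [show 1 + (S.s + d) = S.s + S.s by omega] at this
  have hC : ∀ x : R₃ k, x.IsHomogeneous 1 → ∀ w ∈ t.reesSpan p g,
      C₁ x * w ∈ t.reesSpan p g := by
    refine fun x hx w hw => t.mul_mem_reesSpan_of_basis (fun i => ?_) hw
    rcases i with (_ | j) | i
    · rw [show reesBasis L p g (Sum.inl none) = 1 from rfl, mul_one]
      exact t.C_mem_reesSpan hp hx
    · rw [show reesBasis L p g (Sum.inl (some j)) = C₁ (p j) * X₁ from rfl,
        ← mul_assoc, ← Polynomial.C_mul, ← pow_one X₁]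
      refine hB one_le_two ?_ (by rw [pow_one]; exact Ideal.mul_mem_left _ _ (hpm j).1)
      rw [show 2 + d * 1 = 1 + S.s by omega]
      exact hx.mul (hpm j).2
    · rw [show reesBasis L p g (Sum.inr i) = C₁ (L.eqn * g i) * X₁ ^ 2 from rfl,
        show C₁ x * (C₁ (L.eqn * g i) * X₁ ^ 2) =
          t.reesVar 0 * (C₁ (x * g i) * X₁ ^ 2) by
        rw [t.reesVar_zero]; simp only [Polynomial.C_mul]; ring]
      exact t.reesVar_mul_mem_reesSpan 0 (hlin hx (hgm i))
  have hT : ∀ f ∈ S.piece S.s, ∀ w ∈ t.reesSpan p g,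
      C₁ f * X₁ * w ∈ t.reesSpan p g := by
    refine fun f hf w hw => t.mul_mem_reesSpan_of_basis (fun i => ?_) hw
    rcases i with (_ | j) | i
    · rw [show reesBasis L p g (Sum.inl none) = 1 from rfl, mul_one]
      exact t.C_mul_X_mem_reesSpan hp hf
    · rw [show reesBasis L p g (Sum.inl (some j)) = C₁ (p j) * X₁ from rfl,
        show C₁ f * X₁ * (C₁ (p j) * X₁) =
          C₁ (f * p j) * X₁ ^ 2 by rw [Polynomial.C_mul]; ring]
      exact hdouble (S.mul_mem_double hf (hpm j))
    · obtain ⟨x, hx, y, hy, z, hz, hxyz⟩ := t.triple_pred_le h0 hd (S.mul_mem_triple hf (hgm i))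
      have hY : ∀ i, (L.lift (X i)).IsHomogeneous 1 := fun i => L.lift_hom (isHomogeneous_X _ _)
      rw [show reesBasis L p g (Sum.inr i) = C₁ (L.eqn * g i) * X₁ ^ 2 from rfl,
        show C₁ f * X₁ * (C₁ (L.eqn * g i) * X₁ ^ 2) =
          C₁ L.eqn * C₁ (f * g i) * X₁ ^ 3 by
        simp only [Polynomial.C_mul]; ring, hxyz]
      have h2 := Submodule.sub_mem _
        (t.reesVar_mul_mem_reesSpan 2 (t.C_mul_X_sq_mem_reesSpan (p := p) hg hx))
        (t.reesVar_mul_mem_reesSpan 0 (hlin (hY 1) hx))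
      have h3 := Submodule.sub_mem _
        (t.reesVar_mul_mem_reesSpan 3 (t.C_mul_X_sq_mem_reesSpan (p := p) hg hy))
        (t.reesVar_mul_mem_reesSpan 0 (hlin (hY 0) hy))
      have h4 := t.reesVar_mul_mem_reesSpan 1 (t.C_mul_X_sq_mem_reesSpan (p := p) hg hz)
      have h5 := Submodule.add_mem _ (Submodule.add_mem _ h2 h3) h4
      rw [t.reesVar_zero, t.reesVar_one, t.reesVar_two, t.reesVar_three] at h5
      refine (congrArg (· ∈ t.reesSpan p g) ?_).mp h5
      simp only [Polynomial.C_mul, Polynomial.C_add]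
      ring
  rw [← adjoin_monomial_eq_reesAlgebra] at hw
  have hall : ∀ r : R₃ k, ∀ w ∈ t.reesSpan p g,
      C₁ r * w ∈ t.reesSpan p g := by
    intro r
    induction r using MvPolynomial.induction_on with
    | C a =>
      intro w hw
      rw [show C₁ (C a : R₃ k) * w = a • w by
        rw [← Polynomial.smul_eq_C_mul, ← MvPolynomial.algebraMap_eq, algebraMap_smul]]
      exact Submodule.smul_mem _ _ hw
    | add x y hx hy =>
      intro w hw
      rw [Polynomial.C_add, add_mul]
      exact Submodule.add_mem _ (hx w hw) (hy w hw)
    | mul_X x i hx =>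
      intro w hw
      rw [Polynomial.C_mul, mul_assoc]
      exact hx _ (hC _ (isHomogeneous_X _ _) w hw)
  have hallT : ∀ f ∈ S.I, ∀ w ∈ t.reesSpan p g,
      C₁ f * X₁ * w ∈ t.reesSpan p g := by
    intro f hf
    have hf' : f ∈ Ideal.span (S.piece S.s : Set (R₃ k)) := by
      rw [show (S.piece S.s : Set (R₃ k)) = gradedPiece S.I S.s from rfl]
      exact S.span_eq.symm ▸ hf
    clear hf
    induction hf' using Submodule.span_induction with
    | mem x hx => exact hT x hx
    | zero => intro w _; simp
    | add x y _ _ hx hy =>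
      intro w hw
      rw [Polynomial.C_add, add_mul, add_mul]
      exact Submodule.add_mem _ (hx w hw) (hy w hw)
    | smul a x _ hx =>
      intro w hw
      rw [smul_eq_mul, Polynomial.C_mul, mul_assoc, mul_assoc, ← mul_assoc (C₁ x)]
      exact hall a _ (hx w hw)
  suffices h : ∀ v ∈ t.reesSpan p g, w * v ∈ t.reesSpan p g by
    have := h 1 (t.reesBasis_mem_reesSpan (p := p) (g := g) (Sum.inl none))
    rwa [mul_one] at this
  induction hw using Algebra.adjoin_induction with
  | mem x hx =>
    obtain ⟨f, hf, rfl⟩ := hx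
    rw [← Polynomial.C_mul_X_pow_eq_monomial, pow_one]
    exact hallT f hf
  | algebraMap r => exact hall r
  | add x y _ _ hx hy =>
    intro v hv
    rw [add_mul]
    exact Submodule.add_mem _ (hx v hv) (hy v hv)
  | mul x y _ _ hx hy =>
    intro v hv
    rw [mul_assoc]
    exact hx _ (hy v hv)

/-- The Rees algebra is a finite free module over a polynomial ring in four variables. -/
theorem exists_rees_free [Infinite k] (t : S.GoodTriple L 1) (hL : S.Avoids L) (h0 : S.h = 0) :
    ∃ (φ : R[4] k →+* reesAlgebra S.I) (ι : Type) (_ : Fintype ι)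
      (e : ι → reesAlgebra S.I),
      (∀ P : ι → R[4] k, ∑ i, φ (P i) * e i = 0 → P = 0) ∧
      ∀ w, ∃ P : ι → R[4] k, ∑ i, φ (P i) * e i = w := by
  obtain ⟨d, hd⟩ : ∃ d, d + 1 = S.s := ⟨S.s - 1, Nat.sub_add_cancel S.hs_pos⟩
  obtain ⟨p, hpm, hp, hpi⟩ := t.exists_complement_a3 hL h0
  obtain ⟨g, hgm, hg, hgi⟩ := t.exists_double_family h0 hd
  have hθ : ∀ i, t.reesVar i ∈ reesAlgebra S.I := by
    have hX : ∀ f ∈ S.piece S.s, C₁ f * X₁ ∈ reesAlgebra S.I := fun f hf => by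
      rw [← pow_one X₁]
      exact C_mul_X_pow_mem_rees (by rw [pow_one]; exact hf.1)
    have hC : ∀ r : R₃ k, C₁ r ∈ reesAlgebra S.I :=
      (reesAlgebra S.I).algebraMap_mem
    intro i
    fin_cases i
    · exact t.reesVar_zero ▸ hC _
    · exact t.reesVar_one ▸ hX _ t.mem3
    · exact t.reesVar_two ▸ add_mem (hC _) (hX _ t.mem1)
    · exact t.reesVar_three ▸ add_mem (hC _) (hX _ t.mem2)
  have he : ∀ i, reesBasis L p g i ∈ reesAlgebra S.I := by
    rintro ((_ | j) | i)
    · exact (reesAlgebra S.I).one_mem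
    · rw [show reesBasis L p g (Sum.inl (some j)) = C₁ (p j) * X₁ from rfl,
        ← pow_one X₁]
      exact C_mul_X_pow_mem_rees (by rw [pow_one]; exact (hpm j).1)
    · refine C_mul_X_pow_mem_rees (S.F_le_pow_I 2 ?_)
      rw [t.F_two_eq_double h0]
      have := mul_mem_double_of_isHomogeneous L.eqn_hom (hgm i)
      rwa [show 1 + (S.s + d) = S.s + S.s by omega] at this
  let φ : R[4] k →+* reesAlgebra S.I :=
    (aeval fun i => (⟨t.reesVar i, hθ i⟩ : reesAlgebra S.I)).toRingHom
  have hφ : ∀ q, ((φ q : reesAlgebra S.I) : Polynomial (R₃ k)) =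
      aeval t.reesVar q := by
    intro q
    have : ((reesAlgebra S.I).val.restrictScalars k).comp
        (aeval fun i => (⟨t.reesVar i, hθ i⟩ : reesAlgebra S.I)) = aeval t.reesVar := by
      ext i : 1
      rw [AlgHom.comp_apply, aeval_X, aeval_X]
      rfl
    exact congrArg (fun F => F q) this
  have hsum : ∀ P : Option (Fin S.s) ⊕ Fin (S.s.choose 2) → R[4] k,
      ((∑ i, φ (P i) * (⟨reesBasis L p g i, he i⟩ : reesAlgebra S.I) : reesAlgebra S.I) :
        Polynomial (R₃ k)) = ∑ i, aeval t.reesVar (P i) * reesBasis L p g i := by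
    intro P
    rw [AddSubmonoidClass.coe_finsetSum]
    exact sum_congr rfl fun i _ => by rw [MulMemClass.coe_mul, hφ]
  refine ⟨φ, Option (Fin S.s) ⊕ Fin (S.s.choose 2), inferInstance,
    fun i => ⟨reesBasis L p g i, he i⟩, fun P hP => ?_, fun w => ?_⟩
  · refine t.eq_zero_of_sum_reesVar_mul_eq_zero hd hpm hpi hgm hgi P ?_
    rw [← hsum, hP]
    rfl
  · obtain ⟨P, hP⟩ := t.mem_reesSpan.1 (t.reesAlgebra_le_reesSpan hL h0 hd (by simp) hpm hpi hp.le
      hgm hg.ge w.2)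
    exact ⟨P, Subtype.ext ((hsum P).trans hP)⟩

end PointSetup.GoodTriple

section FreeOverPolynomialRing

variable {k : Type*} [Field k] {r : ℕ}

/-- The substitution of the coordinates of a point for the first `j` variables. -/
def partialEval (x : Fin r → k) (j : ℕ) :
    R[r] k →ₐ[k] R[r] k :=
  aeval fun i : Fin r => if (i : ℕ) < j then C (x i) else X i

theorem partialEval_X_sub (x : Fin r → k) (j : ℕ) (i : Fin r) :
    partialEval x j (X i - C (x i)) = if (i : ℕ) < j then 0 else X i - C (x i) := by
  rw [map_sub, partialEval, aeval_X, aeval_C, algebraMap_eq]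
  split_ifs <;> simp

theorem X_sub_C_ne_zero (x : Fin r → k) (i : Fin r) :
    (X i - C (x i) : R[r] k) ≠ 0 := fun h => by
  have h1 := congrArg (coeff (Finsupp.single i 1)) h
  have h2 : (0 : Fin r →₀ ℕ) ≠ Finsupp.single i 1 := fun h => by simpa using DFunLike.congr_fun h i
  rw [coeff_sub, coeff_C, coeff_X, if_neg h2] at h1
  simp at h1

theorem sub_partialEval_mem (x : Fin r → k) (j : ℕ) {J : Ideal (R[r] k)}
    (hJ : ∀ i : Fin r, (i : ℕ) < j → X i - C (x i) ∈ J) (g : R[r] k) :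
    g - partialEval x j g ∈ J := by
  rw [← Ideal.Quotient.eq]
  have : (Ideal.Quotient.mkₐ k J).comp (partialEval x j) = Ideal.Quotient.mkₐ k J := by
    refine MvPolynomial.algHom_ext fun i => ?_
    rw [AlgHom.comp_apply, partialEval, aeval_X]
    split_ifs with h
    · exact (Ideal.Quotient.eq.2 (hJ i h)).symm
    · rfl
  exact (DFunLike.congr_fun this g).symm

/-- The sequence of the translates of the variables to a point. -/
def pointSeq (x : Fin r → k) : List (R[r] k) :=
  List.ofFn fun i => X i - C (x i)

theorem length_pointSeq (x : Fin r → k) : (pointSeq x).length = r := List.length_ofFn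

theorem ofList_take_pointSeq (x : Fin r → k) (j : ℕ) :
    Ideal.ofList ((pointSeq x).take j) = RingHom.ker (partialEval x j) := by
  refine le_antisymm (Ideal.span_le.2 fun y hy => ?_) fun g hg => ?_
  · obtain ⟨i, hi, rfl⟩ := List.mem_take_iff_getElem.1 hy
    rw [length_pointSeq] at hi
    simp only [pointSeq, List.getElem_ofFn]
    rw [SetLike.mem_coe, RingHom.mem_ker]
    have := partialEval_X_sub x j ⟨i, by omega⟩
    rwa [if_pos (by simp; omega)] at this
  · have := sub_partialEval_mem x j (J := Ideal.ofList ((pointSeq x).take j)) (fun i hi => by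
      refine Ideal.subset_span (List.mem_take_iff_getElem.2 ⟨i, ?_, ?_⟩)
      · rw [length_pointSeq]; exact lt_min hi i.2
      · simp [pointSeq]) g
    rw [RingHom.mem_ker] at hg
    rwa [hg, sub_zero] at this

theorem isWeaklyRegular_pointSeq (x : Fin r → k) :
    RingTheory.Sequence.IsWeaklyRegular (R[r] k) (pointSeq x) := by
  rw [RingTheory.Sequence.isWeaklyRegular_iff_Fin]
  intro i
  rw [isSMulRegular_quotient_iff_mem_of_smul_mem]
  intro g hg
  have hi : (i : ℕ) < r := i.2.trans_eq (length_pointSeq x)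
  have h1 : (pointSeq x)[i] = X ⟨i, hi⟩ - C (x ⟨i, hi⟩) :=
    List.getElem_ofFn (f := fun i => X i - C (x i)) i.2
  rw [h1, smul_eq_mul] at hg
  rw [ofList_take_pointSeq, smul_eq_mul, Ideal.mul_top, RingHom.mem_ker] at hg ⊢
  rw [map_mul, partialEval_X_sub, if_neg (by simp)] at hg
  exact (mul_eq_zero.1 hg).resolve_left (X_sub_C_ne_zero x _)

theorem le_height_of_X_sub_C_mem (x : Fin r → k) (p : PrimeSpectrum (R[r] k))
    (hp : ∀ i, X i - C (x i) ∈ p.asIdeal) : (r : ℕ∞) ≤ Order.height p := by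
  let c : ℕ → PrimeSpectrum (R[r] k) := fun j =>
    ⟨RingHom.ker (partialEval x j), RingHom.ker_isPrime _⟩
  have hmono : ∀ j, c j ≤ c (j + 1) := fun j => by
    change RingHom.ker (partialEval x j) ≤ RingHom.ker (partialEval x (j + 1))
    rw [← ofList_take_pointSeq, ← ofList_take_pointSeq]
    exact Ideal.span_mono fun y hy => List.take_subset_take_left _ (Nat.le_succ j) hy
  have hlt : ∀ j < r, c j < c (j + 1) := fun j hj => by
    refine lt_of_le_of_ne (hmono j) fun heq => X_sub_C_ne_zero x ⟨j, hj⟩ ?_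
    have h1 : X ⟨j, hj⟩ - C (x ⟨j, hj⟩) ∈ (c (j + 1)).asIdeal := by
      change _ ∈ RingHom.ker _
      rw [RingHom.mem_ker, partialEval_X_sub, if_pos (by simp)]
    rw [← heq] at h1
    change _ ∈ RingHom.ker _ at h1
    rwa [RingHom.mem_ker, partialEval_X_sub, if_neg (by simp)] at h1
  have hc : ∀ j ≤ r, (j : ℕ∞) ≤ Order.height (c j) := by
    intro j
    induction j with
    | zero => simp
    | succ j ih =>
      intro hj
      push_cast
      exact (add_le_add_left (ih (by omega)) 1).trans (Order.height_add_one_le (hlt j hj))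
  refine (hc r le_rfl).trans (Order.height_mono ?_)
  change RingHom.ker (partialEval x r) ≤ p.asIdeal
  rw [← ofList_take_pointSeq]
  refine Ideal.span_le.2 fun y hy => ?_
  obtain ⟨i, hi, rfl⟩ := List.mem_take_iff_getElem.1 hy
  simp only [pointSeq, List.getElem_ofFn]
  exact hp _

theorem idealHeight_eq_of_isMaximal {A : Type*} [CommRing A] (P : Ideal A) [hP : P.IsMaximal] :
    idealHeight P = P.height := by
  have := hP.isPrime
  rw [(PrimeSpectrum.height_eq_orderHeight (⟨P, this⟩ : PrimeSpectrum A) : P.height = _)]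
  refine le_antisymm (iInf₂_le (⟨P, this⟩ : PrimeSpectrum A) le_rfl) (le_iInf₂ fun p hp => ?_)
  have : p = ⟨P, this⟩ := PrimeSpectrum.ext (hP.eq_of_le p.isPrime.ne_top hp).symm
  rw [this]

/-- A ring that is finite free over a polynomial ring is Cohen–Macaulay. -/
theorem isCohenMacaulayRing_of_free [IsAlgClosed k] {A : Type*} [CommRing A]
    [Algebra (R[r] k) A] [Module.Free (R[r] k) A]
    [Module.Finite (R[r] k) A] : IsCohenMacaulayRing A := by
  intro P hP
  have : IsNoetherianRing A :=
    IsNoetherianRing.of_finite (R[r] k) A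
  have hPp := hP.isPrime
  let p := P.comap (algebraMap (R[r] k) A)
  have hp : p.IsMaximal := Ideal.isMaximal_comap_of_isIntegral_of_isMaximal P
  have hPo : P.LiesOver p := ⟨rfl⟩
  obtain ⟨x, hx⟩ := (MvPolynomial.isMaximal_iff_eq_vanishingIdeal_singleton (K := k)).1 hp
  have hmem : ∀ i, X i - C (x i) ∈ p := fun i => by
    rw [hx, mem_vanishingIdeal_singleton_iff]
    simp
  have hle : ∀ y ∈ (pointSeq x).map (algebraMap (R[r] k) A), y ∈ P := by
    intro y hy
    obtain ⟨z, hz, rfl⟩ := List.mem_map.1 hy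
    obtain ⟨i, rfl⟩ := (List.mem_ofFn' _ _).1 hz
    exact hmem i
  refine ⟨(pointSeq x).map (algebraMap _ A), hle, ⟨(isWeaklyRegular_pointSeq x).of_flat, ?_⟩, ?_⟩
  · rw [smul_eq_mul, Ideal.mul_top]
    exact fun h => hP.ne_top (top_le_iff.1 (h.le.trans (Ideal.span_le.2 hle)))
  · rw [List.length_map, length_pointSeq, idealHeight_eq_of_isMaximal]
    refine le_antisymm ?_ ?_
    · rw [Ideal.height_eq_height_add_of_liesOver_of_hasGoingDown p P]
      refine le_trans ?_ le_self_add
      rw [(PrimeSpectrum.height_eq_orderHeight ⟨p, hp.isPrime⟩ : p.height = _)]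
      exact le_height_of_X_sub_C_mem x _ hmem
    · have h1 : P ∈ (Ideal.span (range fun i : Fin r =>
          algebraMap (R[r] k) A (X i - C (x i)))).minimalPrimes := by
        refine ⟨⟨hPp, Ideal.span_le.2 ?_⟩, fun Q hQ hQP => ?_⟩
        · rintro _ ⟨i, rfl⟩
          exact hmem i
        · have := hQ.1
          have h2 : p ≤ Q.comap (algebraMap (R[r] k) A) := fun g hg => by
            have h3 := sub_partialEval_mem x r (J := Q.comap (algebraMap _ A))
              (fun i _ => hQ.2 (Ideal.subset_span ⟨i, rfl⟩)) g
            have h4 : partialEval x r g = 0 := by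
              rw [hx, mem_vanishingIdeal_singleton_iff] at hg
              have : partialEval x r = (Algebra.ofId k _).comp (aeval x) :=
                MvPolynomial.algHom_ext fun i => by
                  simp [partialEval, Algebra.ofId_apply, algebraMap_eq]
              rw [this, AlgHom.comp_apply, hg, map_zero]
            rwa [h4, sub_zero] at h3
          have h3 : (Q.comap (algebraMap (R[r] k) A)).IsMaximal := by
            rwa [← hp.eq_of_le (Ideal.IsPrime.ne_top inferInstance) h2]
          have h4 := Ideal.isMaximal_of_isIntegral_of_isMaximal_comap Q h3
          exact (h4.eq_of_le hPp.ne_top hQP).ge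
      refine (Ideal.height_le_card_of_mem_minimalPrimes_span (Set.finite_range _) h1).trans ?_
      rw [← Set.image_univ]
      exact_mod_cast (Set.ncard_image_le Set.finite_univ).trans_eq
        ((Set.ncard_univ _).trans (Nat.card_fin r))

theorem isCohenMacaulayRing_of_exists_basis [IsAlgClosed k] {A : Type*} [CommRing A]
    (φ : R[r] k →+* A) {ι : Type*} [Fintype ι] (e : ι → A)
    (hind : ∀ P : ι → R[r] k, ∑ i, φ (P i) * e i = 0 → P = 0)
    (hspan : ∀ w, ∃ P : ι → R[r] k, ∑ i, φ (P i) * e i = w) :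
    IsCohenMacaulayRing A := by
  let _ := φ.toAlgebra
  have hli : LinearIndependent (R[r] k) e :=
    Fintype.linearIndependent_iff.2 fun P hP => congrFun (hind P hP)
  let b := Module.Basis.mk hli fun w _ => (mem_span_range_iff_exists_fun _).2 (hspan w)
  have := Module.Free.of_basis b
  have := Module.Finite.of_basis b
  exact isCohenMacaulayRing_of_free (k := k) (r := r)

end FreeOverPolynomialRing

namespace PointSetup.GoodTriple

variable {k : Type*} [Field k] {S : PointSetup k} {L : LineChart k} {q : ℕ}
  (t : S.GoodTriple L q)

theorem exists_fiberEval_of_mem_F [Infinite k] (h0 : S.h = 0) {m : ℕ}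
    {u : Fin m → R₃ k}
    (hu : S.piece S.s = t.spanA ⊔ span k (range u)) {b : ℕ}
    {g : R₃ k} (hg : g ∈ S.F b) :
    ∃ P, P.totalDegree ≤ 2 ∧ t.fiberEval u P = g := by
  match b with
  | 0 =>
    rw [F, pow_zero] at hg
    obtain ⟨c, rfl⟩ := Submodule.mem_one.1 hg
    refine ⟨C (C c), by rw [totalDegree_C]; omega, ?_⟩
    rw [fiberEval_C, aeval_C]
  | 1 =>
    rw [F, pow_one] at hg
    obtain ⟨P, hP, rfl⟩ := t.exists_fiberEval_of_mem_piece hu hg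
    exact ⟨P, by omega, rfl⟩
  | b + 2 =>
    have h1 : g ∈ t.spanA ^ b * S.F 2 := by
      refine t.F_le_of_three (t.F_three_le h0) b ?_
      rwa [add_comm]
    rw [spanA, span_range_pow_eq_map] at h1
    induction h1 using Submodule.mul_induction_on' with
    | mem_mul_mem x hx y hy =>
      obtain ⟨p, -, rfl⟩ := hx
      obtain ⟨P, hP, rfl⟩ := t.exists_fiberEval_of_mem_F_two hu hy
      refine ⟨C p * P, (totalDegree_mul _ _).trans (by rw [totalDegree_C]; omega), ?_⟩
      rw [map_mul, fiberEval_C]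
      rfl
    | add x hx0 y hy0 hx hy =>
      have hle : ∀ z ∈ span k (range ![t.a1, t.a2, t.a3]) ^ b * S.F 2,
          z ∈ S.F (b + 2) := fun z hz => by
        rw [F, pow_add]
        exact mul_le_mul' (pow_le_pow_left' t.spanA_le b) le_rfl hz
      rw [← span_range_pow_eq_map] at hx0 hy0
      obtain ⟨P, hP, rfl⟩ := hx (hle _ hx0)
      obtain ⟨Q, hQ, rfl⟩ := hy (hle _ hy0)
      exact ⟨P + Q, (totalDegree_add _ _).trans (max_le hP hQ), map_add _ _ _⟩

theorem exists_fiberEval_of_aeval [Infinite k] (h0 : S.h = 0) {m : ℕ}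
    {u : Fin m → R₃ k}
    (hu : S.piece S.s = t.spanA ⊔ span k (range u)) {N : ℕ}
    {f : Fin N → R₃ k} (hf : span k (range f) = S.piece S.s)
    (g : R[N] k) : ∃ P, P.totalDegree ≤ 2 ∧ t.fiberEval u P = aeval f g := by
  have h1 : ∀ b, ∃ P, P.totalDegree ≤ 2 ∧
      t.fiberEval u P = aeval f (homogeneousComponent b g) := fun b => by
    refine t.exists_fiberEval_of_mem_F h0 hu (b := b) ?_
    rw [F, ← hf, span_range_pow_eq_map]
    exact ⟨_, homogeneousComponent_isHomogeneous b g, rfl⟩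
  choose P hP hPg using h1
  refine ⟨∑ b ∈ Finset.range (g.totalDegree + 1), P b,
    totalDegree_finsetSum_le fun b _ => hP b, ?_⟩
  conv_rhs => rw [← sum_homogeneousComponent g]
  rw [map_sum, map_sum]
  exact sum_congr rfl fun b _ => hPg b

/-- The special fiber is Cohen–Macaulay when the ideal is linearly presented. -/
theorem isCohenMacaulayRing_fiber [IsAlgClosed k] (t : S.GoodTriple L q) (h0 : S.h = 0) {N : ℕ}
    {f : Fin N → R₃ k} (hf : span k (range f) = S.piece S.s) :
    IsCohenMacaulayRing (R[N] k ⧸ RingHom.ker (aeval f :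
      R[N] k →ₐ[k] R₃ k)) := by
  have : Infinite k := IsAlgClosed.instInfinite
  obtain ⟨m, hm⟩ : ∃ m, m + 2 = S.s := ⟨S.s - 2, by have := S.hs; omega⟩
  obtain ⟨u, hu, -⟩ := t.exists_complement_spanA h0 hm
  have hlift : ∀ y ∈ S.piece S.s, ∃ l : R[N] k, aeval f l = y := fun y hy => by
    rw [← hf] at hy
    obtain ⟨c, rfl⟩ := (mem_span_range_iff_exists_fun k).1 hy
    exact ⟨∑ i, c i • X i, by simp⟩
  have ha : ∀ i : Fin 3, ∃ l : R[N] k, aeval f l = ![t.a1, t.a2, t.a3] i :=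
    fun i => hlift _ (t.spanA_le (subset_span ⟨i, rfl⟩))
  choose a ha using ha
  have he : ∀ e : exponentsLeTwo m, ∃ l : R[N] k,
      aeval f l = t.fiberEval u (monomial (e : Fin m →₀ ℕ) 1) := by
    have h1 : ∀ j, ∃ l : R[N] k, aeval f l = u j := fun j =>
      hlift _ (hu.ge (Submodule.mem_sup_right (subset_span ⟨j, rfl⟩)))
    choose l hl using h1
    intro e
    refine ⟨(e : Fin m →₀ ℕ).prod fun i n => l i ^ n, ?_⟩
    rw [monomial_eq, C_1, one_mul, Finsupp.prod, Finsupp.prod, map_prod, map_prod]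
    simp only [map_pow, hl, fiberEval_X]
  choose e he using he
  let K := RingHom.ker (aeval f : R[N] k →ₐ[k] R₃ k)
  have hcomp : (aeval f : R[N] k →ₐ[k] R₃ k).comp (aeval a) =
      aeval ![t.a1, t.a2, t.a3] := MvPolynomial.algHom_ext fun j => by
    rw [AlgHom.comp_apply, aeval_X, aeval_X, ha]
  have hval : ∀ P : exponentsLeTwo m → R₃ k,
      aeval f (∑ i, aeval a (P i) * e i) =
        t.fiberEval u (∑ i : exponentsLeTwo m, monomial (i : Fin m →₀ ℕ) (P i)) := fun P => by
    rw [map_sum, map_sum]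
    refine sum_congr rfl fun i _ => ?_
    rw [map_mul, he, t.fiberEval_monomial u _ (P i)]
    exact congrArg (· * _) (DFunLike.congr_fun hcomp (P i))
  refine isCohenMacaulayRing_of_exists_basis (k := k) (r := 3) (ι := exponentsLeTwo m)
    ((Ideal.Quotient.mk K).comp (aeval a : R₃ k →ₐ[k] _).toRingHom)
    (fun i => Ideal.Quotient.mk K (e i)) (fun P hP => ?_) fun w => ?_
  · have h1 : Ideal.Quotient.mk K (∑ i, aeval a (P i) * e i) = 0 := by
      rw [map_sum]
      simp only [map_mul]
      exact hP
    rw [Ideal.Quotient.eq_zero_iff_mem, RingHom.mem_ker] at h1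
    have h1 := (hval P).symm.trans h1
    have h2 := t.eq_zero_of_fiberEval_eq_zero h0 hm hu
      (totalDegree_finsetSum_le fun i _ => (totalDegree_monomial_le _ _).trans
        (mem_exponentsLeTwo.1 i.2)) h1
    funext i
    have h3 := congrArg (coeff (i : Fin m →₀ ℕ)) h2
    classical
    rw [coeff_sum, Finset.sum_eq_single i] at h3
    · simpa using h3
    · intro j _ hj
      rw [coeff_monomial, if_neg fun h => hj (Subtype.ext h)]
    · simp
  · obtain ⟨g, rfl⟩ := Ideal.Quotient.mk_surjective w
    obtain ⟨P, hP, hPg⟩ := t.exists_fiberEval_of_aeval h0 hu hf g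
    refine ⟨fun i => coeff (i : Fin m →₀ ℕ) P, ?_⟩
    have h1 : Ideal.Quotient.mk K (∑ i : exponentsLeTwo m,
        aeval a (coeff (i : Fin m →₀ ℕ) P) * e i) = Ideal.Quotient.mk K g := by
      rw [Ideal.Quotient.eq, RingHom.mem_ker, map_sub, ← hPg, sub_eq_zero, t.fiberEval_eq_sum u hP]
      refine (hval _).trans ?_
      rw [map_sum]
      exact sum_congr rfl fun i _ => t.fiberEval_monomial u _ _
    rw [← h1, map_sum]
    simp only [map_mul]
    rfl

end PointSetup.GoodTriple

section Involutive

variable {k : Type*} [Field k] {v : ℕ} {ι κ κ' : Type*} [DecidableEq κ]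

/-- The vectors whose component at each index only involves monomials in the
multiplicative variables of this index, which are those up to its class. -/
def multSpan (k : Type*) [Field k] {v : ℕ} {κ : Type*} (cls : κ → Fin v) :
    Submodule k (κ → R[v] k) where
  carrier := {x | ∀ l γ i, coeff γ (x l) ≠ 0 → γ i ≠ 0 → i ≤ cls l}
  zero_mem' := fun l γ i h => by simp at h
  add_mem' := fun {x y} hx hy l γ i h hi => by
    by_cases h1 : coeff γ (x l) = 0
    · exact hy l γ i (fun h2 => h (by rw [Pi.add_apply, coeff_add, h1, h2, add_zero])) hi
    · exact hx l γ i h1 hi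
  smul_mem' := fun c x hx l γ i h hi => hx l γ i (fun h1 => h (by simp [h1])) hi

/-- The span of the products of the basis vectors by their multiplicative variables that precede
a given variable. -/
def linSpan (k : Type*) [Field k] {v : ℕ} {κ : Type*} [DecidableEq κ] (cls : κ → Fin v)
    (j : Fin v) : Submodule k (κ → R[v] k) :=
  span k {x | ∃ i l, i < j ∧ i ≤ cls l ∧ x = Pi.single l (X i)}

theorem single_mem_multSpan {cls : κ → Fin v} {γ : Fin v →₀ ℕ} {l : κ}
    (h : ∀ i, γ i ≠ 0 → i ≤ cls l) (c : k) : Pi.single l (monomial γ c) ∈ multSpan k cls := by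
  intro l' δ i hc hi
  by_cases hl : l' = l
  · subst hl
    rw [Pi.single_eq_same, coeff_monomial] at hc
    have : γ = δ := by
      by_contra hne
      exact hc (if_neg hne)
    exact h i (this ▸ hi)
  · rw [Pi.single_eq_of_ne hl] at hc
    simp at hc

theorem mem_of_mem_linSpan {cls : κ → Fin v} {j : Fin v} {W : Type*} [AddCommGroup W] [Module k W]
    (g : (κ → R[v] k) →ₗ[k] W) {N : Submodule k W}
    (h : ∀ i l, i < j → i ≤ cls l → g (Pi.single l (X i)) ∈ N) {y : κ → R[v] k}
    (hy : y ∈ linSpan k cls j) : g y ∈ N := by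
  have : linSpan k cls j ≤ N.comap g := span_le.2 (by
    rintro _ ⟨i, l, h1, h2, rfl⟩
    exact h i l h1 h2)
  exact this hy

theorem exists_of_coeff_linSpan {cls : κ → Fin v} {j : Fin v} {y : κ → R[v] k}
    (hy : y ∈ linSpan k cls j) {l : κ} {δ : Fin v →₀ ℕ} (h : coeff δ (y l) ≠ 0) :
    ∃ i < j, δ = Finsupp.single i 1 := by
  by_contra! hne
  refine h (mem_of_mem_linSpan (N := ⊥) ((lcoeff k δ).comp (LinearMap.proj l)) ?_ hy)
  intro i l' hi _
  change coeff δ ((Pi.single l' (X i) : κ → R[v] k) l) = 0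
  by_cases hl : l = l'
  · subst hl
    rw [Pi.single_eq_same, coeff_X, if_neg (hne i hi).symm]
  · rw [Pi.single_eq_of_ne hl, coeff_zero]

theorem isHomogeneous_of_mem_linSpan {cls : κ → Fin v} {j : Fin v}
    {y : κ → R[v] k} (hy : y ∈ linSpan k cls j) (l : κ) :
    (y l).IsHomogeneous 1 := by
  intro δ hδ
  obtain ⟨i, -, rfl⟩ := exists_of_coeff_linSpan hy hδ
  simp [Finsupp.weight_single]

theorem smul_single_eq (P Q : R[v] k) (l : κ) :
    P • (Pi.single l Q : κ → R[v] k) = Pi.single l (P * Q) := by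
  rw [← Pi.single_smul', smul_eq_mul]

/-- A matrix over a polynomial ring whose columns form an involutive basis, in the sense of
Pommaret, of the module that they span. -/
structure IsInvolutive [Fintype κ] (M : Matrix ι κ (R[v] k)) (cls : κ → Fin v) : Prop where
  eq_zero : ∀ x ∈ multSpan k cls, M *ᵥ x = 0 → x = 0
  exists_lin : ∀ l j, cls l < j → ∃ y ∈ linSpan k cls j, M *ᵥ y = M *ᵥ Pi.single l (X j)

/-- The first syzygies of an involutive basis have a linear involutive basis, indexed by the
nonmultiplicative variables. -/
theorem IsInvolutive.exists_syzygies [Fintype κ] [Fintype κ'] [DecidableEq κ']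
    {M : Matrix ι κ (R[v] k)} {cls : κ → Fin v} (hM : IsInvolutive M cls)
    (p : κ' → κ) (cls' : κ' → Fin v) (hlt : ∀ r, cls (p r) < cls' r)
    (hsurj : ∀ l j, cls l < j → ∃ r, p r = l ∧ cls' r = j)
    (hinj : ∀ r r', p r = p r' → cls' r = cls' r' → r = r') :
    ∃ M' : Matrix κ κ' (R[v] k), IsInvolutive M' cls' ∧
      (∀ l r, (M' l r).IsHomogeneous 1) ∧
      LinearMap.range M'.mulVecLin = ker M.mulVecLin := by
  choose y hy hMy using fun r => hM.exists_lin (p r) (cls' r) (hlt r)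
  let z : κ' → κ → R[v] k := fun r => Pi.single (p r) (X (cls' r)) - y r
  let M' : Matrix κ κ' (R[v] k) := Matrix.of fun l r => z r l
  have hsingle : ∀ r P, M' *ᵥ Pi.single r P = P • z r := fun r P => by
    rw [Matrix.mulVec_single]
    funext l
    simp [M', Matrix.col, mul_comm]
  have hred : ∀ r, Pi.single (p r) (X (cls' r)) = z r + y r := fun r => (sub_add_cancel _ _).symm
  have hMz : ∀ r, M *ᵥ z r = 0 := fun r => by rw [Matrix.mulVec_sub, hMy, sub_self]
  have hMM : ∀ x, M *ᵥ (M' *ᵥ x) = 0 := fun x => by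
    have h1 : M * M' = 0 := by
      exact Matrix.ext fun i r => congrFun (hMz r) i
    rw [Matrix.mulVec_mulVec, h1, Matrix.zero_mulVec]
  let sm : R[v] k →
      (κ → R[v] k) →ₗ[k] (κ → R[v] k) := fun P =>
    (LinearMap.lsmul (R[v] k) (κ → R[v] k) P).restrictScalars k
  have hsm : ∀ P l Q, sm P (Pi.single l Q) = Pi.single l (P * Q) :=
    fun P l Q => smul_single_eq P Q l
  have hquad : ∀ (K : Fin v) (n : ℕ) (a b : Fin v) (l : κ), (a : ℕ) + b < n → a ≤ b → a < K →
      b ≤ K → Pi.single l (X a * X b) ∈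
        multSpan k cls ⊔ (linSpan k cls' K).map (M'.mulVecLin.restrictScalars k) := by
    intro K n
    induction n with
    | zero => intro a b l h; omega
    | succ n ih =>
      intro a b l hn hab haK hbK
      by_cases hb : b ≤ cls l
      · refine Submodule.mem_sup_left ?_
        have := single_mem_multSpan (k := k) (cls := cls) (l := l)
          (γ := Finsupp.single a 1 + Finsupp.single b 1) (fun i hi => ?_) 1
        · rwa [← one_mul (1 : k), ← monomial_mul] at this
        · by_cases hia : i = a
          · exact hia.trans_le (hab.trans hb)
          · by_cases hib : i = b
            · exact hib.trans_le hb
            · rw [Finsupp.add_apply, Finsupp.single_eq_of_ne hia,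
                Finsupp.single_eq_of_ne hib] at hi
              exact absurd rfl hi
      · obtain ⟨r, rfl, rfl⟩ := hsurj l b (not_le.1 hb)
        rw [← smul_single_eq, hred, smul_add]
        refine add_mem (Submodule.mem_sup_right ⟨Pi.single r (X a),
          subset_span ⟨a, r, haK, hab, rfl⟩, hsingle r _⟩) ?_
        refine mem_of_mem_linSpan (sm (X a)) (fun i l' hi _ => ?_) (hy r)
        rw [hsm]
        rcases le_total a i with h | h
        · exact ih a i l' (by have := Fin.lt_def.1 hi; omega) h haK (hi.le.trans hbK)
        · rw [mul_comm]
          exact ih i a l' (by have := Fin.lt_def.1 hi; omega) h (hi.trans_le hbK) haK.le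
  have hmon : ∀ (n : ℕ) (γ : Fin v →₀ ℕ) (c : k) (l : κ),
      weight (fun i : Fin v => (i : ℕ)) γ < n → Pi.single l (monomial γ c) ∈
        multSpan k cls ⊔ (LinearMap.range M'.mulVecLin).restrictScalars k := by
    intro n
    induction n with
    | zero => intro γ c l h; omega
    | succ n ih =>
      intro γ c l hn
      by_cases hγ : ∀ i, γ i ≠ 0 → i ≤ cls l
      · exact Submodule.mem_sup_left (single_mem_multSpan hγ c)
      · push Not at hγ
        obtain ⟨j, hj, hlj⟩ := hγ
        obtain ⟨r, rfl, rfl⟩ := hsurj l j hlj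
        obtain ⟨δ, rfl⟩ : ∃ δ, γ = δ + Finsupp.single (cls' r) 1 :=
          ⟨γ - Finsupp.single (cls' r) 1, (tsub_add_cancel_of_le
            (Finsupp.single_le_iff.2 (Nat.one_le_iff_ne_zero.2 hj))).symm⟩
        rw [map_add, Finsupp.weight_single, one_smul] at hn
        rw [monomial_add_single, pow_one, ← smul_single_eq, hred, smul_add]
        refine add_mem (Submodule.mem_sup_right ⟨Pi.single r (monomial δ c), hsingle r _⟩) ?_
        refine mem_of_mem_linSpan (sm (monomial δ c)) (fun i l' hi _ => ?_) (hy r)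
        rw [hsm]
        have := ih (δ + Finsupp.single i 1) c l' (by
          rw [map_add, Finsupp.weight_single, one_smul]
          have := Fin.lt_def.1 hi
          omega)
        rwa [monomial_add_single, pow_one] at this
  refine ⟨M', ⟨fun x hx hMx => ?_, fun r j hj => ?_⟩, fun l r => ?_, ?_⟩
  · by_contra hx0
    have hT : (Finset.univ.sigma fun r => (x r).support).Nonempty := by
      obtain ⟨r, hr⟩ := Function.ne_iff.1 hx0
      obtain ⟨γ, hγ⟩ := ne_zero_iff.1 hr
      exact ⟨⟨r, γ⟩, by simpa using hγ⟩
    obtain ⟨⟨r, γ⟩, hrγ, hmax⟩ := Finset.exists_max_image _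
      (fun q => weight (fun i : Fin v => (i : ℕ)) q.2 + cls' q.1) hT
    simp only [Finset.mem_sigma, Finset.mem_univ, true_and, mem_support_iff, Sigma.forall] at hrγ hmax
    refine hrγ ?_
    have hY : ∀ r', coeff (Finsupp.single (cls' r) 1 + γ) (y r' (p r) * x r') = 0 := fun r' => by
      rw [coeff_mul]
      refine sum_eq_zero fun q hq => ?_
      by_contra hne
      obtain ⟨i, hi, h1⟩ := exists_of_coeff_linSpan (hy r') (left_ne_zero_of_mul hne)
      have h2 := hmax r' q.2 (right_ne_zero_of_mul hne)
      have h3 := congrArg (weight fun i : Fin v => (i : ℕ)) (Finset.HasAntidiagonal.mem_antidiagonal.1 hq)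
      rw [h1, map_add, map_add, Finsupp.weight_single, Finsupp.weight_single, one_smul,
        one_smul] at h3
      have := Fin.lt_def.1 hi
      omega
    have h1 := congrArg (coeff (Finsupp.single (cls' r) 1 + γ)) (congrFun hMx (p r))
    rw [Matrix.mulVec, dotProduct, coeff_sum, Finset.sum_eq_single r] at h1
    · change coeff _ ((_ - y r (p r)) * x r) = 0 at h1
      rwa [sub_mul, coeff_sub, hY, sub_zero, Pi.single_eq_same, coeff_X_mul] at h1
    · intro r' _ hr'
      change coeff _ (((Pi.single (p r') (X (cls' r')) : κ → R[v] k) (p r) -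
        y r' (p r)) * x r') = 0
      rw [sub_mul, coeff_sub, hY, sub_zero]
      by_cases hp : p r = p r'
      · rw [← hp, Pi.single_eq_same, coeff_X_mul']
        split_ifs with hs
        · by_contra hne
          have hcc : cls' r ≠ cls' r' := fun h => hr' (hinj _ _ hp.symm h.symm)
          have h2 : γ (cls' r') ≠ 0 := by
            rwa [Finsupp.mem_support_iff, Finsupp.add_apply, Finsupp.single_eq_of_ne hcc.symm,
              zero_add] at hs
          have h3 := hx r γ _ hrγ h2
          have h4 := hx r' _ (cls' r) hne (by
            rw [Finsupp.tsub_apply, Finsupp.add_apply, Finsupp.single_eq_same,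
              Finsupp.single_eq_of_ne hcc]
            omega)
          exact hcc (le_antisymm h4 h3)
        · rfl
      · rw [Pi.single_eq_of_ne hp, zero_mul, coeff_zero]
    · exact fun h => absurd (Finset.mem_univ r) h
  · have h1 : (X j : R[v] k) • z r ∈
        multSpan k cls ⊔ (linSpan k cls' j).map (M'.mulVecLin.restrictScalars k) := by
      rw [smul_sub]
      refine sub_mem ?_ ?_
      · rw [smul_single_eq, mul_comm]
        exact hquad j _ (cls' r) j _ (Nat.lt_succ_self _) hj.le hj le_rfl
      · refine mem_of_mem_linSpan (sm (X j)) (fun i l' hi _ => ?_) (hy r)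
        rw [hsm, mul_comm]
        exact hquad j _ i j _ (Nat.lt_succ_self _) (hi.trans hj).le (hi.trans hj) le_rfl
    obtain ⟨μ, hμ, _, ⟨w, hw, rfl⟩, heq⟩ := mem_sup.1 h1
    refine ⟨w, hw, ?_⟩
    have h2 : μ + M' *ᵥ w = X j • z r := heq
    have h3 := hM.eq_zero μ hμ (by
      have := congrArg (M *ᵥ ·) h2
      simpa only [Matrix.mulVec_add, hMM, Matrix.mulVec_smul, hMz, smul_zero, add_zero] using this)
    rw [hsingle, ← h2, h3, zero_add]
  · have h1 : ((Pi.single (p r) (X (cls' r)) : κ → R[v] k) l).IsHomogeneous 1 := by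
      by_cases hl : l = p r
      · subst hl
        rw [Pi.single_eq_same]
        exact isHomogeneous_X k _
      · rw [Pi.single_eq_of_ne hl]
        exact isHomogeneous_zero (Fin v) k 1
    exact h1.sub (isHomogeneous_of_mem_linSpan (hy r) l)
  · refine le_antisymm ?_ fun x hx => ?_
    · rintro _ ⟨x, rfl⟩
      exact hMM x
    · have h1 : x ∈ multSpan k cls ⊔ (LinearMap.range M'.mulVecLin).restrictScalars k := by
        rw [← Finset.univ_sum_single x]
        refine Submodule.sum_mem _ fun l _ => ?_
        rw [(x l).as_sum, ← LinearMap.coe_single (R := k), map_sum]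
        exact Submodule.sum_mem _ fun γ _ => hmon _ γ _ l (Nat.lt_succ_self _)
      obtain ⟨μ, hμ, _, ⟨w, rfl⟩, heq⟩ := mem_sup.1 h1
      have h2 : μ + M' *ᵥ w = x := heq
      have hx : M *ᵥ x = 0 := hx
      have h3 := hM.eq_zero μ hμ (by
        rw [← h2, Matrix.mulVec_add, hMM, add_zero] at hx
        exact hx)
      exact ⟨w, by rw [← h2, h3, zero_add]; rfl⟩

end Involutive

section InvolutiveStart

variable {k : Type*} [Field k] {v : ℕ}

/-- The weight on the variables for which the first three have weight zero. -/
def tailWeight (v : ℕ) (i : Fin v) : ℕ := if (i : ℕ) < 3 then 0 else 1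

theorem weight_tailWeight_add_single (γ : Fin v →₀ ℕ) (i : Fin v) :
    weight (tailWeight v) (γ + Finsupp.single i 1) =
      weight (tailWeight v) γ + tailWeight v i := by
  rw [map_add, Finsupp.weight_single, one_smul]

theorem weight_one_add_single (γ : Fin v →₀ ℕ) (i : Fin v) :
    weight (1 : Fin v → ℕ) (γ + Finsupp.single i 1) =
      weight (1 : Fin v → ℕ) γ + 1 := by
  rw [map_add, Finsupp.weight_single, one_smul, Pi.one_apply]

theorem exists_eq_add_single {γ : Fin v →₀ ℕ} {i : Fin v} (h : γ i ≠ 0) :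
    ∃ δ, γ = δ + Finsupp.single i 1 :=
  ⟨γ - Finsupp.single i 1, (tsub_add_cancel_of_le
    (Finsupp.single_le_iff.2 (Nat.one_le_iff_ne_zero.2 h))).symm⟩

theorem eq_zero_of_weight_one_eq_zero {γ : Fin v →₀ ℕ}
    (h : weight (1 : Fin v → ℕ) γ = 0) : γ = 0 := by
  ext i
  have := Finsupp.le_weight (1 : Fin v → ℕ) (s := i) one_ne_zero γ
  exact Nat.le_zero.1 (h ▸ this)

theorem eq_of_le_of_weight_one_eq {γ δ : Fin v →₀ ℕ} (hle : γ ≤ δ)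
    (h : weight (1 : Fin v → ℕ) γ = weight (1 : Fin v → ℕ) δ) : γ = δ := by
  obtain ⟨ε, rfl⟩ := exists_add_of_le hle
  rw [map_add] at h
  rw [eq_zero_of_weight_one_eq_zero (γ := ε) (by omega), add_zero]

theorem weight_tailWeight_eq {γ : Fin v →₀ ℕ} (h : ∀ i, γ i ≠ 0 → 3 ≤ (i : ℕ)) :
    weight (tailWeight v) γ = weight (1 : Fin v → ℕ) γ := by
  rw [Finsupp.weight_apply, Finsupp.weight_apply]
  refine Finsupp.sum_congr fun i hi => ?_
  have := h i (Finsupp.mem_support_iff.1 hi)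
  rw [tailWeight, if_neg (by omega), Pi.one_apply]

theorem exists_le_of_le_weight_tailWeight (n : ℕ) (γ : Fin v →₀ ℕ)
    (h : n ≤ weight (tailWeight v) γ) : ∃ e δ : Fin v →₀ ℕ, γ = δ + e ∧
      weight (1 : Fin v → ℕ) e = n ∧ ∀ i, e i ≠ 0 → 3 ≤ (i : ℕ) := by
  induction n with
  | zero => exact ⟨0, γ, by simp, by simp, by simp⟩
  | succ n ih =>
    obtain ⟨e, δ, rfl, he, hs⟩ := ih (by omega)
    rw [map_add, weight_tailWeight_eq hs, he] at h
    obtain ⟨i, hi, hi3⟩ : ∃ i, δ i ≠ 0 ∧ 3 ≤ (i : ℕ) := by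
      by_contra! hne
      have : weight (tailWeight v) δ = 0 := by
        rw [Finsupp.weight_apply]
        refine sum_eq_zero fun i hi => ?_
        have : tailWeight v i = 0 := if_pos (hne i (Finsupp.mem_support_iff.1 hi))
        exact mul_eq_zero_of_right _ this
      omega
    obtain ⟨δ, rfl⟩ := exists_eq_add_single hi
    refine ⟨e + Finsupp.single i 1, δ, by abel, by rw [weight_one_add_single, he], fun j hj => ?_⟩
    by_cases hji : j = i
    · exact hji ▸ hi3
    · refine hs j fun h0 => hj ?_
      rw [Finsupp.add_apply, h0, Finsupp.single_eq_of_ne hji, add_zero]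

theorem eq_of_add_eq_add_of_le {p p' γ γ' : Fin v →₀ ℕ} {c c' : Fin v} (h : γ + p = γ' + p')
    (hw : weight (1 : Fin v → ℕ) p = weight (1 : Fin v → ℕ) p')
    (hγ : ∀ i, γ i ≠ 0 → i ≤ c) (hγ' : ∀ i, γ' i ≠ 0 → i ≤ c')
    (hp : ∀ i, p i ≠ 0 → c ≤ i) (hp' : ∀ i, p' i ≠ 0 → c' ≤ i) (hcc : c ≤ c') : p = p' := by
  have h1 : ∀ i, γ i + p i = γ' i + p' i := fun i => DFunLike.congr_fun h i
  have h2 : ∀ i, i ≠ c ∨ c ≠ c' → p' i ≤ p i := fun i hi => by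
    by_cases h3 : p' i = 0
    · omega
    · have h4 := hp' i h3
      have h5 : γ i = 0 := by
        by_contra h5
        have := hγ i h5
        omega
      have := h1 i
      omega
  rcases eq_or_ne c c' with rfl | hne
  · have h3 : ∀ i, i ≠ c → p i = p' i := fun i hi => by
      have := h1 i
      have := h2 i (Or.inl hi)
      by_cases h4 : p i = 0
      · omega
      · have h5 := hp i h4
        have h6 : γ' i = 0 := by
          by_contra h6
          have := hγ' i h6
          omega
        omega
    rcases le_total (p c) (p' c) with h4 | h4
    · exact eq_of_le_of_weight_one_eq (fun i => by
        by_cases hi : i = c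
        · exact hi ▸ h4
        · exact (h3 i hi).le) hw
    · exact (eq_of_le_of_weight_one_eq (fun i => by
        by_cases hi : i = c
        · exact hi ▸ h4
        · exact (h3 i hi).ge) hw.symm).symm
  · exact (eq_of_le_of_weight_one_eq (fun i => h2 i (Or.inr hne)) hw.symm).symm

/-- The polynomials of degree at most two in the variables of positive index at least three. -/
def tailLe (k : Type*) [Field k] (v : ℕ) : Submodule k (R[v] k) :=
  restrictSupport k {γ | weight (tailWeight v) γ ≤ 2}

theorem tailWeight_le_of_mem_tailLe {P : R[v] k} (hP : P ∈ tailLe k v)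
    {γ : Fin v →₀ ℕ} (h : coeff γ P ≠ 0) : weight (tailWeight v) γ ≤ 2 :=
  (mem_restrictSupport_iff k).1 hP (mem_support_iff.2 h)

theorem monomial_mem_tailLe {γ : Fin v →₀ ℕ} (h : weight (tailWeight v) γ ≤ 2) (c : k) :
    monomial γ c ∈ tailLe k v :=
  (mem_restrictSupport_iff k).2 fun δ hδ => by
    have := Finset.mem_singleton.1 (support_monomial_subset hδ)
    exact this ▸ h

theorem exists_isInvolutive (Q : Ideal (R[v] k))
    (hQ0 : ∀ P ∈ Q, P ∈ tailLe k v → P = 0)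
    (hQ1 : ∀ e : Fin v →₀ ℕ, weight (1 : Fin v → ℕ) e = 3 → (∀ i, e i ≠ 0 → 3 ≤ (i : ℕ)) →
      ∃ nf ∈ tailLe k v, nf.IsHomogeneous 3 ∧ monomial e 1 - nf ∈ Q) :
    ∃ (c : ℕ) (M : Matrix (Fin 1) (Fin c) (R[v] k)) (cls : Fin c → Fin v),
      IsInvolutive M cls ∧ (∀ l, 3 ≤ (cls l : ℕ)) ∧ (∀ j l, (M j l).IsHomogeneous 3) ∧
      Ideal.span {x | ∃ j l, x = M j l} = Q := by
  have hfin : {e : Fin v →₀ ℕ | weight (1 : Fin v → ℕ) e = 3 ∧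
      ∀ i, e i ≠ 0 → 3 ≤ (i : ℕ)}.Finite :=
    (Finsupp.finite_of_nat_weight_le (1 : Fin v → ℕ) (fun _ => one_ne_zero) 3).subset
      fun e he => he.1.le
  have := hfin.fintype
  obtain ⟨c, p, hinj, hw, hs, hE⟩ : ∃ (c : ℕ) (p : Fin c → Fin v →₀ ℕ), Function.Injective p ∧
      (∀ l, weight (1 : Fin v → ℕ) (p l) = 3) ∧ (∀ l i, p l i ≠ 0 → 3 ≤ (i : ℕ)) ∧
      ∀ e : Fin v →₀ ℕ, weight (1 : Fin v → ℕ) e = 3 → (∀ i, e i ≠ 0 → 3 ≤ (i : ℕ)) →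
        ∃ l, e = p l := by
    let E := (Fintype.equivFin {e : Fin v →₀ ℕ | weight (1 : Fin v → ℕ) e = 3 ∧
      ∀ i, e i ≠ 0 → 3 ≤ (i : ℕ)}).symm
    exact ⟨_, fun l => E l, Subtype.val_injective.comp E.injective, fun l => (E l).2.1,
      fun l => (E l).2.2, fun e h1 h2 => ⟨E.symm ⟨e, h1, h2⟩, by simp⟩⟩
  have hcls : ∀ l, ∃ i, p l i ≠ 0 ∧ ∀ j, p l j ≠ 0 → i ≤ j := fun l => by
    obtain ⟨i, hi, hmin⟩ := Finset.exists_min_image (p l).support id (by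
      rw [Finsupp.support_nonempty_iff]
      intro h
      have := hw l
      rw [h, map_zero] at this
      omega)
    exact ⟨i, Finsupp.mem_support_iff.1 hi, fun j hj => hmin j (Finsupp.mem_support_iff.2 hj)⟩
  choose cls hcls hmin using hcls
  choose nf hnf hhom hQ using fun l => hQ1 (p l) (hw l) (hs l)
  let g : Fin c → R[v] k := fun l => monomial (p l) 1 - nf l
  let M : Matrix (Fin 1) (Fin c) (R[v] k) := Matrix.of fun _ l => g l
  have hMx : ∀ x j, (M *ᵥ x) j = ∑ l, g l * x l := fun x j => rfl
  have hMQ : ∀ x, (M *ᵥ x) 0 ∈ Q := fun x => by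
    rw [hMx]
    exact sum_mem fun l _ => Q.mul_mem_right _ (hQ l)
  have hMs : ∀ l P, (M *ᵥ Pi.single l P) 0 = g l * P := fun l P => by
    rw [hMx, Finset.sum_eq_single l]
    · rw [Pi.single_eq_same]
    · intro l' _ hl'
      rw [Pi.single_eq_of_ne hl', mul_zero]
    · exact fun h => absurd (Finset.mem_univ l) h
  let ev : (Fin c → R[v] k) →ₗ[k] R[v] k :=
    ((LinearMap.proj 0).comp M.mulVecLin).restrictScalars k
  have hev : ∀ x, ev x = (M *ᵥ x) 0 := fun x => rfl
  have hlin : ∀ (i j : Fin v) l, 3 ≤ (i : ℕ) → 3 ≤ (j : ℕ) →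
      X i * nf l ∈ tailLe k v ⊔ (linSpan k cls j).map ev := by
    intro i j l hi3 hj3
    rw [(nf l).as_sum, mul_sum]
    refine Submodule.sum_mem _ fun γ hγ => ?_
    rw [mul_comm, X, monomial_mul, mul_one]
    have h1 := tailWeight_le_of_mem_tailLe (hnf l) (mem_support_iff.1 hγ)
    have h2 : weight (1 : Fin v → ℕ) γ = 3 := hhom l (mem_support_iff.1 hγ)
    by_cases h3 : weight (tailWeight v) (γ + Finsupp.single i 1) ≤ 2
    · exact Submodule.mem_sup_left (monomial_mem_tailLe h3 _)
    · obtain ⟨e, δ, heq, he, hes⟩ :=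
        exists_le_of_le_weight_tailWeight 3 (γ + Finsupp.single i 1) (by omega)
      obtain ⟨l', rfl⟩ := hE e he hes
      have h4 := weight_one_add_single γ i
      have h5 := weight_tailWeight_add_single γ i
      have h6 : tailWeight v i = 1 := if_neg (by omega)
      rw [heq, map_add, he] at h4
      rw [heq, map_add, weight_tailWeight_eq hes, he] at h5
      obtain ⟨a, ha⟩ : ∃ a, δ a ≠ 0 := by
        by_contra! h0
        rw [show δ = 0 from Finsupp.ext h0, map_zero] at h4
        omega
      obtain ⟨ε, rfl⟩ := exists_eq_add_single ha
      rw [weight_one_add_single] at h4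
      obtain rfl := eq_zero_of_weight_one_eq_zero (γ := ε) (by omega)
      rw [zero_add, Finsupp.weight_single, one_smul] at h5
      have ha3 : (a : ℕ) < 3 := by
        by_contra h7
        rw [tailWeight, if_neg h7] at h5
        omega
      rw [heq, zero_add]
      have h8 : monomial (Finsupp.single a 1 + p l') (coeff γ (nf l)) =
          coeff γ (nf l) • (nf l' * X a) + coeff γ (nf l) • ev (Pi.single l' (X a)) := by
        rw [hev, hMs, ← smul_add, ← add_mul, add_sub_cancel, X, monomial_mul, smul_monomial, add_comm]
        simp
      rw [h8]
      refine add_mem (Submodule.mem_sup_left (Submodule.smul_mem _ _ ?_))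
        (Submodule.mem_sup_right (Submodule.smul_mem _ _
          ⟨_, subset_span ⟨a, l', Fin.lt_def.2 (by omega), ?_, rfl⟩, rfl⟩))
      · rw [(nf l').as_sum, Finset.sum_mul]
        refine Submodule.sum_mem _ fun γ' hγ' => ?_
        rw [X, monomial_mul, mul_one]
        refine monomial_mem_tailLe ?_ _
        rw [weight_tailWeight_add_single, tailWeight, if_pos ha3]
        exact tailWeight_le_of_mem_tailLe (hnf l') (mem_support_iff.1 hγ')
      · have := hs l' _ (hcls l')
        exact Fin.le_def.2 (by omega)
  refine ⟨c, M, cls, ⟨fun x hx hMx0 => ?_, fun l j hj => ?_⟩, fun l => hs l _ (hcls l), fun _ l => ?_, ?_⟩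
  · by_contra hx0
    have hT : (Finset.univ.sigma fun r => (x r).support).Nonempty := by
      obtain ⟨r, hr⟩ := Function.ne_iff.1 hx0
      obtain ⟨γ, hγ⟩ := ne_zero_iff.1 hr
      exact ⟨⟨r, γ⟩, by simpa using hγ⟩
    obtain ⟨⟨l, γ⟩, hlγ, hmax⟩ := Finset.exists_max_image _
      (fun q => weight (tailWeight v) q.2) hT
    simp only [Finset.mem_sigma, Finset.mem_univ, true_and, mem_support_iff, Sigma.forall] at hlγ hmax
    refine hlγ ?_
    have hY : ∀ l', coeff (p l + γ) (nf l' * x l') = 0 := fun l' => by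
      rw [coeff_mul]
      refine sum_eq_zero fun q hq => ?_
      by_contra hne
      have h1 := tailWeight_le_of_mem_tailLe (hnf l') (left_ne_zero_of_mul hne)
      have h2 := hmax l' q.2 (right_ne_zero_of_mul hne)
      have h3 := congrArg (weight (tailWeight v)) (Finset.HasAntidiagonal.mem_antidiagonal.1 hq)
      rw [map_add, map_add, weight_tailWeight_eq (hs l), hw] at h3
      omega
    have h1 := congrArg (coeff (p l + γ)) (congrFun hMx0 0)
    rw [hMx, coeff_sum, Finset.sum_eq_single l] at h1
    · rwa [sub_mul, coeff_sub, hY, sub_zero, coeff_monomial_mul, one_mul] at h1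
    · intro l' _ hl'
      rw [sub_mul, coeff_sub, hY, sub_zero, coeff_monomial_mul', one_mul]
      split_ifs with hle
      · by_contra hne
        refine hl' (hinj ?_)
        have heq : γ + p l = (p l + γ - p l') + p l' := by
          rw [tsub_add_cancel_of_le hle, add_comm]
        have hww := (hw l).trans (hw l').symm
        rcases le_total (cls l) (cls l') with h | h
        · exact (eq_of_add_eq_add_of_le heq hww (fun i => hx l γ i hlγ)
            (fun i => hx l' _ i hne) (hmin l) (hmin l') h).symm
        · exact eq_of_add_eq_add_of_le heq.symm hww.symm (fun i => hx l' _ i hne)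
            (fun i => hx l γ i hlγ) (hmin l') (hmin l) h
      · rfl
    · exact fun h => absurd (Finset.mem_univ l) h
  · obtain ⟨δ, hδ⟩ := exists_eq_add_single (hcls l)
    have hi3 := hs l _ (hcls l)
    have hj3 : 3 ≤ (j : ℕ) := by
      have := Fin.lt_def.1 hj
      omega
    have hδs : ∀ i, δ i ≠ 0 → p l i ≠ 0 := fun i hi => by
      rw [hδ, Finsupp.add_apply]
      omega
    have hj' : ∀ i, (δ + Finsupp.single j 1 : Fin v →₀ ℕ) i ≠ 0 → i = j ∨ δ i ≠ 0 := fun i hi => by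
      by_cases hij : i = j
      · exact Or.inl hij
      · rw [Finsupp.add_apply, Finsupp.single_eq_of_ne hij] at hi
        exact Or.inr hi
    obtain ⟨l', hl'⟩ := hE (δ + Finsupp.single j 1)
      (by
        have := hw l
        rw [hδ, weight_one_add_single] at this
        rw [weight_one_add_single, this])
      (fun i hi => (hj' i hi).elim (fun h => h ▸ hj3) fun h => hs l i (hδs i h))
    have hcl : cls l ≤ cls l' := by
      have := hcls l'
      rw [← hl'] at this
      exact (hj' _ this).elim (fun h => h ▸ hj.le) fun h => hmin l _ (hδs _ h)
    obtain ⟨n, hn, _, ⟨y, hy, rfl⟩, heq⟩ := mem_sup.1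
      (sub_mem (hlin (cls l) j l' hi3 hj3) (hlin j j l hj3 hj3))
    have hsum : ev (Pi.single l (X j)) = ev (Pi.single l' (X (cls l)) + y) + n := by
      rw [map_add, add_assoc, add_comm (ev y), heq, hev, hev, hMs, hMs]
      have h1 : (monomial (p l) (1 : k)) * X j =
          monomial (p l') (1 : k) * X (cls l) := by
        rw [hδ, ← hl', X, X, monomial_mul, monomial_mul, add_right_comm]
      simp only [g, sub_mul, h1]
      ring
    have hn0 : n = 0 := hQ0 n (by
      rw [eq_sub_of_add_eq' hsum.symm, hev, hev]
      exact sub_mem (hMQ _) (hMQ _)) hn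
    refine ⟨Pi.single l' (X (cls l)) + y, add_mem (subset_span
      ⟨cls l, l', hj, hcl, rfl⟩) hy, ?_⟩
    funext i
    rw [Subsingleton.elim i 0]
    rw [hn0, add_zero] at hsum
    exact hsum.symm
  · exact (isHomogeneous_monomial 1 (by
      rw [← hw l, Finsupp.degree_eq_weight_one]
      rfl)).sub (hhom l)
  · refine le_antisymm (Ideal.span_le.2 ?_) fun P hP => ?_
    · rintro _ ⟨j, l, rfl⟩
      exact hQ l
    · have hmon : ∀ (n : ℕ) (γ : Fin v →₀ ℕ) (b : k), weight (tailWeight v) γ < n →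
          monomial γ b ∈ tailLe k v ⊔
            (Ideal.span {x | ∃ j l, x = M j l}).restrictScalars k := by
        intro n
        induction n with
        | zero => intro γ b h; omega
        | succ n ih =>
          intro γ b h
          by_cases h3 : weight (tailWeight v) γ ≤ 2
          · exact Submodule.mem_sup_left (monomial_mem_tailLe h3 b)
          · obtain ⟨e, δ, rfl, he, hes⟩ := exists_le_of_le_weight_tailWeight 3 γ (by omega)
            obtain ⟨l, rfl⟩ := hE e he hes
            have h4 : monomial (δ + p l) b = monomial δ b * nf l + monomial δ b * g l := by
              rw [← mul_add, add_sub_cancel, monomial_mul, mul_one]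
            rw [h4]
            refine add_mem ?_ (Submodule.mem_sup_right (Ideal.mul_mem_left _ _
              (Ideal.subset_span ⟨0, l, rfl⟩)))
            rw [(nf l).as_sum, mul_sum]
            refine Submodule.sum_mem _ fun γ' hγ' => ?_
            rw [monomial_mul]
            refine ih _ _ ?_
            have h5 := tailWeight_le_of_mem_tailLe (hnf l) (mem_support_iff.1 hγ')
            rw [map_add, weight_tailWeight_eq hes, he] at h
            rw [map_add]
            omega
      have h1 : P ∈ tailLe k v ⊔ (Ideal.span {x | ∃ j l, x = M j l}).restrictScalars k := by
        rw [P.as_sum]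
        exact Submodule.sum_mem _ fun γ _ => hmon _ γ _ (Nat.lt_succ_self _)
      obtain ⟨n, hn, q, hq, rfl⟩ := mem_sup.1 h1
      have hqQ : q ∈ Q := by
        refine (Ideal.span_le.2 ?_ : Ideal.span _ ≤ Q) hq
        rintro _ ⟨j, l, rfl⟩
        exact hQ l
      rw [hQ0 n ((Q.add_mem_iff_left hqQ).1 hP) hn, zero_add]
      exact hq

end InvolutiveStart

section LinearResolution

variable {k : Type*} [Field k] {v : ℕ}

/-- The quotient by the ideal has a free resolution of length at most `v - 3` that is linear
apart from its first map, which is given by cubic forms. -/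
def HasCubicLinearResolution (Q : Ideal (R[v] k)) : Prop :=
  ∃ (β : ℕ → ℕ) (A : ∀ i : ℕ, Matrix (Fin (β i)) (Fin (β (i + 1))) (R[v] k)),
    β 0 = 1 ∧ (∀ i, v - 3 < i → β i = 0) ∧ (∀ j l, (A 0 j l).IsHomogeneous 3) ∧
    (∀ i, 1 ≤ i → ∀ j l, (A i j l).IsHomogeneous 1) ∧ Ideal.span {x | ∃ j l, x = A 0 j l} = Q ∧
    ∀ i, LinearMap.range (A (i + 1)).mulVecLin = ker (A i).mulVecLin

/-- A matrix with involutive columns together with its classes. -/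
structure InvolutiveStage (k : Type*) [Field k] (v : ℕ) where
  rows : ℕ
  cols : ℕ
  matrix : Matrix (Fin rows) (Fin cols) (R[v] k)
  cls : Fin cols → Fin v
  isInvolutive : IsInvolutive matrix cls

theorem InvolutiveStage.exists_next (T : InvolutiveStage k v) :
    ∃ (c : ℕ) (M : Matrix (Fin T.cols) (Fin c) (R[v] k)) (cls : Fin c → Fin v),
      IsInvolutive M cls ∧ (∀ l r, (M l r).IsHomogeneous 1) ∧
      LinearMap.range M.mulVecLin = ker T.matrix.mulVecLin ∧
      ∀ r, ∃ l, T.cls l < cls r := by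
  let E := (Fintype.equivFin {q : Fin T.cols × Fin v // T.cls q.1 < q.2}).symm
  obtain ⟨M, h1, h2, h3⟩ := T.isInvolutive.exists_syzygies (fun r => (E r).1.1)
    (fun r => (E r).1.2) (fun r => (E r).2) (fun l j h => ⟨E.symm ⟨(l, j), h⟩, by simp⟩)
    fun r r' h h' => E.injective (Subtype.ext (Prod.ext h h'))
  exact ⟨_, M, _, h1, h2, h3, fun r => ⟨_, (E r).2⟩⟩

theorem HasCubicLinearResolution.of_exists {Q : Ideal (R[v] k)}
    (h : ∃ (c : ℕ) (M : Matrix (Fin 1) (Fin c) (R[v] k)) (cls : Fin c → Fin v),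
      IsInvolutive M cls ∧ (∀ l, 3 ≤ (cls l : ℕ)) ∧ (∀ j l, (M j l).IsHomogeneous 3) ∧
      Ideal.span {x | ∃ j l, x = M j l} = Q) : HasCubicLinearResolution Q := by
  obtain ⟨c, M, cls, hM, hcls, hhom, hspan⟩ := h
  choose c' M' cls' hinv hhom' hex hlt using InvolutiveStage.exists_next (k := k) (v := v)
  let T : ℕ → InvolutiveStage k v := fun i =>
    Nat.rec ⟨1, c, M, cls, hM⟩ (fun _ T => ⟨T.cols, c' T, M' T, cls' T, hinv T⟩) i
  have hT : ∀ i l, 3 + i ≤ ((T i).cls l : ℕ) := by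
    intro i
    induction i with
    | zero => exact hcls
    | succ i ih =>
      intro r
      obtain ⟨l, hl⟩ := hlt (T i) r
      exact Nat.succ_le_of_lt ((ih l).trans_lt (Fin.lt_def.1 hl))
  refine ⟨fun i => (T i).rows, fun i => (T i).matrix, rfl, fun i hi => ?_, hhom, fun i hi => ?_,
    hspan, fun i => hex (T i)⟩
  · obtain _ | i := i
    · omega
    · by_contra h0
      have h1 := hT i (⟨0, Nat.pos_of_ne_zero h0⟩ : Fin (T i).cols)
      have h2 := ((T i).cls (⟨0, Nat.pos_of_ne_zero h0⟩ : Fin (T i).cols)).2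
      omega
  · obtain _ | i := i
    · omega
    · exact hhom' (T i)

theorem isHomogeneous_algHom (φ : R[v] k →ₐ[k] R[v] k)
    (hφ : ∀ i, (φ (X i)).IsHomogeneous 1) {P : R[v] k} {n : ℕ}
    (hP : P.IsHomogeneous n) : (φ P).IsHomogeneous n := by
  have h : φ = MvPolynomial.aeval fun i => φ (X i) :=
    MvPolynomial.algHom_ext fun i => (aeval_X (fun i => φ (X i)) i).symm
  rw [h]
  exact aeval_isHomogeneous_of_linear hφ hP

theorem HasCubicLinearResolution.map {Q Q' : Ideal (R[v] k)}
    (h : HasCubicLinearResolution Q) (Φ : R[v] k ≃ₐ[k] R[v] k)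
    (hΦ : ∀ i, (Φ (X i)).IsHomogeneous 1) (hQ : ∀ P, Φ P ∈ Q' ↔ P ∈ Q) :
    HasCubicLinearResolution Q' := by
  obtain ⟨β, A, h0, hβ, h3, h1, hspan, hex⟩ := h
  have hhom : ∀ {P n}, IsHomogeneous P n → (Φ P).IsHomogeneous n := fun hP =>
    isHomogeneous_algHom (Φ : R[v] k →ₐ[k] _) hΦ hP
  have hmul : ∀ i x, (A i).map Φ *ᵥ (fun l => Φ (x l)) = fun j => Φ ((A i *ᵥ x) j) := fun i x =>
    funext fun j =>
      ((Φ : R[v] k →+* R[v] k).map_mulVec (A i) x j).symm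
  have hlift : ∀ {n} (x : Fin n → R[v] k), ∃ y : Fin n → R[v] k, x = fun l => Φ (y l) :=
    fun x =>
    ⟨fun l => Φ.symm (x l), funext fun l => (Φ.apply_symm_apply _).symm⟩
  have hinj : ∀ {n} {x y : Fin n → R[v] k},
      (fun l => Φ (x l)) = (fun l => Φ (y l)) → x = y := fun h =>
    funext fun l => Φ.injective (congrFun h l)
  have hker : ∀ {i x}, A i *ᵥ x = 0 ↔ ∃ y, A (i + 1) *ᵥ y = x := fun {i x} =>
    (SetLike.ext_iff.1 (hex i) x).symm
  refine ⟨β, fun i => (A i).map Φ, h0, hβ, fun j l => hhom (h3 j l),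
    fun i hi j l => hhom (h1 i hi j l), ?_, fun i => ?_⟩
  · have h2 : Q' = Q.map (Φ : R[v] k →+* R[v] k) := by
      refine le_antisymm (fun P hP => ?_) (Ideal.map_le_iff_le_comap.2 fun P hP => (hQ P).2 hP)
      rw [← Φ.apply_symm_apply P] at hP ⊢
      exact Ideal.mem_map_of_mem _ ((hQ _).1 hP)
    rw [h2, ← hspan, Ideal.map_span]
    congr 1
    ext P
    constructor
    · rintro ⟨j, l, rfl⟩
      exact ⟨_, ⟨j, l, rfl⟩, rfl⟩
    · rintro ⟨_, ⟨j, l, rfl⟩, rfl⟩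
      exact ⟨j, l, rfl⟩
  · ext x
    obtain ⟨x, rfl⟩ := hlift x
    rw [LinearMap.mem_ker, LinearMap.mem_range, Matrix.mulVecLin_apply, hmul]
    constructor
    · rintro ⟨y, hy⟩
      obtain ⟨y, rfl⟩ := hlift y
      rw [Matrix.mulVecLin_apply, hmul] at hy
      exact funext fun j => by
        rw [hker.2 ⟨y, hinj hy⟩, Pi.zero_apply, map_zero]
    · intro hx
      obtain ⟨y, rfl⟩ := hker.1 (hinj (y := 0) (hx.trans (funext fun _ => (map_zero Φ).symm)))
      exact ⟨fun l => Φ (y l), hmul (i + 1) y⟩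

/-- Two bases of the same space of polynomials differ by a linear change of variables. -/
theorem exists_algEquiv_of_span_eq {f f' : Fin v → R₃ k}
    (hf : LinearIndependent k f) (hf' : LinearIndependent k f')
    (h : span k (range f) = span k (range f')) :
    ∃ Φ : R[v] k ≃ₐ[k] R[v] k, (∀ i, (Φ (X i)).IsHomogeneous 1) ∧
      ∀ P, aeval f (Φ P) = aeval f' P := by
  have key : ∀ {f f' : Fin v → R₃ k},
      span k (range f) = span k (range f') →
      ∃ φ : R[v] k →ₐ[k] R[v] k,
        (∀ i, (φ (X i)).IsHomogeneous 1) ∧ ∀ P, aeval f (φ P) = aeval f' P := by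
    intro f f' h
    have h1 : ∀ i, ∃ c : Fin v → k, ∑ j, c j • f j = f' i := fun i =>
      (mem_span_range_iff_exists_fun k).1 (h.ge (subset_span ⟨i, rfl⟩))
    choose c hc using h1
    refine ⟨aeval fun i => linForm (c i), fun i => ?_, fun P => ?_⟩
    · rw [aeval_X]
      exact linForm_isHomogeneous _
    · have : (aeval f).comp (aeval fun i => linForm (c i)) = aeval f' :=
        MvPolynomial.algHom_ext fun i => by
          rw [AlgHom.comp_apply, aeval_X, aeval_X, aeval_linForm, hc]
      exact DFunLike.congr_fun this P
  have inv : ∀ {f : Fin v → R₃ k}, LinearIndependent k f →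
      ∀ φ : R[v] k →ₐ[k] R[v] k,
      (∀ i, (φ (X i)).IsHomogeneous 1) → (∀ P, aeval f (φ P) = aeval f P) →
      φ = AlgHom.id k _ := by
    intro f hf φ hφ hfφ
    refine MvPolynomial.algHom_ext fun i => ?_
    have h1 : (φ (X i) - X i).IsHomogeneous 1 := (hφ i).sub (isHomogeneous_X k i)
    obtain ⟨c, hc⟩ := eq_linForm_of_isHomogeneous h1
    have h2 : ∑ j, c j • f j = 0 := by
      rw [← aeval_linForm, ← hc, map_sub, hfφ, sub_self]
    rw [AlgHom.id_apply, ← sub_eq_zero, hc]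
    exact sum_eq_zero fun j _ => by
      rw [Fintype.linearIndependent_iff.1 hf c h2 j, zero_smul]
  obtain ⟨φ, hφ, hfφ⟩ := key h
  obtain ⟨ψ, hψ, hfψ⟩ := key h.symm
  exact ⟨AlgEquiv.ofAlgHom φ ψ
    (inv hf _ (fun i => isHomogeneous_algHom φ hφ (hψ i)) fun P => by rw [AlgHom.comp_apply, hfφ, hfψ])
    (inv hf' _ (fun i => isHomogeneous_algHom ψ hψ (hφ i)) fun P => by rw [AlgHom.comp_apply, hfψ, hfφ]), hφ, hfφ⟩

end LinearResolution

namespace PointSetup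

namespace GoodTriple

variable {k : Type*} [Field k] {S : PointSetup k} {L : LineChart k} {q : ℕ}

theorem span_range_sumElim (t : S.GoodTriple L q) {m v : ℕ} {u : Fin m → R₃ k}
    (hu : S.piece S.s = t.spanA ⊔ span k (range u)) (E : Fin v ≃ Fin m ⊕ Fin 3) :
    span k (range fun i => Sum.elim u ![t.a1, t.a2, t.a3] (E i)) = S.piece S.s := by
  have h : range (fun i => Sum.elim u ![t.a1, t.a2, t.a3] (E i)) =
      range (Sum.elim u ![t.a1, t.a2, t.a3]) :=
    E.surjective.range_comp (Sum.elim u ![t.a1, t.a2, t.a3])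
  rw [h, Set.Sum.elim_range, Submodule.span_union, sup_comm, hu, spanA]

theorem hasCubicLinearResolution_of_equiv [Infinite k] (t : S.GoodTriple L q) (h0 : S.h = 0)
    {m v : ℕ} (hm : m + 2 = S.s) {u : Fin m → R₃ k}
    (hu : S.piece S.s = t.spanA ⊔ span k (range u)) (E : Fin v ≃ Fin m ⊕ Fin 3)
    (hE : ∀ i : Fin v, ((i : ℕ) < 3 ↔ (E i).isRight)) :
    HasCubicLinearResolution (RingHom.ker (aeval fun i => Sum.elim u ![t.a1, t.a2, t.a3] (E i) :
      R[v] k →ₐ[k] R₃ k)) := by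
  let f : Fin v → R₃ k := fun i => Sum.elim u ![t.a1, t.a2, t.a3] (E i)
  have hf : span k (range f) = S.piece S.s := t.span_range_sumElim hu E
  have hF : ∀ b, S.F b = (homogeneousSubmodule (Fin v) k b).map (aeval f).toLinearMap := fun b => by
    rw [← span_range_pow_eq_map, hf, F]
  have hin : ∀ γ : Fin v →₀ ℕ,
      weight (tailWeight v) γ ≤ weight (1 : Fin v → ℕ) γ := fun γ => by
    rw [Finsupp.weight_apply, Finsupp.weight_apply]
    exact Finset.sum_le_sum fun i _ => Nat.mul_le_mul_left _ (by
      rw [tailWeight, Pi.one_apply]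
      split_ifs <;> omega)
  refine HasCubicLinearResolution.of_exists (exists_isInvolutive _ (fun P hP hP2 => ?_)
    fun e he hes => ?_)
  · let Θ : R[v] k →ₐ[k] R[m] (R₃ k) :=
      (sumAlgEquiv k (Fin m) (Fin 3) : _ →ₐ[k] _).comp (rename E)
    have hX : ∀ i, Θ (X i) = Sum.elim X (fun c => C (X c)) (E i) := fun i => by
      change sumAlgEquiv k (Fin m) (Fin 3) (rename E (X i)) = _
      rw [rename_X]
      rcases E i with j | c
      · exact sumAlgEquiv_X_inl k _ _ j
      · exact sumAlgEquiv_X_inr k _ _ c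
    have hinj : Function.Injective Θ :=
      (sumAlgEquiv k (Fin m) (Fin 3)).injective.comp (rename_injective _ E.injective)
    have hval : ∀ P, t.fiberEval u (Θ P) = aeval f P := by
      have : ((t.fiberEval u).restrictScalars k).comp Θ = aeval f :=
        MvPolynomial.algHom_ext fun i => by
          change t.fiberEval u (Θ (X i)) = _
          rw [hX, aeval_X]
          change _ = Sum.elim u ![t.a1, t.a2, t.a3] (E i)
          rcases E i with j | c
          · exact t.fiberEval_X u j
          · exact (t.fiberEval_C u _).trans (aeval_X _ c)
      exact DFunLike.congr_fun this
    have hdeg : ∀ i, (Θ (X i)).totalDegree ≤ tailWeight v i := fun i => by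
      have := hE i
      rw [hX, tailWeight]
      rcases hEi : E i with j | c <;> rw [hEi] at this
      · rw [if_neg (by simpa using this)]
        exact (totalDegree_X j).le
      · exact (totalDegree_C _).le.trans (Nat.zero_le _)
    refine (map_eq_zero_iff Θ hinj).1 (t.eq_zero_of_fiberEval_eq_zero h0 hm hu ?_
      ((hval P).trans hP))
    rw [P.as_sum, map_sum]
    refine totalDegree_finsetSum_le fun γ hγ => ?_
    refine le_trans ?_ (tailWeight_le_of_mem_tailLe hP2 (mem_support_iff.1 hγ))
    rw [monomial_eq, map_mul, Finsupp.prod, map_prod, Finsupp.weight_apply]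
    refine (totalDegree_mul _ _).trans ?_
    have h1 : Θ (C (coeff γ P)) = C (C (coeff γ P)) := Θ.commutes (coeff γ P)
    rw [h1, totalDegree_C, zero_add]
    refine (totalDegree_finsetProd _ _).trans (Finset.sum_le_sum fun i _ => ?_)
    rw [map_pow]
    exact (totalDegree_pow _ _).trans (Nat.mul_le_mul_left _ (hdeg i))
  · let K : Submodule k (R[v] k) := tailLe k v ⊓ homogeneousSubmodule (Fin v) k 3
    have hK : t.spanA * S.F 2 ≤ K.map (aeval f).toLinearMap := by
      refine Submodule.mul_le.2 fun a ha g hg => ?_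
      obtain ⟨c, rfl⟩ := (mem_span_range_iff_exists_fun k).1 ha
      rw [hF] at hg
      obtain ⟨P, hP, rfl⟩ := hg
      rw [Finset.sum_mul]
      refine Submodule.sum_mem _ fun i _ => ?_
      rw [smul_mul_assoc]
      refine Submodule.smul_mem _ _ ⟨P * X (E.symm (Sum.inr i)), ⟨?_, ?_⟩, ?_⟩
      · rw [P.as_sum, Finset.sum_mul]
        refine Submodule.sum_mem _ fun γ hγ => ?_
        rw [X, monomial_mul]
        refine monomial_mem_tailLe ?_ _
        have h3 : ((E.symm (Sum.inr i) : Fin v) : ℕ) < 3 := (hE _).2 (by simp)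
        rw [weight_tailWeight_add_single, tailWeight, if_pos h3]
        exact (hin γ).trans (hP (mem_support_iff.1 hγ)).le
      · exact IsHomogeneous.mul hP (isHomogeneous_X k _)
      · change aeval f (P * X _) = _ * aeval f P
        rw [map_mul, aeval_X, mul_comm]
        simp [f]
    have he3 : (monomial e (1 : k)).IsHomogeneous 3 := isHomogeneous_monomial 1 (by
      rw [← he, Finsupp.degree_eq_weight_one]
      rfl)
    obtain ⟨nf, ⟨h1, h2⟩, h3⟩ := hK (t.F_three_le h0 ((hF 3).ge ⟨_, he3, rfl⟩))
    refine ⟨nf, h1, h2, ?_⟩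
    rw [RingHom.mem_ker, map_sub, sub_eq_zero]
    exact h3.symm

theorem hasCubicLinearResolution [Infinite k] (t : S.GoodTriple L q) (h0 : S.h = 0) {v : ℕ}
    (hv : v = S.s + 1) {f : Fin v → R₃ k}
    (hf : span k (range f) = S.piece S.s) :
    HasCubicLinearResolution (RingHom.ker (aeval f :
      R[v] k →ₐ[k] R₃ k)) := by
  obtain ⟨m, hm⟩ : ∃ m, m + 2 = S.s := ⟨S.s - 2, by have := S.hs; omega⟩
  obtain rfl : v = 3 + m := by omega
  obtain ⟨u, hu, -⟩ := t.exists_complement_spanA h0 hm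
  let E : Fin (3 + m) ≃ Fin m ⊕ Fin 3 := finSumFinEquiv.symm.trans (Equiv.sumComm _ _)
  let f' : Fin (3 + m) → R₃ k := fun i => Sum.elim u ![t.a1, t.a2, t.a3] (E i)
  have hf' : span k (range f') = S.piece S.s := t.span_range_sumElim hu E
  have hind : ∀ {f : Fin (3 + m) → R₃ k},
      span k (range f) = S.piece S.s → LinearIndependent k f := fun {f} hf => by
    rw [linearIndependent_iff_card_eq_finrank_span, Set.finrank, hf, S.finrank_piece_s, h0,
      Fintype.card_fin]
    omega
  obtain ⟨Φ, hΦ, hΦf⟩ := exists_algEquiv_of_span_eq (hind hf) (hind hf') (hf.trans hf'.symm)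
  refine (t.hasCubicLinearResolution_of_equiv h0 hm hu E fun i => ?_).map Φ hΦ fun P => ?_
  · refine Fin.addCases (fun i => ?_) (fun i => ?_) i
    · simp [E]
    · simp [E]
  · rw [RingHom.mem_ker, RingHom.mem_ker, hΦf]

end GoodTriple

end PointSetup

section

theorem PointSetup.h_eq_zero_of_cubicLinearResolution {k : Type*} [Field k] [Infinite k]
    (S : PointSetup k) (f : Fin (S.s - S.h + 1) → R₃ k)
    (hf : span k (range f) = S.piece S.s)
    (hres : HasCubicLinearResolution (RingHom.ker (aeval f :
      MvPolynomial (Fin (S.s - S.h + 1)) k →ₐ[k] R₃ k))) : S.h = 0 := by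
  obtain ⟨β, A, hβ0, hβ, hA0, hA, hQ, hex⟩ := hres
  have hs := S.hs
  obtain ⟨⟨P, hP⟩, hlow⟩ := exists_polynomial_finrank_ideal A hβ0 (fun i hi => hβ i (by omega))
    (by omega) hA0 hA hex hQ
  obtain ⟨P', hP'⟩ := exists_polynomial_choose (S.s - S.h) (S.s - S.h)
  have hF : ∀ b, finrank k (S.F b) + finrank k ↥((RingHom.ker (aeval f :
      MvPolynomial (Fin (S.s - S.h + 1)) k →ₐ[k] R₃ k)).restrictScalars k ⊓
        homogeneousSubmodule (Fin (S.s - S.h + 1)) k b) = (S.s - S.h + 1).multichoose b := fun b => by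
    rw [F, ← hf]
    exact finrank_span_range_pow f b
  refine S.h_eq_zero_of_polynomial (P := P' - P) (fun b => ?_) ?_
  · rw [Polynomial.eval_sub, ← hP, ← hP', eq_sub_iff_add_eq, ← Nat.cast_add, hF,
      Nat.multichoose_eq, show S.s - S.h + 1 + b - 1 = b + (S.s - S.h) by omega,
      Nat.choose_symm_add]
  · have := hF 2
    rwa [hlow 2 (by norm_num), finrank_bot, add_zero] at this

end

end Arguments

/-- Let `I ⊂ k[x,y,z]` be the radical ideal of `n` distinct points of `ℙ²`
in tight generic `n`-position with `μ := μ(I) = s−h+1 ≥ 4`, `n = C(s+1,2) + h`,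
`0 ≤ h ≤ s/2 − 1`.  The following are equivalent: (a) the Rees algebra of `I` is
Cohen–Macaulay; (b) the special fiber `F(I) = S/Q` is Cohen–Macaulay and its minimal graded
free resolution over `S = k[t_1,…,t_μ]` has the form
`0 → S(−μ+1)^{β_{μ−3}} → ⋯ → S(−3)^{β₁} → S → F(I) → 0`; (c) `I` is linearly presented,
i.e. `h = 0`. -/
theorem statement16 {k : Type*} [Field k] [IsAlgClosed k] {n s h : ℕ}
    (pts : Fin n → (Fin 3 → k)) (hfam : IsPointFamily pts)
    (htight : InTightGenericPosition pts s)
    (hindeg : HasInitialDegree (vanishingIdeal pts) s)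
    (hn : n = (s + 1).choose 2 + h) (hh : 2 * (h + 1) ≤ s)
    (hμ : 4 ≤ s - h + 1)
    (f : Fin (s - h + 1) → MvPolynomial (Fin 3) k)
    (hfmem : ∀ i, f i ∈ gradedPiece (vanishingIdeal pts) s)
    (hfspan : Submodule.span k (Set.range f) = gradedPiece (vanishingIdeal pts) s)
    (hfI : Ideal.span (Set.range f) = vanishingIdeal pts)
    (Q : Ideal (MvPolynomial (Fin (s - h + 1)) k))
    (hQ : Q = RingHom.ker (MvPolynomial.aeval f :
      MvPolynomial (Fin (s - h + 1)) k →ₐ[k] MvPolynomial (Fin 3) k)) :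
    (IsCohenMacaulayRing (reesAlgebra (vanishingIdeal pts)) ↔ h = 0) ∧
    ((IsCohenMacaulayRing (MvPolynomial (Fin (s - h + 1)) k ⧸ Q) ∧
      ∃ (β : ℕ → ℕ)
        (A : ∀ i : ℕ, Matrix (Fin (β i)) (Fin (β (i + 1)))
          (MvPolynomial (Fin (s - h + 1)) k)),
        β 0 = 1 ∧
        (∀ i, s - h + 1 - 3 < i → β i = 0) ∧
        (∀ j l, (A 0 j l).IsHomogeneous 3) ∧
        (∀ i, 1 ≤ i → ∀ j l, (A i j l).IsHomogeneous 1) ∧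
        Ideal.span {x | ∃ j l, x = A 0 j l} = Q ∧
        (∀ i, LinearMap.range (A (i + 1)).mulVecLin = LinearMap.ker (A i).mulVecLin)) ↔
      h = 0) := by
  have : Infinite k := IsAlgClosed.instInfinite
  have hspan : Ideal.span (gradedPiece (_root_.vanishingIdeal pts) s : Set (MvPolynomial (Fin 3) k)) =
      _root_.vanishingIdeal pts := by
    refine le_antisymm (Ideal.span_le.2 fun x hx => hx.1) ?_
    rw [← hfI]
    exact Ideal.span_mono (Set.range_subset_iff.2 fun i => hfI ▸ hfmem i)
  let S : PointSetup k := ⟨n, s, h, pts, hfam, htight.1, hindeg, hn, hh, by omega, hspan⟩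
  refine ⟨⟨fun hCM => S.h_eq_zero_of_rees hCM, fun h0 => ?_⟩,
    ⟨fun ⟨_, β, A, hβ0, hβ, hA0, hA, hA0Q, hex⟩ => ?_, fun h0 => ?_⟩⟩
  · obtain ⟨L, hL⟩ := S.exists_avoids
    obtain ⟨t⟩ := S.exists_goodTriple hL (q := 1) (show (1 : ℕ) ≠ s by omega)
    obtain ⟨φ, ι, _, e, hind, hgen⟩ := t.exists_rees_free hL h0
    exact isCohenMacaulayRing_of_exists_basis φ e hind hgen
  · exact S.h_eq_zero_of_cubicLinearResolution f hfspan
      (hQ ▸ ⟨β, A, hβ0, hβ, hA0, hA, hA0Q, hex⟩)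
  · obtain ⟨L, hL⟩ := S.exists_avoids
    obtain ⟨t⟩ := S.exists_goodTriple hL (q := 1) (show (1 : ℕ) ≠ s by omega)
    subst hQ
    exact ⟨t.isCohenMacaulayRing_fiber h0 hfspan,
      t.hasCubicLinearResolution h0 (show s - h + 1 = s + 1 by omega) hfspan⟩
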